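/- Let H_< = {(x,y) ∈ ℝ² | x < y}, the set of strict intervals of ℝ, with the relation ≺ restricted to H_< (so (x,y) ≺ (x',y') iff x < x' and y < y'; this is the Allen relation overlaps ∪ meets ∪ before). The set of formulas of the basic temporal language that are valid on the frame (H_<, ≺) is decidable: there exists a computable total function from formulas to Bool that returns true exactly on the valid formulas. -/

import Mathlib

/-- Formulas of the basic temporal language. -/
inductive Formula : Type
  | var : ℕ → Formula
  | neg : Formula → Formula
  | or : Formula → Formula → Formula
  | F : Formula → Formula
  | P : Formula → Formula

/-- Satisfaction of a formula at a world, given a frame `(W, R)` and valuation `v`. -/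
def Sat {W : Type} (R : W → W → Prop) (v : ℕ → Set W) : W → Formula → Prop
  | w, Formula.var n => w ∈ v n
  | w, Formula.neg φ => ¬ Sat R v w φ
  | w, Formula.or φ ψ => Sat R v w φ ∨ Sat R v w ψ
  | w, Formula.F φ => ∃ u, R w u ∧ Sat R v u φ
  | w, Formula.P φ => ∃ u, R u w ∧ Sat R v u φ

/-- Validity of a formula on a frame. -/
def Valid {W : Type} (R : W → W → Prop) (φ : Formula) : Prop :=
  ∀ (v : ℕ → Set W) (w : W), Sat R v w φ

/-- The irreflexive slower-than-light relation on ℝ². -/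
def slt (a b : ℝ × ℝ) : Prop := a.1 < b.1 ∧ a.2 < b.2

/-- An injective encoding of formulas as natural numbers. -/
def Formula.enc : Formula → ℕ
  | Formula.var n => Nat.pair 0 n
  | Formula.neg φ => Nat.pair 1 φ.enc
  | Formula.or φ ψ => Nat.pair 2 (Nat.pair φ.enc ψ.enc)
  | Formula.F φ => Nat.pair 3 φ.enc
  | Formula.P φ => Nat.pair 4 φ.enc

/-- The open half-plane `H_< = {(x, y) ∈ ℝ² | x < y}` of strict intervals of ℝ. -/
def HalfPlane : Type := {p : ℝ × ℝ // p.1 < p.2}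

/-- `≺` restricted to `H_<`: the Allen relation `overlaps ∪ meets ∪ before`. -/
def sltH (a b : HalfPlane) : Prop := slt a.val b.val

/-! ## Part 0: reduction to label models -/

namespace HP

def bit (m i : ℕ) : Prop := m.testBit i = true

open Classical in
noncomputable def setN (N : ℕ) (P : ℕ → Prop) : ℕ :=
  Nat.ofBits (fun i : Fin (N+1) => decide (P i))

theorem bit_setN (N : ℕ) (P : ℕ → Prop) (i : ℕ) : bit (setN N P) i ↔ i ≤ N ∧ P i := by
  unfold bit setN
  by_cases h : i < N+1
  · rw [Nat.testBit_ofBits_lt _ _ h]; simp; omega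
  · rw [Nat.testBit_ofBits_ge _ _ (by omega)]; simp; intro; omega

theorem setN_lt (N : ℕ) (P : ℕ → Prop) : setN N P < 2^(N+1) := Nat.ofBits_lt_two_pow _

theorem setN_congr (N : ℕ) (P Q : ℕ → Prop) (h : ∀ i ≤ N, (P i ↔ Q i)) : setN N P = setN N Q := by
  apply Nat.eq_of_testBit_eq
  intro i
  rw [Bool.eq_iff_iff]
  change bit _ _ ↔ bit _ _
  rw [bit_setN, bit_setN]
  constructor
  · rintro ⟨a, b⟩; exact ⟨a, (h i a).1 b⟩
  · rintro ⟨a, b⟩; exact ⟨a, (h i a).2 b⟩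

theorem lt_pair (t r : ℕ) (h : 1 ≤ t) : r < Nat.pair t r := by
  have := Nat.add_le_pair t r; omega

theorem unpair_snd_lt (k : ℕ) (h : 1 ≤ k.unpair.1) : k.unpair.2 < k := by
  have := lt_pair k.unpair.1 k.unpair.2 h
  rwa [Nat.pair_unpair] at this

/-- total decoding -/
def decF (k : ℕ) : Formula :=
  if h1 : k.unpair.1 = 1 then
    have := unpair_snd_lt k (by omega)
    Formula.neg (decF k.unpair.2)
  else if h2 : k.unpair.1 = 2 then
    have := unpair_snd_lt k (by omega)
    have := Nat.unpair_left_le k.unpair.2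
    have := Nat.unpair_right_le k.unpair.2
    Formula.or (decF k.unpair.2.unpair.1) (decF k.unpair.2.unpair.2)
  else if h3 : k.unpair.1 = 3 then
    have := unpair_snd_lt k (by omega)
    Formula.F (decF k.unpair.2)
  else if h4 : k.unpair.1 = 4 then
    have := unpair_snd_lt k (by omega)
    Formula.P (decF k.unpair.2)
  else Formula.var k.unpair.2
termination_by k
decreasing_by all_goals omega

theorem decF_enc (φ : Formula) : decF φ.enc = φ := by
  induction φ with
  | var n => rw [decF]; simp [Formula.enc]
  | neg a ih => rw [decF]; simp [Formula.enc, ih]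
  | or a b iha ihb => rw [decF]; simp [Formula.enc, iha, ihb]
  | F a ih => rw [decF]; simp [Formula.enc, ih]
  | P a ih => rw [decF]; simp [Formula.enc, ih]

def okLab (N m : ℕ) : Prop :=
  ∀ k ≤ N, (k.unpair.1 = 1 → (bit m k ↔ ¬ bit m k.unpair.2)) ∧
    (k.unpair.1 = 2 → (bit m k ↔ (bit m k.unpair.2.unpair.1 ∨ bit m k.unpair.2.unpair.2)))

structure Model {W : Type} (R : W → W → Prop) (N : ℕ) (lam : W → ℕ) : Prop where
  ok : ∀ w, okLab N (lam w)
  mF : ∀ i, Nat.pair 3 i ≤ N → ∀ w, (bit (lam w) (Nat.pair 3 i) ↔ ∃ u, R w u ∧ bit (lam u) i)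
  mP : ∀ i, Nat.pair 4 i ≤ N → ∀ w, (bit (lam w) (Nat.pair 4 i) ↔ ∃ u, R u w ∧ bit (lam u) i)

theorem Model.truth {W : Type} {R : W → W → Prop} {N : ℕ} {lam : W → ℕ} (h : Model R N lam) :
    ∀ φ : Formula, φ.enc ≤ N → ∀ w, (Sat R (fun n => {w | bit (lam w) (Nat.pair 0 n)}) w φ ↔ bit (lam w) φ.enc) := by
  intro φ
  induction φ with
  | var n => intro _ w; simp [Sat, Formula.enc]
  | neg a ih =>
    intro hN w
    have hlt := lt_pair 1 a.enc le_rfl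
    simp only [Formula.enc] at hN
    have := (h.ok w _ hN).1 (by simp)
    simp only [Nat.unpair_pair] at this
    rw [Sat, Formula.enc, this, ih (by omega) w]
  | or a b iha ihb =>
    intro hN w
    simp only [Formula.enc] at hN
    have hlt := lt_pair 2 (Nat.pair a.enc b.enc) (by omega)
    have h1 := Nat.left_le_pair a.enc b.enc
    have h2 := Nat.right_le_pair a.enc b.enc
    have := (h.ok w _ hN).2 (by simp)
    simp only [Nat.unpair_pair] at this
    rw [Sat, Formula.enc, this, iha (by omega) w, ihb (by omega) w]
  | F a ih =>
    intro hN w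
    simp only [Formula.enc] at hN
    have hlt := lt_pair 3 a.enc (by omega)
    rw [Sat, Formula.enc, h.mF _ hN w]
    exact exists_congr fun u => and_congr_right fun _ => ih (by omega) u
  | P a ih =>
    intro hN w
    simp only [Formula.enc] at hN
    have hlt := lt_pair 4 a.enc (by omega)
    rw [Sat, Formula.enc, h.mP _ hN w]
    exact exists_congr fun u => and_congr_right fun _ => ih (by omega) u

theorem Model.of_val {W : Type} (R : W → W → Prop) (N : ℕ) (v : ℕ → Set W) :
    Model R N (fun w => setN N (fun k => Sat R v w (decF k))) := by
  constructor
  · intro w k hk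
    constructor
    · intro h1
      have := unpair_snd_lt k (by omega)
      rw [bit_setN, bit_setN]
      conv_lhs => rw [decF]
      simp only [h1, dite_true, Sat]
      constructor
      · rintro ⟨_, b⟩ ⟨_, c⟩; exact b c
      · intro b; exact ⟨hk, fun c => b ⟨by omega, c⟩⟩
    · intro h1
      have := unpair_snd_lt k (by omega)
      have := Nat.unpair_left_le k.unpair.2
      have := Nat.unpair_right_le k.unpair.2
      rw [bit_setN, bit_setN, bit_setN]
      conv_lhs => rw [decF]
      simp only [h1, show ¬ (2:ℕ) = 1 by omega, dite_true, dite_false, Sat]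
      constructor
      · rintro ⟨_, b | b⟩
        · left; exact ⟨by omega, b⟩
        · right; exact ⟨by omega, b⟩
      · rintro (b | b)
        · exact ⟨hk, Or.inl b.2⟩
        · exact ⟨hk, Or.inr b.2⟩
  · intro i hi w
    have := lt_pair 3 i (by omega)
    have e : decF (Nat.pair 3 i) = Formula.F (decF i) := by rw [decF]; simp
    simp only [bit_setN, e, Sat]
    constructor
    · rintro ⟨_, u, a, b⟩; exact ⟨u, a, by omega, b⟩
    · rintro ⟨u, a, _, b⟩; exact ⟨hi, u, a, b⟩
  · intro i hi w
    have := lt_pair 4 i (by omega)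
    have e : decF (Nat.pair 4 i) = Formula.P (decF i) := by rw [decF]; simp
    simp only [bit_setN, e, Sat]
    constructor
    · rintro ⟨_, u, a, b⟩; exact ⟨u, a, by omega, b⟩
    · rintro ⟨u, a, _, b⟩; exact ⟨hi, u, a, b⟩

/-- the open triangle -/
def Tri : Set (ℝ × ℝ) := {p | 0 < p.1 ∧ p.1 < p.2 ∧ p.2 < 1}

def sltT (a b : Tri) : Prop := slt a.val b.val

def SAT (N : ℕ) : Prop := ∃ lam : Tri → ℕ, Model sltT N lam ∧ ∃ w, bit (lam w) N

theorem Model.comap {W W' : Type} {R : W → W → Prop} {R' : W' → W' → Prop} {N : ℕ} {lam : W → ℕ}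
    (h : Model R N lam) (e : W' ≃ W) (he : ∀ a b, R' a b ↔ R (e a) (e b)) : Model R' N (fun w => lam (e w)) := by
  constructor
  · intro w; exact h.ok _
  · intro i hi w
    rw [h.mF i hi]
    constructor
    · rintro ⟨u, a, b⟩; exact ⟨e.symm u, by rw [he]; simpa using a, by simpa using b⟩
    · rintro ⟨u, a, b⟩; exact ⟨e u, (he _ _).1 a, b⟩
  · intro i hi w
    rw [h.mP i hi]
    constructor
    · rintro ⟨u, a, b⟩; exact ⟨e.symm u, by rw [he]; simpa using a, by simpa using b⟩
    · rintro ⟨u, a, b⟩; exact ⟨e u, (he _ _).1 a, b⟩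

theorem exists_iso01 : ∃ f : ℝ → ℝ, ∃ g : ℝ → ℝ, StrictMono f ∧ (∀ x, 0 < f x ∧ f x < 1) ∧
    (∀ x, g (f x) = x) ∧ (∀ y, 0 < y → y < 1 → f (g y) = y) := by
  let e := orderIsoIooNegOneOne ℝ
  refine ⟨fun x => ((e x : ℝ) + 1)/2,
    fun y => if h : (2*y-1) ∈ Set.Ioo (-1:ℝ) 1 then e.symm ⟨2*y-1, h⟩ else 0, ?_, ?_, ?_, ?_⟩
  · intro a b hab
    have : (e a : ℝ) < e b := e.strictMono hab
    simp only; linarith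
  · intro x
    have := (e x).2
    simp only [Set.mem_Ioo] at this
    constructor <;> linarith [this.1, this.2]
  · intro x
    have h := (e x).2
    have e1 : 2 * (((e x : ℝ) + 1)/2) - 1 = (e x : ℝ) := by ring
    simp only [e1]
    rw [dif_pos h]
    simp
  · intro y h0 h1
    have h : (2*y-1) ∈ Set.Ioo (-1:ℝ) 1 := ⟨by linarith, by linarith⟩
    simp only [dif_pos h, OrderIso.apply_symm_apply]
    ring

theorem exists_equiv : ∃ e : HalfPlane ≃ Tri, ∀ a b, sltH a b ↔ sltT (e a) (e b) := by
  obtain ⟨f, g, hf, h01, gf, fg⟩ := exists_iso01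
  have hg : ∀ x y, 0 < x → x < y → y < 1 → g x < g y := by
    intro x y h0 h1 h2
    by_contra hc
    have := hf.monotone (not_lt.1 hc)
    rw [fg x h0 (by linarith), fg y (by linarith) h2] at this
    linarith
  refine ⟨⟨fun p => ⟨(f p.1.1, f p.1.2), (h01 _).1, hf p.2, (h01 _).2⟩,
    fun p => ⟨(g p.1.1, g p.1.2), hg _ _ p.2.1 p.2.2.1 p.2.2.2⟩, ?_, ?_⟩, ?_⟩
  · intro p; apply Subtype.ext; simp [gf]
  · rintro ⟨⟨x, y⟩, h1, h2, h3⟩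
    apply Subtype.ext
    simp only at h1 h2 h3
    simp [fg x h1 (by linarith), fg y (by linarith) h3]
  · intro a b
    change _ ↔ f a.1.1 < f b.1.1 ∧ f a.1.2 < f b.1.2
    rw [hf.lt_iff_lt, hf.lt_iff_lt]; rfl

theorem valid_iff (φ : Formula) : Valid sltH φ ↔ ¬ SAT (Nat.pair 1 φ.enc) := by
  obtain ⟨e, he⟩ := exists_equiv
  constructor
  · rintro hv ⟨lam, hm, w, hw⟩
    have h2 := hm.comap e he
    have := (h2.truth (Formula.neg φ) le_rfl (e.symm w)).2 (by simpa [Formula.enc] using hw)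
    exact this (hv _ _)
  · intro hs v w
    by_contra hc
    apply hs
    have h1 := Model.of_val sltH (Nat.pair 1 φ.enc) v
    refine ⟨_, h1.comap e.symm (fun a b => by rw [he]; simp), e w, ?_⟩
    rw [bit_setN]
    refine ⟨le_rfl, ?_⟩
    have : decF (Nat.pair 1 φ.enc) = Formula.neg φ := decF_enc (Formula.neg φ)
    rw [this]
    simpa [Sat] using hc

/-! ## Part 1: certificates -/

/-- a position: a set of future demands and a set of past demands -/
structure Pos where
  f : ℕ
  p : ℕ

structure Ent where
  lo : Pos
  hi : Pos
  lab : ℕ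

def ple (N : ℕ) (a b : Pos) : Prop :=
  ∀ i ≤ N, (bit b.f i → bit a.f i) ∧ (bit a.p i → bit b.p i)

def adm (N : ℕ) (lo hi : Pos) (m : ℕ) : Prop :=
  okLab N m ∧ ∀ i ≤ N, (bit m i → bit lo.f i ∧ bit hi.p i) ∧
    (Nat.pair 3 i ≤ N → (bit m (Nat.pair 3 i) ↔ bit hi.f i)) ∧
    (Nat.pair 4 i ≤ N → (bit m (Nat.pair 4 i) ↔ bit lo.p i))

def hasAdm (N : ℕ) (lo hi : Pos) : Prop := ∃ m < 2^(N+1), adm N lo hi m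

/-- Rectangle rows. `A`,`B`: lower/upper edge in direction `u`; `C`,`E`: edges in direction `v`. -/
structure Row where
  m : ℕ
  k : ℕ
  tag : ℕ
  A : ℕ → Ent
  B : ℕ → Ent
  C : ℕ → Ent
  E : ℕ → Ent

structure Rec where
  M : ℕ
  K : ℕ
  ru : ℕ → ℕ
  rv : ℕ → ℕ
  L : ℕ → ℕ → Ent
  ch : ℕ → ℕ
  rc : ℕ → ℕ → ℕ

structure TRow where
  m : ℕ
  L : ℕ → Ent
  U : ℕ → Ent

structure TRec where
  M : ℕ
  Q : ℕ
  ruZ : ℕ → ℕ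
  ruC : ℕ → ℕ
  zc : ℕ → ℕ
  V : ℕ → ℕ → Ent
  H : ℕ → ℕ → Ent
  chT : ℕ → ℕ
  chR : ℕ → ℕ
  rT : ℕ → ℕ → ℕ
  rA : ℕ → ℕ → ℕ
  rC : ℕ → ℕ → ℕ

/-- index maps from a refinement (`M` slots) to a coarser subdivision (`m` slots) -/
def IsRef (ru : ℕ → ℕ) (M m : ℕ) : Prop :=
  ru 0 = 0 ∧ ru (2*M) = 2*m ∧ ∀ j < 2*M, (j % 2 = 1 → ru j % 2 = 1) ∧
    (ru j % 2 = 0 → ru (j+1) = ru j + 1) ∧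
    (ru j % 2 = 1 → ru (j+1) = ru j ∨ ru (j+1) = ru j + 1)

def Halv (ru : ℕ → ℕ) (M : ℕ) : Prop :=
  ∀ j < M, ru (2*j) % 2 = 0 → ru (2*j+2) % 2 = 1

def gq (e e' : Ent) : Prop := e.lo = e'.lo ∧ e.hi = e'.hi

def refE (N : ℕ) (e : Ent) (i : ℕ) (e' : Ent) (j : ℕ) : Prop :=
  gq e e' ∧ (e'.lab ≠ 0 → (i % 2 = j % 2 ∧ e'.lab = e.lab) ∨
    (i % 2 = 1 ∧ j % 2 = 0 ∧ e.lab = 1 ∧ adm N e.lo e.hi (e'.lab - 1)))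

def cooE (e : Ent) (i : ℕ) (e' : Ent) (j : ℕ) : Prop :=
  gq e e' ∧ (i % 2 = j % 2 → e.lab ≠ 0 → e'.lab = e.lab)

def wit (N i j : ℕ) (e : Ent) : Prop :=
  e.lab ≠ 0 ∧ (j % 2 = 0 → bit (e.lab - 1) i) ∧
    (j % 2 = 1 → e.lab = 1 ∧ ∃ m < 2^(N+1), adm N e.lo e.hi m ∧ bit m i)

/-- an entry on an interior line -/
def intE (N : ℕ) (e : Ent) (j : ℕ) : Prop :=
  (j % 2 = 0 → e.lab ≠ 0 ∧ adm N e.lo e.hi (e.lab - 1)) ∧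
  (j % 2 = 1 → e.lab = 1 ∧ hasAdm N e.lo e.hi)

def EdgeOK (N m : ℕ) (A : ℕ → Ent) : Prop :=
  (∀ i ≤ 2*m, ple N (A i).lo (A i).hi) ∧
  ∀ i < m, ple N (A (2*i+1)).hi (A (2*i)).hi ∧ ple N (A (2*i+2)).lo (A (2*i+1)).lo

def OppOK (N m : ℕ) (A B : ℕ → Ent) : Prop :=
  ∀ i < 2*m, ∀ j ≤ 2*m, (i < j ∨ (i = j ∧ i % 2 = 1)) → ple N (A i).hi (B j).lo

def AdjOK (N m k : ℕ) (A E : ℕ → Ent) : Prop :=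
  ∀ i < 2*m, ∀ j ≤ 2*k, 0 < j → ple N (A i).hi (E j).lo

structure RowOK (N : ℕ) (r : Row) : Prop where
  hm : 1 ≤ r.m
  hk : 1 ≤ r.k
  c1 : r.A 0 = r.C 0
  c2 : r.A (2*r.m) = r.E 0
  c3 : r.B 0 = r.C (2*r.k)
  c4 : r.B (2*r.m) = r.E (2*r.k)
  eA : EdgeOK N r.m r.A
  eB : EdgeOK N r.m r.B
  eC : EdgeOK N r.k r.C
  eE : EdgeOK N r.k r.E
  oAB : OppOK N r.m r.A r.B
  oCE : OppOK N r.k r.C r.E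
  aAE : AdjOK N r.m r.k r.A r.E
  aCB : AdjOK N r.k r.m r.C r.B
  ht : r.tag ≤ 6
  tg : r.tag = 0 → hasAdm N (r.A 0).hi (r.B (2*r.m)).lo

def sameGap (N : ℕ) (r c : Row) : Prop :=
  ple N (r.A 0).hi (c.A 0).hi ∧ ple N (c.A 0).hi (r.A 0).hi ∧
  ple N (r.B (2*r.m)).lo (c.B (2*c.m)).lo ∧ ple N (c.B (2*c.m)).lo (r.B (2*r.m)).lo

def tagStep (M t tag tag' rk rk' : ℕ) : Prop :=
  tag = 0 ∨ tag' = 0 ∨ (tag = 1 ∧ tag' = 2) ∨ (tag = 2 ∧ tag' = 3) ∨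
  (tag = 3 ∧ ((t = 0 ∧ tag' = 5) ∨ (t + 1 = M ∧ tag' = 4) ∨ tag' = 6)) ∨
  (tag = 4 ∧ ((t = 0 ∧ tag' = 5) ∨ tag' = 6)) ∨
  (tag = 5 ∧ ((t + 1 = M ∧ tag' = 4) ∨ tag' = 6)) ∨
  (tag = 6 ∧ tag' = 6 ∧ rk' < rk)

structure ChildOK (N : ℕ) (r : Row) (R : Rec) (t : ℕ) (c : Row) : Prop where
  k1 : c.k = 1
  ref : IsRef (R.rc t) R.K c.m
  A : ∀ j ≤ 2*R.K, cooE (c.A (R.rc t j)) (R.rc t j) (R.L t j) j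
  B : ∀ j ≤ 2*R.K, cooE (c.B (R.rc t j)) (R.rc t j) (R.L (t+1) j) j
  C : cooE (c.C 1) 1 (r.A (R.ru (2*t+1))) 1
  E : cooE (c.E 1) 1 (r.B (R.ru (2*t+1))) 1

/-- label bit `i` occurs somewhere in the closed cell -/
def WitIn (N : ℕ) (r : Row) (R : Rec) (i : ℕ) : Prop :=
  (∃ j ≤ 2*r.m, wit N i j (r.A j)) ∨ (∃ j ≤ 2*r.m, wit N i j (r.B j)) ∨
  (∃ j ≤ 2*r.k, wit N i j (r.C j)) ∨ (∃ j ≤ 2*r.k, wit N i j (r.E j)) ∨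
  ∃ t < R.M, 0 < t ∧ ∃ j < R.K, 0 < j ∧ bit ((R.L t (2*j)).lab - 1) i

structure RecOK (N : ℕ) (row : ℕ → Row) (rk : ℕ → ℕ) (S : ℕ → Prop) (s : ℕ) (R : Rec) : Prop where
  refu : IsRef R.ru R.M (row s).m
  halv : Halv R.ru R.M
  refv : IsRef R.rv R.K (row s).k
  LA : ∀ t ≤ R.M, refE N ((row s).A (R.ru (2*t))) (R.ru (2*t)) (R.L t 0) 0
  LB : ∀ t ≤ R.M, refE N ((row s).B (R.ru (2*t))) (R.ru (2*t)) (R.L t (2*R.K)) 0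
  LC : ∀ j ≤ 2*R.K, refE N ((row s).C (R.rv j)) (R.rv j) (R.L 0 j) j
  LE : ∀ j ≤ 2*R.K, refE N ((row s).E (R.rv j)) (R.rv j) (R.L R.M j) j
  Li : ∀ t < R.M, 0 < t → ∀ j < 2*R.K, 0 < j → intE N (R.L t j) j
  chS : ∀ t < R.M, S (R.ch t)
  chO : ∀ t < R.M, ChildOK N (row s) R t (row (R.ch t))
  tg : ∀ t < R.M, sameGap N (row s) (row (R.ch t)) →
    tagStep R.M t (row s).tag (row (R.ch t)).tag (rk s) (rk (R.ch t))
  FA : ∀ a < (row s).m, ∀ i ≤ N, bit ((row s).A (2*a+1)).hi.f i →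
    bit ((row s).B (2*a+1)).hi.f i ∨ bit ((row s).E 1).hi.f i ∨ WitIn N (row s) R i
  FC : ∀ a < (row s).k, ∀ i ≤ N, bit ((row s).C (2*a+1)).hi.f i →
    bit ((row s).E (2*a+1)).hi.f i ∨ bit ((row s).B 1).hi.f i ∨ WitIn N (row s) R i
  PB : ∀ a < (row s).m, ∀ i ≤ N, bit ((row s).B (2*a+1)).lo.p i →
    bit ((row s).A (2*a+1)).lo.p i ∨ bit ((row s).C (2*(row s).k-1)).lo.p i ∨ WitIn N (row s) R i
  PE : ∀ a < (row s).k, ∀ i ≤ N, bit ((row s).E (2*a+1)).lo.p i →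
    bit ((row s).C (2*a+1)).lo.p i ∨ bit ((row s).A (2*(row s).m-1)).lo.p i ∨ WitIn N (row s) R i

structure TRowOK (N : ℕ) (r : TRow) : Prop where
  hm : 1 ≤ r.m
  c : r.L (2*r.m) = r.U 0
  lhL : ∀ i ≤ 2*r.m, 0 < i → ple N (r.L i).lo (r.L i).hi
  lhU : ∀ i < 2*r.m, ple N (r.U i).lo (r.U i).hi
  eL1 : ∀ i < r.m, 0 < i → ple N (r.L (2*i+1)).hi (r.L (2*i)).hi
  eL2 : ∀ i < r.m, ple N (r.L (2*i+2)).lo (r.L (2*i+1)).lo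
  eU1 : ∀ i < r.m, ple N (r.U (2*i+1)).hi (r.U (2*i)).hi
  eU2 : ∀ i < r.m, i + 1 < r.m → ple N (r.U (2*i+2)).lo (r.U (2*i+1)).lo
  o : ∀ i < 2*r.m, 0 < i → ∀ j < 2*r.m, 0 < j → ple N (r.L i).hi (r.U j).lo

def TWitIn (N : ℕ) (r : TRow) (R : TRec) (i : ℕ) : Prop :=
  (∃ j ≤ 2*r.m, 0 < j ∧ wit N i j (r.L j)) ∨ (∃ j < 2*r.m, wit N i j (r.U j)) ∨
  ∃ t < R.M, 0 < t ∧ ∃ j < R.Q, R.zc t < j ∧ bit ((R.V t (2*j)).lab - 1) i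

structure ChildTOK (R : TRec) (t : ℕ) (c : TRow) : Prop where
  ref : IsRef (R.rT t) (R.zc (t+1) - R.zc t) c.m
  L : ∀ j ≤ 2*(R.zc (t+1) - R.zc t), 0 < j →
    cooE (c.L (R.rT t j)) (R.rT t j) (R.V t (2*R.zc t + j)) j
  U : ∀ j < 2*(R.zc (t+1) - R.zc t),
    cooE (c.U (R.rT t j)) (R.rT t j) (R.H t (2*R.zc t + j)) j

structure ChildROK (N : ℕ) (r : TRow) (R : TRec) (t : ℕ) (c : Row) : Prop where
  refA : IsRef (R.rA t) (R.zc (t+1) - R.zc t) c.m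
  refC : IsRef (R.rC t) (R.Q - R.zc (t+1)) c.k
  A : ∀ j < 2*(R.zc (t+1) - R.zc t), cooE (c.A (R.rA t j)) (R.rA t j) (R.H t (2*R.zc t + j)) j
  A1 : (c.A (2*c.m)).lab = 0
  B0 : cooE (c.B 0) 0 (R.V t (2*R.Q)) 0
  B1 : cooE (c.B (2*c.m)) 0 (R.V (t+1) (2*R.Q)) 0
  Bi : ∀ i < 2*c.m, 0 < i → refE N (r.U (R.ruZ (2*t+1))) 1 (c.B i) i
  C : ∀ j ≤ 2*(R.Q - R.zc (t+1)), cooE (c.C (R.rC t j)) (R.rC t j) (R.V t (2*R.zc (t+1) + j)) j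
  E : ∀ j ≤ 2*(R.Q - R.zc (t+1)), 0 < j →
    cooE (c.E (R.rC t j)) (R.rC t j) (R.V (t+1) (2*R.zc (t+1) + j)) j

structure TRecOK (N : ℕ) (row : ℕ → Row) (trow : ℕ → TRow) (S ST : ℕ → Prop) (s : ℕ) (R : TRec) :
    Prop where
  refZ : IsRef R.ruZ R.M (trow s).m
  halv : Halv R.ruZ R.M
  refC : IsRef R.ruC R.Q R.M
  zc0 : R.zc 0 = 0
  zcM : R.zc R.M = R.Q
  zcl : ∀ t < R.M, R.zc t < R.zc (t+1)
  zcr : ∀ t ≤ R.M, R.ruC (2*R.zc t) = 2*t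
  VL : ∀ j ≤ 2*R.Q, 0 < j →
    refE N ((trow s).L (R.ruZ (R.ruC j))) (R.ruZ (R.ruC j)) (R.V 0 j) j
  HU : ∀ j < 2*R.Q, 2*R.zc (R.M-1) ≤ j →
    refE N ((trow s).U (R.ruZ (R.ruC j))) (R.ruZ (R.ruC j)) (R.H (R.M-1) j) j
  VU : ∀ t < R.M, refE N ((trow s).U (R.ruZ (2*t))) (R.ruZ (2*t)) (R.V t (2*R.Q)) 0
  HV : ∀ t < R.M, R.H t (2*R.zc t) = R.V t (2*R.zc (t+1))
  Vi : ∀ t < R.M, 0 < t → ∀ j < 2*R.Q, 2*R.zc t < j → intE N (R.V t j) j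
  Hi : ∀ t < R.M, t + 1 < R.M → ∀ j < 2*R.zc (t+1), 2*R.zc t < j → intE N (R.H t j) j
  cTS : ∀ t < R.M, ST (R.chT t)
  cTO : ∀ t < R.M, ChildTOK R t (trow (R.chT t))
  cRS : ∀ t < R.M, t + 1 < R.M → S (R.chR t)
  cRO : ∀ t < R.M, t + 1 < R.M → ChildROK N (trow s) R t (row (R.chR t))
  TF : ∀ a < (trow s).m, ∀ i ≤ N, bit ((trow s).L (2*a+1)).hi.f i →
    bit ((trow s).U 1).hi.f i ∨ TWitIn N (trow s) R i
  TP : ∀ a < (trow s).m, ∀ i ≤ N, bit ((trow s).U (2*a+1)).lo.p i →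
    bit ((trow s).L (2*(trow s).m-1)).lo.p i ∨ TWitIn N (trow s) R i

structure RootOK (N : ℕ) (r : TRow) (R : TRec) : Prop where
  U : ∀ a < r.m, ∀ i ≤ N, ¬ bit (r.U (2*a+1)).hi.f i
  L : ∀ a < r.m, ∀ i ≤ N, ¬ bit (r.L (2*a+1)).lo.p i
  lU : ∀ j < 2*r.m, (r.U j).lab = 0
  lL : ∀ j ≤ 2*r.m, 0 < j → (r.L j).lab = 0
  w : ∃ t < R.M, 0 < t ∧ ∃ j < R.Q, R.zc t < j ∧ bit ((R.V t (2*j)).lab - 1) N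

structure Cert (N : ℕ) (row : ℕ → Row) (trow : ℕ → TRow) (rk : ℕ → ℕ) (S ST : ℕ → Prop) : Prop where
  rows : ∀ s, S s → RowOK N (row s)
  recs : ∀ s, S s → ∃ R, RecOK N row rk S s R
  trows : ∀ s, ST s → TRowOK N (trow s)
  trecs : ∀ s, ST s → ∃ R, TRecOK N row trow S ST s R
  root : ∃ s, ST s ∧ ∃ R, TRecOK N row trow S ST s R ∧ RootOK N (trow s) R

/-! ## Part B1: marks and refinements -/

variable {N n m k i j s t t' M K : ℕ} {x y u v a b x' y' η ε : ℝ} {us vs Us : ℕ -> ℝ} {ru : ℕ -> ℕ} {sw : Bool} {e e' : Ent} {r : Row} {A : ℕ -> Ent}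

def loc (us : ℕ -> ℝ) (i : ℕ) (x : ℝ) : Prop :=
  (i % 2 = 0 /\ x = us (i/2)) ∨ (i % 2 = 1 /\ us (i/2) < x /\ x < us (i/2+1))

def SM (us : ℕ -> ℝ) (m : ℕ) : Prop := ∀ i < m, us i < us (i+1)

theorem SM.lt (h : SM us m) : ∀ {i j : ℕ}, i < j -> j <= m -> us i < us j := by
  intro i j hij hj
  induction j, hij using Nat.le_induction with
  | base => exact h _ hj
  | succ j h1 ih => exact (ih (by omega)).trans (h j (by omega))

theorem SM.le (h : SM us m) (hij : i <= j) (hj : j <= m) : us i <= us j := by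
  rcases hij.eq_or_lt with rfl | h1
  · exact le_rfl
  · exact (h.lt h1 hj).le

theorem SM.lt_iff (h : SM us m) (hi : i <= m) (hj : j <= m) : us i < us j ↔ i < j := by
  constructor
  · intro h1; by_contra hc; exact absurd (h.le (not_lt.1 hc) hi) (not_le.2 h1)
  · intro h1; exact h.lt h1 hj

theorem SM.le_iff (h : SM us m) (hi : i <= m) (hj : j <= m) : us i <= us j ↔ i <= j := by
  rw [<- not_lt, h.lt_iff hj hi, not_lt]

theorem SM.inj (h : SM us m) (hi : i <= m) (hj : j <= m) (e : us i = us j) : i = j := by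
  have h1 := (h.le_iff hi hj).1 e.le
  have h2 := (h.le_iff hj hi).1 e.ge
  omega

theorem loc_ge (h : loc us i x) : us (i/2) <= x := by
  rcases h with ⟨_, h⟩ | ⟨_, h, _⟩
  · exact h.ge
  · exact h.le

theorem loc_le (h : loc us i x) : x <= us ((i+1)/2) := by
  rcases h with ⟨h0, h⟩ | ⟨h0, _, h⟩
  · rw [show (i+1)/2 = i/2 by omega]; exact h.le
  · rw [show (i+1)/2 = i/2+1 by omega]; exact h.le

theorem loc_even (us : ℕ -> ℝ) (i : ℕ) : loc us (2*i) (us i) := by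
  left; constructor
  · omega
  · congr 1; omega

theorem loc_even_iff : loc us (2*i) x ↔ x = us i := by
  unfold loc
  rw [show 2*i/2 = i by omega]
  constructor
  · rintro (⟨_, h⟩ | ⟨h, _⟩)
    · exact h
    · omega
  · intro h; left; exact ⟨by omega, h⟩

theorem loc_odd_iff : loc us (2*i+1) x ↔ us i < x /\ x < us (i+1) := by
  unfold loc
  rw [show (2*i+1)/2 = i by omega]
  constructor
  · rintro (⟨h, _⟩ | ⟨_, h⟩)
    · omega
    · exact h
  · intro h; right; exact ⟨by omega, h⟩

theorem loc_lt (h : SM us m) (hi : i <= 2*m) (hj : j <= 2*m) (h1 : loc us i x) (h2 : loc us j y) (hxy : x < y) : i < j ∨ (i = j /\ i % 2 = 1) := by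
  have a := loc_ge h1
  have b := loc_le h2
  have c : us (i/2) < us ((j+1)/2) := by linarith
  have d := (h.lt_iff (by omega) (by omega)).1 c
  by_contra hc
  push Not at hc
  have e : j <= i := hc.1
  by_cases hij : i = j
  · have := hc.2 hij; omega
  · have : i / 2 = j/2 /\ i % 2 = 1 /\ j % 2 = 0 ∨ (j+1)/2 <= i/2 := by omega
    omega

theorem loc_unique (h : SM us m) (hi : i <= 2*m) (hj : j <= 2*m) (h1 : loc us i x) (h2 : loc us j x) : i = j := by
  have key : ∀ {i j : ℕ}, i <= 2*m -> j <= 2*m -> loc us i x -> loc us j x -> i <= j := by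
    intro i j hi hj h1 h2
    by_contra hc
    push Not at hc
    have hle : us ((j+1)/2) <= us (i/2) := h.le (by omega) (by omega)
    have ha := loc_ge h1
    have hb := loc_le h2
    rcases h1 with ⟨p1, q1⟩ | ⟨p1, q1, r1⟩
    · rcases h2 with ⟨p2, q2⟩ | ⟨p2, q2, r2⟩
      · have := h.inj (by omega) (by omega) (q1.symm.trans q2); omega
      · have : us (j/2+1) <= us (i/2) := h.le (by omega) (by omega)
        linarith
    · linarith
  exact le_antisymm (key hi hj h1 h2) (key hj hi h2 h1)

theorem loc_exists (h0 : us 0 <= x) (h1 : x <= us m) : ∃ i ≤ 2*m, loc us i x := by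
  induction m with
  | zero => exact ⟨0, le_rfl, Or.inl ⟨rfl, le_antisymm h1 h0⟩⟩
  | succ m ih =>
    by_cases h : x <= us m
    · obtain ⟨i, hi, hl⟩ := ih h
      exact ⟨i, by omega, hl⟩
    · push Not at h
      rcases h1.eq_or_lt with e | e
      · exact ⟨2*(m+1), le_rfl, loc_even_iff.2 e⟩
      · exact ⟨2*m+1, by omega, loc_odd_iff.2 ⟨h, e⟩⟩

theorem loc_ge0 (h : SM us m) (hi : i <= 2*m) (h1 : loc us i x) : us 0 <= x :=
  (h.le (Nat.zero_le _) (by omega)).trans (loc_ge h1)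

theorem loc_lem (h : SM us m) (hi : i <= 2*m) (h1 : loc us i x) : x <= us m :=
  (loc_le h1).trans (h.le (by omega) le_rfl)

theorem loc_pos_iff (h : SM us m) (hi : i <= 2*m) (h1 : loc us i x) : us 0 < x ↔ 0 < i := by
  constructor
  · intro hx
    rcases loc_lt h (by omega) hi (loc_even us 0) h1 hx with h2 | h2 <;> omega
  · intro hx
    rcases h1 with ⟨a, b⟩ | ⟨a, b, _⟩
    · rw [b]; exact h.lt (by omega) (by omega)
    · exact (h.le (Nat.zero_le _) (by omega)).trans_lt b

theorem loc_lt_iff (h : SM us m) (hi : i <= 2*m) (h1 : loc us i x) : x < us m ↔ i < 2*m := by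
  constructor
  · intro hx
    rcases loc_lt h hi le_rfl h1 (loc_even us m) hx with h2 | h2 <;> omega
  · intro hx
    rcases h1 with ⟨a, b⟩ | ⟨a, _, b⟩
    · rw [b]; exact h.lt (by omega) (by omega)
    · exact b.trans_le (h.le (by omega) (by omega))

theorem loc_shift {X : ℕ -> ℝ} {z : ℕ} : loc (fun n => X (z + n)) j x ↔ loc X (2*z+j) x := by
  unfold loc
  rw [show (2*z+j)/2 = z + j/2 by omega, show (2*z+j)%2 = j % 2 by omega]
  rfl

theorem SM.shift {X : ℕ -> ℝ} {Q z : ℕ} (h : SM X Q) (hz : z + K <= Q) : SM (fun n => X (z+n)) K := fun i hi => h (z+i) (by omega)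

/-! ### index maps -/

theorem IsRef.step (h : IsRef ru M m) (hj : j < 2*M) : ru (j+1) = ru j ∨ ru (j+1) = ru j + 1 := by
  have := h.2.2 j hj
  rcases Nat.mod_two_eq_zero_or_one (ru j) with e | e
  · right; exact this.2.1 e
  · exact this.2.2 e

theorem IsRef.mono (h : IsRef ru M m) (hij : i <= j) (hj : j <= 2*M) : ru i <= ru j := by
  induction j, hij using Nat.le_induction with
  | base => exact le_rfl
  | succ j h1 ih =>
    have := h.step (j := j) (by omega)
    have := ih (by omega)
    omega

theorem IsRef.le (h : IsRef ru M m) (hj : j <= 2*M) : ru j <= 2*m := by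
  rw [<- h.2.1]; exact h.mono hj le_rfl

theorem IsRef.odd (h : IsRef ru M m) (hj : j <= 2*M) (h1 : j % 2 = 1) : ru j % 2 = 1 := (h.2.2 j (by omega)).1 h1

/-- after an even value the map increases -/
theorem IsRef.lt_of_even (h : IsRef ru M m) (hij : i < j) (hj : j <= 2*M) (he : ru i % 2 = 0) : ru i < ru j := by
  have h1 := (h.2.2 i (by omega)).2.1 he
  have h2 := h.mono (i := i+1) (j := j) hij hj
  omega

theorem IsRef.lt_of_even' (h : IsRef ru M m) (hij : i < j) (hj : j <= 2*M) (he : ru j % 2 = 0) : ru i < ru j := by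
  obtain ⟨j, rfl⟩ : ∃ k, j = k+1 := ⟨j-1, by omega⟩
  have h1 := h.2.2 j (by omega)
  have h2 := h.mono (i := i) (j := j) (by omega) (by omega)
  have h3 := h.step (j := j) (by omega)
  rcases h3 with h3 | h3
  · rw [h3] at he
    have := h1.2.1 he; omega
  · omega

theorem IsRef.pos (h : IsRef ru M m) (hj : j <= 2*M) (h0 : 0 < j) : 0 < ru j := by
  have := h.lt_of_even h0 hj (by rw [h.1])
  rw [h.1] at this; exact this

theorem IsRef.ltm (h : IsRef ru M m) (hj : j < 2*M) : ru j < 2*m := by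
  have := h.lt_of_even' hj le_rfl (by rw [h.2.1]; omega)
  rw [h.2.1] at this; exact this

theorem IsRef.surj (h : IsRef ru M m) {v : ℕ} (hv : v <= 2*m) : ∃ j ≤ 2*M, ru j = v := by
  have : ∀ J ≤ 2*M, ∀ v ≤ ru J, ∃ j ≤ J, ru j = v := by
    intro J
    induction J with
    | zero => intro _ v hv; rw [h.1] at hv; exact ⟨0, le_rfl, by rw [h.1]; omega⟩
    | succ J ih =>
      intro hJ v hv
      by_cases hc : v <= ru J
      · obtain ⟨j, a, b⟩ := ih (by omega) v hc
        exact ⟨j, by omega, b⟩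
      · have := h.step (j := J) (by omega)
        exact ⟨J+1, le_rfl, by omega⟩
  exact this _ le_rfl v (by rw [h.2.1]; exact hv)

theorem IsRef.surjE (h : IsRef ru M m) {v : ℕ} (hv : v <= m) : ∃ t ≤ M, ru (2*t) = 2*v := by
  obtain ⟨j, hj, e⟩ := h.surj (v := 2*v) (by omega)
  have : j % 2 = 0 := by
    by_contra hc
    have := h.odd hj (by omega)
    omega
  exact ⟨j/2, by omega, by rw [show 2*(j/2) = j by omega]; exact e⟩

/-! ### refining marks -/

noncomputable def refU (us : ℕ -> ℝ) (ru : ℕ -> ℕ) : ℕ -> ℝ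
  | 0 => us 0
  | t+1 => if ru (2*t+2) % 2 = 0 then us (ru (2*t+2) / 2)
      else (refU us ru t + us (ru (2*t+2) / 2 + 1)) / 2

theorem refU_loc (hus : SM us m) (h : IsRef ru M m) : ∀ t ≤ M, loc us (ru (2*t)) (refU us ru t) /\ (∀ t', t = t'+1 -> refU us ru t' < refU us ru t) := by
  intro t
  induction t with
  | zero =>
    intro _
    refine ⟨?_, by intro t' ht; omega⟩
    rw [show 2*0 = 0 from rfl, h.1]; exact loc_even us 0
  | succ t ih =>
    intro ht
    have l := (ih (by omega)).1
    have s1 := h.step (j := 2*t) (by omega)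
    have s2 := h.step (j := 2*t+1) (by omega)
    have o := h.odd (j := 2*t+1) (by omega) (by omega)
    have le2 := h.le (j := 2*t+2) (by omega)
    rw [show 2*t+1+1 = 2*t+2 by omega] at s2
    rw [show 2*(t+1) = 2*t+2 by ring]
    have hstep : refU us ru (t+1) = if ru (2*t+2) % 2 = 0 then us (ru (2*t+2) / 2)
      else (refU us ru t + us (ru (2*t+2) / 2 + 1)) / 2 := rfl
    by_cases he : ru (2*t+2) % 2 = 0
    · rw [if_pos he] at hstep
      have hx := h.lt_of_even' (i := 2*t) (j := 2*t+2) (by omega) (by omega) he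
      have : refU us ru t < us (ru (2*t+2) / 2) := by
        rcases l with ⟨a, b⟩ | ⟨a, _, b⟩
        · rw [b]; exact hus.lt (by omega) (by omega)
        · exact b.trans_le (hus.le (by omega) (by omega))
      constructor
      · left; exact ⟨he, hstep⟩
      · intro t' ht'
        obtain rfl : t = t' := by omega
        rw [hstep]; exact this
    · rw [if_neg he] at hstep
      have e1 : ru (2*t+2) = ru (2*t+1) := by omega
      have b1 : us (ru (2*t+2)/2) <= refU us ru t := by
        rcases s1 with s | s
        · have := loc_ge l; rw [e1, s]; exact this
        · have := loc_ge l
          have : ru (2*t) % 2 = 0 := by omega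
          rw [show ru (2*t+2)/2 = ru (2*t)/2 by omega]
          exact loc_ge l
      have b2 : refU us ru t < us (ru (2*t+2)/2+1) := by
        rcases l with ⟨a, b⟩ | ⟨a, _, b⟩
        · rw [b]; exact hus.lt (by omega) (by omega)
        · exact b.trans_le (hus.le (by omega) (by omega))
      have b3 : us (ru (2*t+2)/2) < us (ru (2*t+2)/2+1) := hus _ (by omega)
      constructor
      · right; refine ⟨by omega, ?_, ?_⟩
        · rw [hstep]; linarith
        · rw [hstep]; linarith
      · intro t' ht'
        obtain rfl : t = t' := by omega
        rw [hstep]; linarith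

theorem refU_SM (hus : SM us m) (h : IsRef ru M m) : SM (refU us ru) M := fun t ht => (refU_loc hus h (t+1) ht).2 t rfl

theorem refU_last (hus : SM us m) (h : IsRef ru M m) : refU us ru M = us m := by
  have := (refU_loc hus h M le_rfl).1
  rw [h.2.1] at this
  exact loc_even_iff.1 this

theorem refU_transfer (hus : SM us m) (h : IsRef ru M m) (hj : j <= 2*M) (hl : loc (refU us ru) j x) : loc us (ru j) x := by
  rcases hl with ⟨a, b⟩ | ⟨a, b, c⟩
  · have := (refU_loc hus h (j/2) (by omega)).1
    rw [show 2*(j/2) = j by omega] at this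
    rw [b]; exact this
  · have l1 := (refU_loc hus h (j/2) (by omega)).1
    have l2 := (refU_loc hus h (j/2+1) (by omega)).1
    have o := h.odd hj a
    have s1 := h.step (j := j-1) (by omega)
    have s2 := h.step (j := j) (by omega)
    have le2 := h.le (j := j+1) (by omega)
    rw [show 2*(j/2) = j-1 by omega] at l1
    rw [show 2*(j/2+1) = j+1 by omega] at l2
    rw [show j-1+1 = j by omega] at s1
    right
    refine ⟨o, ?_, ?_⟩
    · have : us (ru j/2) <= refU us ru (j/2) := by
        have := loc_ge l1
        rwa [show ru (j-1)/2 = ru j/2 by omega] at this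
      linarith
    · have : refU us ru (j/2+1) <= us (ru j/2+1) := by
        have := loc_le l2
        rwa [show (ru (j+1)+1)/2 = ru j/2+1 by omega] at this
      linarith

theorem refU_half (hus : SM us m) (h : IsRef ru M m) (hh : Halv ru M) (ht : t < M) : refU us ru (t+1) - refU us ru t <= (us m - us 0)/2 := by
  have hm : ∀ t ≤ M, us 0 <= refU us ru t := fun t ht => (refU_SM hus h).le (Nat.zero_le _) ht
  have le2 := h.le (j := 2*t+2) (by omega)
  have hstep : ∀ t, refU us ru (t+1) = if ru (2*t+2) % 2 = 0 then us (ru (2*t+2) / 2)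
      else (refU us ru t + us (ru (2*t+2) / 2 + 1)) / 2 := fun _ => rfl
  by_cases he : ru (2*t+2) % 2 = 0
  · have ho : ru (2*t) % 2 = 1 := by
      by_contra hc
      have := hh t ht (by omega); omega
    have ht0 : 0 < t := by
      rcases Nat.eq_zero_or_pos t with rfl | h1
      · simp [h.1] at ho
      · exact h1
    obtain ⟨t, rfl⟩ : ∃ k, t = k+1 := ⟨t-1, by omega⟩
    have h1 := hstep (t+1)
    rw [if_pos he] at h1
    have h2 := hstep t
    rw [show 2*(t+1) = 2*t+2 by ring] at ho
    rw [if_neg (by omega)] at h2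
    have s1 := h.step (j := 2*t+2) (by omega)
    have s2 := h.step (j := 2*t+3) (by omega)
    have o := h.odd (j := 2*t+3) (by omega) (by omega)
    rw [show 2*(t+1)+2 = 2*t+4 by ring] at he h1 le2
    have e1 : ru (2*t+4)/2 = ru (2*t+2)/2+1 := by
      simp only [show 2*t+2+1 = 2*t+3 by omega, show 2*t+3+1 = 2*t+4 by omega] at s1 s2
      omega
    rw [h1, h2, e1]
    have := hm t (by omega)
    have : us (ru (2*t+2)/2+1) <= us m := hus.le (by omega) le_rfl
    linarith
  · have h1 := hstep t
    rw [if_neg he] at h1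
    rw [h1]
    have := hm t (by omega)
    have : us (ru (2*t+2)/2+1) <= us m := hus.le (by omega) le_rfl
    linarith

/-! ### marks of children -/

open Classical in
noncomputable def cm (V : ℕ -> ℝ) (rc : ℕ -> ℕ) (K : ℕ) (i : ℕ) : ℝ :=
  if h : ∃ t ≤ K, rc (2*t) = 2*i then V h.choose else 0

theorem cm_eq {V : ℕ -> ℝ} {rc : ℕ -> ℕ} (h : IsRef rc K m) (ht : t <= K) (e : rc (2*t) = 2*i) : cm V rc K i = V t := by
  have hx : ∃ t ≤ K, rc (2*t) = 2*i := ⟨t, ht, e⟩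
  unfold cm
  rw [dif_pos hx]
  have hs := hx.choose_spec
  congr 1
  rcases lt_trichotomy hx.choose t with h1 | h1 | h1
  · have := h.lt_of_even (i := 2*hx.choose) (j := 2*t) (by omega) (by omega) (by rw [hs.2]; omega)
    rw [hs.2, e] at this; omega
  · exact h1
  · have := h.lt_of_even (i := 2*t) (j := 2*hx.choose) (by omega) (by omega) (by rw [e]; omega)
    rw [hs.2, e] at this; omega

theorem cm_zero {V : ℕ -> ℝ} {rc : ℕ -> ℕ} (h : IsRef rc K m) : cm V rc K 0 = V 0 :=
  cm_eq h (Nat.zero_le _) (by rw [show 2*0 = 0 from rfl, h.1])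

theorem cm_last {V : ℕ -> ℝ} {rc : ℕ -> ℕ} (h : IsRef rc K m) : cm V rc K m = V K :=
  cm_eq h le_rfl h.2.1

theorem cm_SM {V : ℕ -> ℝ} {rc : ℕ -> ℕ} (hV : SM V K) (h : IsRef rc K m) : SM (cm V rc K) m := by
  intro i hi
  obtain ⟨t, ht, e⟩ := h.surjE (v := i) (by omega)
  obtain ⟨t', ht', e'⟩ := h.surjE (v := i+1) (by omega)
  rw [cm_eq h ht e, cm_eq h ht' e']
  apply hV.lt _ ht'
  by_contra hc
  have := h.mono (i := 2*t') (j := 2*t) (by omega) (by omega)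
  omega

theorem cm_transfer {V : ℕ -> ℝ} {rc : ℕ -> ℕ} (hV : SM V K) (h : IsRef rc K m) (hj : j <= 2*K) (hl : loc V j x) : loc (cm V rc K) (rc j) x := by
  have hle := h.le hj
  rcases Nat.mod_two_eq_zero_or_one (rc j) with e | e
  · have hj2 : j % 2 = 0 := by
      by_contra hc
      have := h.odd hj (by omega); omega
    left
    refine ⟨e, ?_⟩
    rw [cm_eq (t := j/2) h (by omega) (by rw [show 2*(j/2) = j by omega]; omega)]
    rcases hl with ⟨_, b⟩ | ⟨a, _⟩
    · exact b
    · omega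
  · obtain ⟨t, ht, e1⟩ := h.surjE (v := rc j/2) (by omega)
    obtain ⟨t', ht', e2⟩ := h.surjE (v := rc j/2+1) (by omega)
    right
    refine ⟨e, ?_, ?_⟩
    · rw [cm_eq h ht e1]
      have : 2*t < j := by
        by_contra hc
        have := h.mono (i := j) (j := 2*t) (by omega) (by omega)
        omega
      rcases hl with ⟨a, b⟩ | ⟨a, b, _⟩
      · rw [b]; exact hV.lt (by omega) (by omega)
      · exact (hV.le (by omega) (by omega)).trans_lt b
    · rw [cm_eq h ht' e2]
      have : j < 2*t' := by
        by_contra hc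
        have := h.mono (i := 2*t') (j := j) (by omega) (by omega)
        omega
      rcases hl with ⟨a, b⟩ | ⟨a, _, b⟩
      · rw [b]; exact hV.lt (by omega) (by omega)
      · exact b.trans_le (hV.le (by omega) (by omega))

/-- given a location in the coarse marks, find the fine one -/
theorem cm_back {V : ℕ -> ℝ} {rc : ℕ -> ℕ} (hV : SM V K) (h : IsRef rc K m) (hi : i <= 2*m) (hl : loc (cm V rc K) i x) : ∃ j ≤ 2*K, rc j = i /\ loc V j x := by
  have a := loc_ge0 (cm_SM hV h) hi hl
  have b := loc_lem (cm_SM hV h) hi hl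
  rw [cm_zero h] at a
  rw [cm_last h] at b
  obtain ⟨j, hj, hx⟩ := loc_exists a b
  exact ⟨j, hj, loc_unique (cm_SM hV h) (h.le hj) hi (cm_transfer hV h hj hx) hl, hx⟩

theorem refU_back (hus : SM us m) (h : IsRef ru M m) (hi : i <= 2*m) (hl : loc us i x) : ∃ j ≤ 2*M, ru j = i /\ loc (refU us ru) j x := by
  have a := loc_ge0 hus hi hl
  have b := loc_lem hus hi hl
  rw [<- refU_last hus h] at b
  obtain ⟨j, hj, hx⟩ := loc_exists (us := refU us ru) a b
  exact ⟨j, hj, loc_unique hus (h.le hj) hi (refU_transfer hus h hj hx) hl, hx⟩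

/-! ## Part B2: abstract subdivision trees -/

abbrev Pt := ℝ × ℝ
abbrev Gap := Pos × Pos
variable {p q z : Pt} {g g' : Gap} {G : Pt -> ℕ -> Prop}

def pl (p q : Pt) : Prop := p.1 < q.1 /\ p.2 < q.2

def gle (N : ℕ) (g g' : Gap) : Prop := ple N g.2 g'.1

theorem ple_trans {a b c : Pos} (h1 : ple N a b) (h2 : ple N b c) : ple N a c :=
  fun i hi => ⟨fun h => (h1 i hi).1 ((h2 i hi).1 h), fun h => (h2 i hi).2 ((h1 i hi).2 h)⟩

def gap (e : Ent) : Gap := (e.lo, e.hi)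

theorem gap_eq_of_gq (h : gq e e') : gap e = gap e' := by
  unfold gap; rw [h.1, h.2]

structure Geo (C : Type) where
  N : ℕ
  V : C -> Prop
  nch : C -> ℕ
  chd : C -> ℕ -> C
  reg : C -> Pt -> Prop
  bd : C -> Pt -> Gap -> Prop
  il : C -> Pt -> Ent -> Bool -> Prop
  w : C -> ℝ
  A1 : ∀ {c t}, V c -> t < nch c -> V (chd c t)
  A2 : ∀ {c p g}, V c -> bd c p g -> reg c p
  A2' : ∀ {c p t}, V c -> t < nch c -> reg (chd c t) p -> reg c p
  A3 : ∀ {c p g g'}, V c -> bd c p g -> bd c p g' -> g = g'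
  A4 : ∀ {c p g}, V c -> bd c p g -> ∃ t < nch c, bd (chd c t) p g
  A5 : ∀ {c p t t'}, V c -> t < t' -> t' < nch c -> reg (chd c t) p -> reg (chd c t') p -> ∃ g, bd (chd c t) p g /\ bd (chd c t') p g
  A6 : ∀ {c p q g g'}, V c -> bd c p g -> bd c q g' -> pl p q -> gle N g g'
  A6' : ∀ {c p g}, V c -> bd c p g -> ple N g.1 g.2
  O1 : ∀ {c p q a b}, V c -> a < nch c -> b < nch c -> reg (chd c a) p -> reg (chd c b) q -> pl p q -> a <= b
  A7 : ∀ {c p q a b}, V c -> a < b -> b < nch c -> reg (chd c a) p -> reg (chd c b) q -> pl p q -> (∃ a' < nch c, a < a' /\ reg (chd c a') p) ∨ reg (chd c a) q ∨ ∃ r, pl p r /\ pl r q /\ reg (chd c a) r /\ ∃ a' < nch c, a < a' /\ reg (chd c a') r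
  w1 : ∀ {c t}, V c -> t < nch c -> w (chd c t) <= 3/4 * w c
  w2 : ∀ {c p q}, V c -> reg c p -> reg c q -> |p.1 - q.1| <= w c /\ |p.2 - q.2| <= w c
  i1 : ∀ {c p e b}, V c -> il c p e b -> ∃ t < nch c, bd (chd c t) p (gap e)
  i2 : ∀ {c p e b g}, V c -> il c p e b -> ¬ bd c p g
  i3 : ∀ {c p e b e' b'}, V c -> il c p e b -> il c p e' b' -> e = e' /\ b = b'
  i4 : ∀ {c p t g}, V c -> t < nch c -> bd (chd c t) p g -> (∃ g', bd c p g') ∨ ∃ e b, il c p e b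
  i5 : ∀ {c p e b}, V c -> il c p e b -> (b = true -> e.lab ≠ 0 /\ adm N e.lo e.hi (e.lab - 1)) /\ (b = false -> hasAdm N e.lo e.hi)

namespace Geo

variable {C : Type} (T : Geo C) {c d d' c0 : C}

def Desc : ℕ -> C -> C -> Prop
  | 0, c, d => d = c
  | n+1, c, d => ∃ t < T.nch c, Desc n (T.chd c t) d

variable {T}

theorem Desc.V : ∀ {c d : C}, T.V c -> T.Desc n c d -> T.V d := by
  induction n with
  | zero => intro c d h h1; cases h1; exact h
  | succ n ih => rintro c d h ⟨t, ht, h1⟩; exact ih (T.A1 h ht) h1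

theorem Desc.reg : ∀ {c d : C} {p : Pt}, T.V c -> T.Desc n c d -> T.reg d p -> T.reg c p := by
  induction n with
  | zero => intro c d p h h1; cases h1; exact id
  | succ n ih =>
    rintro c d p h ⟨t, ht, h1⟩ h2; exact T.A2' h ht (ih (T.A1 h ht) h1 h2)

theorem Desc.append : ∀ {c d e : C}, T.Desc n c d -> T.Desc m d e -> T.Desc (n+m) c e := by
  induction n with
  | zero => intro c d e h1 h2; cases h1; rwa [Nat.zero_add]
  | succ n ih =>
    rintro c d e ⟨t, ht, h1⟩ h2
    rw [show n + 1 + m = (n+m)+1 by omega]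
    exact ⟨t, ht, ih h1 h2⟩

theorem Desc.one (ht : t < T.nch c) : T.Desc 1 c (T.chd c t) := ⟨t, ht, rfl⟩

theorem Desc.split : ∀ {c e : C}, T.Desc (n+m) c e -> ∃ d, T.Desc n c d /\ T.Desc m d e := by
  induction n with
  | zero => intro c e h; rw [Nat.zero_add] at h; exact ⟨c, rfl, h⟩
  | succ n ih =>
    intro c e h
    rw [show n + 1 + m = (n+m)+1 by omega] at h
    obtain ⟨t, ht, h1⟩ := h
    obtain ⟨d, h2, h3⟩ := ih h1
    exact ⟨d, ⟨t, ht, h2⟩, h3⟩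

theorem bd_child (hc : T.V c) (h : T.bd c p g) (ht : t < T.nch c) (hr : T.reg (T.chd c t) p) : T.bd (T.chd c t) p g := by
  obtain ⟨t', ht', h'⟩ := T.A4 hc h
  rcases lt_trichotomy t t' with h1 | h1 | h1
  · obtain ⟨g0, ha, hb⟩ := T.A5 hc h1 ht' hr (T.A2 (T.A1 hc ht') h')
    rwa [T.A3 (T.A1 hc ht') h' hb]
  · rwa [h1]
  · obtain ⟨g0, ha, hb⟩ := T.A5 hc h1 ht (T.A2 (T.A1 hc ht') h') hr
    rwa [T.A3 (T.A1 hc ht') h' ha]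

theorem bd_desc : ∀ {c d : C} {p : Pt} {g : Gap}, T.V c -> T.bd c p g -> T.Desc n c d -> T.reg d p -> T.bd d p g := by
  induction n with
  | zero => intro c d p g hc hb hd _; cases hd; exact hb
  | succ n ih =>
    rintro c d p g hc hb ⟨t, ht, hd⟩ hr
    exact ih (T.A1 hc ht) (bd_child hc hb ht (Desc.reg (T.A1 hc ht) hd hr)) hd hr

theorem push (n : ℕ) : ∀ {c : C} {p : Pt} {g : Gap}, T.V c -> T.bd c p g -> ∃ d, T.Desc n c d /\ T.bd d p g := by
  induction n with
  | zero => intro c p g hc hb; exact ⟨c, rfl, hb⟩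
  | succ n ih =>
    intro c p g hc hb
    obtain ⟨t, ht, h⟩ := T.A4 hc hb
    obtain ⟨d, h1, h2⟩ := ih (T.A1 hc ht) h
    exact ⟨d, ⟨t, ht, h1⟩, h2⟩

theorem share : ∀ {c d d' : C} {p : Pt}, T.V c -> T.Desc n c d -> T.Desc n c d' -> T.reg d p -> T.reg d' p -> d = d' ∨ ∃ g, T.bd d p g /\ T.bd d' p g := by
  induction n with
  | zero => intro c d d' p hc h1 h2 _ _; cases h1; cases h2; exact Or.inl rfl
  | succ n ih =>
    rintro c d d' p hc ⟨t, ht, h1⟩ ⟨t', ht', h2⟩ hr hr'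
    have ha := Desc.reg (T.A1 hc ht) h1 hr
    have hb := Desc.reg (T.A1 hc ht') h2 hr'
    rcases lt_trichotomy t t' with h | h | h
    · obtain ⟨g, x, y⟩ := T.A5 hc h ht' ha hb
      exact Or.inr ⟨g, bd_desc (T.A1 hc ht) x h1 hr, bd_desc (T.A1 hc ht') y h2 hr'⟩
    · subst h; exact ih (T.A1 hc ht) h1 h2 hr hr'
    · obtain ⟨g, x, y⟩ := T.A5 hc h ht hb ha
      exact Or.inr ⟨g, bd_desc (T.A1 hc ht) y h1 hr, bd_desc (T.A1 hc ht') x h2 hr'⟩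

theorem bd_of_reg (hc : T.V c) (h1 : T.Desc n c d) (hb : T.bd d p g) (h2 : T.Desc (n+k) c d') (hr : T.reg d' p) : T.bd d' p g := by
  obtain ⟨e, he, he'⟩ := Desc.split h2
  have hre := Desc.reg (he.V hc) he' hr
  rcases share hc h1 he (T.A2 (h1.V hc) hb) hre with h | ⟨g', x, y⟩
  · subst h; exact bd_desc (h1.V hc) hb he' hr
  · rw [T.A3 (h1.V hc) hb x]; exact bd_desc (he.V hc) y he' hr

variable (T) in
def Done (c : C) (p : Pt) (g : Gap) : Prop := ∃ n d, T.Desc n c d /\ T.bd d p g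

theorem Done.at (hc : T.V c) (h : T.Done c p g) : ∃ n, ∀ k, n ≤ k -> ∃ d, T.Desc k c d /\ T.bd d p g := by
  obtain ⟨n, d, h1, h2⟩ := h
  refine ⟨n, fun k hk => ?_⟩
  obtain ⟨j, rfl⟩ := Nat.exists_eq_add_of_le hk
  obtain ⟨e, he, hb⟩ := push j (h1.V hc) h2
  exact ⟨e, h1.append he, hb⟩

theorem Done.unique (hc : T.V c) (h : T.Done c p g) (h' : T.Done c p g') : g = g' := by
  obtain ⟨n, hn⟩ := h.at hc
  obtain ⟨m, hm⟩ := h'.at hc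
  obtain ⟨d, hd, hb⟩ := hn (max n m) (le_max_left _ _)
  obtain ⟨d', hd', hb'⟩ := hm (max n m) (le_max_right _ _)
  have := bd_of_reg (k := 0) hc hd hb hd' (T.A2 (hd'.V hc) hb')
  exact T.A3 (hd'.V hc) this hb'

theorem Done.self (hc : T.V c) (h : T.Done c p g) : ple T.N g.1 g.2 := by
  obtain ⟨n, d, h1, h2⟩ := h
  exact T.A6' (h1.V hc) h2

theorem coh_aux : ∀ {c d d' : C} {p q : Pt} {g g' : Gap}, T.V c -> T.Desc n c d -> T.Desc n c d' -> T.bd d p g -> T.bd d' q g' -> pl p q -> gle T.N g g' := by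
  induction n with
  | zero =>
    intro c d d' p q g g' hc h1 h2 h3 h4 h5
    cases h1; cases h2; exact T.A6 hc h3 h4 h5
  | succ n ih =>
    rintro c d d' p q g g' hc ⟨a, ha, h1⟩ ⟨b, hb, h2⟩ h3 h4 h5
    have hq := Desc.reg (T.A1 hc hb) h2 (T.A2 (h2.V (T.A1 hc hb)) h4)
    have key : ∀ j, ∀ a < T.nch c, T.nch c - a <= j -> ∀ d p g, T.Desc n (T.chd c a) d -> T.bd d p g -> pl p q -> gle T.N g g' := by
      intro j
      induction j with
      | zero => intro a ha hj; omega
      | succ j ihj =>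
        intro a ha hj d p g h1 h3 h5
        have hp := Desc.reg (T.A1 hc ha) h1 (T.A2 (h1.V (T.A1 hc ha)) h3)
        have hab := T.O1 hc ha hb hp hq h5
        rcases hab.eq_or_lt with hab | hab
        · subst hab; exact ih (T.A1 hc ha) h1 h2 h3 h4 h5
        · rcases T.A7 hc hab hb hp hq h5 with ⟨a', ha', haa, hr⟩ | hr | ⟨r, hpr, hrq, hr, a', ha', haa, hr'⟩
          · obtain ⟨g0, x, y⟩ := T.A5 hc haa ha' hp hr
            have : g = g0 := T.A3 (h1.V (T.A1 hc ha)) h3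
              (bd_desc (T.A1 hc ha) x h1 (T.A2 (h1.V (T.A1 hc ha)) h3))
            subst this
            obtain ⟨e, he, hbe⟩ := push n (T.A1 hc ha') y
            exact ihj a' ha' (by omega) e p g he hbe h5
          · obtain ⟨g0, x, y⟩ := T.A5 hc hab hb hr hq
            have : g' = g0 := T.A3 (h2.V (T.A1 hc hb)) h4
              (bd_desc (T.A1 hc hb) y h2 (T.A2 (h2.V (T.A1 hc hb)) h4))
            subst this
            obtain ⟨e, he, hbe⟩ := push n (T.A1 hc ha) x
            exact ih (T.A1 hc ha) h1 he h3 hbe h5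
          · obtain ⟨g0, x, y⟩ := T.A5 hc haa ha' hr hr'
            obtain ⟨e, he, hbe⟩ := push n (T.A1 hc ha) x
            obtain ⟨e', he', hbe'⟩ := push n (T.A1 hc ha') y
            have l1 := ih (T.A1 hc ha) h1 he h3 hbe hpr
            have l2 := ihj a' ha' (by omega) e' r g0 he' hbe' hrq
            exact ple_trans l1 (ple_trans (T.A6' (T.A1 hc ha) x) l2)
    exact key _ a ha le_rfl d p g h1 h3 h5

theorem coh (hc : T.V c) (h : T.Done c p g) (h' : T.Done c q g') (hpq : pl p q) : gle T.N g g' := by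
  obtain ⟨n, hn⟩ := h.at hc
  obtain ⟨m, hm⟩ := h'.at hc
  obtain ⟨d, hd, hb⟩ := hn (max n m) (le_max_left _ _)
  obtain ⟨d', hd', hb'⟩ := hm (max n m) (le_max_right _ _)
  exact coh_aux hc hd hd' hb hb' hpq

variable (T) in
def IL (c : C) (p : Pt) (e : Ent) (b : Bool) : Prop := ∃ n d, T.Desc n c d /\ T.il d p e b

theorem IL.done (hc : T.V c) {b : Bool} (h : T.IL c p e b) : T.Done c p (gap e) := by
  obtain ⟨n, d, h1, h2⟩ := h
  obtain ⟨t, ht, h3⟩ := T.i1 (h1.V hc) h2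
  exact ⟨n+1, _, h1.append (Desc.one ht), h3⟩

theorem IL_aux (hc : T.V c) {b b' : Bool} (h1 : T.Desc n c d) (h2 : T.il d p e b) (h1' : T.Desc (n+k) c d') (h2' : T.il d' p e' b') : e = e' /\ b = b' := by
  have hr' : T.reg d' p := by
    obtain ⟨t, ht, h3⟩ := T.i1 (h1'.V hc) h2'
    exact T.A2' (h1'.V hc) ht (T.A2 (T.A1 (h1'.V hc) ht) h3)
  obtain ⟨t, ht, h3⟩ := T.i1 (h1.V hc) h2
  have hr : T.reg d p := T.A2' (h1.V hc) ht (T.A2 (T.A1 (h1.V hc) ht) h3)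
  cases k with
  | zero =>
    rcases share hc h1 h1' hr hr' with h | ⟨g, x, _⟩
    · subst h; exact T.i3 (h1.V hc) h2 h2'
    · exact absurd x (T.i2 (h1.V hc) h2)
  | succ k =>
    exfalso
    have := bd_of_reg (n := n+1) (k := k) hc (h1.append (Desc.one ht)) h3
      (by rwa [show n + 1 + k = n + (k+1) by omega]) hr'
    exact T.i2 (h1'.V hc) h2' this

theorem IL.unique (hc : T.V c) {b b' : Bool} (h : T.IL c p e b) (h' : T.IL c p e' b') : e = e' /\ b = b' := by
  obtain ⟨n, d, h1, h2⟩ := h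
  obtain ⟨m, d', h1', h2'⟩ := h'
  rcases le_total n m with hh | hh
  · obtain ⟨k, rfl⟩ := Nat.exists_eq_add_of_le hh
    exact IL_aux hc h1 h2 h1' h2'
  · obtain ⟨k, rfl⟩ := Nat.exists_eq_add_of_le hh
    have := IL_aux hc h1' h2' h1 h2
    exact ⟨this.1.symm, this.2.symm⟩

/-- a done point which is not on the boundary of the root lies on an interior line of some cell -/
theorem Done.IL (hc : T.V c) (h : T.Done c p g) (hn : ∀ g, ¬ T.bd c p g) : ∃ e b, T.IL c p e b /\ g = gap e := by
  obtain ⟨n, d, h1, h2⟩ := h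
  have : ∀ n d g, T.Desc n c d -> T.bd d p g -> ∃ e b, T.IL c p e b := by
    intro n
    induction n with
    | zero => intro d g h1 h2; cases h1; exact absurd h2 (hn _)
    | succ n ih =>
      intro d g h1 h2
      obtain ⟨d0, h3, t, ht, h4⟩ := Desc.split (n := n) (m := 1) h1
      cases h4
      rcases T.i4 (h3.V hc) ht h2 with ⟨g', hg⟩ | ⟨e, b, hil⟩
      · exact ih d0 g' h3 hg
      · exact ⟨e, b, n, d0, h3, hil⟩
  obtain ⟨e, b, he⟩ := this n d g h1 h2
  exact ⟨e, b, he, Done.unique hc ⟨n, d, h1, h2⟩ (he.done hc)⟩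

theorem Desc.w : ∀ {c d : C}, T.V c -> T.Desc n c d -> T.w d <= (3/4)^n * T.w c := by
  induction n with
  | zero => intro c d hc h; cases h; simp
  | succ n ih =>
    rintro c d hc ⟨t, ht, h⟩
    have h1 := ih (T.A1 hc ht) h
    have h2 := T.w1 hc ht
    calc T.w d <= (3/4)^n * T.w (T.chd c t) := h1
      _ <= (3/4)^n * (3/4 * T.w c) := by gcongr
      _ = _ := by ring

theorem small (hc : T.V c) (he : 0 < ε) : ∃ n, ∀ k, n ≤ k -> ∀ d, T.Desc k c d -> T.w d < ε := by
  have h1 : Filter.Tendsto (fun n : ℕ => ((3:ℝ)/4)^n * T.w c) Filter.atTop (nhds (0 * T.w c)) :=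
    (tendsto_pow_atTop_nhds_zero_of_lt_one (by norm_num) (by norm_num)).mul_const _
  rw [zero_mul] at h1
  obtain ⟨n, hn⟩ := Filter.eventually_atTop.1 (h1.eventually (gt_mem_nhds he))
  exact ⟨n, fun k hk d hd => (Desc.w hc hd).trans_lt (hn k hk)⟩

/-! ### resolving demands -/

/-- Data for resolving demands in one direction. -/
structure Res (T : Geo C) (c0 : C) where
  Ho : C -> Pt -> Prop
  Out : C -> Pt -> Prop
  le : Pt -> Pt -> Prop
  Hit : Pt -> Prop
  dem : Gap -> Prop
  n : ℕ
  mu : C -> ℕ -> ℕ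
  hreg : ∀ {c p}, T.V c -> Ho c p -> T.reg c p
  hcov : ∀ {c p}, T.V c -> Ho c p -> ∃ t < T.nch c, Ho (T.chd c t) p
  out : ∀ {c r t}, T.V c -> t < T.nch c -> Out (T.chd c t) r -> Out c r ∨ ∃ t' < T.nch c, mu c t' < mu c t /\ Ho (T.chd c t') r
  le_trans : ∀ {p q r}, le p q -> le q r -> le p r
  hit : ∀ {p q}, le p q -> Hit q -> Hit p
  task : ∀ {c p g}, T.V c -> T.Desc n c0 c -> Ho c p -> T.bd c p g -> dem g -> Hit p ∨ ∃ r, le p r /\ Out c r /\ ∃ g', T.bd c r g' /\ dem g'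

theorem Res.HoN (Rs : Res T c0) (k : ℕ) : ∀ {c : C} {p : Pt}, T.V c -> Rs.Ho c p -> ∃ d, T.Desc k c d /\ Rs.Ho d p := by
  induction k with
  | zero => intro c p hc h; exact ⟨c, rfl, h⟩
  | succ k ih =>
    intro c p hc h
    obtain ⟨t, ht, h1⟩ := Rs.hcov hc h
    obtain ⟨d, h2, h3⟩ := ih (T.A1 hc ht) h1
    exact ⟨d, ⟨t, ht, h2⟩, h3⟩

theorem Res.resolve_aux (Rs : Res T c0) (hc0 : T.V c0) (k : ℕ) : ∀ {j : ℕ}, j + k = Rs.n -> ∀ {c d : C} {p : Pt} {g : Gap}, T.Desc j c0 c -> T.Desc k c d -> Rs.Ho d p -> T.bd d p g -> Rs.dem g -> Rs.Hit p ∨ ∃ r, Rs.le p r /\ Rs.Out c r /\ ∃ g', T.Done c r g' /\ Rs.dem g' := by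
  induction k with
  | zero =>
    intro j hj c d p g hc hd hH hb hg
    cases hd
    rcases Rs.task (hc.V hc0) (by rwa [<- hj]) hH hb hg with h | ⟨r, h1, h2, g', h3, h4⟩
    · exact Or.inl h
    · exact Or.inr ⟨r, h1, h2, g', ⟨0, _, rfl, h3⟩, h4⟩
  | succ k ih =>
    rintro j hj c d p g hc ⟨t, ht, hd⟩ hH hb hg
    have hcV := hc.V hc0
    revert d p g
    induction t using (measure (Rs.mu c)).wf.induction with
    | _ t iht =>
    intro d p g hd hH hb hg
    rcases ih (j := j+1) (by omega) (hc.append (Desc.one ht)) hd hH hb hg with h | ⟨r, h1, h2, g', h3, h4⟩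
    · exact Or.inl h
    · rcases Rs.out hcV ht h2 with h5 | ⟨t', ht', hbf, h5⟩
      · refine Or.inr ⟨r, h1, h5, g', ?_, h4⟩
        obtain ⟨n, e, he, hbe⟩ := h3
        exact ⟨n+1, e, ⟨t, ht, he⟩, hbe⟩
      · obtain ⟨e, he, hHe⟩ := Rs.HoN k (T.A1 hcV ht') h5
        have hre := Rs.hreg (he.V (T.A1 hcV ht')) hHe
        have hbe : T.bd e r g' := by
          obtain ⟨n, f, hf, hbf'⟩ := h3
          have hr1 : T.reg (T.chd c t) r := Desc.reg (T.A1 hcV ht) hf (T.A2 (hf.V (T.A1 hcV ht)) hbf')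
          have hr2 : T.reg (T.chd c t') r := Rs.hreg (T.A1 hcV ht') h5
          have hne : t ≠ t' := by
            rintro rfl
            exact lt_irrefl _ hbf
          have : ∃ g0, T.bd (T.chd c t) r g0 /\ T.bd (T.chd c t') r g0 := by
            rcases lt_or_gt_of_ne hne with hl | hl
            · exact T.A5 hcV hl ht' hr1 hr2
            · obtain ⟨g0, x, y⟩ := T.A5 hcV hl ht hr2 hr1
              exact ⟨g0, y, x⟩
          obtain ⟨g0, x, y⟩ := this
          have e1 : g' = g0 := T.A3 (hf.V (T.A1 hcV ht)) hbf'
            (bd_desc (T.A1 hcV ht) x hf (T.A2 (hf.V (T.A1 hcV ht)) hbf'))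
          rw [e1]
          exact bd_desc (T.A1 hcV ht') y he hre
        rcases iht t' hbf ht' he hHe hbe h4 with h | ⟨r', a1, a2⟩
        · exact Or.inl (Rs.hit h1 h)
        · exact Or.inr ⟨r', Rs.le_trans h1 a1, a2⟩

theorem Res.resolve (Rs : Res T c0) (hc0 : T.V c0) (hj : j <= Rs.n) (hd : T.Desc j c0 d) (hb : T.bd d p g) (hp : Rs.Ho c0 p) (hg : Rs.dem g) : Rs.Hit p ∨ ∃ r, Rs.Out c0 r /\ ∃ g', T.Done c0 r g' /\ Rs.dem g' := by
  obtain ⟨e, he, hH⟩ := Rs.HoN Rs.n hc0 hp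
  obtain ⟨k, hk⟩ := Nat.exists_eq_add_of_le hj
  have hbe : T.bd e p g := bd_of_reg (k := k) hc0 hd hb (by rwa [<- hk]) (Rs.hreg (he.V hc0) hH)
  rcases Rs.resolve_aux hc0 Rs.n (j := 0) (by omega) rfl he hH hbe hg with h | ⟨r, _, h1⟩
  · exact Or.inl h
  · exact Or.inr ⟨r, h1⟩

end Geo

/-! ## Part B3: local geometry of rectangle cells -/

def bdl (r : Row) (us vs : ℕ -> ℝ) (u v : ℝ) (e : Ent) : Prop :=
  (v = vs 0 /\ ∃ i ≤ 2*r.m, loc us i u /\ e = r.A i) ∨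
  (v = vs r.k /\ ∃ i ≤ 2*r.m, loc us i u /\ e = r.B i) ∨
  (u = us 0 /\ ∃ i ≤ 2*r.k, loc vs i v /\ e = r.C i) ∨
  (u = us r.m /\ ∃ i ≤ 2*r.k, loc vs i v /\ e = r.E i)

def bdg (r : Row) (us vs : ℕ -> ℝ) (u v : ℝ) (g : Gap) : Prop := ∃ e, bdl r us vs u v e /\ g = gap e

def inBox (r : Row) (us vs : ℕ -> ℝ) (u v : ℝ) : Prop :=
  us 0 <= u /\ u <= us r.m /\ vs 0 <= v /\ v <= vs r.k

theorem bdl_box (hu : SM us r.m) (hv : SM vs r.k) (h : bdl r us vs u v e) : inBox r us vs u v := by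
  have a := hu.le (Nat.zero_le r.m) le_rfl
  have b := hv.le (Nat.zero_le r.k) le_rfl
  rcases h with ⟨rfl, i, hi, hl, _⟩ | ⟨rfl, i, hi, hl, _⟩ | ⟨rfl, i, hi, hl, _⟩ | ⟨rfl, i, hi, hl, _⟩
  · exact ⟨loc_ge0 hu hi hl, loc_lem hu hi hl, le_rfl, b⟩
  · exact ⟨loc_ge0 hu hi hl, loc_lem hu hi hl, b, le_rfl⟩
  · exact ⟨le_rfl, a, loc_ge0 hv hi hl, loc_lem hv hi hl⟩
  · exact ⟨a, le_rfl, loc_ge0 hv hi hl, loc_lem hv hi hl⟩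

theorem bdl_unique (hr : RowOK N r) (hu : SM us r.m) (hv : SM vs r.k) (h : bdl r us vs u v e) (h' : bdl r us vs u v e') : e = e' := by
  have a : us 0 ≠ us r.m := (hu.lt hr.hm le_rfl).ne
  have b : vs 0 ≠ vs r.k := (hv.lt hr.hk le_rfl).ne
  have hu0 : ∀ i ≤ 2*r.m, loc us i (us 0) -> i = 0 := fun i hi hl =>
    loc_unique hu hi (by omega) hl (loc_even us 0)
  have hum : ∀ i ≤ 2*r.m, loc us i (us r.m) -> i = 2*r.m := fun i hi hl =>
    loc_unique hu hi (by omega) hl (loc_even us _)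
  have hv0 : ∀ i ≤ 2*r.k, loc vs i (vs 0) -> i = 0 := fun i hi hl =>
    loc_unique hv hi (by omega) hl (loc_even vs 0)
  have hvm : ∀ i ≤ 2*r.k, loc vs i (vs r.k) -> i = 2*r.k := fun i hi hl =>
    loc_unique hv hi (by omega) hl (loc_even vs _)
  have c1 := hr.c1
  have c2 := hr.c2
  have c3 := hr.c3
  have c4 := hr.c4
  rcases h with ⟨rfl, i, hi, hl, rfl⟩ | ⟨rfl, i, hi, hl, rfl⟩ | ⟨rfl, i, hi, hl, rfl⟩ | ⟨rfl, i, hi, hl, rfl⟩ <;>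
  rcases h' with ⟨h1, j, hj, hl', rfl⟩ | ⟨h1, j, hj, hl', rfl⟩ | ⟨h1, j, hj, hl', rfl⟩ | ⟨h1, j, hj, hl', rfl⟩
  · rw [loc_unique hu hi hj hl hl']
  · exact absurd h1 b
  · subst h1; rw [hu0 i hi hl, hv0 j hj hl', c1]
  · subst h1; rw [hum i hi hl, hv0 j hj hl', c2]
  · exact absurd h1.symm b
  · rw [loc_unique hu hi hj hl hl']
  · subst h1; rw [hu0 i hi hl, hvm j hj hl', c3]
  · subst h1; rw [hum i hi hl, hvm j hj hl', c4]
  · subst h1; rw [hv0 i hi hl, hu0 j hj hl', c1]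
  · subst h1; rw [hvm i hi hl, hu0 j hj hl', c3]
  · rw [loc_unique hv hi hj hl hl']
  · exact absurd h1 a
  · subst h1; rw [hv0 i hi hl, hum j hj hl', c2]
  · subst h1; rw [hvm i hi hl, hum j hj hl', c4]
  · exact absurd h1.symm a
  · rw [loc_unique hv hi hj hl hl']

theorem bdg_unique (hr : RowOK N r) (hu : SM us r.m) (hv : SM vs r.k) (h : bdg r us vs u v g) (h' : bdg r us vs u v g') : g = g' := by
  obtain ⟨e, h1, rfl⟩ := h
  obtain ⟨e', h1', rfl⟩ := h'
  rw [bdl_unique hr hu hv h1 h1']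

theorem bdg_iff_strict (hb : inBox r us vs u v) (h : ∀ g, ¬ bdg r us vs u v g) : us 0 < u /\ u < us r.m /\ vs 0 < v /\ v < vs r.k := by
  obtain ⟨h1, h2, h3, h4⟩ := hb
  obtain ⟨i, hi, hl⟩ := loc_exists h1 h2
  obtain ⟨j, hj, hl'⟩ := loc_exists h3 h4
  refine ⟨lt_of_le_of_ne h1 ?_, lt_of_le_of_ne h2 ?_, lt_of_le_of_ne h3 ?_, lt_of_le_of_ne h4 ?_⟩
  · rintro rfl; exact h _ ⟨_, Or.inr (Or.inr (Or.inl ⟨rfl, j, hj, hl', rfl⟩)), rfl⟩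
  · rintro rfl; exact h _ ⟨_, Or.inr (Or.inr (Or.inr ⟨rfl, j, hj, hl', rfl⟩)), rfl⟩
  · rintro rfl; exact h _ ⟨_, Or.inl ⟨rfl, i, hi, hl, rfl⟩, rfl⟩
  · rintro rfl; exact h _ ⟨_, Or.inr (Or.inl ⟨rfl, i, hi, hl, rfl⟩), rfl⟩

theorem bdl_self (hr : RowOK N r) (h : bdl r us vs u v e) : ple N e.lo e.hi := by
  rcases h with ⟨rfl, i, hi, hl, rfl⟩ | ⟨rfl, i, hi, hl, rfl⟩ | ⟨rfl, i, hi, hl, rfl⟩ | ⟨rfl, i, hi, hl, rfl⟩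
  · exact hr.eA.1 i hi
  · exact hr.eB.1 i hi
  · exact hr.eC.1 i hi
  · exact hr.eE.1 i hi

theorem bdl_coh (hr : RowOK N r) {u' v' : ℝ} (hu : SM us r.m) (hv : SM vs r.k) (h : bdl r us vs u v e) (h' : bdl r us vs u' v' e') (h1 : u < u') (h2 : v < v') : ple N e.hi e'.lo := by
  have hb := bdl_box hu hv h
  have hb' := bdl_box hu hv h'
  rcases h with ⟨rfl, i, hi, hl, rfl⟩ | ⟨rfl, i, hi, hl, rfl⟩ | ⟨rfl, i, hi, hl, rfl⟩ | ⟨rfl, i, hi, hl, rfl⟩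
  · have hi' : i < 2*r.m := (loc_lt_iff hu hi hl).1 (h1.trans_le hb'.2.1)
    rcases h' with ⟨rfl, j, hj, hl', rfl⟩ | ⟨rfl, j, hj, hl', rfl⟩ | ⟨rfl, j, hj, hl', rfl⟩ | ⟨rfl, j, hj, hl', rfl⟩
    · exact absurd h2 (lt_irrefl _)
    · exact hr.oAB i hi' j hj (loc_lt hu hi hj hl hl' h1)
    · exact absurd hb.1 (not_le.2 h1)
    · exact hr.aAE i hi' j hj ((loc_pos_iff hv hj hl').1 h2)
  · exact absurd hb'.2.2.2 (not_le.2 h2)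
  · have hi' : i < 2*r.k := (loc_lt_iff hv hi hl).1 (h2.trans_le hb'.2.2.2)
    rcases h' with ⟨rfl, j, hj, hl', rfl⟩ | ⟨rfl, j, hj, hl', rfl⟩ | ⟨rfl, j, hj, hl', rfl⟩ | ⟨rfl, j, hj, hl', rfl⟩
    · exact absurd hb.2.2.1 (not_le.2 h2)
    · exact hr.aCB i hi' j hj ((loc_pos_iff hu hj hl').1 h1)
    · exact absurd h1 (lt_irrefl _)
    · exact hr.oCE i hi' j hj (loc_lt hv hi hj hl hl' h2)
  · exact absurd hb'.2.1 (not_le.2 h1)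

/-! ### children of a rectangle -/

/-- data of a rectangle cell with its record -/
structure RC (N : ℕ) (row : ℕ -> Row) (rk : ℕ -> ℕ) (S : ℕ -> Prop) (s : ℕ) (R : Rec)
    (us vs : ℕ -> ℝ) : Prop where
  rows : ∀ s, S s -> RowOK N (row s)
  hs : S s
  R : RecOK N row rk S s R
  hu : SM us (row s).m
  hv : SM vs (row s).k

noncomputable def cvs (U : ℕ -> ℝ) (t : ℕ) : ℕ -> ℝ := fun n => if n = 0 then U t else U (t+1)

/-- points on the line `t` -/
def ln (R : Rec) (U V : ℕ -> ℝ) (t : ℕ) (u v : ℝ) (g : Gap) : Prop :=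
  u = U t /\ ∃ j ≤ 2*R.K, loc V j v /\ g = gap (R.L t j)

/-- points on the long edges -/
def md (r : Row) (R : Rec) (U vs : ℕ -> ℝ) (t : ℕ) (u v : ℝ) (g : Gap) : Prop :=
  U t < u /\ u < U (t+1) /\ ((v = vs 0 /\ g = gap (r.A (R.ru (2*t+1)))) ∨ (v = vs r.k /\ g = gap (r.B (R.ru (2*t+1)))))

namespace RC
variable {row : ℕ -> Row} {rk : ℕ -> ℕ} {S : ℕ -> Prop} {R : Rec}

theorem rowOK (h : RC N row rk S s R us vs) : RowOK N (row s) := h.rows s h.hs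

theorem U_SM (h : RC N row rk S s R us vs) : SM (refU us R.ru) R.M := refU_SM h.hu h.R.refu
theorem V_SM (h : RC N row rk S s R us vs) : SM (refU vs R.rv) R.K := refU_SM h.hv h.R.refv
theorem U_M (h : RC N row rk S s R us vs) : refU us R.ru R.M = us (row s).m := refU_last h.hu h.R.refu
theorem V_K (h : RC N row rk S s R us vs) : refU vs R.rv R.K = vs (row s).k := refU_last h.hv h.R.refv
theorem U_0 (_ : RC N row rk S s R us vs) : refU us R.ru 0 = us 0 := rfl
theorem V_0 (_ : RC N row rk S s R us vs) : refU vs R.rv 0 = vs 0 := rfl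

theorem M2 (h : RC N row rk S s R us vs) : 2 <= R.M := by
  have h1 := h.rowOK.hm
  by_contra hc
  have hM : R.M = 0 ∨ R.M = 1 := by omega
  rcases hM with hM | hM
  · have a := h.R.refu.1
    have b := h.R.refu.2.1
    rw [hM] at b; simp at b; omega
  · have b := h.R.refu.2.1
    have c := h.R.halv 0 (by omega) (by rw [Nat.mul_zero, h.R.refu.1])
    rw [hM] at b; simp at b c; omega

theorem cvs_SM (h : RC N row rk S s R us vs) (ht : t < R.M) : SM (cvs (refU us R.ru) t) (row (R.ch t)).k := by
  have hk := (h.R.chO t ht).k1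
  intro i hi
  rw [hk] at hi
  have : i = 0 := by omega
  subst this
  simp only [cvs]
  simpa using h.U_SM t ht

theorem cus_SM (h : RC N row rk S s R us vs) (ht : t < R.M) : SM (cm (refU vs R.rv) (R.rc t) R.K) (row (R.ch t)).m := cm_SM h.V_SM (h.R.chO t ht).ref

theorem child_bd (h : RC N row rk S s R us vs) (ht : t < R.M) : bdg (row (R.ch t)) (cm (refU vs R.rv) (R.rc t) R.K) (cvs (refU us R.ru) t) v u g ↔ ln R (refU us R.ru) (refU vs R.rv) t u v g ∨ ln R (refU us R.ru) (refU vs R.rv) (t+1) u v g ∨ md (row s) R (refU us R.ru) vs t u v g := by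
  have hO := h.R.chO t ht
  have hk := hO.k1
  have hrow := h.rows _ (h.R.chS t ht)
  have hV := h.V_SM
  have hcs := cm_SM hV hO.ref
  have c0 : cvs (refU us R.ru) t 0 = refU us R.ru t := by simp [cvs]
  have c1 : cvs (refU us R.ru) t 1 = refU us R.ru (t+1) := by simp [cvs]
  have V0 := h.V_0
  have VK := h.V_K
  have lineA : ∀ j ≤ 2*R.K, gap ((row (R.ch t)).A (R.rc t j)) = gap (R.L t j) := fun j hj =>
    gap_eq_of_gq (hO.A j hj).1
  have lineB : ∀ j ≤ 2*R.K, gap ((row (R.ch t)).B (R.rc t j)) = gap (R.L (t+1) j) := fun j hj =>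
    gap_eq_of_gq (hO.B j hj).1
  constructor
  · rintro ⟨e, (⟨he, i, hi, hl, rfl⟩ | ⟨he, i, hi, hl, rfl⟩ | ⟨he, i, hi, hl, rfl⟩ | ⟨he, i, hi, hl, rfl⟩), rfl⟩
    · obtain ⟨j, hj, rfl, hl'⟩ := cm_back hV hO.ref hi hl
      exact Or.inl ⟨by rw [he, c0], j, hj, hl', lineA j hj⟩
    · obtain ⟨j, hj, rfl, hl'⟩ := cm_back hV hO.ref hi hl
      exact Or.inr (Or.inl ⟨by rw [he, hk, c1], j, hj, hl', lineB j hj⟩)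
    · rw [cm_zero hO.ref] at he
      rw [hk] at hi
      have hi' : i = 0 ∨ i = 1 ∨ i = 2 := by omega
      rcases hi' with rfl | rfl | rfl
      · rw [show (0:ℕ) = 2*0 from rfl, loc_even_iff, c0] at hl
        refine Or.inl ⟨hl, 0, by omega, ?_, ?_⟩
        · rw [he]; exact loc_even _ 0
        · rw [<- hrow.c1, <- lineA 0 (by omega), hO.ref.1]
      · rw [show (1:ℕ) = 2*0+1 from rfl, loc_odd_iff, c0] at hl
        rw [c1] at hl
        exact Or.inr (Or.inr ⟨hl.1, hl.2, Or.inl ⟨by rw [he, V0], gap_eq_of_gq hO.C.1⟩⟩)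
      · rw [show (2:ℕ) = 2*1 from rfl, loc_even_iff, c1] at hl
        refine Or.inr (Or.inl ⟨hl, 0, by omega, ?_, ?_⟩)
        · rw [he]; exact loc_even _ 0
        · have := hrow.c3; rw [hk] at this
          rw [show (2:ℕ) = 2*1 from rfl, <- this, <- lineB 0 (by omega), hO.ref.1]
    · rw [cm_last hO.ref] at he
      rw [hk] at hi
      have hi' : i = 0 ∨ i = 1 ∨ i = 2 := by omega
      rcases hi' with rfl | rfl | rfl
      · rw [show (0:ℕ) = 2*0 from rfl, loc_even_iff, c0] at hl
        refine Or.inl ⟨hl, 2*R.K, by omega, ?_, ?_⟩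
        · rw [he]; exact loc_even _ _
        · rw [<- hrow.c2, <- lineA (2*R.K) (by omega), hO.ref.2.1]
      · rw [show (1:ℕ) = 2*0+1 from rfl, loc_odd_iff, c0] at hl
        rw [c1] at hl
        exact Or.inr (Or.inr ⟨hl.1, hl.2, Or.inr ⟨by rw [he, VK], gap_eq_of_gq hO.E.1⟩⟩)
      · rw [show (2:ℕ) = 2*1 from rfl, loc_even_iff, c1] at hl
        refine Or.inr (Or.inl ⟨hl, 2*R.K, by omega, ?_, ?_⟩)
        · rw [he]; exact loc_even _ _
        · have := hrow.c4; rw [hk] at this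
          rw [show (2:ℕ) = 2*1 from rfl, <- this, <- lineB (2*R.K) (by omega), hO.ref.2.1]
  · rintro (⟨rfl, j, hj, hl, rfl⟩ | ⟨rfl, j, hj, hl, rfl⟩ | ⟨h1, h2, (⟨h3, rfl⟩ | ⟨h3, rfl⟩)⟩)
    · exact ⟨_, Or.inl ⟨c0.symm, R.rc t j, hO.ref.le hj, cm_transfer hV hO.ref hj hl, rfl⟩, (lineA j hj).symm⟩
    · exact ⟨_, Or.inr (Or.inl ⟨by rw [hk, c1], R.rc t j, hO.ref.le hj, cm_transfer hV hO.ref hj hl, rfl⟩), (lineB j hj).symm⟩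
    · refine ⟨_, Or.inr (Or.inr (Or.inl ⟨by rw [cm_zero hO.ref, h3, V0], 1, by omega, ?_, rfl⟩)), (gap_eq_of_gq hO.C.1).symm⟩
      rw [show (1:ℕ) = 2*0+1 from rfl, loc_odd_iff, c0]
      exact ⟨h1, by rw [c1]; exact h2⟩
    · refine ⟨_, Or.inr (Or.inr (Or.inr ⟨by rw [cm_last hO.ref, h3, VK], 1, by omega, ?_, rfl⟩)), (gap_eq_of_gq hO.E.1).symm⟩
      rw [show (1:ℕ) = 2*0+1 from rfl, loc_odd_iff, c0]
      exact ⟨h1, by rw [c1]; exact h2⟩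

theorem child_box (h : RC N row rk S s R us vs) (ht : t < R.M) : inBox (row (R.ch t)) (cm (refU vs R.rv) (R.rc t) R.K) (cvs (refU us R.ru) t) v u ↔ refU us R.ru t <= u /\ u <= refU us R.ru (t+1) /\ vs 0 <= v /\ v <= vs (row s).k := by
  have hO := h.R.chO t ht
  unfold inBox
  rw [cm_zero hO.ref, cm_last hO.ref, hO.k1, h.V_0, h.V_K]
  simp only [cvs, if_true, one_ne_zero, if_false]
  tauto

theorem parent_bd (h : RC N row rk S s R us vs) : bdg (row s) us vs u v g ↔ ln R (refU us R.ru) (refU vs R.rv) 0 u v g ∨ ln R (refU us R.ru) (refU vs R.rv) R.M u v g ∨ (∃ t ≤ R.M, ln R (refU us R.ru) (refU vs R.rv) t u v g /\ (v = vs 0 ∨ v = vs (row s).k)) ∨ ∃ t < R.M, md (row s) R (refU us R.ru) vs t u v g := by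
  have hR := h.R
  have hU := h.U_SM
  have hV := h.V_SM
  constructor
  · rintro ⟨e, (⟨rfl, i, hi, hl, rfl⟩ | ⟨rfl, i, hi, hl, rfl⟩ | ⟨rfl, i, hi, hl, rfl⟩ | ⟨rfl, i, hi, hl, rfl⟩), rfl⟩
    · obtain ⟨j, hj, rfl, hl'⟩ := refU_back h.hu hR.refu hi hl
      rcases Nat.even_or_odd' j with ⟨t, rfl | rfl⟩
      · refine Or.inr (Or.inr (Or.inl ⟨t, by omega, ⟨loc_even_iff.1 hl', 0, by omega, loc_even _ 0, ?_⟩, Or.inl rfl⟩))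
        exact gap_eq_of_gq (hR.LA t (by omega)).1
      · have := loc_odd_iff.1 hl'
        exact Or.inr (Or.inr (Or.inr ⟨t, by omega, this.1, this.2, Or.inl ⟨rfl, rfl⟩⟩))
    · obtain ⟨j, hj, rfl, hl'⟩ := refU_back h.hu hR.refu hi hl
      rcases Nat.even_or_odd' j with ⟨t, rfl | rfl⟩
      · refine Or.inr (Or.inr (Or.inl ⟨t, by omega, ⟨loc_even_iff.1 hl', 2*R.K, by omega, ?_, ?_⟩, Or.inr rfl⟩))
        · rw [<- h.V_K]; exact loc_even _ _
        · exact gap_eq_of_gq (hR.LB t (by omega)).1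
      · have := loc_odd_iff.1 hl'
        exact Or.inr (Or.inr (Or.inr ⟨t, by omega, this.1, this.2, Or.inr ⟨rfl, rfl⟩⟩))
    · obtain ⟨j, hj, rfl, hl'⟩ := refU_back h.hv hR.refv hi hl
      exact Or.inl ⟨rfl, j, hj, hl', gap_eq_of_gq (hR.LC j hj).1⟩
    · obtain ⟨j, hj, rfl, hl'⟩ := refU_back h.hv hR.refv hi hl
      exact Or.inr (Or.inl ⟨h.U_M.symm, j, hj, hl', gap_eq_of_gq (hR.LE j hj).1⟩)
  · rintro (⟨rfl, j, hj, hl, rfl⟩ | ⟨rfl, j, hj, hl, rfl⟩ | ⟨t, ht, ⟨rfl, j, hj, hl, rfl⟩, (rfl | rfl)⟩ |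
      ⟨t, ht, h1, h2, (⟨h3, rfl⟩ | ⟨h3, rfl⟩)⟩)
    · exact ⟨_, Or.inr (Or.inr (Or.inl ⟨rfl, R.rv j, hR.refv.le hj, refU_transfer h.hv hR.refv hj hl, rfl⟩)), (gap_eq_of_gq (hR.LC j hj).1).symm⟩
    · exact ⟨_, Or.inr (Or.inr (Or.inr ⟨h.U_M, R.rv j, hR.refv.le hj, refU_transfer h.hv hR.refv hj hl, rfl⟩)), (gap_eq_of_gq (hR.LE j hj).1).symm⟩
    · have : j = 0 := loc_unique hV hj (by omega) hl (loc_even _ 0)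
      subst this
      exact ⟨_, Or.inl ⟨rfl, R.ru (2*t), hR.refu.le (by omega), (refU_loc h.hu hR.refu t ht).1, rfl⟩, (gap_eq_of_gq (hR.LA t ht).1).symm⟩
    · have : j = 2*R.K := loc_unique hV hj (by omega) hl (by rw [<- h.V_K]; exact loc_even _ _)
      subst this
      exact ⟨_, Or.inr (Or.inl ⟨rfl, R.ru (2*t), hR.refu.le (by omega), (refU_loc h.hu hR.refu t ht).1, rfl⟩), (gap_eq_of_gq (hR.LB t ht).1).symm⟩
    · exact ⟨_, Or.inl ⟨h3, _, hR.refu.le (by omega), refU_transfer h.hu hR.refu (by omega) (loc_odd_iff.2 ⟨h1, h2⟩), rfl⟩, rfl⟩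
    · exact ⟨_, Or.inr (Or.inl ⟨h3, _, hR.refu.le (by omega), refU_transfer h.hu hR.refu (by omega) (loc_odd_iff.2 ⟨h1, h2⟩), rfl⟩), rfl⟩

end RC

/-! ## Part B4: local geometry, continued; triangles -/

def ilR (R : Rec) (U V : ℕ -> ℝ) (u v : ℝ) (e : Ent) (b : Bool) : Prop :=
  ∃ t < R.M, 0 < t /\ u = U t /\ ∃ j < 2*R.K, 0 < j /\ loc V j v /\ e = R.L t j /\ b = decide (j % 2 = 0)

theorem bdl_not_strict (h : bdl r us vs u v e) (h1 : us 0 < u) (h2 : u < us r.m) (h3 : vs 0 < v) (h4 : v < vs r.k) : False := by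
  rcases h with ⟨rfl, _⟩ | ⟨rfl, _⟩ | ⟨rfl, _⟩ | ⟨rfl, _⟩
  · exact lt_irrefl _ h3
  · exact lt_irrefl _ h4
  · exact lt_irrefl _ h1
  · exact lt_irrefl _ h2

namespace RC
variable {row : ℕ -> Row} {rk : ℕ -> ℕ} {S : ℕ -> Prop} {R : Rec}

theorem A4r (h : RC N row rk S s R us vs) (hb : bdg (row s) us vs u v g) : ∃ t < R.M, bdg (row (R.ch t)) (cm (refU vs R.rv) (R.rc t) R.K) (cvs (refU us R.ru) t) v u g := by
  have hM := h.M2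
  have line : ∀ t ≤ R.M, ln R (refU us R.ru) (refU vs R.rv) t u v g -> ∃ t < R.M, bdg (row (R.ch t)) (cm (refU vs R.rv) (R.rc t) R.K) (cvs (refU us R.ru) t) v u g := by
    intro t ht hl
    rcases ht.eq_or_lt with rfl | ht
    · refine ⟨R.M - 1, by omega, (h.child_bd (by omega)).2 (Or.inr (Or.inl ?_))⟩
      rwa [show R.M - 1 + 1 = R.M by omega]
    · exact ⟨t, ht, (h.child_bd ht).2 (Or.inl hl)⟩
  rcases h.parent_bd.1 hb with h1 | h1 | ⟨t, ht, h1, _⟩ | ⟨t, ht, h1⟩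
  · exact line 0 (by omega) h1
  · exact line _ le_rfl h1
  · exact line t ht h1
  · exact ⟨t, ht, (h.child_bd ht).2 (Or.inr (Or.inr h1))⟩

theorem A5r (h : RC N row rk S s R us vs) (htt : t < t') (ht' : t' < R.M) (h1 : refU us R.ru t <= u /\ u <= refU us R.ru (t+1) /\ vs 0 <= v /\ v <= vs (row s).k) (h2 : refU us R.ru t' <= u /\ u <= refU us R.ru (t'+1) /\ vs 0 <= v /\ v <= vs (row s).k) : ∃ g, bdg (row (R.ch t)) (cm (refU vs R.rv) (R.rc t) R.K) (cvs (refU us R.ru) t) v u g /\ bdg (row (R.ch t')) (cm (refU vs R.rv) (R.rc t') R.K) (cvs (refU us R.ru) t') v u g := by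
  have e : t' = t+1 := by
    have := (h.U_SM.le_iff (i := t') (j := t+1) (by omega) (by omega)).1 (h2.1.trans h1.2.1)
    omega
  subst e
  have hu : u = refU us R.ru (t+1) := le_antisymm h1.2.1 h2.1
  obtain ⟨j, hj, hl⟩ := loc_exists (us := refU vs R.rv) (m := R.K) (x := v) h1.2.2.1
    (by rw [h.V_K]; exact h1.2.2.2)
  have hl : ln R (refU us R.ru) (refU vs R.rv) (t+1) u v (gap (R.L (t+1) j)) := ⟨hu, j, hj, hl, rfl⟩
  exact ⟨_, (h.child_bd (by omega)).2 (Or.inr (Or.inl hl)), (h.child_bd ht').2 (Or.inl hl)⟩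

theorem i1r (h : RC N row rk S s R us vs) {b : Bool} (hi : ilR R (refU us R.ru) (refU vs R.rv) u v e b) : ∃ t < R.M, bdg (row (R.ch t)) (cm (refU vs R.rv) (R.rc t) R.K) (cvs (refU us R.ru) t) v u (gap e) := by
  obtain ⟨t, ht, ht0, hu, j, hj, hj0, hl, he, hb⟩ := hi
  exact ⟨t, ht, (h.child_bd ht).2 (Or.inl ⟨hu, j, hj.le, hl, by rw [he]⟩)⟩

theorem il_strict (h : RC N row rk S s R us vs) {b : Bool} (hi : ilR R (refU us R.ru) (refU vs R.rv) u v e b) : us 0 < u /\ u < us (row s).m /\ vs 0 < v /\ v < vs (row s).k := by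
  obtain ⟨t, ht, ht0, hu, j, hj, hj0, hl, he, hb⟩ := hi
  rw [hu, <- h.U_0, <- h.U_M, <- h.V_0, <- h.V_K]
  exact ⟨h.U_SM.lt ht0 ht.le, h.U_SM.lt ht le_rfl, (loc_pos_iff h.V_SM hj.le hl).2 hj0, (loc_lt_iff h.V_SM hj.le hl).2 hj⟩

theorem i3r (h : RC N row rk S s R us vs) {b b' : Bool} (hi : ilR R (refU us R.ru) (refU vs R.rv) u v e b) (hi' : ilR R (refU us R.ru) (refU vs R.rv) u v e' b') : e = e' /\ b = b' := by
  obtain ⟨t, ht, ht0, hu, j, hj, hj0, hl, he, hb⟩ := hi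
  obtain ⟨t', ht', ht0', hu', j', hj', hj0', hl', he', hb'⟩ := hi'
  have e1 : t = t' := h.U_SM.inj ht.le ht'.le (hu.symm.trans hu')
  have e2 : j = j' := loc_unique h.V_SM hj.le hj'.le hl hl'
  subst e1 e2
  exact ⟨he.trans he'.symm, hb.trans hb'.symm⟩

theorem i4r (h : RC N row rk S s R us vs) (ht : t < R.M) (hb : bdg (row (R.ch t)) (cm (refU vs R.rv) (R.rc t) R.K) (cvs (refU us R.ru) t) v u g) : (∃ g', bdg (row s) us vs u v g') ∨ ∃ e b, ilR R (refU us R.ru) (refU vs R.rv) u v e b := by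
  have line : ∀ t ≤ R.M, ln R (refU us R.ru) (refU vs R.rv) t u v g -> (∃ g', bdg (row s) us vs u v g') ∨ ∃ e b, ilR R (refU us R.ru) (refU vs R.rv) u v e b := by
    intro t ht hl
    by_cases h0 : t = 0
    · subst h0; exact Or.inl ⟨g, h.parent_bd.2 (Or.inl hl)⟩
    by_cases hM : t = R.M
    · subst hM; exact Or.inl ⟨g, h.parent_bd.2 (Or.inr (Or.inl hl))⟩
    have hl0 := hl
    obtain ⟨hu, j, hj, hl, hg⟩ := hl
    by_cases j0 : j = 0
    · subst j0
      have : v = vs 0 := by rw [show (0:ℕ) = 2*0 from rfl, loc_even_iff] at hl; exact hl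
      exact Or.inl ⟨g, h.parent_bd.2 (Or.inr (Or.inr (Or.inl ⟨t, ht, hl0, Or.inl this⟩)))⟩
    by_cases jK : j = 2*R.K
    · subst jK
      have : v = vs (row s).k := by rw [loc_even_iff, h.V_K] at hl; exact hl
      exact Or.inl ⟨g, h.parent_bd.2 (Or.inr (Or.inr (Or.inl ⟨t, ht, hl0, Or.inr this⟩)))⟩
    exact Or.inr ⟨_, _, t, by omega, by omega, hu, j, by omega, by omega, hl, rfl, rfl⟩
  rcases (h.child_bd ht).1 hb with h1 | h1 | h1
  · exact line t ht.le h1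
  · exact line (t+1) ht h1
  · exact Or.inl ⟨g, h.parent_bd.2 (Or.inr (Or.inr (Or.inr ⟨t, ht, h1⟩)))⟩

theorem i5r (h : RC N row rk S s R us vs) {b : Bool} (hi : ilR R (refU us R.ru) (refU vs R.rv) u v e b) : (b = true -> e.lab ≠ 0 /\ adm N e.lo e.hi (e.lab - 1)) /\ (b = false -> hasAdm N e.lo e.hi) := by
  obtain ⟨t, ht, ht0, hu, j, hj, hj0, hl, he, hb⟩ := hi
  have := h.R.Li t ht ht0 j hj hj0
  subst he hb
  refine ⟨fun h => this.1 (by simpa using h), fun h => (this.2 (by simp at h; omega)).2⟩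

end RC

/-! ### triangles -/

def tbl (r : TRow) (us : ℕ -> ℝ) (x y : ℝ) (e : Ent) : Prop :=
  (x = us 0 /\ ∃ i ≤ 2*r.m, 0 < i /\ loc us i y /\ e = r.L i) ∨
  (y = us r.m /\ ∃ i < 2*r.m, loc us i x /\ e = r.U i)

def tbg (r : TRow) (us : ℕ -> ℝ) (x y : ℝ) (g : Gap) : Prop := ∃ e, tbl r us x y e /\ g = gap e

theorem tbl_box {r : TRow} (hu : SM us r.m) (h : tbl r us x y e) : us 0 <= x /\ y <= us r.m /\ x < y := by
  rcases h with ⟨rfl, i, hi, hi0, hl, _⟩ | ⟨rfl, i, hi, hl, _⟩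
  · exact ⟨le_rfl, loc_lem hu hi hl, (loc_pos_iff hu hi hl).2 hi0⟩
  · exact ⟨loc_ge0 hu hi.le hl, le_rfl, (loc_lt_iff hu hi.le hl).2 hi⟩

theorem tbl_unique {r : TRow} (hr : TRowOK N r) (hu : SM us r.m) (h : tbl r us x y e) (h' : tbl r us x y e') : e = e' := by
  rcases h with ⟨rfl, i, hi, hi0, hl, rfl⟩ | ⟨rfl, i, hi, hl, rfl⟩ <;>
  rcases h' with ⟨h1, j, hj, hj0, hl', rfl⟩ | ⟨h1, j, hj, hl', rfl⟩
  · rw [loc_unique hu hi hj hl hl']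
  · subst h1
    rw [loc_unique hu hi le_rfl hl (loc_even _ _), hr.c, loc_unique hu hj.le (Nat.zero_le _) hl' (loc_even us 0)]
  · subst h1
    rw [loc_unique hu hj le_rfl hl' (loc_even _ _), hr.c, loc_unique hu hi.le (Nat.zero_le _) hl (loc_even us 0)]
  · rw [loc_unique hu hi.le hj.le hl hl']

theorem tbl_self {r : TRow} (hr : TRowOK N r) (h : tbl r us x y e) : ple N e.lo e.hi := by
  rcases h with ⟨rfl, i, hi, hi0, hl, rfl⟩ | ⟨rfl, i, hi, hl, rfl⟩
  · exact hr.lhL i hi hi0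
  · exact hr.lhU i hi

theorem tbl_coh {r : TRow} (hr : TRowOK N r) (hu : SM us r.m) (h : tbl r us x y e) (h' : tbl r us x' y' e') (h1 : x < x') (h2 : y < y') : ple N e.hi e'.lo := by
  have hb := tbl_box hu h
  have hb' := tbl_box hu h'
  rcases h with ⟨rfl, i, hi, hi0, hl, rfl⟩ | ⟨rfl, i, hi, hl, rfl⟩
  · rcases h' with ⟨rfl, j, hj, hj0, hl', rfl⟩ | ⟨rfl, j, hj, hl', rfl⟩
    · exact absurd h1 (lt_irrefl _)
    · exact hr.o i ((loc_lt_iff hu hi hl).1 h2) hi0 j hj ((loc_pos_iff hu hj.le hl').1 h1)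
  · exact absurd hb'.2.1 (not_le.2 h2)

structure TC (N : ℕ) (row : ℕ -> Row) (trow : ℕ -> TRow) (S ST : ℕ -> Prop) (s : ℕ) (R : TRec)
    (us : ℕ -> ℝ) : Prop where
  rows : ∀ s, S s -> RowOK N (row s)
  trows : ∀ s, ST s -> TRowOK N (trow s)
  hs : ST s
  R : TRecOK N row trow S ST s R
  hu : SM us (trow s).m

/-- vertical lines -/
def Vl (R : TRec) (Z X : ℕ -> ℝ) (t : ℕ) (x y : ℝ) (g : Gap) : Prop :=
  t < R.M /\ x = Z t /\ ∃ j ≤ 2*R.Q, 2*R.zc t < j /\ loc X j y /\ g = gap (R.V t j)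
def Hl (R : TRec) (Z X : ℕ -> ℝ) (t : ℕ) (x y : ℝ) (g : Gap) : Prop :=
  t < R.M /\ y = Z (t+1) /\ ∃ j < 2*R.zc (t+1), 2*R.zc t <= j /\ loc X j x /\ g = gap (R.H t j)
def Tl (r : TRow) (R : TRec) (Z : ℕ -> ℝ) (t : ℕ) (x y : ℝ) (g : Gap) : Prop :=
  t < R.M /\ y = Z R.M /\ Z t < x /\ x < Z (t+1) /\ g = gap (r.U (R.ruZ (2*t+1)))

def ilT (R : TRec) (Z X : ℕ -> ℝ) (x y : ℝ) (e : Ent) (b : Bool) : Prop :=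
  (∃ t < R.M, 0 < t /\ x = Z t /\ ∃ j < 2*R.Q, 2*R.zc t < j /\ loc X j y /\ e = R.V t j /\
    b = decide (j % 2 = 0)) ∨
  (∃ t < R.M, t + 1 < R.M /\ y = Z (t+1) /\ ∃ j < 2*R.zc (t+1), 2*R.zc t < j /\ loc X j x /\ e = R.H t j /\
    b = decide (j % 2 = 0))

noncomputable def TZ (R : TRec) (us : ℕ -> ℝ) : ℕ -> ℝ := refU us R.ruZ
noncomputable def TX (R : TRec) (us : ℕ -> ℝ) : ℕ -> ℝ := refU (refU us R.ruZ) R.ruC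
noncomputable def Tus (R : TRec) (us : ℕ -> ℝ) (t : ℕ) : ℕ -> ℝ :=
  cm (fun n => TX R us (R.zc t + n)) (R.rT t) (R.zc (t+1) - R.zc t)
noncomputable def Rus (R : TRec) (us : ℕ -> ℝ) (t : ℕ) : ℕ -> ℝ :=
  cm (fun n => TX R us (R.zc t + n)) (R.rA t) (R.zc (t+1) - R.zc t)
noncomputable def Rvs (R : TRec) (us : ℕ -> ℝ) (t : ℕ) : ℕ -> ℝ :=
  cm (fun n => TX R us (R.zc (t+1) + n)) (R.rC t) (R.Q - R.zc (t+1))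

namespace TC
variable {row : ℕ -> Row} {trow : ℕ -> TRow} {S ST : ℕ -> Prop} {R : TRec}

theorem rowOK (h : TC N row trow S ST s R us) : TRowOK N (trow s) := h.trows s h.hs
theorem Z_SM (h : TC N row trow S ST s R us) : SM (TZ R us) R.M := refU_SM h.hu h.R.refZ
theorem X_SM (h : TC N row trow S ST s R us) : SM (TX R us) R.Q := refU_SM h.Z_SM h.R.refC
theorem Z_M (h : TC N row trow S ST s R us) : TZ R us R.M = us (trow s).m := refU_last h.hu h.R.refZ
theorem Z_0 (_ : TC N row trow S ST s R us) : TZ R us 0 = us 0 := rfl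

theorem zc_le (h : TC N row trow S ST s R us) (htt : t <= t') (ht : t' <= R.M) : R.zc t <= R.zc t' := by
  induction t', htt using Nat.le_induction with
  | base => exact le_rfl
  | succ j h1 ih => exact (ih (by omega)).trans (h.R.zcl j (by omega)).le

theorem zc_leQ (h : TC N row trow S ST s R us) (ht : t <= R.M) : R.zc t <= R.Q := by
  rw [<- h.R.zcM]; exact h.zc_le ht le_rfl

theorem X_zc (h : TC N row trow S ST s R us) (ht : t <= R.M) : TX R us (R.zc t) = TZ R us t := by
  have h1 : loc (TX R us) (2*R.zc t) (TX R us (R.zc t)) := loc_even _ _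
  have h2 := refU_transfer h.Z_SM h.R.refC (j := 2*R.zc t) (by have := h.zc_leQ ht; omega) h1
  rw [h.R.zcr t ht, loc_even_iff] at h2
  exact h2

theorem M2 (h : TC N row trow S ST s R us) : 2 <= R.M := by
  have h1 := h.rowOK.hm
  by_contra hc
  have hM : R.M = 0 ∨ R.M = 1 := by omega
  rcases hM with hM | hM
  · have a := h.R.refZ.1
    have b := h.R.refZ.2.1
    rw [hM] at b; simp at b; omega
  · have b := h.R.refZ.2.1
    have c := h.R.halv 0 (by omega) (by rw [Nat.mul_zero, h.R.refZ.1])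
    rw [hM] at b; simp at b c; omega

/-- fine location of a point in terms of comparisons with coarse marks -/
theorem loc_ge_zc (h : TC N row trow S ST s R us) (hj : j <= 2*R.Q) (ht : t <= R.M) (hl : loc (TX R us) j x) : TZ R us t <= x ↔ 2*R.zc t <= j := by
  have hz := h.zc_leQ ht
  rw [<- h.X_zc ht]
  constructor
  · intro h1
    rcases h1.eq_or_lt with h1 | h1
    · rw [<- h1] at hl
      rw [loc_unique h.X_SM hj (by omega) hl (loc_even _ _)]
    · rcases loc_lt h.X_SM (by omega) hj (loc_even _ (R.zc t)) hl h1 with h2 | h2 <;> omega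
  · intro h1
    exact (h.X_SM.le (by omega) (by omega)).trans (loc_ge hl)

theorem loc_le_zc (h : TC N row trow S ST s R us) (hj : j <= 2*R.Q) (ht : t <= R.M) (hl : loc (TX R us) j x) : x <= TZ R us t ↔ j <= 2*R.zc t := by
  have hz := h.zc_leQ ht
  rw [<- h.X_zc ht]
  constructor
  · intro h1
    rcases h1.eq_or_lt with h1 | h1
    · rw [h1] at hl
      rw [loc_unique h.X_SM hj (by omega) hl (loc_even _ _)]
    · rcases loc_lt h.X_SM hj (by omega) hl (loc_even _ (R.zc t)) h1 with h2 | h2 <;> omega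
  · intro h1
    exact (loc_le hl).trans (h.X_SM.le (by omega) (by omega))

theorem loc_lt_zc (h : TC N row trow S ST s R us) (hj : j <= 2*R.Q) (ht : t <= R.M) (hl : loc (TX R us) j x) : x < TZ R us t ↔ j < 2*R.zc t := by
  rw [<- not_le, h.loc_ge_zc hj ht hl, not_le]

theorem loc_gt_zc (h : TC N row trow S ST s R us) (hj : j <= 2*R.Q) (ht : t <= R.M) (hl : loc (TX R us) j x) : TZ R us t < x ↔ 2*R.zc t < j := by
  rw [<- not_le, h.loc_le_zc hj ht hl, not_le]

theorem X_exists (h : TC N row trow S ST s R us) (h0 : TZ R us 0 <= x) (h1 : x <= TZ R us R.M) : ∃ j ≤ 2*R.Q, loc (TX R us) j x := by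
  apply loc_exists
  · rw [<- h.R.zc0, h.X_zc (by omega)]; exact h0
  · rw [<- h.R.zcM, h.X_zc le_rfl]; exact h1

theorem Xs_SM (h : TC N row trow S ST s R us) (ht : t < R.M) : SM (fun n => TX R us (R.zc t + n)) (R.zc (t+1) - R.zc t) :=
  h.X_SM.shift (by have := h.zc_leQ (t := t+1) ht; have := h.R.zcl t ht; omega)

theorem Xs'_SM (h : TC N row trow S ST s R us) (ht : t < R.M) : SM (fun n => TX R us (R.zc (t+1) + n)) (R.Q - R.zc (t+1)) :=
  h.X_SM.shift (by have := h.zc_leQ (t := t+1) ht; omega)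

theorem Tus_SM (h : TC N row trow S ST s R us) (ht : t < R.M) : SM (Tus R us t) (trow (R.chT t)).m := cm_SM (h.Xs_SM ht) (h.R.cTO t ht).ref

theorem Tus_0 (h : TC N row trow S ST s R us) (ht : t < R.M) : Tus R us t 0 = TZ R us t := by
  unfold Tus; rw [cm_zero (h.R.cTO t ht).ref, Nat.add_zero, h.X_zc ht.le]

theorem Tus_m (h : TC N row trow S ST s R us) (ht : t < R.M) : Tus R us t (trow (R.chT t)).m = TZ R us (t+1) := by
  have := h.R.zcl t ht
  unfold Tus; rw [cm_last (h.R.cTO t ht).ref, <- h.X_zc (t := t+1) ht]; congr 1; omega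

theorem Rus_SM (h : TC N row trow S ST s R us) (ht : t + 1 < R.M) : SM (Rus R us t) (row (R.chR t)).m := cm_SM (h.Xs_SM (by omega)) (h.R.cRO t (by omega) ht).refA

theorem Rvs_SM (h : TC N row trow S ST s R us) (ht : t + 1 < R.M) : SM (Rvs R us t) (row (R.chR t)).k := cm_SM (h.Xs'_SM (by omega)) (h.R.cRO t (by omega) ht).refC

theorem Rus_0 (h : TC N row trow S ST s R us) (ht : t + 1 < R.M) : Rus R us t 0 = TZ R us t := by
  unfold Rus; rw [cm_zero (h.R.cRO t (by omega) ht).refA, Nat.add_zero, h.X_zc (by omega)]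

theorem Rus_m (h : TC N row trow S ST s R us) (ht : t + 1 < R.M) : Rus R us t (row (R.chR t)).m = TZ R us (t+1) := by
  have := h.R.zcl t (by omega)
  unfold Rus; rw [cm_last (h.R.cRO t (by omega) ht).refA, <- h.X_zc (t := t+1) (by omega)]; congr 1; omega

theorem Rvs_0 (h : TC N row trow S ST s R us) (ht : t + 1 < R.M) : Rvs R us t 0 = TZ R us (t+1) := by
  unfold Rvs; rw [cm_zero (h.R.cRO t (by omega) ht).refC, Nat.add_zero, h.X_zc (by omega)]

theorem Rvs_k (h : TC N row trow S ST s R us) (ht : t + 1 < R.M) : Rvs R us t (row (R.chR t)).k = TZ R us R.M := by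
  have := h.zc_leQ (t := t+1) (by omega)
  unfold Rvs; rw [cm_last (h.R.cRO t (by omega) ht).refC, <- h.X_zc le_rfl, h.R.zcM]; congr 1; omega

theorem childT_bd (h : TC N row trow S ST s R us) (ht : t < R.M) : tbg (trow (R.chT t)) (Tus R us t) x y g ↔ (Vl R (TZ R us) (TX R us) t x y g /\ y <= TZ R us (t+1)) ∨ Hl R (TZ R us) (TX R us) t x y g := by
  have hO := h.R.cTO t ht
  have hX := h.Xs_SM ht
  have z1 := h.R.zcl t ht
  have z2 := h.zc_leQ (t := t+1) ht
  constructor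
  · rintro ⟨e, (⟨he, i, hi, hi0, hl, rfl⟩ | ⟨he, i, hi, hl, rfl⟩), rfl⟩
    · obtain ⟨j, hj, rfl, hl'⟩ := cm_back hX hO.ref hi hl
      rw [loc_shift] at hl'
      have hj0 : 0 < j := by
        by_contra hc
        rw [show j = 0 by omega, hO.ref.1] at hi0; omega
      left
      refine ⟨⟨ht, by rw [he, h.Tus_0 ht], 2*R.zc t + j, by omega, by omega, hl', ?_⟩, ?_⟩
      · exact gap_eq_of_gq (hO.L j hj hj0).1
      · rw [h.loc_le_zc (t := t+1) (by omega) ht hl']; omega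
    · obtain ⟨j, hj, rfl, hl'⟩ := cm_back hX hO.ref hi.le hl
      rw [loc_shift] at hl'
      have hj0 : j < 2*(R.zc (t+1) - R.zc t) := by
        by_contra hc
        rw [show j = 2*(R.zc (t+1) - R.zc t) by omega, hO.ref.2.1] at hi; omega
      right
      exact ⟨ht, by rw [he, h.Tus_m ht], 2*R.zc t + j, by omega, by omega, hl', gap_eq_of_gq (hO.U j hj0).1⟩
  · rintro (⟨⟨_, rfl, j, hj, hj0, hl, rfl⟩, hy⟩ | ⟨_, rfl, j, hj, hj0, hl, rfl⟩)
    · rw [h.loc_le_zc (t := t+1) hj ht hl] at hy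
      obtain ⟨j, rfl⟩ := Nat.exists_eq_add_of_le hj0.le
      have hl2 := cm_transfer hX hO.ref (j := j) (by omega) (loc_shift.2 hl)
      exact ⟨_, Or.inl ⟨(h.Tus_0 ht).symm, R.rT t j, hO.ref.le (by omega), hO.ref.pos (by omega) (by omega), hl2, rfl⟩, (gap_eq_of_gq (hO.L j (by omega) (by omega)).1).symm⟩
    · obtain ⟨j, rfl⟩ := Nat.exists_eq_add_of_le hj0
      have hl2 := cm_transfer hX hO.ref (j := j) (by omega) (loc_shift.2 hl)
      exact ⟨_, Or.inr ⟨(h.Tus_m ht).symm, R.rT t j, hO.ref.ltm (by omega), hl2, rfl⟩, (gap_eq_of_gq (hO.U j (by omega)).1).symm⟩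

theorem childR_bd (h : TC N row trow S ST s R us) (ht : t + 1 < R.M) (hxy : x < y) : bdg (row (R.chR t)) (Rus R us t) (Rvs R us t) x y g ↔ Hl R (TZ R us) (TX R us) t x y g ∨ (Vl R (TZ R us) (TX R us) t x y g /\ TZ R us (t+1) <= y) ∨ Vl R (TZ R us) (TX R us) (t+1) x y g ∨ Tl (trow s) R (TZ R us) t x y g := by
  have ht' : t < R.M := by omega
  have hO := h.R.cRO t ht' ht
  have hX := h.Xs_SM ht'
  have hX' := h.Xs'_SM ht'
  have z1 := h.R.zcl t ht'
  have z2 := h.zc_leQ (t := t+1) ht.le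
  have z3 := h.R.zcl (t+1) ht
  have z4 := h.zc_leQ (t := t+1+1) ht
  have hr := h.rows _ (h.R.cRS t ht' ht)
  have hQ : TX R us R.Q = TZ R us R.M := by rw [<- h.R.zcM, h.X_zc le_rfl]
  constructor
  · rintro ⟨e, (⟨he, i, hi, hl, rfl⟩ | ⟨he, i, hi, hl, rfl⟩ | ⟨he, i, hi, hl, rfl⟩ | ⟨he, i, hi, hl, rfl⟩), rfl⟩
    · rw [h.Rvs_0 ht] at he
      obtain ⟨j, hj, rfl, hl'⟩ := cm_back hX hO.refA hi hl
      rw [loc_shift] at hl'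
      rw [he, h.loc_lt_zc (by omega) ht.le hl'] at hxy
      left
      exact ⟨ht', he, 2*R.zc t + j, hxy, by omega, hl', gap_eq_of_gq (hO.A j (by omega)).1⟩
    · rw [h.Rvs_k ht] at he
      by_cases i0 : i = 0
      · subst i0
        rw [show (0:ℕ) = 2*0 from rfl, loc_even_iff, h.Rus_0 ht] at hl
        refine Or.inr (Or.inl ⟨⟨ht', hl, 2*R.Q, le_rfl, by omega, ?_, gap_eq_of_gq hO.B0.1⟩, ?_⟩)
        · rw [loc_even_iff, hQ, he]
        · rw [he]; exact h.Z_SM.le ht.le le_rfl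
      by_cases im : i = 2*(row (R.chR t)).m
      · subst im
        rw [loc_even_iff, h.Rus_m ht] at hl
        refine Or.inr (Or.inr (Or.inl ⟨ht, hl, 2*R.Q, le_rfl, by omega, ?_, gap_eq_of_gq hO.B1.1⟩))
        rw [loc_even_iff, hQ, he]
      · refine Or.inr (Or.inr (Or.inr ⟨ht', he, ?_, ?_, ?_⟩))
        · rw [<- h.Rus_0 ht, loc_pos_iff (h.Rus_SM ht) hi hl]; omega
        · rw [<- h.Rus_m ht, loc_lt_iff (h.Rus_SM ht) hi hl]; omega
        · exact (gap_eq_of_gq (hO.Bi i (by omega) (by omega)).1).symm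
    · rw [h.Rus_0 ht] at he
      obtain ⟨j, hj, rfl, hl'⟩ := cm_back hX' hO.refC hi hl
      rw [loc_shift] at hl'
      refine Or.inr (Or.inl ⟨⟨ht', he, 2*R.zc (t+1) + j, by omega, by omega, hl', gap_eq_of_gq (hO.C j hj).1⟩, ?_⟩)
      rw [h.loc_ge_zc (by omega) ht.le hl']; omega
    · rw [h.Rus_m ht] at he
      obtain ⟨j, hj, rfl, hl'⟩ := cm_back hX' hO.refC hi hl
      rw [loc_shift] at hl'
      rw [he, h.loc_gt_zc (by omega) ht.le hl'] at hxy
      exact Or.inr (Or.inr (Or.inl ⟨ht, he, 2*R.zc (t+1) + j, by omega, hxy, hl', gap_eq_of_gq (hO.E j hj (by omega)).1⟩))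
  · rintro (⟨_, rfl, j, hj, hj0, hl, rfl⟩ | ⟨⟨_, rfl, j, hj, hj0, hl, rfl⟩, hy⟩ |
      ⟨_, rfl, j, hj, hj0, hl, rfl⟩ | ⟨_, rfl, h1, h2, rfl⟩)
    · obtain ⟨j, rfl⟩ := Nat.exists_eq_add_of_le hj0
      have hl2 := cm_transfer hX hO.refA (j := j) (by omega) (loc_shift.2 hl)
      exact ⟨_, Or.inl ⟨(h.Rvs_0 ht).symm, R.rA t j, hO.refA.le (by omega), hl2, rfl⟩, (gap_eq_of_gq (hO.A j (by omega)).1).symm⟩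
    · rw [h.loc_ge_zc hj ht.le hl] at hy
      obtain ⟨j, rfl⟩ := Nat.exists_eq_add_of_le hy
      have hl2 := cm_transfer hX' hO.refC (j := j) (by omega) (loc_shift.2 hl)
      exact ⟨_, Or.inr (Or.inr (Or.inl ⟨(h.Rus_0 ht).symm, R.rC t j, hO.refC.le (by omega), hl2, rfl⟩)), (gap_eq_of_gq (hO.C j (by omega)).1).symm⟩
    · obtain ⟨j, rfl⟩ := Nat.exists_eq_add_of_le hj0.le
      have hl2 := cm_transfer hX' hO.refC (j := j) (by omega) (loc_shift.2 hl)
      exact ⟨_, Or.inr (Or.inr (Or.inr ⟨(h.Rus_m ht).symm, R.rC t j, hO.refC.le (by omega), hl2, rfl⟩)), (gap_eq_of_gq (hO.E j (by omega) (by omega)).1).symm⟩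
    · obtain ⟨i, hi, hl⟩ := loc_exists (us := Rus R us t) (m := (row (R.chR t)).m) (x := x)
        (by rw [h.Rus_0 ht]; exact h1.le) (by rw [h.Rus_m ht]; exact h2.le)
      have i0 : 0 < i := by rw [<- loc_pos_iff (h.Rus_SM ht) hi hl, h.Rus_0 ht]; exact h1
      have i1 : i < 2*(row (R.chR t)).m := by
        rw [<- loc_lt_iff (h.Rus_SM ht) hi hl, h.Rus_m ht]; exact h2
      exact ⟨_, Or.inr (Or.inl ⟨(h.Rvs_k ht).symm, i, hi, hl, rfl⟩), gap_eq_of_gq (hO.Bi i i1 i0).1⟩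

theorem parentT_bd (h : TC N row trow S ST s R us) : tbg (trow s) us x y g ↔ Vl R (TZ R us) (TX R us) 0 x y g ∨ Hl R (TZ R us) (TX R us) (R.M-1) x y g ∨ (∃ t < R.M, Vl R (TZ R us) (TX R us) t x y g /\ y = TZ R us R.M) ∨ ∃ t < R.M, Tl (trow s) R (TZ R us) t x y g := by
  have hR := h.R
  have hM := h.M2
  have hQ : TX R us R.Q = TZ R us R.M := by rw [<- h.R.zcM, h.X_zc le_rfl]
  have hM1 : R.M - 1 + 1 = R.M := by omega
  constructor
  · rintro ⟨e, (⟨he, i, hi, hi0, hl, rfl⟩ | ⟨he, i, hi, hl, rfl⟩), rfl⟩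
    · obtain ⟨j, hj, rfl, hl'⟩ := refU_back h.hu hR.refZ hi hl
      obtain ⟨l, hl1, rfl, hl2⟩ := refU_back h.Z_SM hR.refC hj hl'
      have l0 : 0 < l := by
        by_contra hc
        rw [show l = 0 by omega, hR.refC.1, hR.refZ.1] at hi0; omega
      exact Or.inl ⟨by omega, he, l, hl1, by rw [hR.zc0]; omega, hl2, gap_eq_of_gq (hR.VL l hl1 l0).1⟩
    · obtain ⟨j, hj, rfl, hl'⟩ := refU_back h.hu hR.refZ hi.le hl
      rw [<- h.Z_M] at he
      have jM : j < 2*R.M := by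
        by_contra hc
        rw [show j = 2*R.M by omega, hR.refZ.2.1] at hi; omega
      rcases Nat.even_or_odd' j with ⟨t, rfl | rfl⟩
      · refine Or.inr (Or.inr (Or.inl ⟨t, by omega, ⟨by omega, loc_even_iff.1 hl', 2*R.Q, le_rfl, ?_, ?_, ?_⟩, he⟩))
        · have a := hR.zcl t (by omega)
          have b := h.zc_leQ (t := t+1) (by omega)
          omega
        · rw [loc_even_iff, hQ, he]
        · exact gap_eq_of_gq (hR.VU t (by omega)).1
      · have := loc_odd_iff.1 hl'
        exact Or.inr (Or.inr (Or.inr ⟨t, by omega, by omega, he, this.1, this.2, rfl⟩))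
  · rintro (⟨_, rfl, j, hj, hj0, hl, rfl⟩ | ⟨_, rfl, j, hj, hj0, hl, rfl⟩ |
      ⟨t, ht, ⟨_, rfl, j, hj, hj0, hl, rfl⟩, hy⟩ | ⟨t, ht, _, rfl, h1, h2, rfl⟩)
    · rw [hR.zc0] at hj0
      have l1 := refU_transfer h.Z_SM hR.refC hj hl
      have l2 := refU_transfer h.hu hR.refZ (hR.refC.le hj) l1
      exact ⟨_, Or.inl ⟨rfl, _, hR.refZ.le (hR.refC.le hj), hR.refZ.pos (hR.refC.le hj) (hR.refC.pos hj (by omega)), l2, rfl⟩, (gap_eq_of_gq (hR.VL j hj (by omega)).1).symm⟩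
    · rw [hM1] at hj ⊢
      rw [hR.zcM] at hj
      have l1 := refU_transfer h.Z_SM hR.refC hj.le hl
      have l2 := refU_transfer h.hu hR.refZ (hR.refC.le hj.le) l1
      exact ⟨_, Or.inr ⟨h.Z_M, _, hR.refZ.ltm (hR.refC.ltm hj), l2, rfl⟩, (gap_eq_of_gq (hR.HU j hj hj0).1).symm⟩
    · rw [hy, <- hQ] at hl
      have : j = 2*R.Q := loc_unique h.X_SM hj le_rfl hl (loc_even _ _)
      subst this
      exact ⟨_, Or.inr ⟨by rw [hy, h.Z_M], R.ruZ (2*t), hR.refZ.ltm (by omega), (refU_loc h.hu hR.refZ t ht.le).1, rfl⟩, (gap_eq_of_gq (hR.VU t ht).1).symm⟩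
    · exact ⟨_, Or.inr ⟨h.Z_M, _, hR.refZ.ltm (by omega), refU_transfer h.hu hR.refZ (by omega) (loc_odd_iff.2 ⟨h1, h2⟩), rfl⟩, rfl⟩

end TC

/-! ## Part B5: the concrete subdivision tree -/

namespace TC
variable {row : ℕ -> Row} {trow : ℕ -> TRow} {S ST : ℕ -> Prop} {R : TRec}

theorem Tl_last (h : TC N row trow S ST s R us) (ht : t + 1 = R.M) (hT : Tl (trow s) R (TZ R us) t x y g) : Hl R (TZ R us) (TX R us) t x y g := by
  obtain ⟨ht', hy, h1, h2, rfl⟩ := hT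
  have hM1 : R.M - 1 = t := by omega
  have b0 : TZ R us 0 <= x := (h.Z_SM.le (Nat.zero_le t) ht'.le).trans h1.le
  have b1 : x <= TZ R us R.M := by rw [<- ht]; exact h2.le
  obtain ⟨j, hj, hl⟩ := h.X_exists b0 b1
  have j1 := (h.loc_gt_zc hj ht'.le hl).1 h1
  have j2 := (h.loc_lt_zc hj ht' hl).1 h2
  refine ⟨ht', by rw [hy, ht], j, j2, j1.le, hl, ?_⟩
  have hQ : j < 2*R.Q := by rw [<- h.R.zcM, <- ht]; exact j2
  have h3 := h.R.HU j hQ (by rw [hM1]; exact j1.le)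
  have h4 := refU_transfer h.Z_SM h.R.refC hj hl
  have h5 := loc_unique h.Z_SM (h.R.refC.le hj) (j := 2*t+1) (by omega) h4 (loc_odd_iff.2 ⟨h1, h2⟩)
  rw [h5, hM1] at h3
  exact gap_eq_of_gq h3.1

theorem Vl_exists (h : TC N row trow S ST s R us) (ht : t < R.M) (hx : x = TZ R us t) (h1 : x < y) (h2 : y <= TZ R us R.M) : ∃ g, Vl R (TZ R us) (TX R us) t x y g := by
  subst hx
  obtain ⟨j, hj, hl⟩ := h.X_exists ((h.Z_SM.le (Nat.zero_le t) ht.le).trans h1.le) h2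
  exact ⟨_, ht, rfl, j, hj, (h.loc_gt_zc hj ht.le hl).1 h1, hl, rfl⟩

theorem Hl_exists (h : TC N row trow S ST s R us) (ht : t < R.M) (hy : y = TZ R us (t+1)) (h1 : x < y) (h2 : TZ R us t <= x) : ∃ g, Hl R (TZ R us) (TX R us) t x y g := by
  subst hy
  obtain ⟨j, hj, hl⟩ := h.X_exists ((h.Z_SM.le (Nat.zero_le t) ht.le).trans h2)
    (h1.le.trans (h.Z_SM.le ht le_rfl))
  exact ⟨_, ht, rfl, j, (h.loc_lt_zc hj ht hl).1 h1, (h.loc_ge_zc hj ht.le hl).1 h2, hl, rfl⟩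

end TC

/-- a system of certificates with chosen records -/
structure Sys where
  N : ℕ
  row : ℕ -> Row
  trow : ℕ -> TRow
  rk : ℕ -> ℕ
  S : ℕ -> Prop
  ST : ℕ -> Prop
  rows : ∀ s, S s -> RowOK N (row s)
  trows : ∀ s, ST s -> TRowOK N (trow s)
  rec' : ℕ -> Rec
  recs : ∀ s, S s -> RecOK N row rk S s (rec' s)
  trec : ℕ -> TRec
  trecs : ∀ s, ST s -> TRecOK N row trow S ST s (trec s)
  s0 : ℕ
  hs0 : ST s0
  root : RootOK N (trow s0) (trec s0)

theorem Cert.sys {row : ℕ -> Row} {trow : ℕ -> TRow} {rk : ℕ -> ℕ} {S ST : ℕ -> Prop} (h : Cert N row trow rk S ST) : ∃ Y : Sys, Y.N = N := by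
  classical
  obtain ⟨s0, hs0, R0, h0, hr⟩ := h.root
  have h1 : ∀ s, ∃ R, S s -> RecOK N row rk S s R := by
    intro s
    by_cases hs : S s
    · obtain ⟨R, hR⟩ := h.recs s hs; exact ⟨R, fun _ => hR⟩
    · exact ⟨⟨0, 0, fun _ => 0, fun _ => 0, fun _ _ => (row 0).A 0, fun _ => 0, fun _ _ => 0⟩, fun h => absurd h hs⟩
  have h2 : ∀ s, ∃ R, (ST s -> TRecOK N row trow S ST s R) /\ (s = s0 -> R = R0) := by
    intro s
    by_cases e : s = s0
    · subst e; exact ⟨R0, fun _ => h0, fun _ => rfl⟩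
    by_cases hs : ST s
    · obtain ⟨R, hR⟩ := h.trecs s hs; exact ⟨R, fun _ => hR, fun h => absurd h e⟩
    · exact ⟨R0, fun h => absurd h hs, fun h => absurd h e⟩
  choose f hf using h1
  choose f' hf' using h2
  exact ⟨⟨N, row, trow, rk, S, ST, h.rows, h.trows, f, fun s => hf s, f', fun s => (hf' s).1, s0, hs0, by rw [(hf' s0).2 rfl]; exact hr⟩, rfl⟩

inductive Cell where
  | rect (sw : Bool) (s : ℕ) (us vs : ℕ -> ℝ)
  | tri (s : ℕ) (us : ℕ -> ℝ)

def cu : Bool -> Pt -> ℝ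
  | false, p => p.1
  | true, p => p.2
def cv : Bool -> Pt -> ℝ
  | false, p => p.2
  | true, p => p.1

theorem cu_not (sw : Bool) (p : Pt) : cu (!sw) p = cv sw p := by cases sw <;> rfl
theorem cv_not (sw : Bool) (p : Pt) : cv (!sw) p = cu sw p := by cases sw <;> rfl

theorem pl_cu (h : pl p q) (sw : Bool) : cu sw p < cu sw q /\ cv sw p < cv sw q := by
  cases sw
  · exact h
  · exact ⟨h.2, h.1⟩

/-- the point with given local coordinates -/
def mkP : Bool -> ℝ -> ℝ -> Pt
  | false, u, v => (u, v)
  | true, u, v => (v, u)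

@[simp] theorem cu_mkP (sw : Bool) (u v : ℝ) : cu sw (mkP sw u v) = u := by cases sw <;> rfl
@[simp] theorem cv_mkP (sw : Bool) (u v : ℝ) : cv sw (mkP sw u v) = v := by cases sw <;> rfl

theorem pl_of_cu (sw : Bool) (h1 : cu sw p < cu sw q) (h2 : cv sw p < cv sw q) : pl p q := by
  cases sw
  · exact ⟨h1, h2⟩
  · exact ⟨h2, h1⟩

namespace Sys
variable (Y : Sys) {c : Cell}

def V : Cell -> Prop
  | .rect sw s us vs => Y.S s /\ SM us (Y.row s).m /\ SM vs (Y.row s).k /\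
      (sw = false -> us (Y.row s).m <= vs 0) /\ (sw = true -> vs (Y.row s).k <= us 0)
  | .tri s us => Y.ST s /\ SM us (Y.trow s).m

def nch : Cell -> ℕ
  | .rect _ s _ _ => (Y.rec' s).M
  | .tri s _ => 2 * (Y.trec s).M - 1

noncomputable def chd : Cell -> ℕ -> Cell
  | .rect sw s us vs, t => .rect (!sw) ((Y.rec' s).ch t)
      (cm (refU vs (Y.rec' s).rv) ((Y.rec' s).rc t) (Y.rec' s).K) (cvs (refU us (Y.rec' s).ru) t)
  | .tri s us, n => if n % 2 = 0 then .tri ((Y.trec s).chT (n/2)) (Tus (Y.trec s) us (n/2))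
      else .rect false ((Y.trec s).chR (n/2)) (Rus (Y.trec s) us (n/2)) (Rvs (Y.trec s) us (n/2))

def reg : Cell -> Pt -> Prop
  | .rect sw s us vs, p => inBox (Y.row s) us vs (cu sw p) (cv sw p) /\ p.1 < p.2
  | .tri s us, p => us 0 <= p.1 /\ p.2 <= us (Y.trow s).m /\ p.1 < p.2

def bd : Cell -> Pt -> Gap -> Prop
  | .rect sw s us vs, p, g => bdg (Y.row s) us vs (cu sw p) (cv sw p) g /\ p.1 < p.2
  | .tri s us, p, g => tbg (Y.trow s) us p.1 p.2 g

def il : Cell -> Pt -> Ent -> Bool -> Prop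
  | .rect sw s us vs, p, e, b => ilR (Y.rec' s) (refU us (Y.rec' s).ru) (refU vs (Y.rec' s).rv)
      (cu sw p) (cv sw p) e b /\ p.1 < p.2
  | .tri s us, p, e, b => ilT (Y.trec s) (TZ (Y.trec s) us) (TX (Y.trec s) us) p.1 p.2 e b

def w : Cell -> ℝ
  | .rect _ s us vs => 2 * (us (Y.row s).m - us 0) + 3 * (vs (Y.row s).k - vs 0)
  | .tri s us => 6 * (us (Y.trow s).m - us 0)

variable {Y}

theorem rc (h : Y.V (.rect sw s us vs)) : RC Y.N Y.row Y.rk Y.S s (Y.rec' s) us vs := ⟨Y.rows, h.1, Y.recs s h.1, h.2.1, h.2.2.1⟩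

theorem tc (h : Y.V (.tri s us)) : TC Y.N Y.row Y.trow Y.S Y.ST s (Y.trec s) us := ⟨Y.rows, Y.trows, h.1, Y.trecs s h.1, h.2⟩

theorem tidx (hn : n < Y.nch (.tri s us)) : (∃ t, n = 2*t /\ t < (Y.trec s).M) ∨ ∃ t, n = 2*t+1 /\ t + 1 < (Y.trec s).M := by
  simp only [nch] at hn
  rcases Nat.even_or_odd' n with ⟨t, rfl | rfl⟩
  · exact Or.inl ⟨t, rfl, by omega⟩
  · exact Or.inr ⟨t, rfl, by omega⟩

theorem chd_even (s : ℕ) (us : ℕ -> ℝ) (t : ℕ) : Y.chd (.tri s us) (2*t) = .tri ((Y.trec s).chT t) (Tus (Y.trec s) us t) := by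
  simp only [chd]
  rw [if_pos (by omega), show 2*t/2 = t by omega]

theorem chd_odd (s : ℕ) (us : ℕ -> ℝ) (t : ℕ) : Y.chd (.tri s us) (2*t+1) = .rect false ((Y.trec s).chR t) (Rus (Y.trec s) us t) (Rvs (Y.trec s) us t) := by
  simp only [chd]
  rw [if_neg (by omega), show (2*t+1)/2 = t by omega]

theorem reg_even (h : Y.V (.tri s us)) (ht : t < (Y.trec s).M) : Y.reg (Y.chd (.tri s us) (2*t)) p ↔ TZ (Y.trec s) us t <= p.1 /\ p.2 <= TZ (Y.trec s) us (t+1) /\ p.1 < p.2 := by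
  rw [chd_even]; simp only [reg]; rw [(tc h).Tus_0 ht, (tc h).Tus_m ht]

theorem reg_odd (h : Y.V (.tri s us)) (ht : t + 1 < (Y.trec s).M) : Y.reg (Y.chd (.tri s us) (2*t+1)) p ↔ (TZ (Y.trec s) us t <= p.1 /\ p.1 <= TZ (Y.trec s) us (t+1) /\ TZ (Y.trec s) us (t+1) <= p.2 /\ p.2 <= TZ (Y.trec s) us (Y.trec s).M) /\ p.1 < p.2 := by
  rw [chd_odd]; simp only [reg, inBox, cu, cv]
  rw [(tc h).Rus_0 ht, (tc h).Rus_m ht, (tc h).Rvs_0 ht, (tc h).Rvs_k ht]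

theorem reg_rect (h : Y.V (.rect sw s us vs)) (ht : t < (Y.rec' s).M) : Y.reg (Y.chd (.rect sw s us vs) t) p ↔ (refU us (Y.rec' s).ru t <= cu sw p /\ cu sw p <= refU us (Y.rec' s).ru (t+1) /\ vs 0 <= cv sw p /\ cv sw p <= vs (Y.row s).k) /\ p.1 < p.2 := by
  simp only [chd, reg, cu_not, cv_not]
  rw [(rc h).child_box ht]

theorem bd_even (h : Y.V (.tri s us)) (ht : t < (Y.trec s).M) : Y.bd (Y.chd (.tri s us) (2*t)) p g ↔ (Vl (Y.trec s) (TZ (Y.trec s) us) (TX (Y.trec s) us) t p.1 p.2 g /\ p.2 <= TZ (Y.trec s) us (t+1)) ∨ Hl (Y.trec s) (TZ (Y.trec s) us) (TX (Y.trec s) us) t p.1 p.2 g := by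
  rw [chd_even]; simp only [bd]; rw [(tc h).childT_bd ht]

theorem bd_odd (h : Y.V (.tri s us)) (ht : t + 1 < (Y.trec s).M) (hp : p.1 < p.2) : Y.bd (Y.chd (.tri s us) (2*t+1)) p g ↔ Hl (Y.trec s) (TZ (Y.trec s) us) (TX (Y.trec s) us) t p.1 p.2 g ∨ (Vl (Y.trec s) (TZ (Y.trec s) us) (TX (Y.trec s) us) t p.1 p.2 g /\ TZ (Y.trec s) us (t+1) <= p.2) ∨ Vl (Y.trec s) (TZ (Y.trec s) us) (TX (Y.trec s) us) (t+1) p.1 p.2 g ∨ Tl (Y.trow s) (Y.trec s) (TZ (Y.trec s) us) t p.1 p.2 g := by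
  rw [chd_odd]; simp only [bd, cu, cv, hp, and_true]; rw [(tc h).childR_bd ht hp]

theorem bd_rect : Y.bd (Y.chd (.rect sw s us vs) t) p g ↔ bdg (Y.row ((Y.rec' s).ch t)) (cm (refU vs (Y.rec' s).rv) ((Y.rec' s).rc t) (Y.rec' s).K) (cvs (refU us (Y.rec' s).ru) t) (cv sw p) (cu sw p) g /\ p.1 < p.2 := by
  simp only [chd, bd, cu_not, cv_not]

theorem bd_lt (hV : Y.V c) (h : Y.bd c p g) : p.1 < p.2 := by
  cases c with
  | rect sw s us vs => exact h.2
  | tri s us => obtain ⟨e, h1, _⟩ := h; exact (tbl_box hV.2 h1).2.2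

theorem gA1 (h : Y.V c) (ht : t < Y.nch c) : Y.V (Y.chd c t) := by
  cases c with
  | rect sw s us vs =>
    have hc := rc h
    have ht' : t < (Y.rec' s).M := ht
    have hO := hc.R.chO t ht'
    have l1 := hc.U_SM.le (i := t+1) ht' le_rfl
    have l0 := hc.U_SM.le (i := 0) (j := t) (Nat.zero_le _) ht'.le
    rw [hc.U_M] at l1
    rw [hc.U_0] at l0
    refine ⟨hc.R.chS t ht', hc.cus_SM ht', hc.cvs_SM ht', fun hs => ?_, fun hs => ?_⟩
    · have : sw = true := by simpa using hs
      rw [cm_last hO.ref, hc.V_K]; simp only [cvs, if_true]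
      exact (h.2.2.2.2 this).trans l0
    · have : sw = false := by simpa using hs
      rw [cm_zero hO.ref, hO.k1, hc.V_0]; simp only [cvs, one_ne_zero, if_false]
      exact l1.trans (h.2.2.2.1 this)
  | tri s us =>
    rcases tidx ht with ⟨t, rfl, ht'⟩ | ⟨t, rfl, ht'⟩
    · rw [chd_even]; exact ⟨(tc h).R.cTS t ht', (tc h).Tus_SM ht'⟩
    · rw [chd_odd]
      exact ⟨(tc h).R.cRS t (by omega) ht', (tc h).Rus_SM ht', (tc h).Rvs_SM ht', fun _ => by rw [(tc h).Rus_m ht', (tc h).Rvs_0 ht'], fun h => by cases h⟩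

theorem gA2 (h : Y.V c) (hb : Y.bd c p g) : Y.reg c p := by
  cases c with
  | rect sw s us vs =>
    obtain ⟨⟨e, h1, _⟩, h2⟩ := hb
    exact ⟨bdl_box h.2.1 h.2.2.1 h1, h2⟩
  | tri s us => obtain ⟨e, h1, _⟩ := hb; exact tbl_box h.2 h1

theorem gA2' (h : Y.V c) (ht : t < Y.nch c) (hr : Y.reg (Y.chd c t) p) : Y.reg c p := by
  cases c with
  | rect sw s us vs =>
    have hc := rc h
    have ht' : t < (Y.rec' s).M := ht
    rw [reg_rect h ht'] at hr
    have l1 := hc.U_SM.le (i := t+1) ht' le_rfl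
    have l0 := hc.U_SM.le (i := 0) (j := t) (Nat.zero_le _) ht'.le
    rw [hc.U_M] at l1
    rw [hc.U_0] at l0
    obtain ⟨⟨a, b, c, d⟩, e⟩ := hr
    exact ⟨⟨l0.trans a, b.trans l1, c, d⟩, e⟩
  | tri s us =>
    have hc := tc h
    rcases tidx ht with ⟨t, rfl, ht'⟩ | ⟨t, rfl, ht'⟩
    · rw [reg_even h ht'] at hr
      simp only [reg]
      rw [<- hc.Z_0, <- hc.Z_M]
      exact ⟨(hc.Z_SM.le (Nat.zero_le _) ht'.le).trans hr.1, hr.2.1.trans (hc.Z_SM.le ht' le_rfl), hr.2.2⟩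
    · rw [reg_odd h ht'] at hr
      simp only [reg]
      rw [<- hc.Z_0, <- hc.Z_M]
      exact ⟨(hc.Z_SM.le (Nat.zero_le _) (by omega)).trans hr.1.1, hr.1.2.2.2, hr.2⟩

theorem Vl_child (h : Y.V (.tri s us)) (hp : p.1 < p.2) (hb : Vl (Y.trec s) (TZ (Y.trec s) us) (TX (Y.trec s) us) t p.1 p.2 g) : ∃ n < Y.nch (.tri s us), Y.bd (Y.chd (.tri s us) n) p g /\ n / 2 = t := by
  have ht := hb.1
  have hc := tc h
  simp only [nch]
  by_cases hy : p.2 <= TZ (Y.trec s) us (t+1)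
  · exact ⟨2*t, by omega, (bd_even h ht).2 (Or.inl ⟨hb, hy⟩), by omega⟩
  · have : t + 1 < (Y.trec s).M := by
      by_contra hcon
      apply hy
      rw [show t + 1 = (Y.trec s).M by omega]
      obtain ⟨_, _, j, hj, _, hl, _⟩ := hb
      rw [hc.loc_le_zc hj le_rfl hl, hc.R.zcM]; exact hj
    exact ⟨2*t+1, by omega, (bd_odd h this hp).2 (Or.inr (Or.inl ⟨hb, (not_le.1 hy).le⟩)), by omega⟩

theorem gA4 (h : Y.V c) (hb : Y.bd c p g) : ∃ t < Y.nch c, Y.bd (Y.chd c t) p g := by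
  cases c with
  | rect sw s us vs =>
    obtain ⟨t, ht, h1⟩ := (rc h).A4r hb.1
    exact ⟨t, ht, bd_rect.2 ⟨h1, hb.2⟩⟩
  | tri s us =>
    have hp := bd_lt h hb
    have hM := (tc h).M2
    rcases (tc h).parentT_bd.1 hb with h1 | h1 | ⟨t, ht, h1, _⟩ | ⟨t, ht, h1⟩
    · obtain ⟨n, hn, hb, _⟩ := Vl_child h hp h1; exact ⟨n, hn, hb⟩
    · exact ⟨2*((Y.trec s).M-1), by simp only [nch]; omega, (bd_even h (by omega)).2 (Or.inr h1)⟩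
    · obtain ⟨n, hn, hb, _⟩ := Vl_child h hp h1; exact ⟨n, hn, hb⟩
    · by_cases hc : t + 1 < (Y.trec s).M
      · exact ⟨2*t+1, by simp only [nch]; omega, (bd_odd h hc hp).2 (Or.inr (Or.inr (Or.inr h1)))⟩
      · exact ⟨2*t, by simp only [nch]; omega, (bd_even h ht).2 (Or.inr ((tc h).Tl_last (by omega) h1))⟩

theorem gA5 (h : Y.V c) (htt : t < t') (ht' : t' < Y.nch c) (h1 : Y.reg (Y.chd c t) p) (h2 : Y.reg (Y.chd c t') p) : ∃ g, Y.bd (Y.chd c t) p g /\ Y.bd (Y.chd c t') p g := by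
  cases c with
  | rect sw s us vs =>
    have ht2 : t' < (Y.rec' s).M := ht'
    rw [reg_rect h (htt.trans ht2)] at h1
    rw [reg_rect h ht2] at h2
    obtain ⟨g, a, b⟩ := (rc h).A5r htt ht2 h1.1 h2.1
    exact ⟨g, bd_rect.2 ⟨a, h1.2⟩, bd_rect.2 ⟨b, h1.2⟩⟩
  | tri s us =>
    have hc := tc h
    have hZ := hc.Z_SM
    rcases tidx (htt.trans ht') with ⟨a, rfl, ha⟩ | ⟨a, rfl, ha⟩ <;>
    rcases tidx ht' with ⟨b, rfl, hb⟩ | ⟨b, rfl, hb⟩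
    · rw [reg_even h ha] at h1; rw [reg_even h hb] at h2
      have := hZ.le (i := a+1) (j := b) (by omega) (by omega)
      linarith [h1.2.1, h2.1, h2.2.2]
    · rw [reg_even h ha] at h1; rw [reg_odd h hb] at h2
      have e := (hZ.le_iff (i := b+1) (j := a+1) (by omega) (by omega)).1 (h2.1.2.2.1.trans h1.2.1)
      have e : b = a := by omega
      subst e
      obtain ⟨g, hg⟩ := hc.Hl_exists ha (le_antisymm h1.2.1 h2.1.2.2.1) h1.2.2 h1.1
      exact ⟨g, (bd_even h ha).2 (Or.inr hg), (bd_odd h hb h2.2).2 (Or.inl hg)⟩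
    · rw [reg_odd h ha] at h1; rw [reg_even h hb] at h2
      have e := (hZ.le_iff (i := b) (j := a+1) (by omega) (by omega)).1 (h2.1.trans h1.1.2.1)
      have e : b = a+1 := by omega
      subst e
      obtain ⟨g, hg⟩ := hc.Vl_exists hb (le_antisymm h1.1.2.1 h2.1) h1.2 h1.1.2.2.2
      exact ⟨g, (bd_odd h ha h1.2).2 (Or.inr (Or.inr (Or.inl hg))), (bd_even h hb).2 (Or.inl ⟨hg, h2.2.1⟩)⟩
    · rw [reg_odd h ha] at h1; rw [reg_odd h hb] at h2
      have e := (hZ.le_iff (i := b) (j := a+1) (by omega) (by omega)).1 (h2.1.1.trans h1.1.2.1)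
      have e : b = a+1 := by omega
      subst e
      obtain ⟨g, hg⟩ := hc.Vl_exists (by omega) (le_antisymm h1.1.2.1 h2.1.1) h1.2 h1.1.2.2.2
      exact ⟨g, (bd_odd h ha h1.2).2 (Or.inr (Or.inr (Or.inl hg))), (bd_odd h hb h2.2).2 (Or.inr (Or.inl ⟨hg, h2.1.2.2.1⟩))⟩

theorem gA3 (h : Y.V c) (h1 : Y.bd c p g) (h2 : Y.bd c p g') : g = g' := by
  cases c with
  | rect sw s us vs => exact bdg_unique (Y.rows s h.1) h.2.1 h.2.2.1 h1.1 h2.1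
  | tri s us =>
    obtain ⟨e, h1, rfl⟩ := h1
    obtain ⟨e', h1', rfl⟩ := h2
    rw [tbl_unique (Y.trows s h.1) h.2 h1 h1']

theorem gA6 (h : Y.V c) (h1 : Y.bd c p g) (h2 : Y.bd c q g') (hpq : pl p q) : gle Y.N g g' := by
  cases c with
  | rect sw s us vs =>
    obtain ⟨⟨e, h1, rfl⟩, _⟩ := h1
    obtain ⟨⟨e', h1', rfl⟩, _⟩ := h2
    exact bdl_coh (Y.rows s h.1) h.2.1 h.2.2.1 h1 h1' (pl_cu hpq sw).1 (pl_cu hpq sw).2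
  | tri s us =>
    obtain ⟨e, h1, rfl⟩ := h1
    obtain ⟨e', h1', rfl⟩ := h2
    exact tbl_coh (Y.trows s h.1) h.2 h1 h1' hpq.1 hpq.2

theorem gA6' (h : Y.V c) (h1 : Y.bd c p g) : ple Y.N g.1 g.2 := by
  cases c with
  | rect sw s us vs =>
    obtain ⟨⟨e, h1, rfl⟩, _⟩ := h1
    exact bdl_self (Y.rows s h.1) h1
  | tri s us =>
    obtain ⟨e, h1, rfl⟩ := h1
    exact tbl_self (Y.trows s h.1) h1

theorem gO1 {a b : ℕ} (h : Y.V c) (ha : a < Y.nch c) (hb : b < Y.nch c) (h1 : Y.reg (Y.chd c a) p) (h2 : Y.reg (Y.chd c b) q) (hpq : pl p q) : a <= b := by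
  cases c with
  | rect sw s us vs =>
    have ha' : a < (Y.rec' s).M := ha
    have hb' : b < (Y.rec' s).M := hb
    rw [reg_rect h ha'] at h1
    rw [reg_rect h hb'] at h2
    have := ((rc h).U_SM.lt_iff (i := a) (j := b+1) (by omega) (by omega)).1
      (h1.1.1.trans_lt ((pl_cu hpq sw).1.trans_le h2.1.2.1))
    omega
  | tri s us =>
    have hZ := (tc h).Z_SM
    rcases tidx ha with ⟨a, rfl, ha'⟩ | ⟨a, rfl, ha'⟩ <;>
    rcases tidx hb with ⟨b, rfl, hb'⟩ | ⟨b, rfl, hb'⟩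
    · rw [reg_even h ha'] at h1; rw [reg_even h hb'] at h2
      have := (hZ.lt_iff (i := a) (j := b+1) (by omega) (by omega)).1 (by linarith [hpq.1, h1.1, h2.2.1, h2.2.2])
      omega
    · rw [reg_even h ha'] at h1; rw [reg_odd h hb'] at h2
      have := (hZ.lt_iff (i := a) (j := b+1) (by omega) (by omega)).1 (by linarith [hpq.1, h1.1, h2.1.2.1])
      omega
    · rw [reg_odd h ha'] at h1; rw [reg_even h hb'] at h2
      have := (hZ.lt_iff (i := a+1) (j := b+1) (by omega) (by omega)).1
        (by linarith [hpq.2, h1.1.2.2.1, h2.2.1])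
      omega
    · rw [reg_odd h ha'] at h1; rw [reg_odd h hb'] at h2
      have := (hZ.lt_iff (i := a) (j := b+1) (by omega) (by omega)).1 (by linarith [hpq.1, h1.1.1, h2.1.2.1])
      omega

/-- a point of a triangle to the right of the mark `t` and in column `t` is in one of the two children -/
theorem col (h : Y.V (.tri s us)) (ht : t < (Y.trec s).M) (h1 : TZ (Y.trec s) us t <= p.1) (h2 : p.1 <= TZ (Y.trec s) us (t+1)) (h3 : p.1 < p.2) (h4 : p.2 <= TZ (Y.trec s) us (Y.trec s).M) : ∃ n < Y.nch (.tri s us), n / 2 = t /\ Y.reg (Y.chd (.tri s us) n) p := by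
  simp only [nch]
  by_cases hy : p.2 <= TZ (Y.trec s) us (t+1)
  · exact ⟨2*t, by omega, by omega, (reg_even h ht).2 ⟨h1, hy, h3⟩⟩
  · have : t + 1 < (Y.trec s).M := by
      by_contra hcon
      apply hy
      rwa [show t + 1 = (Y.trec s).M by omega]
    exact ⟨2*t+1, by omega, by omega, (reg_odd h this).2 ⟨⟨h1, h2, (not_le.1 hy).le, h4⟩, h3⟩⟩

theorem reg_tri (h : Y.V (.tri s us)) : Y.reg (.tri s us) p ↔ TZ (Y.trec s) us 0 <= p.1 /\ p.2 <= TZ (Y.trec s) us (Y.trec s).M /\ p.1 < p.2 := by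
  rw [(tc h).Z_0, (tc h).Z_M]; rfl

theorem gA7 {a b : ℕ} (h : Y.V c) (hab : a < b) (hb : b < Y.nch c) (h1 : Y.reg (Y.chd c a) p) (h2 : Y.reg (Y.chd c b) q) (hpq : pl p q) : (∃ a' < Y.nch c, a < a' /\ Y.reg (Y.chd c a') p) ∨ Y.reg (Y.chd c a) q ∨ ∃ r, pl p r /\ pl r q /\ Y.reg (Y.chd c a) r /\ ∃ a' < Y.nch c, a < a' /\ Y.reg (Y.chd c a') r := by
  have hq := gA2' h hb h2
  have hpr := gA2' h (hab.trans hb) h1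
  cases c with
  | rect sw s us vs =>
    have hc := rc h
    have hb' : b < (Y.rec' s).M := hb
    have ha' : a < (Y.rec' s).M := by omega
    rw [reg_rect h ha'] at h1 ⊢
    rw [reg_rect h hb'] at h2
    obtain ⟨hu, hv⟩ := pl_cu hpq sw
    have hU := hc.U_SM
    have hq1 : refU us (Y.rec' s).ru (a+1) <= cu sw q := (hU.le (i := a+1) (j := b) hab (by omega)).trans h2.1.1
    have hU12 := hU (a+1) (by omega : a+1 < _)
    have ha1 : a + 1 < (Y.rec' s).M := by omega
    rcases h1.1.2.1.eq_or_lt with he | he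
    · refine Or.inl ⟨a+1, ha1, by omega, (reg_rect h ha1).2 ⟨⟨he.ge, ?_, h1.1.2.2⟩, h1.2⟩⟩
      rw [he]; exact hU12.le
    rcases hq1.eq_or_lt with hqe | hqe
    · exact Or.inr (Or.inl ⟨⟨(h1.1.1.trans hu.le), hqe.ge, h2.1.2.2⟩, h2.2⟩)
    · refine Or.inr (Or.inr ⟨mkP sw (refU us (Y.rec' s).ru (a+1)) ((cv sw p + cv sw q)/2), ?_⟩)
      have hlt : (mkP sw (refU us (Y.rec' s).ru (a+1)) ((cv sw p + cv sw q)/2)).1 <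
          (mkP sw (refU us (Y.rec' s).ru (a+1)) ((cv sw p + cv sw q)/2)).2 := by
        have l1 := hU.le (i := a+1) ha' le_rfl
        have l0 := hU.lt (i := 0) (j := a+1) (by omega) ha'
        rw [hc.U_M] at l1
        rw [hc.U_0] at l0
        have hp3 := h1.1.2.2
        have hq3 := h2.1.2.2
        cases sw
        · have := h.2.2.2.1 rfl
          simp only [mkP]; linarith
        · have := h.2.2.2.2 rfl
          simp only [mkP]; linarith
      refine ⟨pl_of_cu sw ?_ ?_, pl_of_cu sw ?_ ?_, (reg_rect h ha').2 ⟨⟨?_, ?_, ?_, ?_⟩, hlt⟩, a+1, ha1, by omega, (reg_rect h ha1).2 ⟨⟨?_, ?_, ?_, ?_⟩, hlt⟩⟩ <;> (try simp only [cu_mkP, cv_mkP]) <;>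
        first
        | linarith [hU a ha', h1.1.2.2.1, h2.1.2.2.2]
  | tri s us =>
    have hc := tc h
    have hZ := hc.Z_SM
    rw [reg_tri h] at hq hpr
    rcases tidx (hab.trans hb) with ⟨a, rfl, ha⟩ | ⟨a, rfl, ha⟩
    · have ha1 : a + 1 < (Y.trec s).M := by
        rcases tidx hb with ⟨b, rfl, hb'⟩ | ⟨b, rfl, hb'⟩ <;> omega
      have hn : 2*a+1 < Y.nch (.tri s us) := by simp only [nch]; omega
      rw [reg_even h ha] at h1
      -- the second child lies above the mark
      have hq2 : TZ (Y.trec s) us (a+1) <= q.2 := by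
        rcases tidx hb with ⟨b, rfl, hb'⟩ | ⟨b, rfl, hb'⟩
        · rw [reg_even h hb'] at h2
          exact (hZ.le (i := a+1) (j := b) (by omega) (by omega)).trans (h2.1.trans h2.2.2.le)
        · rw [reg_odd h hb'] at h2
          exact (hZ.le (i := a+1) (j := b+1) (by omega) (by omega)).trans h2.1.2.2.1
      rcases h1.2.1.eq_or_lt with he | he
      · refine Or.inl ⟨2*a+1, hn, by omega, (reg_odd h ha1).2 ⟨⟨h1.1, ?_, he.ge, hpr.2.1⟩, h1.2.2⟩⟩
        linarith [h1.2.2]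
      rcases hq2.eq_or_lt with hqe | hqe
      · exact Or.inr (Or.inl ((reg_even h ha).2 ⟨h1.1.trans hpq.1.le, hqe.ge, hq.2.2⟩))
      · obtain ⟨x, hx1, hx2⟩ := exists_between (show p.1 < min q.1 (TZ (Y.trec s) us (a+1)) from
          lt_min hpq.1 (h1.2.2.trans he))
        have hx3 := hx2.trans_le (min_le_left _ _)
        have hx4 := hx2.trans_le (min_le_right _ _)
        refine Or.inr (Or.inr ⟨(x, TZ (Y.trec s) us (a+1)), ⟨hx1, he⟩, ⟨hx3, hqe⟩, (reg_even h ha).2 ⟨h1.1.trans hx1.le, le_rfl, hx4⟩, 2*a+1, hn, by omega, (reg_odd h ha1).2 ⟨⟨h1.1.trans hx1.le, hx4.le, le_rfl, hZ.le ha le_rfl⟩, hx4⟩⟩)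
    · rw [reg_odd h ha] at h1
      have hq1 : TZ (Y.trec s) us (a+1) <= q.1 := by
        rcases tidx hb with ⟨b, rfl, hb'⟩ | ⟨b, rfl, hb'⟩
        · rw [reg_even h hb'] at h2
          exact (hZ.le (i := a+1) (j := b) (by omega) (by omega)).trans h2.1
        · rw [reg_odd h hb'] at h2
          exact (hZ.le (i := a+1) (j := b) (by omega) (by omega)).trans h2.1.1
      have hZ12 := hZ (a+1) ha
      rcases h1.1.2.1.eq_or_lt with he | he
      · obtain ⟨n, hn, hn2, hr⟩ := col h ha he.ge (by rw [he]; exact hZ12.le) h1.2 h1.1.2.2.2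
        exact Or.inl ⟨n, hn, by omega, hr⟩
      rcases hq1.eq_or_lt with hqe | hqe
      · exact Or.inr (Or.inl ((reg_odd h ha).2 ⟨⟨h1.1.1.trans hpq.1.le, hqe.ge, h1.1.2.2.1.trans hpq.2.le, hq.2.1⟩, hq.2.2⟩))
      · obtain ⟨y, hy1, hy2⟩ := exists_between hpq.2
        have hlt : TZ (Y.trec s) us (a+1) < y := h1.1.2.2.1.trans_lt hy1
        obtain ⟨n, hn, hn2, hr⟩ := col h ha (p := (TZ (Y.trec s) us (a+1), y)) le_rfl hZ12.le hlt
          (hy2.le.trans hq.2.1)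
        exact Or.inr (Or.inr ⟨(TZ (Y.trec s) us (a+1), y), ⟨he, hy1⟩, ⟨hqe, hy2⟩, (reg_odd h ha).2 ⟨⟨(hZ a (by omega)).le, le_rfl, hlt.le, hy2.le.trans hq.2.1⟩, hlt⟩, n, hn, by omega, hr⟩)

theorem gw1 (h : Y.V c) (ht : t < Y.nch c) : Y.w (Y.chd c t) <= 3/4 * Y.w c := by
  cases c with
  | rect sw s us vs =>
    have hc := rc h
    have ht' : t < (Y.rec' s).M := ht
    have hO := hc.R.chO t ht'
    have := refU_half hc.hu hc.R.refu hc.R.halv ht'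
    have l := hc.hv.le (i := 0) (Nat.zero_le _) le_rfl
    simp only [chd, w]
    rw [cm_zero hO.ref, cm_last hO.ref, hO.k1, hc.V_0, hc.V_K]
    simp only [cvs, if_true, one_ne_zero, if_false]
    linarith
  | tri s us =>
    have hc := tc h
    have l := hc.hu.le (i := 0) (Nat.zero_le _) le_rfl
    have l' := hc.hu.lt (i := 0) (hc.rowOK.hm) le_rfl
    rcases tidx ht with ⟨t, rfl, ht'⟩ | ⟨t, rfl, ht'⟩
    · have := refU_half hc.hu hc.R.refZ hc.R.halv ht'
      rw [chd_even]; simp only [w]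
      rw [hc.Tus_0 ht', hc.Tus_m ht']
      unfold TZ
      linarith
    · have := refU_half hc.hu hc.R.refZ hc.R.halv (show t < _ by omega)
      have l2 := hc.Z_SM.le (i := 0) (j := t+1) (Nat.zero_le _) (by omega)
      rw [chd_odd]; simp only [w]
      rw [hc.Rus_0 ht', hc.Rus_m ht', hc.Rvs_0 ht', hc.Rvs_k ht', hc.Z_M]
      rw [hc.Z_0] at l2
      unfold TZ at l2 ⊢
      linarith

theorem gw2 (h : Y.V c) (h1 : Y.reg c p) (h2 : Y.reg c q) : |p.1 - q.1| <= Y.w c /\ |p.2 - q.2| <= Y.w c := by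
  cases c with
  | rect sw s us vs =>
    obtain ⟨⟨a1, a2, a3, a4⟩, _⟩ := h1
    obtain ⟨⟨b1, b2, b3, b4⟩, _⟩ := h2
    simp only [w]
    cases sw <;> simp only [cu, cv] at * <;> constructor <;> rw [abs_le] <;> constructor <;> linarith
  | tri s us =>
    obtain ⟨a1, a2, a3⟩ := h1
    obtain ⟨b1, b2, b3⟩ := h2
    simp only [w]
    constructor <;> rw [abs_le] <;> constructor <;> linarith

theorem ilT_lt (h : Y.V (.tri s us)) {b : Bool} (hi : ilT (Y.trec s) (TZ (Y.trec s) us) (TX (Y.trec s) us) x y e b) : us 0 < x /\ x < y /\ y < us (Y.trow s).m := by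
  have hc := tc h
  have hM := hc.M2
  rw [<- hc.Z_0, <- hc.Z_M]
  rcases hi with ⟨t, ht, ht0, rfl, j, hj, hj0, hl, rfl, hb⟩ | ⟨t, ht, ht0, rfl, j, hj, hj0, hl, rfl, hb⟩
  · refine ⟨hc.Z_SM.lt ht0 ht.le, (hc.loc_gt_zc hj.le ht.le hl).2 hj0, (hc.loc_lt_zc hj.le le_rfl hl).2 (by rw [hc.R.zcM]; exact hj)⟩
  · have hQ := hc.zc_leQ (t := t+1) ht
    have hjQ : j <= 2*(Y.trec s).Q := by omega
    have h1 := (hc.loc_gt_zc hjQ ht.le hl).2 hj0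
    exact ⟨(hc.Z_SM.le (Nat.zero_le _) ht.le).trans_lt h1, (hc.loc_lt_zc hjQ ht0.le hl).2 hj, hc.Z_SM.lt ht0 le_rfl⟩

theorem gi1 {b : Bool} (h : Y.V c) (hi : Y.il c p e b) : ∃ t < Y.nch c, Y.bd (Y.chd c t) p (gap e) := by
  cases c with
  | rect sw s us vs =>
    obtain ⟨t, ht, h1⟩ := (rc h).i1r hi.1
    exact ⟨t, ht, bd_rect.2 ⟨h1, hi.2⟩⟩
  | tri s us =>
    have hp := (ilT_lt h hi).2.1
    rcases hi with ⟨t, ht, ht0, hx, j, hj, hj0, hl, rfl, hb⟩ | ⟨t, ht, ht0, hy, j, hj, hj0, hl, rfl, hb⟩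
    · obtain ⟨n, hn, hb, _⟩ := Vl_child h hp (t := t) (g := gap ((Y.trec s).V t j))
        ⟨ht, hx, j, hj.le, hj0, hl, rfl⟩
      exact ⟨n, hn, hb⟩
    · exact ⟨2*t, by simp only [nch]; omega, (bd_even h ht).2 (Or.inr ⟨ht, hy, j, hj, hj0.le, hl, rfl⟩)⟩

theorem gi2 {b : Bool} (h : Y.V c) (hi : Y.il c p e b) : ¬ Y.bd c p g := by
  intro hb
  cases c with
  | rect sw s us vs =>
    obtain ⟨a1, a2, a3, a4⟩ := (rc h).il_strict hi.1
    obtain ⟨⟨e, h1, _⟩, _⟩ := hb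
    exact bdl_not_strict h1 a1 a2 a3 a4
  | tri s us =>
    obtain ⟨a1, a2, a3⟩ := ilT_lt h hi
    obtain ⟨e, ⟨h1, _⟩ | ⟨h1, _⟩, _⟩ := hb
    · exact a1.ne' h1
    · exact a3.ne h1

theorem gi3 {b b' : Bool} (h : Y.V c) (h1 : Y.il c p e b) (h2 : Y.il c p e' b') : e = e' /\ b = b' := by
  cases c with
  | rect sw s us vs => exact (rc h).i3r h1.1 h2.1
  | tri s us =>
    have hc := tc h
    have hZ := hc.Z_SM
    have cross : ∀ {t t' : ℕ}, t < (Y.trec s).M -> t' < (Y.trec s).M -> t' + 1 < (Y.trec s).M -> ∀ {j : ℕ}, j < 2*(Y.trec s).zc (t'+1) -> 2*(Y.trec s).zc t' < j -> loc (TX (Y.trec s) us) j (TZ (Y.trec s) us t) -> False := by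
      intro t t' ht ht' _ j hj hj0 hl
      have hQ := hc.zc_leQ (t := t'+1) ht'
      have a1 := (hc.loc_gt_zc (by omega) ht'.le hl).2 hj0
      have a2 := (hc.loc_lt_zc (by omega) ht' hl).2 hj
      rw [hZ.lt_iff ht'.le ht.le] at a1
      rw [hZ.lt_iff ht.le ht'] at a2
      omega
    rcases h1 with ⟨t, ht, ht0, hx, j, hj, hj0, hl, rfl, rfl⟩ | ⟨t, ht, ht0, hy, j, hj, hj0, hl, rfl, rfl⟩ <;>
    rcases h2 with ⟨t', ht', ht0', hx', j', hj', hj0', hl', rfl, rfl⟩ |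
      ⟨t', ht', ht0', hy', j', hj', hj0', hl', rfl, rfl⟩
    · have e1 : t = t' := hZ.inj ht.le ht'.le (hx.symm.trans hx')
      have e2 : j = j' := loc_unique hc.X_SM hj.le hj'.le hl hl'
      subst e1 e2; exact ⟨rfl, rfl⟩
    · rw [hx] at hl'; exact (cross ht ht' ht0' hj' hj0' hl').elim
    · rw [hx'] at hl; exact (cross ht' ht ht0 hj hj0 hl).elim
    · have e1 : t + 1 = t' + 1 := hZ.inj ht ht' (hy.symm.trans hy')
      have e1 : t = t' := by omega
      subst e1
      have hQ := hc.zc_leQ (t := t+1) ht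
      have e2 : j = j' := loc_unique hc.X_SM (by omega) (by omega) hl hl'
      subst e2; exact ⟨rfl, rfl⟩

theorem gi4 (h : Y.V c) (ht : t < Y.nch c) (hb : Y.bd (Y.chd c t) p g) : (∃ g', Y.bd c p g') ∨ ∃ e b, Y.il c p e b := by
  have hp := bd_lt (gA1 h ht) hb
  cases c with
  | rect sw s us vs =>
    have ht' : t < (Y.rec' s).M := ht
    rcases (rc h).i4r ht' (bd_rect.1 hb).1 with ⟨g', h1⟩ | ⟨e, b, h1⟩
    · exact Or.inl ⟨g', h1, hp⟩
    · exact Or.inr ⟨e, b, h1, hp⟩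
  | tri s us =>
    have hc := tc h
    have hM := hc.M2
    have VL : ∀ t, Vl (Y.trec s) (TZ (Y.trec s) us) (TX (Y.trec s) us) t p.1 p.2 g -> (∃ g', Y.bd (.tri s us) p g') ∨ ∃ e b, Y.il (.tri s us) p e b := by
      intro t hv
      have hv0 := hv
      obtain ⟨ht, hx, j, hj, hj0, hl, hg⟩ := hv
      by_cases t0 : t = 0
      · subst t0; exact Or.inl ⟨g, hc.parentT_bd.2 (Or.inl hv0)⟩
      by_cases hjQ : j = 2*(Y.trec s).Q
      · refine Or.inl ⟨g, hc.parentT_bd.2 (Or.inr (Or.inr (Or.inl ⟨t, ht, hv0, ?_⟩)))⟩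
        subst hjQ
        rw [loc_even_iff] at hl
        rw [hl, <- hc.R.zcM, hc.X_zc le_rfl]
      · exact Or.inr ⟨_, _, Or.inl ⟨t, ht, by omega, hx, j, by omega, hj0, hl, rfl, rfl⟩⟩
    have HL : ∀ t, Hl (Y.trec s) (TZ (Y.trec s) us) (TX (Y.trec s) us) t p.1 p.2 g -> (∃ g', Y.bd (.tri s us) p g') ∨ ∃ e b, Y.il (.tri s us) p e b := by
      intro t hv
      have hv0 := hv
      obtain ⟨ht, hy, j, hj, hj0, hl, hg⟩ := hv
      by_cases tM : t + 1 = (Y.trec s).M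
      · refine Or.inl ⟨g, hc.parentT_bd.2 (Or.inr (Or.inl ?_))⟩
        rwa [show (Y.trec s).M - 1 = t by omega]
      have z1 := hc.R.zcl t ht
      have z2 := hc.R.zcl (t+1) (by omega)
      have z3 := hc.zc_leQ (t := t+1+1) (by omega)
      rcases hj0.eq_or_lt with he | he
      · subst he
        apply VL t
        refine ⟨ht, ?_, 2*(Y.trec s).zc (t+1), by omega, by omega, ?_, ?_⟩
        · rw [loc_even_iff.1 hl, hc.X_zc ht.le]
        · rw [loc_even_iff, hc.X_zc (t := t+1) ht, hy]
        · rw [hg, hc.R.HV t ht]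
      · exact Or.inr ⟨_, _, Or.inr ⟨t, ht, by omega, hy, j, hj, he, hl, rfl, rfl⟩⟩
    rcases tidx ht with ⟨t, rfl, ht'⟩ | ⟨t, rfl, ht'⟩
    · rcases (bd_even h ht').1 hb with h1 | h1
      · exact VL t h1.1
      · exact HL t h1
    · rcases (bd_odd h ht' hp).1 hb with h1 | h1 | h1 | h1
      · exact HL t h1
      · exact VL t h1.1
      · exact VL (t+1) h1
      · exact Or.inl ⟨g, hc.parentT_bd.2 (Or.inr (Or.inr (Or.inr ⟨t, by omega, h1⟩)))⟩

theorem gi5 {b : Bool} (h : Y.V c) (hi : Y.il c p e b) : (b = true -> e.lab ≠ 0 /\ adm Y.N e.lo e.hi (e.lab - 1)) /\ (b = false -> hasAdm Y.N e.lo e.hi) := by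
  cases c with
  | rect sw s us vs => exact (rc h).i5r hi.1
  | tri s us =>
    have hc := tc h
    rcases hi with ⟨t, ht, ht0, hx, j, hj, hj0, hl, rfl, rfl⟩ | ⟨t, ht, ht0, hy, j, hj, hj0, hl, rfl, rfl⟩
    · have := hc.R.Vi t ht ht0 j hj hj0
      refine ⟨fun h => this.1 (by simpa using h), fun h => (this.2 (by simp at h; omega)).2⟩
    · have := hc.R.Hi t ht ht0 j hj hj0
      refine ⟨fun h => this.1 (by simpa using h), fun h => (this.2 (by simp at h; omega)).2⟩

variable (Y) in
noncomputable def geo : Geo Cell where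
  N := Y.N
  V := Y.V
  nch := Y.nch
  chd := Y.chd
  reg := Y.reg
  bd := Y.bd
  il := Y.il
  w := Y.w
  A1 := gA1
  A2 := gA2
  A2' := gA2'
  A3 := gA3
  A4 := gA4
  A5 := gA5
  A6 := gA6
  A6' := gA6'
  O1 := gO1
  A7 := gA7
  w1 := gw1
  w2 := gw2
  i1 := gi1
  i2 := gi2
  i3 := gi3
  i4 := gi4
  i5 := gi5

end Sys

/-! ## Part B6: guarantees are inherited by the subdivision -/

/-- guarantee attached to an entry: `G z m` means that label `m` occurs arbitrarily near `z` -/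
def GE (N : ℕ) (G : Pt -> ℕ -> Prop) (z : Pt) (e : Ent) (j : ℕ) : Prop :=
  (j % 2 = 0 -> e.lab ≠ 0 -> G z (e.lab - 1)) /\
  (j % 2 = 1 -> e.lab = 1 -> ∀ m, adm N e.lo e.hi m -> G z m)

/-- closedness of the guarantee -/
def GCl (G : Pt -> ℕ -> Prop) : Prop :=
  ∀ z m, (∀ ε > 0, ∃ z', |z'.1 - z.1| < ε /\ |z'.2 - z.2| < ε /\ G z' m) -> G z m

def Lip (f : ℝ -> Pt) : Prop := ∀ x y, |(f x).1 - (f y).1| <= |x - y| /\ |(f x).2 - (f y).2| <= |x - y|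

theorem lip1 (sw : Bool) (v : ℝ) : Lip (fun u => mkP sw u v) := by
  intro x y; cases sw <;> simp [mkP]
theorem lip2 (sw : Bool) (u : ℝ) : Lip (fun v => mkP sw u v) := by
  intro x y; cases sw <;> simp [mkP]

theorem GE.ref (h : refE N e i e' j) (hg : GE N G z e i) : GE N G z e' j := by
  obtain ⟨⟨hlo, hhi⟩, h2⟩ := h
  constructor
  · intro hj hl
    rcases h2 hl with ⟨h3, h4⟩ | ⟨h3, h4, h5, h6⟩
    · rw [h4]; exact hg.1 (by omega) (by rwa [<- h4])
    · exact hg.2 h3 h5 _ h6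
  · intro hj hl m hm
    rcases h2 (by omega) with ⟨h3, h4⟩ | ⟨h3, h4, h5, h6⟩
    · exact hg.2 (by omega) (by rwa [<- h4]) m (by rwa [hlo, hhi])
    · omega

theorem GE.coo (h : cooE e i e' j) (hij : i % 2 = j % 2) (hg : GE N G z e' j) : GE N G z e i := by
  obtain ⟨⟨hlo, hhi⟩, h2⟩ := h
  constructor
  · intro hi hl
    have h3 := h2 hij hl
    rw [<- h3]; exact hg.1 (by omega) (by rwa [h3])
  · intro hi hl m hm
    have h3 := h2 hij (by omega)
    exact hg.2 (by omega) (by rw [h3, hl]) m (by rwa [<- hlo, <- hhi])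

theorem coo_edge (hcl : GCl G) {f : ℝ -> Pt} (hf : Lip f) {V : ℕ -> ℝ} {rc : ℕ -> ℕ} (hV : SM V K) (h : IsRef rc K m) {L : ℕ -> Ent} (P : ℕ -> Prop) (hL : ∀ j ≤ 2*K, P j -> ∀ x, loc V j x -> GE N G (f x) (L j) j) (hA : ∀ j ≤ 2*K, P j -> cooE (A (rc j)) (rc j) (L j) j) (hP : ∀ j ≤ 2*K, j % 2 = 1 -> P j) (hi : i <= 2*m) (hPi : ∀ j ≤ 2*K, rc j = i -> P j) {x : ℝ} (hx : loc (cm V rc K) i x) : GE N G (f x) (A i) i := by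
  obtain ⟨j, hj, rfl, hl⟩ := cm_back hV h hi hx
  by_cases hp : rc j % 2 = j % 2
  · exact (hL j hj (hPi j hj rfl) x hl).coo (hA j hj (hPi j hj rfl)) hp
  · have hj0 : j % 2 = 0 := by
      by_contra hc
      have := h.odd hj (by omega)
      omega
    have hr1 : rc j % 2 = 1 := by omega
    have hjlt : j < 2*K := by
      rcases hj.eq_or_lt with rfl | hh
      · rw [h.2.1] at hr1; omega
      · exact hh
    have hr : rc (j+1) = rc j := by
      rcases (h.2.2 j hjlt).2.2 hr1 with h3 | h3
      · exact h3
      · have := h.odd (j := j+1) hjlt (by omega)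
        omega
    refine ⟨fun h0 => by omega, fun _ hl1 m' hm' => hcl _ _ fun ε he => ?_⟩
    obtain ⟨t, rfl⟩ : ∃ t, j = 2*t := ⟨j/2, by omega⟩
    rw [loc_even_iff] at hl
    have hlt := hV t (by omega)
    set δ := min (ε/2) ((V (t+1) - V t)/2) with hd
    have d0 : 0 < δ := lt_min (by linarith) (by linarith)
    have d1 : δ <= ε/2 := min_le_left _ _
    have d2 : δ <= (V (t+1) - V t)/2 := min_le_right _ _
    have hl' : loc V (2*t+1) (V t + δ) := loc_odd_iff.2 ⟨by linarith, by linarith⟩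
    have hge := hL (2*t+1) (by omega) (hP _ (by omega) (by omega)) _ hl'
    have hco := hA (2*t+1) (by omega) (hP _ (by omega) (by omega))
    rw [hr] at hco
    have hge' := hge.coo hco (by omega)
    obtain ⟨l1, l2⟩ := hf (V t + δ) x
    have l3 : |V t + δ - x| < ε := by
      rw [hl, add_sub_cancel_left, abs_of_pos d0]; linarith
    exact ⟨f (V t + δ), l1.trans_lt l3, l2.trans_lt l3, hge'.2 hr1 hl1 m' hm'⟩

namespace Sys
variable {Y : Sys} {c : Cell}

variable (Y) in
def GI (G : Pt -> ℕ -> Prop) : Cell -> Prop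
  | .rect sw s us vs =>
    (∀ i ≤ 2*(Y.row s).m, ∀ u, loc us i u -> GE Y.N G (mkP sw u (vs 0)) ((Y.row s).A i) i) /\
    (∀ i ≤ 2*(Y.row s).m, ∀ u, loc us i u -> GE Y.N G (mkP sw u (vs (Y.row s).k)) ((Y.row s).B i) i) /\
    (∀ i ≤ 2*(Y.row s).k, ∀ v, loc vs i v -> GE Y.N G (mkP sw (us 0) v) ((Y.row s).C i) i) /\
    (∀ i ≤ 2*(Y.row s).k, ∀ v, loc vs i v -> GE Y.N G (mkP sw (us (Y.row s).m) v) ((Y.row s).E i) i)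
  | .tri s us =>
    (∀ i ≤ 2*(Y.trow s).m, 0 < i -> ∀ y, loc us i y -> GE Y.N G (us 0, y) ((Y.trow s).L i) i) /\
    (∀ i < 2*(Y.trow s).m, ∀ x, loc us i x -> GE Y.N G (x, us (Y.trow s).m) ((Y.trow s).U i) i)

/-- guarantees on the interior lines of a cell -/
def GIL (Y : Sys) (G : Pt -> ℕ -> Prop) (c : Cell) : Prop :=
  ∀ z e b, Y.il c z e b -> GE Y.N G z e (if b then 0 else 1)

theorem GE.par (h : GE N G z e (if decide (j % 2 = 0) then 0 else 1)) : GE N G z e j := by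
  rcases Nat.mod_two_eq_zero_or_one j with hj | hj
  · simp only [hj, decide_true, if_true] at h
    exact ⟨fun _ => h.1 (by omega), fun h1 => by omega⟩
  · simp only [hj, one_ne_zero, decide_false, Bool.false_eq_true, if_false] at h
    exact ⟨fun h1 => by omega, fun _ => h.2 (by omega)⟩

theorem rect_lt (h : Y.V (.rect sw s us vs)) (h1 : us 0 <= u) (h2 : u <= us (Y.row s).m) (h3 : vs 0 <= v) (h4 : v <= vs (Y.row s).k) (h5 : (sw = false -> u < us (Y.row s).m ∨ vs 0 < v) /\ (sw = true -> us 0 < u ∨ v < vs (Y.row s).k)) : (mkP sw u v).1 < (mkP sw u v).2 := by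
  cases sw
  · have := h.2.2.2.1 rfl
    simp only [mkP]
    rcases h5.1 rfl with h | h <;> linarith
  · have := h.2.2.2.2 rfl
    simp only [mkP]
    rcases h5.2 rfl with h | h <;> linarith

theorem GI_line (h : Y.V (.rect sw s us vs)) (hG : Y.GI G (.rect sw s us vs)) (hI : GIL Y G (.rect sw s us vs)) (ht : t <= (Y.rec' s).M) (hj : j <= 2*(Y.rec' s).K) (hl : loc (refU vs (Y.rec' s).rv) j v) : GE Y.N G (mkP sw (refU us (Y.rec' s).ru t) v) ((Y.rec' s).L t j) j := by
  have hc := rc h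
  have hR := hc.R
  obtain ⟨gA, gB, gC, gE⟩ := hG
  by_cases h0 : t = 0
  · subst h0
    exact (gC _ (hR.refv.le hj) v (refU_transfer hc.hv hR.refv hj hl)).ref (hR.LC j hj)
  by_cases hM : t = (Y.rec' s).M
  · subst hM
    rw [hc.U_M]
    exact (gE _ (hR.refv.le hj) v (refU_transfer hc.hv hR.refv hj hl)).ref (hR.LE j hj)
  have hut := (refU_loc hc.hu hR.refu t ht).1
  by_cases hj0 : j = 0
  · subst hj0
    have : v = vs 0 := (loc_even_iff (us := refU vs (Y.rec' s).rv) (i := 0)).1 hl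
    subst this
    exact (gA _ (hR.refu.le (by omega)) _ hut).ref (hR.LA t ht)
  by_cases hjK : j = 2*(Y.rec' s).K
  · have : v = vs (Y.row s).k := by
      rw [<- hc.V_K]; rw [hjK] at hl; exact loc_even_iff.1 hl
    subst this
    have := (gB _ (hR.refu.le (by omega)) _ hut).ref (hR.LB t ht)
    rw [hjK]
    exact ⟨fun _ => this.1 (by omega), fun h => by omega⟩
  · have hil : ilR (Y.rec' s) (refU us (Y.rec' s).ru) (refU vs (Y.rec' s).rv)
        (refU us (Y.rec' s).ru t) v ((Y.rec' s).L t j) (decide (j % 2 = 0)) :=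
      ⟨t, by omega, by omega, rfl, j, by omega, by omega, hl, rfl, rfl⟩
    obtain ⟨s1, s2, s3, s4⟩ := hc.il_strict hil
    exact GE.par (hI (mkP sw (refU us (Y.rec' s).ru t) v) _ _ ⟨by rwa [cu_mkP, cv_mkP], rect_lt h s1.le s2.le s3.le s4.le ⟨fun _ => Or.inl s2, fun _ => Or.inl s1⟩⟩)

theorem mkP_not (sw : Bool) (u v : ℝ) : mkP (!sw) u v = mkP sw v u := by cases sw <;> rfl

theorem GI_rect (hcl : GCl G) (h : Y.V (.rect sw s us vs)) (hG : Y.GI G (.rect sw s us vs)) (hI : GIL Y G (.rect sw s us vs)) (ht : t < (Y.rec' s).M) : Y.GI G (Y.chd (.rect sw s us vs) t) := by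
  have hc := rc h
  have hR := hc.R
  have hO := hR.chO t ht
  have hrow := Y.rows _ (hR.chS t ht)
  simp only [chd, GI, mkP_not]
  have eA : ∀ i ≤ 2*(Y.row ((Y.rec' s).ch t)).m, ∀ u, loc (cm (refU vs (Y.rec' s).rv) ((Y.rec' s).rc t) (Y.rec' s).K) i u -> GE Y.N G (mkP sw (refU us (Y.rec' s).ru t) u) ((Y.row ((Y.rec' s).ch t)).A i) i := fun i hi u hu =>
    coo_edge hcl (lip2 sw _) hc.V_SM hO.ref (fun _ => True)
      (fun j hj _ x hx => GI_line h hG hI ht.le hj hx) (fun j hj _ => hO.A j hj)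
      (fun _ _ _ => trivial) hi (fun _ _ _ => trivial) hu
  have eB : ∀ i ≤ 2*(Y.row ((Y.rec' s).ch t)).m, ∀ u, loc (cm (refU vs (Y.rec' s).rv) ((Y.rec' s).rc t) (Y.rec' s).K) i u -> GE Y.N G (mkP sw (refU us (Y.rec' s).ru (t+1)) u) ((Y.row ((Y.rec' s).ch t)).B i) i := fun i hi u hu =>
    coo_edge hcl (lip2 sw _) hc.V_SM hO.ref (fun _ => True)
      (fun j hj _ x hx => GI_line h hG hI ht hj hx) (fun j hj _ => hO.B j hj)
      (fun _ _ _ => trivial) hi (fun _ _ _ => trivial) hu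
  have c0 : cvs (refU us (Y.rec' s).ru) t 0 = refU us (Y.rec' s).ru t := by simp [cvs]
  have c1 : cvs (refU us (Y.rec' s).ru) t 1 = refU us (Y.rec' s).ru (t+1) := by simp [cvs]
  rw [hO.k1, c0, c1]
  refine ⟨eA, eB, fun i hi v hv => ?_, fun i hi v hv => ?_⟩
  · have : i = 0 ∨ i = 1 ∨ i = 2 := by omega
    rcases this with rfl | rfl | rfl
    · have := loc_even_iff (i := 0) |>.1 hv
      rw [this, c0, <- hrow.c1]
      exact eA 0 (by omega) _ (loc_even _ 0)
    · have := loc_odd_iff (i := 0) |>.1 hv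
      rw [zero_add, c0, c1] at this
      have hl := refU_transfer hc.hu hR.refu (j := 2*t+1) (by omega) (loc_odd_iff.2 this)
      have hge := hG.1 _ (hR.refu.le (by omega)) _ hl
      have hod := hR.refu.odd (j := 2*t+1) (by omega) (by omega)
      rw [cm_zero hO.ref, hc.V_0]
      have hge' : GE Y.N G (mkP sw v (vs 0)) ((Y.row s).A ((Y.rec' s).ru (2*t+1))) 1 :=
        ⟨fun h => by omega, fun _ => hge.2 hod⟩
      exact hge'.coo hO.C rfl
    · have := loc_even_iff (i := 1) |>.1 hv
      have e3 := hrow.c3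
      rw [hO.k1] at e3
      rw [this, c1, <- e3]
      have := eB 0 (by omega) _ (loc_even _ 0)
      exact ⟨fun _ => this.1 rfl, fun h => by omega⟩
  · have : i = 0 ∨ i = 1 ∨ i = 2 := by omega
    rcases this with rfl | rfl | rfl
    · have := loc_even_iff (i := 0) |>.1 hv
      rw [this, c0, <- hrow.c2]
      have := eA (2*(Y.row ((Y.rec' s).ch t)).m) (by omega) _ (loc_even _ _)
      exact ⟨fun _ => this.1 (by omega), fun h => by omega⟩
    · have := loc_odd_iff (i := 0) |>.1 hv
      rw [zero_add, c0, c1] at this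
      have hl := refU_transfer hc.hu hR.refu (j := 2*t+1) (by omega) (loc_odd_iff.2 this)
      have hge := hG.2.1 _ (hR.refu.le (by omega)) _ hl
      have hod := hR.refu.odd (j := 2*t+1) (by omega) (by omega)
      rw [cm_last hO.ref, hc.V_K]
      have hge' : GE Y.N G (mkP sw v (vs (Y.row s).k)) ((Y.row s).B ((Y.rec' s).ru (2*t+1))) 1 :=
        ⟨fun h => by omega, fun _ => hge.2 hod⟩
      exact hge'.coo hO.E rfl
    · have := loc_even_iff (i := 1) |>.1 hv
      have e3 := hrow.c4
      rw [hO.k1] at e3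
      rw [this, c1, <- e3]
      have := eB (2*(Y.row ((Y.rec' s).ch t)).m) (by omega) _ (loc_even _ _)
      exact ⟨fun _ => this.1 (by omega), fun h => by omega⟩

theorem GI_V (h : Y.V (.tri s us)) (hG : Y.GI G (.tri s us)) (hI : GIL Y G (.tri s us)) (ht : t < (Y.trec s).M) (hj : j <= 2*(Y.trec s).Q) (hj0 : 2*(Y.trec s).zc t < j) (hl : loc (TX (Y.trec s) us) j y) : GE Y.N G (TZ (Y.trec s) us t, y) ((Y.trec s).V t j) j := by
  have hc := tc h
  have hR := hc.R
  by_cases h0 : t = 0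
  · subst h0
    have l1 := refU_transfer hc.Z_SM hR.refC hj hl
    have l2 := refU_transfer hc.hu hR.refZ (hR.refC.le hj) l1
    have j0 : 0 < j := by omega
    exact (hG.1 _ (hR.refZ.le (hR.refC.le hj)) (hR.refZ.pos (hR.refC.le hj) (hR.refC.pos hj j0)) _ l2).ref
      (hR.VL j hj j0)
  by_cases hQ : j = 2*(Y.trec s).Q
  · have hy : y = us (Y.trow s).m := by
      have := loc_even_iff.1 (hQ ▸ hl)
      rw [this, <- hc.Z_M]; exact refU_last hc.Z_SM hR.refC
    rw [hy, hQ]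
    have hut := (refU_loc hc.hu hR.refZ t ht.le).1
    have := (hG.2 _ (hR.refZ.ltm (j := 2*t) (by omega)) _ hut).ref (hR.VU t ht)
    exact ⟨fun _ => this.1 rfl, fun h => by omega⟩
  · exact GE.par (hI (TZ (Y.trec s) us t, y) _ _ (Or.inl ⟨t, ht, by omega, rfl, j, by omega, hj0, hl, rfl, rfl⟩))

theorem GI_H (h : Y.V (.tri s us)) (hG : Y.GI G (.tri s us)) (hI : GIL Y G (.tri s us)) (ht : t < (Y.trec s).M) (hj : j < 2*(Y.trec s).zc (t+1)) (hj0 : 2*(Y.trec s).zc t <= j) (hl : loc (TX (Y.trec s) us) j x) : GE Y.N G (x, TZ (Y.trec s) us (t+1)) ((Y.trec s).H t j) j := by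
  have hc := tc h
  have hR := hc.R
  have hQ := hc.zc_leQ (t := t+1) ht
  by_cases h0 : t + 1 = (Y.trec s).M
  · have l1 := refU_transfer hc.Z_SM hR.refC (by omega) hl
    have l2 := refU_transfer hc.hu hR.refZ (hR.refC.le (by omega)) l1
    rw [h0, hc.Z_M]
    have ht' : (Y.trec s).M - 1 = t := by omega
    have := hR.HU j (by omega) (by rw [ht']; exact hj0)
    rw [ht'] at this
    exact (hG.2 _ (hR.refZ.ltm (hR.refC.ltm (by omega))) _ l2).ref this
  by_cases hz : j = 2*(Y.trec s).zc t
  · subst hz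
    have hx : x = TX (Y.trec s) us ((Y.trec s).zc t) := loc_even_iff.1 hl
    rw [hc.X_zc ht.le] at hx
    subst hx
    rw [hR.HV t ht]
    have hl' : loc (TX (Y.trec s) us) (2*(Y.trec s).zc (t+1)) (TZ (Y.trec s) us (t+1)) := by
      rw [<- hc.X_zc (t := t+1) ht]; exact loc_even _ _
    have := GI_V h hG hI ht (j := 2*(Y.trec s).zc (t+1)) (by omega) hj hl'
    exact ⟨fun _ => this.1 (by omega), fun h => by omega⟩
  · exact GE.par (hI (x, TZ (Y.trec s) us (t+1)) _ _
      (Or.inr ⟨t, ht, by omega, rfl, j, hj, by omega, hl, rfl, rfl⟩))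

theorem lipH (y : ℝ) : Lip (fun x => (x, y)) := lip1 false y
theorem lipV (x : ℝ) : Lip (fun y => (x, y)) := lip2 false x

theorem GI_Vs (hcl : GCl G) (h : Y.V (.tri s us)) (hG : Y.GI G (.tri s us)) (hI : GIL Y G (.tri s us)) (ht : t < (Y.trec s).M) (hz : (Y.trec s).zc t <= n) (hK : n + K <= (Y.trec s).Q) (hr : IsRef ru K m) (hA : ∀ j ≤ 2*K, 0 < j -> cooE (A (ru j)) (ru j) ((Y.trec s).V t (2*n + j)) j) (hi : i <= 2*m) (hi0 : 0 < i) (hy : loc (cm (fun l => TX (Y.trec s) us (n + l)) ru K) i y) : GE Y.N G (TZ (Y.trec s) us t, y) (A i) i := by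
  refine coo_edge hcl (lipV _) ((tc h).X_SM.shift (by omega)) hr (fun j => 0 < j) (L := fun j => (Y.trec s).V t (2*n + j))
    (fun j hj hj0 y hl => ?_) hA (fun j hj h1 => by omega) hi (fun j hj h1 => Nat.pos_of_ne_zero fun e => ?_) hy
  · have := GI_V h hG hI ht (j := 2*n + j) (by omega) (by omega) (loc_shift.1 hl)
    exact ⟨fun h => this.1 (by omega), fun h => this.2 (by omega)⟩
  · rw [e, hr.1] at h1; omega

theorem GI_Hs (hcl : GCl G) (h : Y.V (.tri s us)) (hG : Y.GI G (.tri s us)) (hI : GIL Y G (.tri s us)) (ht : t < (Y.trec s).M) (hr : IsRef ru ((Y.trec s).zc (t+1) - (Y.trec s).zc t) m) (hA : ∀ j, j < 2*((Y.trec s).zc (t+1) - (Y.trec s).zc t) -> cooE (A (ru j)) (ru j) ((Y.trec s).H t (2*(Y.trec s).zc t + j)) j) (hi : i < 2*m) (hx : loc (cm (fun l => TX (Y.trec s) us ((Y.trec s).zc t + l)) ru ((Y.trec s).zc (t+1) - (Y.trec s).zc t)) i x) : GE Y.N G (x, TZ (Y.trec s) us (t+1)) (A i) i := by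
  have hQ := (tc h).zc_leQ (t := t+1) ht
  have hz := (tc h).R.zcl t ht
  refine coo_edge hcl (lipH _) ((tc h).X_SM.shift (by omega)) hr (fun j => j < 2*((Y.trec s).zc (t+1) - (Y.trec s).zc t))
    (L := fun j => (Y.trec s).H t (2*(Y.trec s).zc t + j)) (fun j hj hj0 y hl => ?_) (fun j hj hj0 => hA j hj0)
    (fun j hj h1 => by omega) hi.le (fun j hj h1 => lt_of_le_of_ne hj fun e => ?_) hx
  · have := GI_H h hG hI ht (j := 2*(Y.trec s).zc t + j) (by omega) (by omega) (loc_shift.1 hl)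
    exact ⟨fun h => this.1 (by omega), fun h => this.2 (by omega)⟩
  · rw [e, hr.2.1] at h1; omega

theorem GI_tri (hcl : GCl G) (h : Y.V (.tri s us)) (hG : Y.GI G (.tri s us)) (hI : GIL Y G (.tri s us)) (hn : n < Y.nch (.tri s us)) : Y.GI G (Y.chd (.tri s us) n) := by
  have hc := tc h
  have hR := hc.R
  rcases tidx hn with ⟨t, rfl, ht⟩ | ⟨t, rfl, ht⟩
  · have hO := hR.cTO t ht
    have hz := hR.zcl t ht
    have hQ := hc.zc_leQ (t := t+1) ht
    rw [chd_even]
    simp only [GI]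
    rw [hc.Tus_0 ht, hc.Tus_m ht]
    exact ⟨fun i hi hi0 y hy => GI_Vs hcl h hG hI ht le_rfl (by omega) hO.ref hO.L hi hi0 hy, fun i hi x hx => GI_Hs hcl h hG hI ht hO.ref hO.U hi hx⟩
  · have htM : t < (Y.trec s).M := by omega
    have hO := hR.cRO t htM ht
    have hz := hR.zcl t htM
    have hz1 := hR.zcl (t+1) ht
    have hQ := hc.zc_leQ (t := t+1) htM
    have hQ1 := hc.zc_leQ (t := t+1+1) ht
    have hrow := Y.rows _ (hR.cRS t htM ht)
    rw [chd_odd]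
    simp only [GI, mkP]
    rw [hc.Rus_0 ht, hc.Rus_m ht, hc.Rvs_0 ht, hc.Rvs_k ht]
    have hSM' : SM (fun n => TX (Y.trec s) us ((Y.trec s).zc (t+1) + n)) ((Y.trec s).Q - (Y.trec s).zc (t+1)) :=
      hc.X_SM.shift (by omega)
    have lQ : loc (TX (Y.trec s) us) (2*(Y.trec s).Q) (TZ (Y.trec s) us (Y.trec s).M) := by
      rw [<- hR.zcM, <- hc.X_zc le_rfl]; exact loc_even _ _
    refine ⟨fun i hi x hx => ?_, fun i hi x hx => ?_, fun i hi y hy => ?_, fun i hi y hy => ?_⟩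
    · by_cases hi' : i = 2*(Y.row ((Y.trec s).chR t)).m
      · rw [hi']
        exact ⟨fun _ h => absurd hO.A1 h, fun h => by omega⟩
      exact GI_Hs hcl h hG hI htM hO.refA hO.A (by omega) hx
    · have hRSM := hc.Rus_SM ht
      by_cases h0 : i = 0
      · subst h0
        have hx' : x = _ := loc_even_iff (i := 0) |>.1 hx
        rw [hc.Rus_0 ht] at hx'
        rw [hx']
        have := GI_V h hG hI htM (j := 2*(Y.trec s).Q) le_rfl (by omega) lQ
        have : GE Y.N G (TZ (Y.trec s) us t, TZ (Y.trec s) us (Y.trec s).M) ((Y.trec s).V t (2*(Y.trec s).Q)) 0 :=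
          ⟨fun _ => this.1 (by omega), fun h => by omega⟩
        exact this.coo hO.B0 rfl
      by_cases h1 : i = 2*(Y.row ((Y.trec s).chR t)).m
      · subst h1
        have hx' : x = _ := loc_even_iff.1 hx
        rw [hc.Rus_m ht] at hx'
        rw [hx']
        have := GI_V h hG hI ht (j := 2*(Y.trec s).Q) le_rfl (by omega) lQ
        have : GE Y.N G (TZ (Y.trec s) us (t+1), TZ (Y.trec s) us (Y.trec s).M) ((Y.trec s).V (t+1) (2*(Y.trec s).Q)) 0 :=
          ⟨fun _ => this.1 (by omega), fun h => by omega⟩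
        have := this.coo hO.B1 rfl
        exact ⟨fun _ => this.1 rfl, fun h => by omega⟩
      · have x0 := (loc_pos_iff hRSM hi hx).2 (by omega)
        have x1 := (loc_lt_iff hRSM hi hx).2 (by omega)
        rw [hc.Rus_0 ht] at x0
        rw [hc.Rus_m ht] at x1
        have hl := refU_transfer hc.hu hR.refZ (j := 2*t+1) (by omega) (loc_odd_iff.2 ⟨x0, x1⟩)
        have hod := hR.refZ.odd (j := 2*t+1) (by omega) (by omega)
        have := hG.2 _ (hR.refZ.ltm (j := 2*t+1) (by omega)) _ hl
        rw [hc.Z_M]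
        have : GE Y.N G (x, us (Y.trow s).m) ((Y.trow s).U ((Y.trec s).ruZ (2*t+1))) 1 :=
          ⟨fun h => by omega, fun _ => this.2 hod⟩
        exact this.ref (hO.Bi i (by omega) (by omega))
    · refine coo_edge hcl (lipV _) hSM' hO.refC (fun j => True)
        (L := fun j => (Y.trec s).V t (2*(Y.trec s).zc (t+1) + j))
        (fun j hj _ y hl => ?_) (fun j hj hj0 => hO.C j hj) (fun j hj h1 => trivial) hi
        (fun j hj h1 => trivial) hy
      have := GI_V h hG hI htM (j := 2*(Y.trec s).zc (t+1) + j) (by omega) (by omega) (loc_shift.1 hl)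
      exact ⟨fun h => this.1 (by omega), fun h => this.2 (by omega)⟩
    · by_cases h0 : i = 0
      · subst h0
        rw [<- hrow.c2]
        exact ⟨fun _ h => absurd hO.A1 h, fun h => by omega⟩
      exact GI_Vs hcl h hG hI ht le_rfl (by omega) hO.refC hO.E hi (by omega) hy

theorem GI_chd (hcl : GCl G) (h : Y.V c) (hG : Y.GI G c) (hI : GIL Y G c) (hn : n < Y.nch c) : Y.GI G (Y.chd c n) := by
  cases c with
  | rect sw s us vs => exact GI_rect hcl h hG hI hn
  | tri s us => exact GI_tri hcl h hG hI hn

/-! ## Part B7: the gap attached to every point -/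

variable {Y : Sys} {c : Cell}

theorem refcov (h0 : us 0 <= x) (h1 : x < us M) : ∃ t < M, us t <= x /\ x < us (t+1) := by
  induction M with
  | zero => exact absurd h1 (not_lt.2 h0)
  | succ M ih =>
    rcases lt_or_ge x (us M) with h | h
    · obtain ⟨t, ht, a⟩ := ih h; exact ⟨t, by omega, a⟩
    · exact ⟨M, by omega, h, h1⟩

theorem refcov' (h0 : us 0 < x) (h1 : x <= us M) : ∃ t < M, us t < x /\ x <= us (t+1) := by
  induction M with
  | zero => exact absurd h0 (not_lt.2 h1)
  | succ M ih =>
    rcases le_or_gt x (us M) with h | h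
    · obtain ⟨t, ht, a⟩ := ih h; exact ⟨t, by omega, a⟩
    · exact ⟨M, by omega, h, h1⟩

theorem cov (h : Y.V c) (hr : Y.reg c p) : ∃ t < Y.nch c, Y.reg (Y.chd c t) p := by
  cases c with
  | rect sw s us vs =>
    have hc := rc h
    obtain ⟨⟨a1, a2, a3, a4⟩, a5⟩ := hr
    rcases a2.eq_or_lt with e | hl
    · refine ⟨(Y.rec' s).M - 1, ?_, ?_⟩
      · have := hc.M2; simp only [nch]; omega
      · have := hc.M2
        rw [reg_rect h (by omega)]
        have e1 : (Y.rec' s).M - 1 + 1 = (Y.rec' s).M := by omega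
        refine ⟨⟨?_, ?_, a3, a4⟩, a5⟩
        · rw [e, <- hc.U_M]; exact hc.U_SM.le (by omega) le_rfl
        · rw [e1, hc.U_M]; exact a2
    · obtain ⟨t, ht, b1, b2⟩ := refcov (us := refU us (Y.rec' s).ru) (M := (Y.rec' s).M) a1
        (by rwa [hc.U_M])
      exact ⟨t, ht, (reg_rect h ht).2 ⟨⟨b1, b2.le, a3, a4⟩, a5⟩⟩
  | tri s us =>
    have hc := tc h
    obtain ⟨a1, a2, a3⟩ := hr
    obtain ⟨t, ht, b1, b2⟩ := refcov (us := TZ (Y.trec s) us) (M := (Y.trec s).M) (x := p.1) a1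
        (by rw [hc.Z_M]; linarith)
    obtain ⟨n, hn, _, h1⟩ := col h ht b1 b2.le a3 (by rw [hc.Z_M]; exact a2)
    exact ⟨n, hn, h1⟩

theorem cov_n (n : ℕ) (h : Y.V c) (hr : Y.reg c p) : ∃ d, Y.geo.Desc n c d /\ Y.reg d p := by
  induction n generalizing c with
  | zero => exact ⟨c, rfl, hr⟩
  | succ n ih =>
    obtain ⟨t, ht, h1⟩ := cov h hr
    obtain ⟨d, h2, h3⟩ := ih (gA1 h ht) h1
    exact ⟨d, ⟨t, ht, h2⟩, h3⟩

variable (Y) in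
noncomputable def c0 : Cell := .tri Y.s0 (fun i => (i:ℝ) / ((Y.trow Y.s0).m : ℝ))

theorem m0 : (0:ℝ) < (Y.trow Y.s0).m := by
  have := (Y.trows _ Y.hs0).hm
  exact_mod_cast this

theorem Vc0 : Y.V Y.c0 := by
  refine ⟨Y.hs0, fun i hi => ?_⟩
  have := m0 (Y := Y)
  show (i:ℝ) / _ < ((i+1 : ℕ):ℝ) / _
  gcongr; linarith

theorem reg_c0 : Y.reg Y.c0 p ↔ 0 <= p.1 /\ p.2 <= 1 /\ p.1 < p.2 := by
  have := m0 (Y := Y)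
  simp only [c0, reg]
  rw [div_self this.ne']; simp

theorem bd_c0 (h : Y.bd Y.c0 p g) : p.1 = 0 ∨ p.2 = 1 := by
  have := m0 (Y := Y)
  obtain ⟨e, ⟨h1, _⟩ | ⟨h1, _⟩, _⟩ := h
  · left; rw [h1]; simp
  · right; rw [h1]; exact div_self this.ne'

theorem Tri_reg (h : p ∈ Tri) : Y.reg Y.c0 p := by
  obtain ⟨a, b, c⟩ := h
  exact reg_c0.2 ⟨a.le, c.le, b⟩

theorem Tri_nbd (h : p ∈ Tri) (g : Gap) : ¬ Y.bd Y.c0 p g := by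
  obtain ⟨a, b, c⟩ := h
  intro hb
  rcases bd_c0 hb with e | e <;> linarith

theorem Tri_of (h : Y.reg Y.c0 p) (hb : ∀ g, ¬ Y.bd Y.c0 p g) : p ∈ Tri := by
  have hh := reg_c0.1 h
  have hm := m0 (Y := Y)
  have hV := Vc0 (Y := Y)
  have e1 : ((Y.trow Y.s0).m : ℝ) / (Y.trow Y.s0).m = 1 := div_self hm.ne'
  refine ⟨lt_of_le_of_ne hh.1 fun e => ?_, hh.2.2, lt_of_le_of_ne hh.2.1 fun e => ?_⟩
  · obtain ⟨i, hi, hl⟩ := loc_exists (us := fun i : ℕ => (i:ℝ) / ((Y.trow Y.s0).m : ℝ))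
      (m := (Y.trow Y.s0).m) (x := p.2) (by simp; linarith) (by simp only [e1]; exact hh.2.1)
    refine hb _ ⟨_, Or.inl ⟨by simpa using e.symm, i, hi, (loc_pos_iff hV.2 hi hl).1 (by simp; linarith), hl, rfl⟩, rfl⟩
  · obtain ⟨i, hi, hl⟩ := loc_exists (us := fun i : ℕ => (i:ℝ) / ((Y.trow Y.s0).m : ℝ))
      (m := (Y.trow Y.s0).m) (x := p.1) (by simpa using hh.1) (by simp only [e1]; linarith)
    refine hb _ ⟨_, Or.inr ⟨by simp only [e1]; exact e, i, (loc_lt_iff hV.2 hi hl).1 (by simp only [e1]; linarith), hl, rfl⟩, rfl⟩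

/-- limit points -/
def Lim (Y : Sys) (p : Pt) : Prop := p ∈ Tri /\ ∀ g, ¬ Y.geo.Done Y.c0 p g

/-- deep cells around a point are rectangles -/
theorem deep_rect (hp : p ∈ Tri) : ∃ n0, ∀ n, n0 ≤ n -> ∀ d, Y.geo.Desc n Y.c0 d -> Y.reg d p -> ∃ sw s us vs, d = .rect sw s us vs := by
  obtain ⟨n0, h0⟩ := Geo.small (T := Y.geo) (c := Y.c0) Vc0 (ε := p.2 - p.1) (by have := hp.2.1; linarith)
  refine ⟨n0, fun n hn d hd hr => ?_⟩
  have := h0 n hn d hd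
  cases d with
  | rect sw s us vs => exact ⟨sw, s, us, vs, rfl⟩
  | tri s us =>
    exfalso
    have h2 : 6 * (us (Y.trow s).m - us 0) < p.2 - p.1 := this
    obtain ⟨a1, a2, a3⟩ := hr
    linarith

/-- gap of a rectangle -/
def LLg (Y : Sys) (s : ℕ) : Gap := gap ((Y.row s).A 0)
def URg (Y : Sys) (s : ℕ) : Gap := gap ((Y.row s).B (2*(Y.row s).m))

theorem mkP_lt (h : Y.V (.rect sw s us vs)) (h1 : u <= us (Y.row s).m) (h2 : vs 0 <= v) (h3 : us 0 <= u) (h4 : v <= vs (Y.row s).k) (h5 : sw = false -> u < us (Y.row s).m ∨ vs 0 < v) (h6 : sw = true -> us 0 < u ∨ v < vs (Y.row s).k) : (mkP sw u v).1 < (mkP sw u v).2 := by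
  cases sw
  · have := h.2.2.2.1 rfl
    simp only [mkP]
    rcases h5 rfl with h | h <;> linarith
  · have := h.2.2.2.2 rfl
    simp only [mkP]
    rcases h6 rfl with h | h <;> linarith

theorem bd_LL (h : Y.V (.rect sw s us vs)) : Y.bd (.rect sw s us vs) (mkP sw (us 0) (vs 0)) (LLg Y s) := by
  have hr := Y.rows s h.1
  have a := h.2.1.lt hr.hm le_rfl
  have b := h.2.2.1.lt hr.hk le_rfl
  refine ⟨⟨_, Or.inl ⟨by simp, 0, by omega, by simpa using loc_even us 0, rfl⟩, rfl⟩, ?_⟩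
  exact mkP_lt h a.le le_rfl le_rfl b.le (fun _ => Or.inl a) (fun _ => Or.inr b)

theorem bd_UR (h : Y.V (.rect sw s us vs)) : Y.bd (.rect sw s us vs) (mkP sw (us (Y.row s).m) (vs (Y.row s).k)) (URg Y s) := by
  have hr := Y.rows s h.1
  have a := h.2.1.lt hr.hm le_rfl
  have b := h.2.2.1.lt hr.hk le_rfl
  refine ⟨⟨_, Or.inr (Or.inl ⟨by simp, 2*(Y.row s).m, by omega, by simpa using loc_even us _, rfl⟩), rfl⟩, ?_⟩
  exact mkP_lt h le_rfl b.le a.le le_rfl (fun _ => Or.inr b) (fun _ => Or.inl a)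

theorem strict_in (hr : Y.reg (.rect sw s us vs) p) (hn : ∀ g, ¬ Y.bd (.rect sw s us vs) p g) : us 0 < cu sw p /\ cu sw p < us (Y.row s).m /\ vs 0 < cv sw p /\ cv sw p < vs (Y.row s).k :=
  bdg_iff_strict hr.1 fun g hg => hn g ⟨hg, hr.2⟩

theorem LL_pl (hr : Y.reg (.rect sw s us vs) p) (hn : ∀ g, ¬ Y.bd (.rect sw s us vs) p g) : pl (mkP sw (us 0) (vs 0)) p /\ pl p (mkP sw (us (Y.row s).m) (vs (Y.row s).k)) := by
  obtain ⟨a, b, c, d⟩ := strict_in hr hn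
  exact ⟨pl_of_cu sw (by simpa using a) (by simpa using c), pl_of_cu sw (by simpa using b) (by simpa using d)⟩

theorem Lim.nbd (h : Lim Y p) {d : Cell} (hd : Y.geo.Desc n Y.c0 d) (g : Gap) : ¬ Y.bd d p g := fun hb => h.2 g ⟨n, d, hd, hb⟩

/-- for deep cells the corners are close to `p` -/
theorem Lim.deep (h : Lim Y p) {q' : Pt} (hq : pl q p) (hq' : pl p q') : ∃ n0, ∀ n, n0 ≤ n -> ∀ d, Y.geo.Desc n Y.c0 d -> Y.reg d p -> ∃ sw s us vs, d = .rect sw s us vs /\ pl q (mkP sw (us 0) (vs 0)) /\ pl (mkP sw (us 0) (vs 0)) p /\ pl p (mkP sw (us (Y.row s).m) (vs (Y.row s).k)) /\ pl (mkP sw (us (Y.row s).m) (vs (Y.row s).k)) q' /\ Y.geo.Done Y.c0 (mkP sw (us 0) (vs 0)) (LLg Y s) /\ Y.geo.Done Y.c0 (mkP sw (us (Y.row s).m) (vs (Y.row s).k)) (URg Y s) := by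
  obtain ⟨n1, h1⟩ := deep_rect (Y := Y) h.1
  set ε := min (min (p.1 - q.1) (p.2 - q.2)) (min (q'.1 - p.1) (q'.2 - p.2)) with he
  have he0 : 0 < ε := by
    have := hq.1; have := hq.2; have := hq'.1; have := hq'.2
    refine lt_min (lt_min ?_ ?_) (lt_min ?_ ?_) <;> linarith
  obtain ⟨n2, h2⟩ := Geo.small (T := Y.geo) (c := Y.c0) Vc0 (ε := ε) he0
  refine ⟨max n1 n2, fun n hn d hd hr => ?_⟩
  obtain ⟨sw, s, us, vs, rfl⟩ := h1 n (le_trans (le_max_left _ _) hn) d hd hr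
  have hw := h2 n (le_trans (le_max_right _ _) hn) _ hd
  have hV : Y.V (.rect sw s us vs) := hd.V Vc0
  have hb := bd_LL hV
  have hb' := bd_UR hV
  have k1 := gw2 hV hr (gA2 hV hb)
  have k2 := gw2 hV hr (gA2 hV hb')
  obtain ⟨p1, p2⟩ := LL_pl hr (h.nbd hd)
  have e1 : ε <= p.1 - q.1 := (min_le_left _ _).trans (min_le_left _ _)
  have e2 : ε <= p.2 - q.2 := (min_le_left _ _).trans (min_le_right _ _)
  have e3 : ε <= q'.1 - p.1 := (min_le_right _ _).trans (min_le_left _ _)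
  have e4 : ε <= q'.2 - p.2 := (min_le_right _ _).trans (min_le_right _ _)
  have hw' : Y.w (.rect sw s us vs) < ε := hw
  have := abs_le.1 k1.1; have := abs_le.1 k1.2; have := abs_le.1 k2.1; have := abs_le.1 k2.2
  refine ⟨sw, s, us, vs, rfl, ⟨?_, ?_⟩, p1, p2, ⟨?_, ?_⟩, ⟨n, _, hd, hb⟩, ⟨n, _, hd, hb'⟩⟩ <;> linarith

variable (Y) in
noncomputable def LO (p : Pt) : Pos :=
  ⟨setN Y.N fun i => ∀ q g, pl q p -> Y.geo.Done Y.c0 q g -> bit g.2.f i, setN Y.N fun i => ∃ q g, pl q p /\ Y.geo.Done Y.c0 q g /\ bit g.2.p i⟩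

variable (Y) in
noncomputable def HI (p : Pt) : Pos :=
  ⟨setN Y.N fun i => ∃ q g, pl p q /\ Y.geo.Done Y.c0 q g /\ bit g.1.f i, setN Y.N fun i => ∀ q g, pl p q -> Y.geo.Done Y.c0 q g -> bit g.1.p i⟩

theorem ple_LO (h : pl q p) (hd : Y.geo.Done Y.c0 q g) : ple Y.N g.2 (LO Y p) := by
  intro i hi
  simp only [LO, bit_setN]
  exact ⟨fun hh => hh.2 q g h hd, fun hh => ⟨hi, q, g, h, hd, hh⟩⟩

theorem HI_ple (h : pl p q) (hd : Y.geo.Done Y.c0 q g) : ple Y.N (HI Y p) g.1 := by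
  intro i hi
  simp only [HI, bit_setN]
  exact ⟨fun hh => ⟨hi, q, g, h, hd, hh⟩, fun hh => hh.2 q g h hd⟩

theorem pl_trans {r : Pt} (h1 : pl p q) (h2 : pl q r) : pl p r := ⟨h1.1.trans h2.1, h1.2.trans h2.2⟩

theorem LO_HI : ple Y.N (LO Y p) (HI Y p) := by
  intro i hi
  simp only [LO, HI, bit_setN]
  refine ⟨?_, ?_⟩
  · rintro ⟨_, q, g, h, hd, hb⟩
    refine ⟨hi, fun q' g' h' hd' => ?_⟩
    exact (Geo.coh Vc0 hd' hd (pl_trans h' h) i hi).1 hb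
  · rintro ⟨_, q, g, h, hd, hb⟩
    refine ⟨hi, fun q' g' h' hd' => ?_⟩
    exact (Geo.coh Vc0 hd hd' (pl_trans h h') i hi).2 hb

theorem Lim.ev (h : Lim Y p) : ∃ n0, ∀ n, n0 ≤ n -> ∀ d, Y.geo.Desc n Y.c0 d -> Y.reg d p -> ∃ sw s us vs, d = .rect sw s us vs /\ ple Y.N (LLg Y s).2 (LO Y p) /\ ple Y.N (LO Y p) (LLg Y s).2 /\ ple Y.N (HI Y p) (URg Y s).1 /\ ple Y.N (URg Y s).1 (HI Y p) := by
  classical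
  have key : ∀ i ≤ Y.N, ∃ n0, ∀ n, n0 ≤ n -> ∀ d, Y.geo.Desc n Y.c0 d -> Y.reg d p -> ∃ sw s us vs, d = .rect sw s us vs /\ ple Y.N (LLg Y s).2 (LO Y p) /\ ple Y.N (HI Y p) (URg Y s).1 /\
        (bit (LLg Y s).2.f i -> bit (LO Y p).f i) /\ (bit (LO Y p).p i -> bit (LLg Y s).2.p i) /\
        (bit (HI Y p).f i -> bit (URg Y s).1.f i) /\ (bit (URg Y s).1.p i -> bit (HI Y p).p i) := by
    intro i hi
    -- four witnesses
    have w1 : ∃ q, pl q p /\ (¬ bit (LO Y p).f i -> ∃ g, Y.geo.Done Y.c0 q g /\ ¬ bit g.2.f i) := by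
      by_cases hb : bit (LO Y p).f i
      · exact ⟨(p.1 - 1, p.2 - 1), ⟨by simp, by simp⟩, fun hh => absurd hb hh⟩
      · have hb' := hb
        simp only [LO, bit_setN] at hb'
        push Not at hb'
        obtain ⟨q, g, h1, h2, h3⟩ := hb' hi
        exact ⟨q, h1, fun _ => ⟨g, h2, h3⟩⟩
    have w2 : ∃ q, pl q p /\ (bit (LO Y p).p i -> ∃ g, Y.geo.Done Y.c0 q g /\ bit g.2.p i) := by
      by_cases hb : bit (LO Y p).p i
      · have hb' := hb
        simp only [LO, bit_setN] at hb'
        obtain ⟨_, q, g, h1, h2, h3⟩ := hb'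
        exact ⟨q, h1, fun _ => ⟨g, h2, h3⟩⟩
      · exact ⟨(p.1 - 1, p.2 - 1), ⟨by simp, by simp⟩, fun hh => absurd hh hb⟩
    have w3 : ∃ q, pl p q /\ (¬ bit (HI Y p).p i -> ∃ g, Y.geo.Done Y.c0 q g /\ ¬ bit g.1.p i) := by
      by_cases hb : bit (HI Y p).p i
      · exact ⟨(p.1 + 1, p.2 + 1), ⟨by simp, by simp⟩, fun hh => absurd hb hh⟩
      · have hb' := hb
        simp only [HI, bit_setN] at hb'
        push Not at hb'
        obtain ⟨q, g, h1, h2, h3⟩ := hb' hi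
        exact ⟨q, h1, fun _ => ⟨g, h2, h3⟩⟩
    have w4 : ∃ q, pl p q /\ (bit (HI Y p).f i -> ∃ g, Y.geo.Done Y.c0 q g /\ bit g.1.f i) := by
      by_cases hb : bit (HI Y p).f i
      · have hb' := hb
        simp only [HI, bit_setN] at hb'
        obtain ⟨_, q, g, h1, h2, h3⟩ := hb'
        exact ⟨q, h1, fun _ => ⟨g, h2, h3⟩⟩
      · exact ⟨(p.1 + 1, p.2 + 1), ⟨by simp, by simp⟩, fun hh => absurd hh hb⟩
    obtain ⟨q1, hq1, w1⟩ := w1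
    obtain ⟨q2, hq2, w2⟩ := w2
    obtain ⟨q3, hq3, w3⟩ := w3
    obtain ⟨q4, hq4, w4⟩ := w4
    obtain ⟨n1, k1⟩ := h.deep hq1 hq3
    obtain ⟨n2, k2⟩ := h.deep hq2 hq4
    refine ⟨max n1 n2, fun n hn d hd hr => ?_⟩
    obtain ⟨sw, s, us, vs, rfl, a1, a2, a3, a4, a5, a6⟩ := k1 n (le_trans (le_max_left _ _) hn) d hd hr
    obtain ⟨sw', s', us', vs', e, b1, b2, b3, b4, b5, b6⟩ := k2 n (le_trans (le_max_right _ _) hn) _ hd hr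
    cases e
    refine ⟨sw, s, us, vs, rfl, ple_LO a2 a5, HI_ple a3 a6, ?_, ?_, ?_, ?_⟩
    · intro hb; by_contra hc
      obtain ⟨g, hg, hg'⟩ := w1 hc
      have := Geo.coh Vc0 hg a5 a1
      have h2 := Geo.Done.self Vc0 a5
      exact hg' ((this i hi).1 ((h2 i hi).1 hb))
    · intro hb
      obtain ⟨g, hg, hg'⟩ := w2 hb
      have := Geo.coh Vc0 hg a5 b1
      have h2 := Geo.Done.self Vc0 a5
      exact (h2 i hi).2 ((this i hi).2 hg')
    · intro hb
      obtain ⟨g, hg, hg'⟩ := w4 hb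
      have := Geo.coh Vc0 a6 hg b4
      have h2 := Geo.Done.self Vc0 a6
      exact (h2 i hi).1 ((this i hi).1 hg')
    · intro hb; by_contra hc
      obtain ⟨g, hg, hg'⟩ := w3 hc
      have := Geo.coh Vc0 a6 hg a4
      have h2 := Geo.Done.self Vc0 a6
      exact hg' ((this i hi).2 ((h2 i hi).2 hb))
  choose! f hf using key
  refine ⟨(Finset.range (Y.N+1)).sup f, fun n hn d hd hr => ?_⟩
  have hle : ∀ i ≤ Y.N, f i <= n := fun i hi => (Finset.le_sup (f := f) (Finset.mem_range.2 (by omega))).trans hn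
  obtain ⟨sw, s, us, vs, rfl, a1, a2, _⟩ := hf 0 (Nat.zero_le _) n (hle 0 (Nat.zero_le _)) d hd hr
  refine ⟨sw, s, us, vs, rfl, a1, fun i hi => ?_, a2, fun i hi => ?_⟩
  · obtain ⟨sw', s', us', vs', e, _, _, b1, b2, b3, b4⟩ := hf i hi n (hle i hi) _ hd hr
    cases e
    exact ⟨b1, b2⟩
  · obtain ⟨sw', s', us', vs', e, _, _, b1, b2, b3, b4⟩ := hf i hi n (hle i hi) _ hd hr
    cases e
    exact ⟨b3, b4⟩

end Sys

/-! ## Part B8: labels of limit points, the labelling -/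

theorem hasAdm_congr {a a' b b' : Pos} (h : hasAdm N a b) (h1 : ple N a a') (h2 : ple N a' a) (h3 : ple N b b') (h4 : ple N b' b) : hasAdm N a' b' := by
  obtain ⟨m, hm, h5, h6⟩ := h
  refine ⟨m, hm, h5, fun i hi => ?_⟩
  obtain ⟨k1, k2, k3⟩ := h6 i hi
  refine ⟨fun hb => ⟨(h2 i hi).1 (k1 hb).1, (h3 i hi).2 (k1 hb).2⟩, fun hb => ?_, fun hb => ?_⟩
  · rw [k2 hb]; exact ⟨(h4 i hi).1, (h3 i hi).1⟩
  · rw [k3 hb]; exact ⟨(h1 i hi).2, (h2 i hi).2⟩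

namespace Sys

variable {Y : Sys} {c : Cell}

theorem child_us (h : Y.V (.rect sw s us vs)) (ht : t < (Y.rec' s).M) : ∃ us' vs', Y.chd (.rect sw s us vs) t = .rect (!sw) ((Y.rec' s).ch t) us' vs' /\ us' 0 = vs 0 /\ us' (Y.row ((Y.rec' s).ch t)).m = vs (Y.row s).k /\ vs' 0 = refU us (Y.rec' s).ru t /\ vs' (Y.row ((Y.rec' s).ch t)).k = refU us (Y.rec' s).ru (t+1) := by
  have hR := Y.recs s h.1
  have hc := hR.chO t ht
  refine ⟨_, _, rfl, ?_, ?_, rfl, ?_⟩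
  · rw [cm_zero hc.ref]; rfl
  · rw [cm_last hc.ref, refU_last h.2.2.1 hR.refv]
  · rw [hc.k1]; rfl

theorem box_w (hr : Y.reg (.rect sw s us vs) p) (h1 : us 0 <= u) (h2 : u <= us (Y.row s).m) (h3 : vs 0 <= v) (h4 : v <= vs (Y.row s).k) :
    |p.1 - (mkP sw u v).1| <= Y.w (.rect sw s us vs) := by
  obtain ⟨⟨a1, a2, a3, a4⟩, _⟩ := hr
  rw [abs_le]
  simp only [w]
  cases sw <;> simp only [mkP, cu, cv] at * <;> constructor <;> linarith

theorem seq_exists (hp : p ∈ Tri) : ∃ c : ℕ -> Cell, ∀ n, Y.geo.Desc n Y.c0 (c n) /\ Y.reg (c n) p /\ ∃ t < Y.nch (c n), c (n+1) = Y.chd (c n) t := by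
  classical
  have hs : ∀ c : {c : Cell // Y.V c /\ Y.reg c p}, ∃ c' : {c : Cell // Y.V c /\ Y.reg c p}, ∃ t < Y.nch c.1, c'.1 = Y.chd c.1 t := by
    rintro ⟨c, hV, hr⟩
    obtain ⟨t, ht, h1⟩ := cov hV hr
    exact ⟨⟨_, gA1 hV ht, h1⟩, t, ht, rfl⟩
  choose f hf using hs
  let sq : ℕ -> {c : Cell // Y.V c /\ Y.reg c p} := fun n => Nat.rec ⟨Y.c0, Vc0, Tri_reg hp⟩ (fun _ c => f c) n
  refine ⟨fun n => (sq n).1, fun n => ⟨?_, (sq n).2.2, hf (sq n)⟩⟩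
  induction n with
  | zero => exact rfl
  | succ n ih =>
    obtain ⟨t, ht, e⟩ := hf (sq n)
    have := ih.append (Geo.Desc.one (T := Y.geo) ht)
    show Y.geo.Desc (n+1) Y.c0 (f (sq n)).1
    rw [e]; exact this

/-- limit points can be labelled -/
theorem Lim.hasAdm (h : Lim Y p) : hasAdm Y.N (LO Y p) (HI Y p) := by
  by_contra hno
  obtain ⟨n0, hev⟩ := h.ev
  obtain ⟨c, hc⟩ := seq_exists (Y := Y) h.1
  have hV : ∀ n, Y.V (c n) := fun n => (hc n).1.V Vc0
  have H : ∀ n, ∃ sw s us vs, n0 <= n -> c n = .rect sw s us vs /\ (Y.row s).tag ≠ 0 /\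
      (Y.row s).tag <= 6 /\ ple Y.N (LLg Y s).2 (LO Y p) /\ ple Y.N (LO Y p) (LLg Y s).2 /\
        ple Y.N (HI Y p) (URg Y s).1 /\ ple Y.N (URg Y s).1 (HI Y p) := by
    intro n
    by_cases hn : n0 <= n
    · obtain ⟨sw, s, us, vs, e, a1, a2, a3, a4⟩ := hev n hn _ (hc n).1 (hc n).2.1
      refine ⟨sw, s, us, vs, fun _ => ⟨e, fun h0 => hno ?_, ?_, a1, a2, a3, a4⟩⟩
      · have hh := hV n; rw [e] at hh
        exact hasAdm_congr ((Y.rows s hh.1).tg h0) a1 a2 a4 a3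
      · have hh := hV n; rw [e] at hh
        exact (Y.rows s hh.1).ht
    · exact ⟨true, 0, fun _ => 0, fun _ => 0, fun h => absurd h hn⟩
  choose sw s us vs hrect using H
  have hVn : ∀ n, n0 ≤ n -> Y.V (.rect (sw n) (s n) (us n) (vs n)) := fun n hn => by
    rw [<- (hrect n hn).1]; exact hV n
  have step : ∀ n, n0 ≤ n -> ∃ t < (Y.rec' (s n)).M, tagStep (Y.rec' (s n)).M t (Y.row (s n)).tag (Y.row (s (n+1))).tag (Y.rk (s n)) (Y.rk (s (n+1))) /\
      sw (n+1) = !(sw n) /\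
      us (n+1) 0 = vs n 0 /\ us (n+1) (Y.row (s (n+1))).m = vs n (Y.row (s n)).k /\
      vs (n+1) 0 = refU (us n) (Y.rec' (s n)).ru t /\
      vs (n+1) (Y.row (s (n+1))).k = refU (us n) (Y.rec' (s n)).ru (t+1) := by
    intro n hn
    obtain ⟨e, _, _, a1, a2, a3, a4⟩ := hrect n hn
    obtain ⟨e', _, _, b1, b2, b3, b4⟩ := hrect (n+1) (by omega)
    obtain ⟨t, ht, e2⟩ := (hc n).2.2
    rw [e] at ht e2
    rw [e'] at e2
    have hVV := hVn n hn
    obtain ⟨us', vs', e3, k1, k2, k3, k4⟩ := child_us hVV ht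
    rw [e3] at e2
    injection e2 with f1 f2 f3 f4
    refine ⟨t, ht, ?_, f1, ?_, ?_, ?_, ?_⟩
    · rw [f2]
      refine (Y.recs _ hVV.1).tg t ht ?_
      rw [f2] at b1 b2 b3 b4
      exact ⟨ple_trans a1 b2, ple_trans b1 a2, ple_trans a4 b3, ple_trans b4 a3⟩
    · rw [f3]; exact k1
    · rw [f3, f2]; exact k2
    · rw [f4]; exact k3
    · rw [f4, f2]; exact k4
  have no6 : ∀ n, n0 ≤ n -> (Y.row (s n)).tag ≠ 6 := by
    intro n hn h6
    have : ∀ j, (Y.row (s (n+j))).tag = 6 /\ Y.rk (s (n+j)) + j <= Y.rk (s n) := by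
      intro j
      induction j with
      | zero => exact ⟨h6, by simp⟩
      | succ j ih =>
        obtain ⟨t, _, h1, _⟩ := step (n+j) (by omega)
        have h2 := (hrect (n+j+1) (by omega)).2.1
        obtain ⟨i1, i2⟩ := ih
        unfold tagStep at h1
        rw [<- add_assoc]
        omega
    have := (this (Y.rk (s n) + 1)).2
    omega
  have n45 : ∀ n, n0 + 3 <= n -> ((Y.row (s n)).tag = 4 ∨ (Y.row (s n)).tag = 5) := by
    intro n hn
    obtain ⟨m, rfl⟩ : ∃ m, n = m + 3 := ⟨n-3, by omega⟩
    have q := fun j (hj : n0 <= j) => (hrect j hj).2.1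
    have q' := hrect m (by omega)
    obtain ⟨t1, _, h1, _⟩ := step m (by omega)
    obtain ⟨t2, _, h2, _⟩ := step (m+1) (by omega)
    obtain ⟨t3, _, h3, _⟩ := step (m+2) (by omega)
    have := no6 m (by omega); have := no6 (m+1) (by omega); have := no6 (m+2) (by omega)
    have := no6 (m+3) (by omega)
    have := q m (by omega); have := q (m+1) (by omega); have := q (m+2) (by omega); have := q (m+3) (by omega)
    have := q'.2.2.1
    unfold tagStep at h1 h2 h3
    simp only [show m+1+1 = m+2 from rfl, show m+2+1 = m+3 from rfl] at *
    omega
  let z : ℕ -> Pt := fun n => if (Y.row (s n)).tag = 4 then mkP (sw n) (us n 0) (vs n (Y.row (s n)).k)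
    else mkP (sw n) (us n (Y.row (s n)).m) (vs n 0)
  have hmk : ∀ b u v, mkP (!b) u v = mkP b v u := by intro b u v; cases b <;> rfl
  have hz : ∀ n, n0 + 3 <= n -> z (n+1) = z n := by
    intro n hn
    obtain ⟨t, ht, h1, e1, e2, e3, e4, e5⟩ := step n (by omega)
    have q1 := n45 n hn
    have q2 := n45 (n+1) (by omega)
    have hVV := hVn n (by omega)
    have hl := refU_last hVV.2.1 (Y.recs _ hVV.1).refu
    have hr := (hrect n (by omega)).2.1
    simp only [z]
    unfold tagStep at h1
    rcases q1 with q1 | q1 <;> rw [q1] at h1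
    · have h5 : t = 0 /\ (Y.row (s (n+1))).tag = 5 := by omega
      rw [if_neg (show ¬ (Y.row (s (n+1))).tag = 4 by omega), if_pos q1, e1, hmk, e3, e4, h5.1]
      rfl
    · have h5 : t + 1 = (Y.rec' (s n)).M /\ (Y.row (s (n+1))).tag = 4 := by omega
      rw [if_pos h5.2, if_neg (show ¬ (Y.row (s n)).tag = 4 by omega), e1, hmk, e2, e5, h5.1, hl]
  have hz' : ∀ j, z (n0 + 3 + j) = z (n0+3) := by
    intro j
    induction j with
    | zero => rfl
    | succ j ih => rw [<- add_assoc, hz _ (by omega), ih]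
  have hreg : ∀ n, n0 ≤ n -> Y.reg (.rect (sw n) (s n) (us n) (vs n)) p := fun n hn => by
    rw [<- (hrect n hn).1]; exact (hc n).2.1
  have hd : ∀ n, n0 + 3 <= n -> |p.1 - (z n).1| <= Y.w (c n) := by
    intro n hn
    have hVV := hVn n (by omega)
    have k1 := hVV.2.1.le (Nat.zero_le _) le_rfl
    have k2 := hVV.2.2.1.le (Nat.zero_le _) le_rfl
    rw [(hrect n (by omega)).1]
    simp only [z]
    split_ifs
    · exact box_w (hreg n (by omega)) le_rfl k1 k2 le_rfl
    · exact box_w (hreg n (by omega)) k1 le_rfl le_rfl k2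
  have hne : 0 < |p.1 - (z (n0+3)).1| := by
    rw [abs_pos, sub_ne_zero]
    have hD := (hc (n0+3)).1
    rw [(hrect (n0+3) (by omega)).1] at hD
    obtain ⟨a, b, c, d⟩ := strict_in (hreg (n0+3) (by omega)) (h.nbd hD)
    simp only [z]
    split_ifs
    · cases hsw : sw (n0+3) <;> rw [hsw] at a b c d <;> simp only [mkP, cu, cv] at * <;> intro hh <;> linarith
    · cases hsw : sw (n0+3) <;> rw [hsw] at a b c d <;> simp only [mkP, cu, cv] at * <;> intro hh <;> linarith
  obtain ⟨n1, hn1⟩ := Geo.small (T := Y.geo) (c := Y.c0) Vc0 hne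
  have k1 := hn1 (n0+3+n1) (by omega) _ (hc _).1
  have k2 := hd (n0+3+n1) (by omega)
  rw [hz'] at k2
  exact absurd (lt_of_le_of_lt k2 k1) (lt_irrefl _)

/-- the gap of a point of the triangle -/
def GapOf (Y : Sys) (p : Pt) (g : Gap) : Prop :=
  Y.geo.Done Y.c0 p g ∨ (Lim Y p /\ g = (LO Y p, HI Y p))

theorem GapOf.exists (hp : p ∈ Tri) : ∃ g, GapOf Y p g := by
  by_cases h : ∃ g, Y.geo.Done Y.c0 p g
  · obtain ⟨g, hg⟩ := h; exact ⟨g, Or.inl hg⟩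
  · push Not at h; exact ⟨_, Or.inr ⟨⟨hp, h⟩, rfl⟩⟩

theorem GapOf.unique (h : GapOf Y p g) (h' : GapOf Y p g') : g = g' := by
  rcases h with h | ⟨h, rfl⟩ <;> rcases h' with h' | ⟨h', rfl⟩
  · exact h.unique Vc0 h'
  · exact absurd h (h'.2 _)
  · exact absurd h' (h.2 _)
  · rfl

theorem GapOf.self (h : GapOf Y p g) : ple Y.N g.1 g.2 := by
  rcases h with h | ⟨h, rfl⟩
  · exact Geo.Done.self Vc0 h
  · exact LO_HI

/-- around a limit point there are arbitrarily close done points -/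
theorem Lim.near {q' : Pt} (h : Lim Y p) (hq : pl q p) (hq' : pl p q') : (∃ r g, Y.geo.Done Y.c0 r g /\ pl p r /\ pl r q') /\ ∃ r g, Y.geo.Done Y.c0 r g /\ pl q r /\ pl r p := by
  obtain ⟨n, h1⟩ := h.deep hq hq'
  obtain ⟨d, hd, hr⟩ := cov_n n Vc0 (Tri_reg (Y := Y) h.1)
  obtain ⟨sw, s, us, vs, rfl, a1, a2, a3, a4, a5, a6⟩ := h1 _ le_rfl _ hd hr
  exact ⟨⟨_, _, a6, a3, a4⟩, _, _, a5, a1, a2⟩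

theorem Lim.above (h : Lim Y p) (hq : pl p q) : ∃ r g, Y.geo.Done Y.c0 r g /\ pl p r /\ pl r q :=
  (h.near (q := (p.1 - 1, p.2 - 1)) ⟨by simp, by simp⟩ hq).1

theorem Lim.below (h : Lim Y p) (hq : pl q p) : ∃ r g, Y.geo.Done Y.c0 r g /\ pl q r /\ pl r p :=
  (h.near (q' := (p.1 + 1, p.2 + 1)) hq ⟨by simp, by simp⟩).2

theorem GapOf.coh (h : GapOf Y p g) (h' : GapOf Y q g') (hpq : pl p q) : ple Y.N g.2 g'.1 := by
  rcases h with h | ⟨h, rfl⟩ <;> rcases h' with h' | ⟨h', rfl⟩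
  · exact Geo.coh Vc0 h h' hpq
  · exact ple_LO hpq h
  · exact HI_ple hpq h'
  · obtain ⟨r, g, hd, h1, h2⟩ := h.above hpq
    exact ple_trans (HI_ple h1 hd) (ple_trans (Geo.Done.self Vc0 hd) (ple_LO h2 hd))

theorem GapOf.adm (hp : p ∈ Tri) (h : GapOf Y p g) : ∃ m, adm Y.N g.1 g.2 m := by
  rcases h with h | ⟨h, rfl⟩
  · obtain ⟨e, b, ⟨n, d, hd, hi⟩, rfl⟩ := h.IL Vc0 (fun g => Tri_nbd hp g)
    obtain ⟨h1, h2⟩ := gi5 (hd.V Vc0) hi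
    cases b
    · obtain ⟨m, _, hm⟩ := h2 rfl; exact ⟨m, hm⟩
    · exact ⟨_, (h1 rfl).2⟩
  · obtain ⟨m, _, hm⟩ := h.hasAdm; exact ⟨m, hm⟩

end Sys

/-! ## Part B9: the labelling -/

open Classical in
noncomputable def DD (x : ℝ) : ℕ := if h : ∃ n : ℕ, ∃ q : ℚ, x = q + n * √2 then h.choose else 0

theorem DD_dense (n : ℕ) (x0 : ℝ) (hab : a < b) : ∃ v, a < v /\ v < b /\ DD (x0 + v) = n := by
  obtain ⟨q, h1, h2⟩ := exists_rat_btwn (show x0 + a - n * √2 < x0 + b - n * √2 by linarith)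
  refine ⟨q + n * √2 - x0, by linarith, by linarith, ?_⟩
  have hx : ∃ n' : ℕ, ∃ q' : ℚ, x0 + (q + n * √2 - x0) = q' + n' * √2 := ⟨n, q, by ring⟩
  unfold DD
  rw [dif_pos hx]
  obtain ⟨q', hq'⟩ := hx.choose_spec
  by_contra hne
  have hne' : ((n:ℝ) - (hx.choose : ℕ)) ≠ 0 := by
    rw [sub_ne_zero]; intro h; exact hne (by exact_mod_cast h.symm)
  have h3 : √2 = ((q' - q) / ((n:ℚ) - (hx.choose:ℕ)) : ℚ) := by
    push_cast
    rw [eq_div_iff hne']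
    linarith
  exact irrational_sqrt_two ⟨_, h3.symm⟩

namespace Sys

variable {Y : Sys} {c : Cell}

open Classical in
noncomputable def pick (Y : Sys) (g : Gap) (n : ℕ) : ℕ :=
  if adm Y.N g.1 g.2 n then n else if h : ∃ m, adm Y.N g.1 g.2 m then h.choose else 0

theorem pick_adm (h : ∃ m, adm Y.N g.1 g.2 m) (n : ℕ) : adm Y.N g.1 g.2 (pick Y g n) := by
  unfold pick
  split_ifs with h1
  · exact h1
  · exact h.choose_spec

open Classical in
noncomputable def lam (Y : Sys) (p : Pt) : ℕ :=
  if h : ∃ e, Y.geo.IL Y.c0 p e true then h.choose.lab - 1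
  else if h : ∃ g, GapOf Y p g then pick Y h.choose (DD (p.1 + p.2)) else 0

theorem lam_IL (h : Y.geo.IL Y.c0 p e true) : lam Y p = e.lab - 1 := by
  have hh : ∃ e, Y.geo.IL Y.c0 p e true := ⟨e, h⟩
  unfold lam
  rw [dif_pos hh, (hh.choose_spec.unique Vc0 h).1]

theorem lam_pick (h : ∀ e, ¬ Y.geo.IL Y.c0 p e true) (hg : GapOf Y p g) : lam Y p = pick Y g (DD (p.1 + p.2)) := by
  have hh : ∃ g, GapOf Y p g := ⟨g, hg⟩
  unfold lam
  rw [dif_neg (by push Not; exact h), dif_pos hh, hh.choose_spec.unique hg]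

theorem lam_adm (hp : p ∈ Tri) (hg : GapOf Y p g) : adm Y.N g.1 g.2 (lam Y p) := by
  by_cases h : ∃ e, Y.geo.IL Y.c0 p e true
  · obtain ⟨e, he⟩ := h
    have hd := GapOf.unique hg (Or.inl (he.done Vc0))
    obtain ⟨n, d, hd', hi⟩ := id he
    rw [lam_IL he, hd]
    exact ((gi5 (hd'.V Vc0) hi).1 rfl).2
  · push Not at h
    rw [lam_pick h hg]
    exact pick_adm (hg.adm hp) _

/-- label `m` occurs near `z` -/
def GG (Y : Sys) (z : Pt) (m : ℕ) : Prop :=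
  ∀ ε > 0, ∃ q ∈ Tri, |q.1 - z.1| < ε /\ |q.2 - z.2| < ε /\ lam Y q = m

theorem GG_cl : GCl (GG Y) := by
  intro z m h ε he
  obtain ⟨z', h1, h2, h3⟩ := h (ε/2) (by linarith)
  obtain ⟨q, hq, h4, h5, h6⟩ := h3 (ε/2) (by linarith)
  refine ⟨q, hq, ?_, ?_, h6⟩
  · have := abs_sub_le q.1 z'.1 z.1; linarith
  · have := abs_sub_le q.2 z'.2 z.2; linarith

theorem il_Tri (hd : Y.geo.Desc n Y.c0 c) {b : Bool} (h : Y.il c p e b) : p ∈ Tri := by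
  have hV := hd.V Vc0
  obtain ⟨t, ht, hb⟩ := gi1 hV h
  have hr := gA2' hV ht (gA2 (gA1 hV ht) hb)
  refine Tri_of (Geo.Desc.reg Vc0 hd hr) fun g hg => ?_
  exact gi2 hV h (Geo.bd_desc (T := Y.geo) (c := Y.c0) Vc0 hg hd hr)

theorem mid_move (V : ℕ -> ℝ) (hj : j % 2 = 1) (hl : loc V j v) (he : 0 < ε) (n : ℕ) (x0 : ℝ) : ∃ v', |v' - v| < ε /\ loc V j v' /\ DD (x0 + v') = n := by
  obtain ⟨i, rfl⟩ : ∃ i, j = 2*i+1 := ⟨j/2, by omega⟩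
  rw [loc_odd_iff] at hl
  obtain ⟨v', h1, h2, h3⟩ := DD_dense n x0 (a := max (V i) (v - ε)) (b := min (V (i+1)) (v + ε)) (by
    rw [max_lt_iff, lt_min_iff, lt_min_iff]; refine ⟨⟨?_, ?_⟩, ?_, ?_⟩ <;> linarith)
  rw [max_lt_iff] at h1
  rw [lt_min_iff] at h2
  exact ⟨v', by rw [abs_lt]; constructor <;> linarith, loc_odd_iff.2 ⟨h1.1, h2.1⟩, h3⟩

theorem il_open (h : Y.il c z e false) (hlt : z.1 < z.2) (he : 0 < ε) (n : ℕ) : ∃ z' : Pt, |z'.1 - z.1| < ε /\ |z'.2 - z.2| < ε /\ Y.il c z' e false /\ DD (z'.1 + z'.2) = n := by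
  cases c with
  | rect sw s us vs =>
    obtain ⟨⟨t, ht, h0, h1, j, hj, hj0, hl, h2, h3⟩, h4⟩ := h
    have hj1 : j % 2 = 1 := by
      have := of_decide_eq_false h3.symm; omega
    obtain ⟨v', k1, k2, k3⟩ := mid_move _ hj1 hl (ε := min ε (z.2 - z.1)) (lt_min he (by linarith)) n (cu sw z)
    rw [lt_min_iff] at k1
    have k1' := abs_lt.1 k1.2
    refine ⟨mkP sw (cu sw z) v', ?_, ?_, ⟨⟨t, ht, h0, by simpa using h1, j, hj, hj0, by simpa using k2, h2, h3⟩, ?_⟩, ?_⟩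
    · cases sw <;> simp only [mkP, cu, cv] at *
      · simpa using he
      · exact k1.1
    · cases sw <;> simp only [mkP, cu, cv] at *
      · exact k1.1
      · simpa using he
    · cases sw <;> simp only [mkP, cu, cv] at * <;> linarith
    · cases sw <;> simp only [mkP, cu, cv] at *
      · exact k3
      · rw [add_comm]; exact k3
  | tri s us =>
    rcases h with ⟨t, ht, h0, h1, j, hj, hj0, hl, h2, h3⟩ | ⟨t, ht, h0, h1, j, hj, hj0, hl, h2, h3⟩
    · have hj1 : j % 2 = 1 := by
        have := of_decide_eq_false h3.symm; omega
      obtain ⟨v', k1, k2, k3⟩ := mid_move _ hj1 hl he n z.1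
      exact ⟨(z.1, v'), by simpa using he, k1, Or.inl ⟨t, ht, h0, h1, j, hj, hj0, k2, h2, h3⟩, k3⟩
    · have hj1 : j % 2 = 1 := by
        have := of_decide_eq_false h3.symm; omega
      obtain ⟨v', k1, k2, k3⟩ := mid_move _ hj1 hl he n z.2
      exact ⟨(v', z.2), k1, by simpa using he, Or.inr ⟨t, ht, h0, h1, j, hj, hj0, k2, h2, h3⟩, by rw [add_comm]; exact k3⟩

theorem GIL_GG (hd : Y.geo.Desc n Y.c0 c) : GIL Y (GG Y) c := by
  intro z e b h
  cases b
  · refine ⟨fun h0 => by simp at h0, fun _ _ m hm ε he => ?_⟩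
    obtain ⟨z', k1, k2, k3, k4⟩ := il_open h (il_Tri hd h).2.1 he m
    refine ⟨z', il_Tri hd k3, k1, k2, ?_⟩
    have hI : Y.geo.IL Y.c0 z' e false := ⟨n, c, hd, k3⟩
    rw [lam_pick (g := gap e) (fun e' h' => by have := (hI.unique Vc0 h').2; simp at this) (Or.inl (hI.done Vc0)), k4]
    unfold pick
    exact if_pos hm
  · refine ⟨fun _ _ ε he => ?_, fun h0 => by simp at h0⟩
    exact ⟨z, il_Tri hd h, by simpa using he, by simpa using he, lam_IL ⟨n, c, hd, h⟩⟩

theorem GI_c0 : Y.GI (GG Y) Y.c0 := by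
  refine ⟨fun i hi h0 y _ => ?_, fun i hi y _ => ?_⟩
  · have := Y.root.lL i hi h0
    exact ⟨fun _ h => absurd this h, fun _ h => by omega⟩
  · have := Y.root.lU i hi
    exact ⟨fun _ h => absurd this h, fun _ h => by omega⟩

theorem GI_desc : ∀ {c : Cell}, Y.geo.Desc n Y.c0 c -> Y.GI (GG Y) c := by
  induction n with
  | zero => intro c h; cases h; exact GI_c0
  | succ n ih =>
    intro c h
    obtain ⟨d, h1, t, ht, h2⟩ := Geo.Desc.split (m := 1) h
    cases h2
    exact GI_chd GG_cl (h1.V Vc0) (ih h1) (GIL_GG h1) ht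

/-! ## Part B10: resolving future demands -/

variable {Y : Sys} {c : Cell}

theorem loc_pt (h : SM us m) (hj : j <= 2*m) : ∃ u, loc us j u := by
  obtain ⟨i, rfl | rfl⟩ := Nat.even_or_odd' j
  · exact ⟨us i, loc_even us i⟩
  · have := h i (by omega)
    exact ⟨(us i + us (i+1))/2, loc_odd_iff.2 ⟨by linarith, by linarith⟩⟩

theorem box_w2 (hr : Y.reg (.rect sw s us vs) p) (h1 : us 0 <= u) (h2 : u <= us (Y.row s).m) (h3 : vs 0 <= v) (h4 : v <= vs (Y.row s).k) :
    |p.1 - (mkP sw u v).1| <= Y.w (.rect sw s us vs) /\ |p.2 - (mkP sw u v).2| <= Y.w (.rect sw s us vs) := by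
  obtain ⟨⟨a1, a2, a3, a4⟩, _⟩ := hr
  simp only [abs_le, w]
  cases sw <;> simp only [mkP, cu, cv] at * <;> refine ⟨⟨?_, ?_⟩, ?_, ?_⟩ <;> linarith

theorem wit_G (h : wit Y.N i j e) (hg : GE Y.N (GG Y) z e j) : ∃ m, bit m i /\ GG Y z m := by
  rcases Nat.mod_two_eq_zero_or_one j with h0 | h1
  · exact ⟨_, h.2.1 h0, hg.1 h0 h.1⟩
  · obtain ⟨e1, m, _, hm, hb⟩ := h.2.2 h1
    exact ⟨m, hb, hg.2 h1 e1 m hm⟩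

theorem GG_near {w : ℝ} (hb : bit m i) (h : GG Y z m) (hw : w < η) (hd : |p.1 - z.1| <= w /\ |p.2 - z.2| <= w) : ∃ q ∈ Tri, bit (lam Y q) i /\ |p.1 - q.1| < η /\ |p.2 - q.2| < η := by
  obtain ⟨q, hq, h1, h2, rfl⟩ := h (η - w) (by linarith)
  refine ⟨q, hq, hb, ?_, ?_⟩
  · have := abs_sub_le p.1 z.1 q.1; rw [abs_sub_comm z.1 q.1] at this; linarith
  · have := abs_sub_le p.2 z.2 q.2; rw [abs_sub_comm z.2 q.2] at this; linarith

theorem witIn_near (hd : Y.geo.Desc n Y.c0 (.rect sw s us vs)) (hp : Y.reg (.rect sw s us vs) p) (hw : Y.w (.rect sw s us vs) < η) (h : WitIn Y.N (Y.row s) (Y.rec' s) i) : ∃ q ∈ Tri, bit (lam Y q) i /\ |p.1 - q.1| < η /\ |p.2 - q.2| < η := by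
  have hV : Y.V (.rect sw s us vs) := hd.V Vc0
  obtain ⟨gA, gB, gC, gE⟩ := GI_desc hd
  have m1 := hV.2.1.le (Nat.zero_le _) le_rfl
  have m2 := hV.2.2.1.le (Nat.zero_le _) le_rfl
  rcases h with ⟨j, hj, h⟩ | ⟨j, hj, h⟩ | ⟨j, hj, h⟩ | ⟨j, hj, h⟩ | ⟨t, ht, ht0, j, hj, hj0, h⟩
  · obtain ⟨u, hu⟩ := loc_pt hV.2.1 hj
    obtain ⟨m, hb, hG⟩ := wit_G h (gA j hj u hu)
    exact GG_near hb hG hw (box_w2 hp (loc_ge0 hV.2.1 hj hu) (loc_lem hV.2.1 hj hu) le_rfl m2)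
  · obtain ⟨u, hu⟩ := loc_pt hV.2.1 hj
    obtain ⟨m, hb, hG⟩ := wit_G h (gB j hj u hu)
    exact GG_near hb hG hw (box_w2 hp (loc_ge0 hV.2.1 hj hu) (loc_lem hV.2.1 hj hu) m2 le_rfl)
  · obtain ⟨u, hu⟩ := loc_pt hV.2.2.1 hj
    obtain ⟨m, hb, hG⟩ := wit_G h (gC j hj u hu)
    exact GG_near hb hG hw (box_w2 hp le_rfl m1 (loc_ge0 hV.2.2.1 hj hu) (loc_lem hV.2.2.1 hj hu))
  · obtain ⟨u, hu⟩ := loc_pt hV.2.2.1 hj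
    obtain ⟨m, hb, hG⟩ := wit_G h (gE j hj u hu)
    exact GG_near hb hG hw (box_w2 hp m1 le_rfl (loc_ge0 hV.2.2.1 hj hu) (loc_lem hV.2.2.1 hj hu))
  · have hR := Y.recs s hV.1
    have sU := refU_SM hV.2.1 hR.refu
    have sV := refU_SM hV.2.2.1 hR.refv
    have lU := refU_last hV.2.1 hR.refu
    have lV := refU_last hV.2.2.1 hR.refv
    have a1 := sU.lt ht0 ht.le
    have a2 := sU.lt ht le_rfl
    have a3 := sV.lt hj0 hj.le
    have a4 := sV.lt hj le_rfl
    rw [lU] at a2; rw [lV] at a4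
    have a1' : us 0 < refU us (Y.rec' s).ru t := a1
    have a3' : vs 0 < refU vs (Y.rec' s).rv j := a3
    have hz : Y.il (.rect sw s us vs) (mkP sw (refU us (Y.rec' s).ru t) (refU vs (Y.rec' s).rv j))
        ((Y.rec' s).L t (2*j)) true :=
      ⟨⟨t, ht, ht0, by simp, 2*j, by omega, by omega, by simpa using loc_even _ j, rfl, by simp⟩, mkP_lt hV a2.le a3'.le a1'.le a4.le (fun _ => Or.inl a2) (fun _ => Or.inl a1')⟩
    have hb := box_w2 hp a1'.le a2.le a3'.le a4.le
    refine ⟨_, il_Tri hd hz, ?_, lt_of_le_of_lt hb.1 hw, lt_of_le_of_lt hb.2 hw⟩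
    rw [lam_IL ⟨n, _, hd, hz⟩]; exact h

theorem twitIn_near (hd : Y.geo.Desc n Y.c0 (.tri s us)) (hp : Y.reg (.tri s us) p) (hw : Y.w (.tri s us) < η) (h : TWitIn Y.N (Y.trow s) (Y.trec s) i) : ∃ q ∈ Tri, bit (lam Y q) i /\ |p.1 - q.1| < η /\ |p.2 - q.2| < η := by
  have hV : Y.V (.tri s us) := hd.V Vc0
  obtain ⟨gL, gU⟩ := GI_desc hd
  have m1 := hV.2.le (Nat.zero_le _) le_rfl
  obtain ⟨p1, p2, p3⟩ := hp
  have box : ∀ x y, us 0 <= x -> x <= us (Y.trow s).m -> us 0 <= y -> y <= us (Y.trow s).m ->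
      |p.1 - x| <= Y.w (.tri s us) /\ |p.2 - y| <= Y.w (.tri s us) := by
    intro x y _ _ _ _
    simp only [abs_le, w]
    refine ⟨⟨?_, ?_⟩, ?_, ?_⟩ <;> linarith
  rcases h with ⟨j, hj, hj0, h⟩ | ⟨j, hj, h⟩ | ⟨t, ht, ht0, j, hj, hj0, h⟩
  · obtain ⟨u, hu⟩ := loc_pt hV.2 hj
    obtain ⟨m, hb, hG⟩ := wit_G h (gL j hj hj0 u hu)
    exact GG_near hb hG hw (box _ _ le_rfl m1 (loc_ge0 hV.2 hj hu) (loc_lem hV.2 hj hu))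
  · obtain ⟨u, hu⟩ := loc_pt hV.2 hj.le
    obtain ⟨m, hb, hG⟩ := wit_G h (gU j hj u hu)
    exact GG_near hb hG hw (box _ _ (loc_ge0 hV.2 hj.le hu) (loc_lem hV.2 hj.le hu) m1 le_rfl)
  · have hc := tc hV
    have hz : Y.il (.tri s us) (TZ (Y.trec s) us t, TX (Y.trec s) us j) ((Y.trec s).V t (2*j)) true :=
      Or.inl ⟨t, ht, ht0, rfl, 2*j, by omega, by omega, loc_even _ j, rfl, by simp⟩
    have hT := il_Tri hd hz
    obtain ⟨k, hk, hbb⟩ := gi1 hV hz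
    obtain ⟨b1, b2, b3⟩ := gA2' hV hk (gA2 (gA1 hV hk) hbb)
    simp only at b1 b2 b3
    have hb := box _ _ b1 (b3.le.trans b2) (b1.trans b3.le) b2
    refine ⟨_, hT, ?_, lt_of_le_of_lt hb.1 hw, lt_of_le_of_lt hb.2 hw⟩
    rw [lam_IL ⟨n, _, hd, hz⟩]; exact h

/-- half open cells -/
def FHo (Y : Sys) : Cell -> Pt -> Prop
  | .rect sw s us vs, p => (us 0 <= cu sw p /\ cu sw p < us (Y.row s).m /\ vs 0 <= cv sw p /\
      cv sw p < vs (Y.row s).k) /\ p.1 < p.2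
  | .tri s us, p => us 0 <= p.1 /\ p.1 < p.2 /\ p.2 < us (Y.trow s).m

def FOut (Y : Sys) : Cell -> Pt -> Prop
  | .rect sw s us vs, p => ((cv sw p = vs (Y.row s).k /\ us 0 < cu sw p /\ cu sw p < us (Y.row s).m) ∨ (cu sw p = us (Y.row s).m /\ vs 0 < cv sw p /\ cv sw p < vs (Y.row s).k)) /\ p.1 < p.2
  | .tri s us, p => p.2 = us (Y.trow s).m /\ us 0 < p.1 /\ p.1 < us (Y.trow s).m

theorem FHo_reg (h : FHo Y c p) : Y.reg c p := by
  cases c with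
  | rect sw s us vs =>
    obtain ⟨⟨a, b, c, d⟩, e⟩ := h
    exact ⟨⟨a, b.le, c, d.le⟩, e⟩
  | tri s us => exact ⟨h.1, h.2.2.le, h.2.1⟩

theorem FHo_rect (h : Y.V (.rect sw s us vs)) (ht : t < (Y.rec' s).M) : FHo Y (Y.chd (.rect sw s us vs) t) p ↔ (vs 0 <= cv sw p /\ cv sw p < vs (Y.row s).k /\ refU us (Y.rec' s).ru t <= cu sw p /\ cu sw p < refU us (Y.rec' s).ru (t+1)) /\ p.1 < p.2 := by
  obtain ⟨us', vs', e, h1, h2, h3, h4⟩ := child_us h ht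
  rw [e]; simp only [FHo, h1, h2, h3, h4, cu_not, cv_not]

theorem FOut_rect (h : Y.V (.rect sw s us vs)) (ht : t < (Y.rec' s).M) : FOut Y (Y.chd (.rect sw s us vs) t) p ↔ ((cu sw p = refU us (Y.rec' s).ru (t+1) /\ vs 0 < cv sw p /\ cv sw p < vs (Y.row s).k) ∨ (cv sw p = vs (Y.row s).k /\ refU us (Y.rec' s).ru t < cu sw p /\ cu sw p < refU us (Y.rec' s).ru (t+1))) /\ p.1 < p.2 := by
  obtain ⟨us', vs', e, h1, h2, h3, h4⟩ := child_us h ht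
  rw [e]; simp only [FOut, h1, h2, h3, h4, cu_not, cv_not]

theorem FHo_even (h : Y.V (.tri s us)) (ht : t < (Y.trec s).M) : FHo Y (Y.chd (.tri s us) (2*t)) p ↔ TZ (Y.trec s) us t <= p.1 /\ p.1 < p.2 /\ p.2 < TZ (Y.trec s) us (t+1) := by
  rw [chd_even]; simp only [FHo]; rw [(tc h).Tus_0 ht, (tc h).Tus_m ht]

theorem FHo_odd (h : Y.V (.tri s us)) (ht : t + 1 < (Y.trec s).M) : FHo Y (Y.chd (.tri s us) (2*t+1)) p ↔ (TZ (Y.trec s) us t <= p.1 /\ p.1 < TZ (Y.trec s) us (t+1) /\ TZ (Y.trec s) us (t+1) <= p.2 /\ p.2 < TZ (Y.trec s) us (Y.trec s).M) /\ p.1 < p.2 := by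
  rw [chd_odd]; simp only [FHo, cu, cv]
  rw [(tc h).Rus_0 ht, (tc h).Rus_m ht, (tc h).Rvs_0 ht, (tc h).Rvs_k ht]

theorem FHo_col (h : Y.V (.tri s us)) (ht : t < (Y.trec s).M) (h1 : TZ (Y.trec s) us t <= p.1) (h2 : p.1 < TZ (Y.trec s) us (t+1)) (h3 : p.1 < p.2) (h4 : p.2 < TZ (Y.trec s) us (Y.trec s).M) : ∃ n < Y.nch (.tri s us), 2*t <= n /\ FHo Y (Y.chd (.tri s us) n) p := by
  rcases lt_or_ge p.2 (TZ (Y.trec s) us (t+1)) with h5 | h5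
  · exact ⟨2*t, by simp only [nch]; omega, le_rfl, (FHo_even h ht).2 ⟨h1, h3, h5⟩⟩
  · have ht1 : t + 1 < (Y.trec s).M := by
      by_contra hc
      have e : t + 1 = (Y.trec s).M := by omega
      rw [e] at h5; linarith
    exact ⟨2*t+1, by simp only [nch]; omega, by omega, (FHo_odd h ht1).2 ⟨⟨h1, h2, h5, h4⟩, h3⟩⟩

theorem FHo_cov (h : Y.V c) (hp : FHo Y c p) : ∃ t < Y.nch c, FHo Y (Y.chd c t) p := by
  cases c with
  | rect sw s us vs =>
    obtain ⟨⟨a1, a2, a3, a4⟩, a5⟩ := hp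
    obtain ⟨t, ht, b1, b2⟩ := refcov (us := refU us (Y.rec' s).ru) (M := (Y.rec' s).M) a1
        (by rwa [(rc h).U_M])
    exact ⟨t, ht, (FHo_rect h ht).2 ⟨⟨a3, a4, b1, b2⟩, a5⟩⟩
  | tri s us =>
    obtain ⟨a1, a2, a3⟩ := hp
    rw [<- (tc h).Z_M] at a3
    obtain ⟨t, ht, b1, b2⟩ := refcov (us := TZ (Y.trec s) us) (M := (Y.trec s).M) (x := p.1) a1 (by linarith)
    obtain ⟨n, hn, _, h1⟩ := FHo_col h ht b1 b2 a2 a3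
    exact ⟨n, hn, h1⟩

theorem FOut_out {r : Pt} (h : Y.V c) (ht : t < Y.nch c) (ho : FOut Y (Y.chd c t) r) : FOut Y c r ∨ ∃ t' < Y.nch c, Y.nch c - t' < Y.nch c - t /\ FHo Y (Y.chd c t') r := by
  cases c with
  | rect sw s us vs =>
    have hc := rc h
    rw [FOut_rect h ht] at ho
    obtain ⟨⟨a1, a2, a3⟩ | ⟨a1, a2, a3⟩, a4⟩ := ho
    · rcases Nat.lt_or_ge (t+1) (Y.rec' s).M with h1 | h1
      · right
        refine ⟨t+1, h1, by simp only [nch]; omega, (FHo_rect h h1).2 ⟨⟨a2.le, a3, a1.ge, ?_⟩, a4⟩⟩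
        rw [a1]; exact hc.U_SM (t+1) h1
      · left
        have e : t + 1 = (Y.rec' s).M := by simp only [nch] at ht; omega
        rw [e, hc.U_M] at a1
        exact ⟨Or.inr ⟨a1, a2, a3⟩, a4⟩
    · left
      refine ⟨Or.inl ⟨a1, lt_of_le_of_lt (hc.U_SM.le (Nat.zero_le t) (le_of_lt ht)) a2, ?_⟩, a4⟩
      rw [<- hc.U_M]
      exact lt_of_lt_of_le a3 (hc.U_SM.le ht le_rfl)
  | tri s us =>
    have hc := tc h
    have hZ := hc.Z_SM
    rcases tidx ht with ⟨t, rfl, ht'⟩ | ⟨t, rfl, ht'⟩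
    · rw [chd_even] at ho
      simp only [FOut] at ho
      rw [hc.Tus_0 ht', hc.Tus_m ht'] at ho
      obtain ⟨a1, a2, a3⟩ := ho
      rcases Nat.lt_or_ge (t+1) (Y.trec s).M with h1 | h1
      · right
        refine ⟨2*t+1, by simp only [nch]; omega, by simp only [nch]; omega, (FHo_odd h h1).2 ⟨⟨a2.le, a3, a1.ge, ?_⟩, by rw [a1]; exact a3⟩⟩
        rw [a1]; exact hZ.lt h1 le_rfl
      · left
        have e : t + 1 = (Y.trec s).M := by omega
        rw [e, hc.Z_M] at a1 a3
        exact ⟨a1, lt_of_le_of_lt (hZ.le (Nat.zero_le t) ht'.le) a2, a3⟩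
    · rw [chd_odd] at ho
      simp only [FOut, cu, cv] at ho
      rw [hc.Rus_0 ht', hc.Rus_m ht', hc.Rvs_0 ht', hc.Rvs_k ht'] at ho
      obtain ⟨⟨a1, a2, a3⟩ | ⟨a1, a2, a3⟩, a4⟩ := ho
      · left
        rw [hc.Z_M] at a1
        refine ⟨a1, lt_of_le_of_lt (hZ.le (Nat.zero_le t) (by omega)) a2, by rw [<- a1]; exact a4⟩
      · right
        obtain ⟨n, hn, hn', h1⟩ := FHo_col h ht' a1.ge (by rw [a1]; exact hZ (t+1) ht') a4 a3
        exact ⟨n, hn, by omega, h1⟩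

theorem EdgeOK.up (h : EdgeOK N m A) (hi : i <= N) (hj : j < 2*m) (hb : bit (A j).hi.f i) : bit (A (2*(j/2)+1)).hi.f i := by
  obtain ⟨a, rfl | rfl⟩ := Nat.even_or_odd' j
  · rw [show 2*(2*a/2)+1 = 2*a+1 by omega]
    exact ((h.2 a (by omega)).1 i hi).1 hb
  · rwa [show 2*((2*a+1)/2)+1 = 2*a+1 by omega]

/-- a point of the slot around or after `u` -/
theorem slot_after (h : SM us m) (hj : j < 2*m) (hl : loc us j u) : ∃ u', u < u' /\ loc us (2*(j/2)+1) u' /\ us 0 < u' /\ u' < us m := by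
  have h1 : us (j/2) <= u /\ u < us (j/2+1) := by
    obtain ⟨a, rfl | rfl⟩ := Nat.even_or_odd' j
    · rw [loc_even_iff] at hl
      rw [show 2*a/2 = a by omega, hl]; exact ⟨le_rfl, h a (by omega)⟩
    · rw [loc_odd_iff] at hl
      rw [show (2*a+1)/2 = a by omega]; exact ⟨hl.1.le, hl.2⟩
  have h2 := h.le (Nat.zero_le (j/2)) (by omega)
  have h3 := h.le (show j/2+1 <= m by omega) le_rfl
  exact ⟨(u + us (j/2+1))/2, by linarith [h1.2], loc_odd_iff.2 ⟨by linarith, by linarith⟩, by linarith, by linarith⟩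

theorem F_task (hd : Y.geo.Desc n Y.c0 c) (hp : FHo Y c p) (hb : Y.bd c p g) (hi : i <= Y.N) (hg : bit g.2.f i) (hw : Y.w c < η) : (∃ q ∈ Tri, bit (lam Y q) i /\ |p.1 - q.1| < η /\ |p.2 - q.2| < η) ∨ ∃ r : Pt, (p.1 <= r.1 /\ p.2 <= r.2) /\ FOut Y c r /\ ∃ g', Y.bd c r g' /\ bit g'.2.f i := by
  have hV : Y.V c := hd.V Vc0
  have hreg := FHo_reg hp
  cases c with
  | rect sw s us vs =>
    have hr := Y.rows s hV.1
    have hR := Y.recs s hV.1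
    have le_mk : ∀ u v, cu sw p <= u -> cv sw p <= v -> p.1 <= (mkP sw u v).1 /\ p.2 <= (mkP sw u v).2 := by
      intro u v h1 h2
      cases sw
      · exact ⟨h1, h2⟩
      · exact ⟨h2, h1⟩
    obtain ⟨⟨a1, a2, a3, a4⟩, a5⟩ := hp
    have hs1 : 0 < 2*(Y.row s).m := by have := hr.hm; omega
    have hs2 : 0 < 2*(Y.row s).k := by have := hr.hk; omega
    -- leaving through the upper edge
    have outB : ∀ j < 2*(Y.row s).m, ∀ u, cu sw p <= u -> loc us j u -> bit ((Y.row s).B (2*(j/2)+1)).hi.f i -> ∃ r : Pt, (p.1 <= r.1 /\ p.2 <= r.2) /\ FOut Y (.rect sw s us vs) r /\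
          ∃ g', Y.bd (.rect sw s us vs) r g' /\ bit g'.2.f i := by
      intro j hj u hu hl hB
      obtain ⟨u', k1, k2, k3, k4⟩ := slot_after hV.2.1 hj hl
      have hlt := mkP_lt hV k4.le (a3.trans a4.le) k3.le le_rfl (fun _ => Or.inl k4) (fun _ => Or.inl k3)
      exact ⟨mkP sw u' (vs (Y.row s).k), le_mk _ _ (by linarith) a4.le, ⟨Or.inl ⟨by simp, by simpa using k3, by simpa using k4⟩, hlt⟩, _, ⟨⟨_, Or.inr (Or.inl ⟨by simp, _, by omega, by simpa using k2, rfl⟩), rfl⟩, hlt⟩, hB⟩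
    have outE : ∀ j < 2*(Y.row s).k, ∀ v, cv sw p <= v -> loc vs j v -> bit ((Y.row s).E (2*(j/2)+1)).hi.f i -> ∃ r : Pt, (p.1 <= r.1 /\ p.2 <= r.2) /\ FOut Y (.rect sw s us vs) r /\
          ∃ g', Y.bd (.rect sw s us vs) r g' /\ bit g'.2.f i := by
      intro j hj v hv hl hB
      obtain ⟨v', k1, k2, k3, k4⟩ := slot_after hV.2.2.1 hj hl
      have hlt := mkP_lt hV le_rfl k3.le (a1.trans a2.le) k4.le (fun _ => Or.inr k3) (fun _ => Or.inr k4)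
      exact ⟨mkP sw (us (Y.row s).m) v', le_mk _ _ a2.le (by linarith), ⟨Or.inr ⟨by simp, by simpa using k3, by simpa using k4⟩, hlt⟩, _, ⟨⟨_, Or.inr (Or.inr (Or.inr ⟨by simp, _, by omega, by simpa using k2, rfl⟩)), rfl⟩, hlt⟩, hB⟩
    obtain ⟨⟨e, he, rfl⟩, _⟩ := hb
    rcases he with ⟨h1, j, hj, hl, rfl⟩ | ⟨h1, _⟩ | ⟨h1, j, hj, hl, rfl⟩ | ⟨h1, _⟩
    · have hj' := (loc_lt_iff hV.2.1 hj hl).1 a2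
      rcases hR.FA (j/2) (by omega) i hi (EdgeOK.up hr.eA hi hj' hg) with h2 | h2 | h2
      · exact Or.inr (outB j hj' _ le_rfl hl h2)
      · exact Or.inr (outE 0 hs2 (vs 0) h1.le (loc_even vs 0) (by simpa using h2))
      · exact Or.inl (witIn_near hd hreg hw h2)
    · exact absurd h1 a4.ne
    · have hj' := (loc_lt_iff hV.2.2.1 hj hl).1 a4
      rcases hR.FC (j/2) (by omega) i hi (EdgeOK.up hr.eC hi hj' hg) with h2 | h2 | h2
      · exact Or.inr (outE j hj' _ le_rfl hl h2)
      · exact Or.inr (outB 0 hs1 (us 0) h1.le (loc_even us 0) (by simpa using h2))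
      · exact Or.inl (witIn_near hd hreg hw h2)
    · exact absurd h1 a2.ne
  | tri s us =>
    have hr := Y.trows s hV.1
    have hR := Y.trecs s hV.1
    obtain ⟨a1, a2, a3⟩ := hp
    obtain ⟨e, he, rfl⟩ := hb
    rcases he with ⟨h1, j, hj, hj0, hl, rfl⟩ | ⟨h1, _⟩
    · have hj' := (loc_lt_iff hV.2 hj hl).1 a3
      have hg' : bit ((Y.trow s).L (2*(j/2)+1)).hi.f i := by
        obtain ⟨a, rfl | rfl⟩ := Nat.even_or_odd' j
        · rw [show 2*(2*a/2)+1 = 2*a+1 by omega]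
          exact ((hr.eL1 a (by omega) (by omega)) i hi).1 hg
        · rwa [show 2*((2*a+1)/2)+1 = 2*a+1 by omega]
      rcases hR.TF (j/2) (by omega) i hi hg' with h2 | h2
      · right
        obtain ⟨u', k1, k2, k3, k4⟩ := slot_after hV.2 (j := 0) (by have := hr.hm; omega) (loc_even us 0)
        exact ⟨(u', us (Y.trow s).m), ⟨by rw [h1]; exact k3.le, a3.le⟩, ⟨rfl, k3, k4⟩, _, ⟨_, Or.inr ⟨rfl, 1, by have := hr.hm; omega, k2, rfl⟩, rfl⟩, h2⟩
      · exact Or.inl (twitIn_near hd hreg hw h2)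
    · exact absurd h1 a3.ne

/-- the resolver for future demands -/
noncomputable def Fres (Y : Sys) {i : ℕ} (hi : i <= Y.N) {η : ℝ} {n : ℕ} (hn : ∀ d, Y.geo.Desc n Y.c0 d -> Y.w d < η) : Geo.Res Y.geo Y.c0 where
  Ho := FHo Y
  Out := FOut Y
  le p q := p.1 <= q.1 /\ p.2 <= q.2
  Hit p := ∃ q ∈ Tri, bit (lam Y q) i /\ p.1 - η < q.1 /\ p.2 - η < q.2
  dem g := bit g.2.f i
  n := n
  mu c t := Y.nch c - t
  hreg _ h := FHo_reg h
  hcov := FHo_cov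
  out := FOut_out
  le_trans h1 h2 := ⟨h1.1.trans h2.1, h1.2.trans h2.2⟩
  hit := by
    rintro p q ⟨h1, h2⟩ ⟨r, hr, hb, h3, h4⟩
    exact ⟨r, hr, hb, by linarith, by linarith⟩
  task := by
    intro c p g _ hd hp hb hg
    rcases F_task hd hp hb hi hg (hn c hd) with ⟨q, hq, hb, h1, h2⟩ | h
    · left
      rw [abs_lt] at h1 h2
      exact ⟨q, hq, hb, by linarith, by linarith⟩
    · exact Or.inr h

/-- a done point of the triangle with a future demand has a witness which is almost above it -/
theorem F_near (hp : p ∈ Tri) (hd : Y.geo.Done Y.c0 p g) (hi : i <= Y.N) (hb : bit g.2.f i) (hη : 0 < η) : ∃ q ∈ Tri, bit (lam Y q) i /\ p.1 - η < q.1 /\ p.2 - η < q.2 := by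
  obtain ⟨n1, hn1⟩ := Geo.small (T := Y.geo) (c := Y.c0) Vc0 hη
  obtain ⟨n2, d, hd2, hb2⟩ := id hd
  have e1 : Y.geo.Desc n2 Y.c0 d := hd2
  have hHo : FHo Y Y.c0 p := by
    obtain ⟨a, b, c⟩ := hp
    have := m0 (Y := Y)
    refine ⟨?_, b, ?_⟩
    · simpa using a.le
    · show p.2 < ((Y.trow Y.s0).m:ℝ) / _
      rw [div_self this.ne']; exact c
  rcases (Fres Y hi (n := max n1 n2) (hn1 _ (le_max_left _ _))).resolve Vc0 (le_max_right _ _) e1 hb2 hHo hb with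
    h | ⟨r, hr, g', hg', hb'⟩
  · exact h
  · exfalso
    obtain ⟨r1, r2, r3⟩ : FOut Y Y.c0 r := hr
    have hr0 := Y.trows _ Y.hs0
    have hu := (Vc0 (Y := Y)).2
    obtain ⟨j, hj, hl⟩ := loc_exists (us := fun i : ℕ => (i:ℝ) / ((Y.trow Y.s0).m : ℝ)) (m := (Y.trow Y.s0).m) r2.le r3.le
    have hj' := (loc_lt_iff hu hj hl).1 r3
    have hbd : Y.bd Y.c0 r (gap ((Y.trow Y.s0).U j)) := ⟨_, Or.inr ⟨r1, j, hj', hl, rfl⟩, rfl⟩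
    have := hg'.unique Vc0 ⟨0, Y.c0, rfl, hbd⟩
    rw [this] at hb'
    have hb'' : bit ((Y.trow Y.s0).U j).hi.f i := hb'
    refine Y.root.U (j/2) (by omega) i hi ?_
    obtain ⟨a, rfl | rfl⟩ := Nat.even_or_odd' j
    · rw [show 2*(2*a/2)+1 = 2*a+1 by omega]
      exact ((hr0.eU1 a (by omega)) i hi).1 hb''
    · rwa [show 2*((2*a+1)/2)+1 = 2*a+1 by omega]

/-! ## Part B11: strict start for future demands -/

variable {Y : Sys} {c : Cell}

theorem FHo_n (k : ℕ) : ∀ {c : Cell} {p : Pt}, Y.V c -> FHo Y c p -> ∃ d, Y.geo.Desc k c d /\ FHo Y d p := by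
  induction k with
  | zero => intro c p hc h; exact ⟨c, rfl, h⟩
  | succ k ih =>
    intro c p hc h
    obtain ⟨t, ht, h1⟩ := FHo_cov hc h
    obtain ⟨d, h2, h3⟩ := ih (gA1 hc ht) h1
    exact ⟨d, ⟨t, ht, h2⟩, h3⟩

theorem FHo_c0 (hp : p ∈ Tri) : FHo Y Y.c0 p := by
  obtain ⟨a, b, c⟩ := hp
  have := m0 (Y := Y)
  refine ⟨?_, b, ?_⟩
  · simpa using a.le
  · show p.2 < ((Y.trow Y.s0).m:ℝ) / _
    rw [div_self this.ne']; exact c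

theorem F_ray (hV : Y.V (.rect sw s us vs)) (hp : FHo Y (.rect sw s us vs) p) (hb : Y.bd (.rect sw s us vs) p g) (hi : i <= Y.N) (hg : bit g.2.f i) : ∃ sw' b, cu sw' p < b /\ (∀ u, cu sw' p <= u -> u < b -> (mkP sw' u (cv sw' p)).1 < (mkP sw' u (cv sw' p)).2 -> ∃ g', Y.bd (.rect sw s us vs) (mkP sw' u (cv sw' p)) g' /\ bit g'.2.f i) /\ ∀ r, Y.reg (.rect sw s us vs) r -> cv sw' p <= cv sw' r := by
  have hr := Y.rows s hV.1
  obtain ⟨⟨a1, a2, a3, a4⟩, a5⟩ := hp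
  have key : ∀ {us : ℕ -> ℝ} {m j : ℕ} {u : ℝ}, SM us m -> j < 2*m -> loc us j u -> u < us (j/2+1) /\
      ∀ u', u ≤ u' -> u' < us (j/2+1) -> loc us j u' ∨ loc us (2*(j/2)+1) u' := by
    intro us m j u h hj hl
    obtain ⟨a, rfl | rfl⟩ := Nat.even_or_odd' j
    · rw [loc_even_iff] at hl
      rw [show 2*a/2 = a by omega, hl]
      refine ⟨h a (by omega), fun u' h1 h2 => ?_⟩
      rcases h1.eq_or_lt with h3 | h3
      · exact Or.inl (loc_even_iff.2 h3.symm)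
      · exact Or.inr (loc_odd_iff.2 ⟨h3, h2⟩)
    · rw [loc_odd_iff] at hl
      rw [show (2*a+1)/2 = a by omega]
      exact ⟨hl.2, fun u' h1 h2 => Or.inr (loc_odd_iff.2 ⟨by linarith [hl.1], h2⟩)⟩
  obtain ⟨⟨e, he, rfl⟩, _⟩ := hb
  rcases he with ⟨h1, j, hj, hl, rfl⟩ | ⟨h1, _⟩ | ⟨h1, j, hj, hl, rfl⟩ | ⟨h1, _⟩
  · have hj' := (loc_lt_iff hV.2.1 hj hl).1 a2
    obtain ⟨k1, k2⟩ := key hV.2.1 hj' hl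
    refine ⟨sw, _, k1, fun u h2 h3 h4 => ?_, fun r hr => by rw [h1]; exact hr.1.2.2.1⟩
    rcases k2 u h2 h3 with h5 | h5
    · exact ⟨_, ⟨⟨_, Or.inl ⟨by simpa using h1, j, hj, by simpa using h5, rfl⟩, rfl⟩, h4⟩, hg⟩
    · exact ⟨_, ⟨⟨_, Or.inl ⟨by simpa using h1, _, by omega, by simpa using h5, rfl⟩, rfl⟩, h4⟩, EdgeOK.up hr.eA hi hj' hg⟩
  · exact absurd h1 a4.ne
  · have hj' := (loc_lt_iff hV.2.2.1 hj hl).1 a4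
    obtain ⟨k1, k2⟩ := key hV.2.2.1 hj' hl
    refine ⟨!sw, _, by rw [cu_not]; exact k1, fun u h2 h3 h4 => ?_, fun r hr => by
      rw [cv_not, cv_not, h1]; exact hr.1.1⟩
    rw [cu_not] at h2
    simp only [mkP_not, cv_not] at h4 ⊢
    rcases k2 u h2 h3 with h5 | h5
    · exact ⟨_, ⟨⟨_, Or.inr (Or.inr (Or.inl ⟨by simpa using h1, j, hj, by simpa using h5, rfl⟩)), rfl⟩, h4⟩, hg⟩
    · exact ⟨_, ⟨⟨_, Or.inr (Or.inr (Or.inl ⟨by simpa using h1, _, by omega, by simpa using h5, rfl⟩)), rfl⟩, h4⟩, EdgeOK.up hr.eC hi hj' hg⟩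
  · exact absurd h1 a2.ne

theorem pl_mk (h1 : cu sw p < u) (h2 : cv sw p < v) : pl p (mkP sw u v) := by
  cases sw
  · exact ⟨h1, h2⟩
  · exact ⟨h2, h1⟩

theorem mk_pl (h1 : u < cu sw p) (h2 : v < cv sw p) : pl (mkP sw u v) p := by
  cases sw
  · exact ⟨h1, h2⟩
  · exact ⟨h2, h1⟩

theorem F_start (hp : p ∈ Tri) (hd : Y.geo.Done Y.c0 p g) (hi : i <= Y.N) (hb : bit g.2.f i) : ∃ r g', r ∈ Tri /\ pl p r /\ Y.geo.Done Y.c0 r g' /\ bit g'.2.f i := by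
  obtain ⟨n0, hn0⟩ := deep_rect (Y := Y) hp
  obtain ⟨n, d0, h1, h2⟩ := id hd
  obtain ⟨d, hd1, hd2⟩ := FHo_n (Y := Y) (n + n0) Vc0 (FHo_c0 hp)
  have hbd : Y.bd d p g := Geo.bd_of_reg (T := Y.geo) (c := Y.c0) Vc0 h1 h2 hd1 (FHo_reg hd2)
  obtain ⟨sw, s, us, vs, rfl⟩ := hn0 _ (Nat.le_add_left _ _) d hd1 (FHo_reg hd2)
  have hV : Y.V (.rect sw s us vs) := hd1.V Vc0
  obtain ⟨sw', b, k1, k2, k3⟩ := F_ray hV hd2 hbd hi hb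
  obtain ⟨p1, p2, p3⟩ := id hp
  obtain ⟨η, e0, e1, e2, e3⟩ : ∃ η : ℝ, 0 < η /\ η <= (p.2 - p.1)/2 /\ η <= 1 - p.2 /\ η <= b - cu sw' p :=
    ⟨min (min ((p.2-p.1)/2) (1-p.2)) (b - cu sw' p), lt_min (lt_min (by linarith) (by linarith)) (by linarith), (min_le_left _ _).trans (min_le_left _ _), (min_le_left _ _).trans (min_le_right _ _), min_le_right _ _⟩
  obtain ⟨n2, hn2⟩ := Geo.small (T := Y.geo) (c := Y.c0) Vc0 e0
  obtain ⟨e, he1, he2⟩ := FHo_n (Y := Y) n2 hV hd2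
  have he : Y.geo.Desc (n + n0 + n2) Y.c0 e := hd1.append he1
  have hw : Y.w e < η := hn2 _ (by omega) e he
  obtain ⟨sw1, s1, us1, vs1, rfl⟩ := hn0 _ (by omega) e he (FHo_reg he2)
  have hV1 : Y.V (.rect sw1 s1 us1 vs1) := he.V Vc0
  have hr := Y.rows s1 hV1.1
  have hreg := FHo_reg he2
  obtain ⟨⟨a1, a2, a3, a4⟩, a5⟩ := he2
  have hu := hV1.2.1.lt hr.hm le_rfl
  have hv := hV1.2.2.1.lt hr.hk le_rfl
  have near : ∀ u v, us1 0 <= u -> u <= us1 (Y.row s1).m -> vs1 0 <= v -> v <= vs1 (Y.row s1).k -> (mkP sw1 u v).1 < (mkP sw1 u v).2 /\ (mkP sw1 u v).2 < 1 /\ u - cu sw1 p < η /\ v - cv sw1 p < η := by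
    intro u v h1 h2 h3 h4
    obtain ⟨h5, h6⟩ := box_w2 hreg h1 h2 h3 h4
    rw [abs_le] at h5 h6
    refine ⟨by linarith, by linarith, ?_⟩
    cases sw1 <;> simp only [mkP, cu, cv] at * <;> constructor <;> linarith
  have fin : ∀ u v g', us1 0 <= u -> u <= us1 (Y.row s1).m -> vs1 0 <= v -> v <= vs1 (Y.row s1).k -> cu sw1 p < u -> cv sw1 p < v -> bdg (Y.row s1) us1 vs1 u v g' -> bit g'.2.f i ->
      ∃ r g', r ∈ Tri /\ pl p r /\ Y.geo.Done Y.c0 r g' /\ bit g'.2.f i := by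
    intro u v g' h1 h2 h3 h4 h5 h6 h7 h8
    obtain ⟨l1, l2, _⟩ := near u v h1 h2 h3 h4
    have hpl := pl_mk h5 h6
    refine ⟨_, g', ⟨?_, l1, l2⟩, hpl, ⟨_, _, he, ⟨?_, l1⟩⟩, h8⟩
    · exact p1.trans hpl.1
    · simpa using h7
  have hsub : ∀ r, Y.reg (.rect sw1 s1 us1 vs1) r -> cv sw' p <= cv sw' r := fun r h =>
    k3 r (he1.reg hV h)
  have hgap : ∀ {r g1}, Y.bd (.rect sw s us vs) r g1 -> Y.reg (.rect sw1 s1 us1 vs1) r -> Y.bd (.rect sw1 s1 us1 vs1) r g1 := fun h h' => Geo.bd_desc (T := Y.geo) (c := .rect sw s us vs) hV h he1 h'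
  have hreg' : ∀ u v, us1 0 <= u -> u <= us1 (Y.row s1).m -> vs1 0 <= v -> v <= vs1 (Y.row s1).k -> Y.reg (.rect sw1 s1 us1 vs1) (mkP sw1 u v) := fun u v h1 h2 h3 h4 =>
    ⟨by simpa using ⟨h1, h2, h3, h4⟩, (near u v h1 h2 h3 h4).1⟩
  rcases (by cases sw' <;> cases sw1 <;> simp : sw' = sw1 ∨ sw' = !sw1) with rfl | rfl
  · -- corner at the end of the lower edge
    have hc : cv sw' p = vs1 0 := by
      have := hsub _ (hreg' (us1 0) (vs1 0) le_rfl hu.le le_rfl hv.le)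
      simp only [cv_mkP] at this
      exact le_antisymm this a3
    obtain ⟨g1, m1, m2⟩ := k2 (us1 (Y.row s1).m) a2.le
      (by have := (near (us1 (Y.row s1).m) (vs1 0) hu.le le_rfl le_rfl hv.le).2.2.1; linarith)
      (by rw [hc]; exact (near _ _ hu.le le_rfl le_rfl hv.le).1)
    rw [hc] at m1
    have m3 := hgap m1 (hreg' _ _ hu.le le_rfl le_rfl hv.le)
    have m4 : g1 = gap ((Y.row s1).E 0) := gA3 hV1 m3
      ⟨⟨_, Or.inr (Or.inr (Or.inr ⟨by simp, 0, by omega, by simpa using loc_even vs1 0, rfl⟩)), rfl⟩, m3.2⟩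
    rw [m4] at m2
    obtain ⟨v', l1, l2, l3, l4⟩ := slot_after hV1.2.2.1 (j := 0) (by have := hr.hk; omega) (loc_even vs1 0)
    exact fin (us1 (Y.row s1).m) v' _ hu.le le_rfl l3.le l4.le a2 (by rw [hc]; exact l3)
      ⟨_, Or.inr (Or.inr (Or.inr ⟨rfl, _, by have := hr.hk; omega, l2, rfl⟩)), rfl⟩
      (EdgeOK.up hr.eE hi (by have := hr.hk; omega) m2)
  · simp only [mkP_not, cv_not, cu_not] at *
    have hc : cu sw1 p = us1 0 := by
      have := hsub _ (hreg' (us1 0) (vs1 0) le_rfl hu.le le_rfl hv.le)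
      simp only [cu_mkP] at this
      exact le_antisymm this a1
    obtain ⟨g1, m1, m2⟩ := k2 (vs1 (Y.row s1).k) a4.le
      (by have := (near (us1 0) (vs1 (Y.row s1).k) le_rfl hu.le hv.le le_rfl).2.2.2; linarith)
      (by rw [hc]; exact (near _ _ le_rfl hu.le hv.le le_rfl).1)
    rw [hc] at m1
    have m3 := hgap m1 (hreg' _ _ le_rfl hu.le hv.le le_rfl)
    have m4 : g1 = gap ((Y.row s1).B 0) := gA3 hV1 m3
      ⟨⟨_, Or.inr (Or.inl ⟨by simp, 0, by omega, by simpa using loc_even us1 0, rfl⟩), rfl⟩, m3.2⟩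
    rw [m4] at m2
    obtain ⟨u', l1, l2, l3, l4⟩ := slot_after hV1.2.1 (j := 0) (by have := hr.hm; omega) (loc_even us1 0)
    exact fin u' (vs1 (Y.row s1).k) _ l3.le l4.le hv.le le_rfl (by rw [hc]; exact l3) a4
      ⟨_, Or.inr (Or.inl ⟨rfl, _, by have := hr.hm; omega, l2, rfl⟩), rfl⟩
      (EdgeOK.up hr.eB hi (by have := hr.hm; omega) m2)

/-- every future demand is met -/
theorem F_ok (hp : p ∈ Tri) (hg : GapOf Y p g) (hi : i <= Y.N) (hb : bit g.2.f i) : ∃ q ∈ Tri, pl p q /\ bit (lam Y q) i := by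
  have hex : ∃ r g', r ∈ Tri /\ pl p r /\ Y.geo.Done Y.c0 r g' /\ bit g'.2.f i := by
    rcases hg with hg | ⟨hl, rfl⟩
    · exact F_start hp hg hi hb
    · have hb' : bit (HI Y p).f i := hb
      simp only [HI, bit_setN] at hb'
      obtain ⟨_, q, g', h1, h2, h3⟩ := hb'
      obtain ⟨r, g1, l1, l2, l3⟩ := hl.above h1
      obtain ⟨n, d, m1, m2⟩ := id h2
      have hq := reg_c0.1 (m1.reg Vc0 (gA2 (m1.V Vc0) m2))
      obtain ⟨n', d', m1', m2'⟩ := id l1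
      have hr := reg_c0.1 (m1'.reg Vc0 (gA2 (m1'.V Vc0) m2'))
      exact ⟨r, g1, ⟨hp.1.trans l2.1, hr.2.2, lt_of_lt_of_le l3.2 hq.2.1⟩, l2, l1, ((Geo.coh (T := Y.geo) (c := Y.c0) Vc0 l1 h2 l3) i hi).1 h3⟩
  obtain ⟨r, g', h1, h2, h3, h4⟩ := hex
  obtain ⟨q, q1, q2, q3, q4⟩ := F_near h1 h3 hi h4 (η := min (r.1 - p.1) (r.2 - p.2))
    (lt_min (by linarith [h2.1]) (by linarith [h2.2]))
  have t1 := min_le_left (r.1 - p.1) (r.2 - p.2)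
  have t2 := min_le_right (r.1 - p.1) (r.2 - p.2)
  exact ⟨q, q1, ⟨by linarith, by linarith⟩, q2⟩

/-! ## Part B12: resolving past demands (mirror image of parts B10, B11) -/

variable {Y : Sys} {c : Cell}

def PHo (Y : Sys) : Cell -> Pt -> Prop
  | .rect sw s us vs, p => (us 0 < cu sw p /\ cu sw p <= us (Y.row s).m /\ vs 0 < cv sw p /\
      cv sw p <= vs (Y.row s).k) /\ p.1 < p.2
  | .tri s us, p => us 0 < p.1 /\ p.1 < p.2 /\ p.2 <= us (Y.trow s).m

def POut (Y : Sys) : Cell -> Pt -> Prop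
  | .rect sw s us vs, p => ((cv sw p = vs 0 /\ us 0 < cu sw p /\ cu sw p < us (Y.row s).m) ∨ (cu sw p = us 0 /\ vs 0 < cv sw p /\ cv sw p < vs (Y.row s).k)) /\ p.1 < p.2
  | .tri s us, p => p.1 = us 0 /\ us 0 < p.2 /\ p.2 < us (Y.trow s).m

theorem PHo_reg (h : PHo Y c p) : Y.reg c p := by
  cases c with
  | rect sw s us vs =>
    obtain ⟨⟨a, b, c, d⟩, e⟩ := h
    exact ⟨⟨a.le, b, c.le, d⟩, e⟩
  | tri s us => exact ⟨h.1.le, h.2.2, h.2.1⟩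

theorem PHo_rect (h : Y.V (.rect sw s us vs)) (ht : t < (Y.rec' s).M) : PHo Y (Y.chd (.rect sw s us vs) t) p ↔ (vs 0 < cv sw p /\ cv sw p <= vs (Y.row s).k /\ refU us (Y.rec' s).ru t < cu sw p /\ cu sw p <= refU us (Y.rec' s).ru (t+1)) /\ p.1 < p.2 := by
  obtain ⟨us', vs', e, h1, h2, h3, h4⟩ := child_us h ht
  rw [e]; simp only [PHo, h1, h2, h3, h4, cu_not, cv_not]

theorem POut_rect (h : Y.V (.rect sw s us vs)) (ht : t < (Y.rec' s).M) : POut Y (Y.chd (.rect sw s us vs) t) p ↔ ((cu sw p = refU us (Y.rec' s).ru t /\ vs 0 < cv sw p /\ cv sw p < vs (Y.row s).k) ∨ (cv sw p = vs 0 /\ refU us (Y.rec' s).ru t < cu sw p /\ cu sw p < refU us (Y.rec' s).ru (t+1))) /\ p.1 < p.2 := by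
  obtain ⟨us', vs', e, h1, h2, h3, h4⟩ := child_us h ht
  rw [e]; simp only [POut, h1, h2, h3, h4, cu_not, cv_not]

theorem PHo_even (h : Y.V (.tri s us)) (ht : t < (Y.trec s).M) : PHo Y (Y.chd (.tri s us) (2*t)) p ↔ TZ (Y.trec s) us t < p.1 /\ p.1 < p.2 /\ p.2 <= TZ (Y.trec s) us (t+1) := by
  rw [chd_even]; simp only [PHo]; rw [(tc h).Tus_0 ht, (tc h).Tus_m ht]

theorem PHo_odd (h : Y.V (.tri s us)) (ht : t + 1 < (Y.trec s).M) : PHo Y (Y.chd (.tri s us) (2*t+1)) p ↔ (TZ (Y.trec s) us t < p.1 /\ p.1 <= TZ (Y.trec s) us (t+1) /\ TZ (Y.trec s) us (t+1) < p.2 /\ p.2 <= TZ (Y.trec s) us (Y.trec s).M) /\ p.1 < p.2 := by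
  rw [chd_odd]; simp only [PHo, cu, cv]
  rw [(tc h).Rus_0 ht, (tc h).Rus_m ht, (tc h).Rvs_0 ht, (tc h).Rvs_k ht]

theorem PHo_col (h : Y.V (.tri s us)) (ht : t < (Y.trec s).M) (h1 : TZ (Y.trec s) us t < p.1) (h2 : p.1 <= TZ (Y.trec s) us (t+1)) (h3 : p.1 < p.2) (h4 : p.2 <= TZ (Y.trec s) us (Y.trec s).M) : ∃ n < Y.nch (.tri s us), n <= 2*t+1 /\ PHo Y (Y.chd (.tri s us) n) p := by
  rcases le_or_gt p.2 (TZ (Y.trec s) us (t+1)) with h5 | h5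
  · exact ⟨2*t, by simp only [nch]; omega, by omega, (PHo_even h ht).2 ⟨h1, h3, h5⟩⟩
  · have ht1 : t + 1 < (Y.trec s).M := by
      by_contra hc
      have e : t + 1 = (Y.trec s).M := by omega
      rw [e] at h5; linarith
    exact ⟨2*t+1, by simp only [nch]; omega, by omega, (PHo_odd h ht1).2 ⟨⟨h1, h2, h5, h4⟩, h3⟩⟩

theorem PHo_cov (h : Y.V c) (hp : PHo Y c p) : ∃ t < Y.nch c, PHo Y (Y.chd c t) p := by
  cases c with
  | rect sw s us vs =>
    obtain ⟨⟨a1, a2, a3, a4⟩, a5⟩ := hp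
    obtain ⟨t, ht, b1, b2⟩ := refcov' (us := refU us (Y.rec' s).ru) (M := (Y.rec' s).M) a1
        (by rwa [(rc h).U_M])
    exact ⟨t, ht, (PHo_rect h ht).2 ⟨⟨a3, a4, b1, b2⟩, a5⟩⟩
  | tri s us =>
    obtain ⟨a1, a2, a3⟩ := hp
    rw [<- (tc h).Z_M] at a3
    obtain ⟨t, ht, b1, b2⟩ := refcov' (us := TZ (Y.trec s) us) (M := (Y.trec s).M) (x := p.1) a1 (by linarith)
    obtain ⟨n, hn, _, h1⟩ := PHo_col h ht b1 b2 a2 a3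
    exact ⟨n, hn, h1⟩

theorem POut_out {r : Pt} (h : Y.V c) (ht : t < Y.nch c) (ho : POut Y (Y.chd c t) r) : POut Y c r ∨ ∃ t' < Y.nch c, t' < t /\ PHo Y (Y.chd c t') r := by
  cases c with
  | rect sw s us vs =>
    have hc := rc h
    rw [POut_rect h ht] at ho
    obtain ⟨⟨a1, a2, a3⟩ | ⟨a1, a2, a3⟩, a4⟩ := ho
    · rcases t with - | t
      · left; exact ⟨Or.inr ⟨a1, a2, a3⟩, a4⟩
      · right
        have h1 : t < (Y.rec' s).M := by simp only [nch] at ht; omega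
        refine ⟨t, h1, by omega, (PHo_rect h h1).2 ⟨⟨a2, a3.le, ?_, a1.le⟩, a4⟩⟩
        rw [a1]; exact hc.U_SM t h1
    · left
      refine ⟨Or.inl ⟨a1, lt_of_le_of_lt (hc.U_SM.le (Nat.zero_le t) (le_of_lt ht)) a2, ?_⟩, a4⟩
      rw [<- hc.U_M]
      exact lt_of_lt_of_le a3 (hc.U_SM.le ht le_rfl)
  | tri s us =>
    have hc := tc h
    have hZ := hc.Z_SM
    have left : ∀ t < (Y.trec s).M, r.1 = TZ (Y.trec s) us t -> r.1 < r.2 -> r.2 < TZ (Y.trec s) us (Y.trec s).M -> POut Y (.tri s us) r ∨ ∃ t' < Y.nch (.tri s us), t' < 2*t /\ PHo Y (Y.chd (.tri s us) t') r := by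
      intro t ht h1 h2 h3
      rcases t with - | t
      · left; exact ⟨h1, by rw [<- hc.Z_0, <- h1]; exact h2, by rwa [<- hc.Z_M]⟩
      · right
        obtain ⟨n, hn, hn', h1⟩ := PHo_col h (t := t) (by omega) (by rw [h1]; exact hZ t (by omega)) h1.le h2 h3.le
        exact ⟨n, hn, by omega, h1⟩
    rcases tidx ht with ⟨t, rfl, ht'⟩ | ⟨t, rfl, ht'⟩
    · rw [chd_even] at ho
      simp only [POut] at ho
      rw [hc.Tus_0 ht', hc.Tus_m ht'] at ho
      obtain ⟨a1, a2, a3⟩ := ho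
      exact left t ht' a1 (by rwa [a1]) (lt_of_lt_of_le a3 (hZ.le ht' le_rfl))
    · rw [chd_odd] at ho
      simp only [POut, cu, cv] at ho
      rw [hc.Rus_0 ht', hc.Rus_m ht', hc.Rvs_0 ht', hc.Rvs_k ht'] at ho
      obtain ⟨⟨a1, a2, a3⟩ | ⟨a1, a2, a3⟩, a4⟩ := ho
      · right
        exact ⟨2*t, by omega, by omega, (PHo_even h (by omega)).2 ⟨a2, a4, a1.le⟩⟩
      · rcases left t (by omega) a1 a4 a3 with h1 | ⟨n, hn, hn', h1⟩
        · exact Or.inl h1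
        · exact Or.inr ⟨n, hn, by omega, h1⟩

theorem EdgeOK.dn (h : EdgeOK N m A) (hi : i <= N) (hj : j <= 2*m) (hj0 : 0 < j) (hb : bit (A j).lo.p i) : bit (A (2*((j-1)/2)+1)).lo.p i := by
  obtain ⟨a, rfl | rfl⟩ := Nat.even_or_odd' j
  · obtain ⟨b, rfl⟩ : ∃ b, a = b + 1 := ⟨a - 1, by omega⟩
    rw [show 2*((2*(b+1)-1)/2)+1 = 2*b+1 by omega]
    exact ((h.2 b (by omega)).2 i hi).2 hb
  · rwa [show 2*((2*a+1-1)/2)+1 = 2*a+1 by omega]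

theorem slot_iff (h : SM us m) (hj : j <= 2*m) (hj0 : 0 < j) (hl : loc us j u) : us ((j-1)/2) < u /\ u <= us ((j-1)/2+1) := by
  obtain ⟨a, rfl | rfl⟩ := Nat.even_or_odd' j
  · rw [loc_even_iff] at hl
    obtain ⟨b, rfl⟩ : ∃ b, a = b + 1 := ⟨a - 1, by omega⟩
    rw [show (2*(b+1)-1)/2 = b by omega, hl]; exact ⟨h b (by omega), le_rfl⟩
  · rw [loc_odd_iff] at hl
    rw [show (2*a+1-1)/2 = a by omega]; exact ⟨hl.1, hl.2.le⟩

/-- a point of the slot around or before `u` -/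
theorem slot_before (h : SM us m) (hj : j <= 2*m) (hj0 : 0 < j) (hl : loc us j u) : ∃ u', u' < u /\ loc us (2*((j-1)/2)+1) u' /\ us 0 < u' /\ u' < us m := by
  have h1 := slot_iff h hj hj0 hl
  have h2 := h.le (Nat.zero_le ((j-1)/2)) (by omega)
  have h3 := h.le (show (j-1)/2+1 <= m by omega) le_rfl
  exact ⟨(u + us ((j-1)/2))/2, by linarith [h1.2], loc_odd_iff.2 ⟨by linarith, by linarith⟩, by linarith, by linarith⟩

theorem P_task (hd : Y.geo.Desc n Y.c0 c) (hp : PHo Y c p) (hb : Y.bd c p g) (hi : i <= Y.N) (hg : bit g.1.p i) (hw : Y.w c < η) : (∃ q ∈ Tri, bit (lam Y q) i /\ |p.1 - q.1| < η /\ |p.2 - q.2| < η) ∨ ∃ r : Pt, (r.1 <= p.1 /\ r.2 <= p.2) /\ POut Y c r /\ ∃ g', Y.bd c r g' /\ bit g'.1.p i := by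
  have hV : Y.V c := hd.V Vc0
  have hreg := PHo_reg hp
  cases c with
  | rect sw s us vs =>
    have hr := Y.rows s hV.1
    have hR := Y.recs s hV.1
    have le_mk : ∀ u v, u <= cu sw p -> v <= cv sw p -> (mkP sw u v).1 <= p.1 /\ (mkP sw u v).2 <= p.2 := by
      intro u v h1 h2
      cases sw
      · exact ⟨h1, h2⟩
      · exact ⟨h2, h1⟩
    obtain ⟨⟨a1, a2, a3, a4⟩, a5⟩ := hp
    have hs1 : 0 < 2*(Y.row s).m := by have := hr.hm; omega
    have hs2 : 0 < 2*(Y.row s).k := by have := hr.hk; omega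
    have outA : ∀ j ≤ 2*(Y.row s).m, 0 < j -> ∀ u, u ≤ cu sw p -> loc us j u -> bit ((Y.row s).A (2*((j-1)/2)+1)).lo.p i -> ∃ r : Pt, (r.1 <= p.1 /\ r.2 <= p.2) /\ POut Y (.rect sw s us vs) r /\
          ∃ g', Y.bd (.rect sw s us vs) r g' /\ bit g'.1.p i := by
      intro j hj hj0 u hu hl hB
      obtain ⟨u', k1, k2, k3, k4⟩ := slot_before hV.2.1 hj hj0 hl
      have hlt := mkP_lt hV k4.le le_rfl k3.le (a3.le.trans a4) (fun _ => Or.inl k4) (fun _ => Or.inl k3)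
      exact ⟨mkP sw u' (vs 0), le_mk _ _ (by linarith) a3.le, ⟨Or.inl ⟨by simp, by simpa using k3, by simpa using k4⟩, hlt⟩, _, ⟨⟨_, Or.inl ⟨by simp, _, by omega, by simpa using k2, rfl⟩, rfl⟩, hlt⟩, hB⟩
    have outC : ∀ j ≤ 2*(Y.row s).k, 0 < j -> ∀ v, v ≤ cv sw p -> loc vs j v -> bit ((Y.row s).C (2*((j-1)/2)+1)).lo.p i -> ∃ r : Pt, (r.1 <= p.1 /\ r.2 <= p.2) /\ POut Y (.rect sw s us vs) r /\
          ∃ g', Y.bd (.rect sw s us vs) r g' /\ bit g'.1.p i := by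
      intro j hj hj0 v hv hl hB
      obtain ⟨v', k1, k2, k3, k4⟩ := slot_before hV.2.2.1 hj hj0 hl
      have hlt := mkP_lt hV (a1.le.trans a2) k3.le le_rfl k4.le (fun _ => Or.inr k3) (fun _ => Or.inr k4)
      exact ⟨mkP sw (us 0) v', le_mk _ _ a1.le (by linarith), ⟨Or.inr ⟨by simp, by simpa using k3, by simpa using k4⟩, hlt⟩, _, ⟨⟨_, Or.inr (Or.inr (Or.inl ⟨by simp, _, by omega, by simpa using k2, rfl⟩)), rfl⟩, hlt⟩, hB⟩
    obtain ⟨⟨e, he, rfl⟩, _⟩ := hb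
    rcases he with ⟨h1, _⟩ | ⟨h1, j, hj, hl, rfl⟩ | ⟨h1, _⟩ | ⟨h1, j, hj, hl, rfl⟩
    · exact absurd h1 a3.ne'
    · have hj' := (loc_pos_iff hV.2.1 hj hl).1 a1
      rcases hR.PB ((j-1)/2) (by omega) i hi (EdgeOK.dn hr.eB hi hj hj' hg) with h2 | h2 | h2
      · exact Or.inr (outA j hj hj' _ le_rfl hl h2)
      · exact Or.inr (outC (2*(Y.row s).k) le_rfl hs2 (vs (Y.row s).k) h1.ge (loc_even vs _)
          (by rwa [show 2*((2*(Y.row s).k-1)/2)+1 = 2*(Y.row s).k-1 by omega]))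
      · exact Or.inl (witIn_near hd hreg hw h2)
    · exact absurd h1 a1.ne'
    · have hj' := (loc_pos_iff hV.2.2.1 hj hl).1 a3
      rcases hR.PE ((j-1)/2) (by omega) i hi (EdgeOK.dn hr.eE hi hj hj' hg) with h2 | h2 | h2
      · exact Or.inr (outC j hj hj' _ le_rfl hl h2)
      · exact Or.inr (outA (2*(Y.row s).m) le_rfl hs1 (us (Y.row s).m) h1.ge (loc_even us _)
          (by rwa [show 2*((2*(Y.row s).m-1)/2)+1 = 2*(Y.row s).m-1 by omega]))
      · exact Or.inl (witIn_near hd hreg hw h2)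
  | tri s us =>
    have hr := Y.trows s hV.1
    have hR := Y.trecs s hV.1
    have hm := hr.hm
    obtain ⟨a1, a2, a3⟩ := hp
    obtain ⟨e, he, rfl⟩ := hb
    rcases he with ⟨h1, _⟩ | ⟨h1, j, hj, hl, rfl⟩
    · exact absurd h1 a1.ne'
    · have hj' := (loc_pos_iff hV.2 hj.le hl).1 a1
      have hg' : bit ((Y.trow s).U (2*((j-1)/2)+1)).lo.p i := by
        obtain ⟨a, rfl | rfl⟩ := Nat.even_or_odd' j
        · obtain ⟨b, rfl⟩ : ∃ b, a = b + 1 := ⟨a - 1, by omega⟩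
          rw [show 2*((2*(b+1)-1)/2)+1 = 2*b+1 by omega]
          exact ((hr.eU2 b (by omega) (by omega)) i hi).2 hg
        · rwa [show 2*((2*a+1-1)/2)+1 = 2*a+1 by omega]
      rcases hR.TP ((j-1)/2) (by omega) i hi hg' with h2 | h2
      · right
        obtain ⟨u', k1, k2, k3, k4⟩ := slot_before hV.2 (j := 2*(Y.trow s).m) le_rfl (by omega) (loc_even us _)
        rw [show 2*((2*(Y.trow s).m-1)/2)+1 = 2*(Y.trow s).m-1 by omega] at k2
        exact ⟨(us 0, u'), ⟨a1.le, by rw [h1]; exact k4.le⟩, ⟨rfl, k3, k4⟩, _, ⟨_, Or.inl ⟨rfl, _, by omega, by omega, k2, rfl⟩, rfl⟩, h2⟩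
      · exact Or.inl (twitIn_near hd hreg hw h2)

noncomputable def Pres (Y : Sys) {i : ℕ} (hi : i <= Y.N) {η : ℝ} {n : ℕ} (hn : ∀ d, Y.geo.Desc n Y.c0 d -> Y.w d < η) : Geo.Res Y.geo Y.c0 where
  Ho := PHo Y
  Out := POut Y
  le p q := q.1 <= p.1 /\ q.2 <= p.2
  Hit p := ∃ q ∈ Tri, bit (lam Y q) i /\ q.1 < p.1 + η /\ q.2 < p.2 + η
  dem g := bit g.1.p i
  n := n
  mu _ t := t
  hreg _ h := PHo_reg h
  hcov := PHo_cov
  out := POut_out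
  le_trans h1 h2 := ⟨h2.1.trans h1.1, h2.2.trans h1.2⟩
  hit := by
    rintro p q ⟨h1, h2⟩ ⟨r, hr, hb, h3, h4⟩
    exact ⟨r, hr, hb, by linarith, by linarith⟩
  task := by
    intro c p g _ hd hp hb hg
    rcases P_task hd hp hb hi hg (hn c hd) with ⟨q, hq, hb, h1, h2⟩ | h
    · left
      rw [abs_lt] at h1 h2
      exact ⟨q, hq, hb, by linarith, by linarith⟩
    · exact Or.inr h

theorem PHo_c0 (hp : p ∈ Tri) : PHo Y Y.c0 p := by
  obtain ⟨a, b, c⟩ := hp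
  have := m0 (Y := Y)
  refine ⟨?_, b, ?_⟩
  · simpa using a
  · show p.2 <= ((Y.trow Y.s0).m:ℝ) / _
    rw [div_self this.ne']; exact c.le

theorem P_near (hp : p ∈ Tri) (hd : Y.geo.Done Y.c0 p g) (hi : i <= Y.N) (hb : bit g.1.p i) (hη : 0 < η) : ∃ q ∈ Tri, bit (lam Y q) i /\ q.1 < p.1 + η /\ q.2 < p.2 + η := by
  obtain ⟨n1, hn1⟩ := Geo.small (T := Y.geo) (c := Y.c0) Vc0 hη
  obtain ⟨n2, d, hd2, hb2⟩ := id hd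
  have e1 : Y.geo.Desc n2 Y.c0 d := hd2
  rcases (Pres Y hi (n := max n1 n2) (hn1 _ (le_max_left _ _))).resolve Vc0 (le_max_right _ _) e1 hb2
    (PHo_c0 hp) hb with h | ⟨r, hr, g', hg', hb'⟩
  · exact h
  · exfalso
    obtain ⟨r1, r2, r3⟩ : POut Y Y.c0 r := hr
    have hr0 := Y.trows _ Y.hs0
    have hu := (Vc0 (Y := Y)).2
    obtain ⟨j, hj, hl⟩ := loc_exists (us := fun i : ℕ => (i:ℝ) / ((Y.trow Y.s0).m : ℝ)) (m := (Y.trow Y.s0).m) r2.le r3.le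
    have hj' := (loc_pos_iff hu hj hl).1 r2
    have hbd : Y.bd Y.c0 r (gap ((Y.trow Y.s0).L j)) := ⟨_, Or.inl ⟨r1, j, hj, hj', hl, rfl⟩, rfl⟩
    have := hg'.unique Vc0 ⟨0, Y.c0, rfl, hbd⟩
    rw [this] at hb'
    have hb'' : bit ((Y.trow Y.s0).L j).lo.p i := hb'
    refine Y.root.L ((j-1)/2) (by omega) i hi ?_
    obtain ⟨a, rfl | rfl⟩ := Nat.even_or_odd' j
    · obtain ⟨b, rfl⟩ : ∃ b, a = b + 1 := ⟨a - 1, by omega⟩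
      rw [show 2*((2*(b+1)-1)/2)+1 = 2*b+1 by omega]
      exact ((hr0.eL2 b (by omega)) i hi).2 hb''
    · rwa [show 2*((2*a+1-1)/2)+1 = 2*a+1 by omega]

theorem PHo_n (k : ℕ) : ∀ {c : Cell} {p : Pt}, Y.V c -> PHo Y c p -> ∃ d, Y.geo.Desc k c d /\ PHo Y d p := by
  induction k with
  | zero => intro c p hc h; exact ⟨c, rfl, h⟩
  | succ k ih =>
    intro c p hc h
    obtain ⟨t, ht, h1⟩ := PHo_cov hc h
    obtain ⟨d, h2, h3⟩ := ih (gA1 hc ht) h1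
    exact ⟨d, ⟨t, ht, h2⟩, h3⟩

theorem P_ray (hV : Y.V (.rect sw s us vs)) (hp : PHo Y (.rect sw s us vs) p) (hb : Y.bd (.rect sw s us vs) p g) (hi : i <= Y.N) (hg : bit g.1.p i) : ∃ sw' b, b < cu sw' p /\ (∀ u, u ≤ cu sw' p -> b < u -> (mkP sw' u (cv sw' p)).1 < (mkP sw' u (cv sw' p)).2 -> ∃ g', Y.bd (.rect sw s us vs) (mkP sw' u (cv sw' p)) g' /\ bit g'.1.p i) /\ ∀ r, Y.reg (.rect sw s us vs) r -> cv sw' r <= cv sw' p := by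
  have hr := Y.rows s hV.1
  obtain ⟨⟨a1, a2, a3, a4⟩, a5⟩ := hp
  have key : ∀ {us : ℕ -> ℝ} {m j : ℕ} {u : ℝ}, SM us m -> j <= 2*m -> 0 < j -> loc us j u -> us ((j-1)/2) < u /\
      ∀ u', u' ≤ u -> us ((j-1)/2) < u' -> loc us j u' ∨ loc us (2*((j-1)/2)+1) u' := by
    intro us m j u h hj hj0 hl
    obtain ⟨k1, k2⟩ := slot_iff h hj hj0 hl
    refine ⟨k1, fun u' h1 h2 => ?_⟩
    rcases h1.eq_or_lt with h3 | h3
    · rw [h3]; exact Or.inl hl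
    · exact Or.inr (loc_odd_iff.2 ⟨h2, by linarith⟩)
  obtain ⟨⟨e, he, rfl⟩, _⟩ := hb
  rcases he with ⟨h1, _⟩ | ⟨h1, j, hj, hl, rfl⟩ | ⟨h1, _⟩ | ⟨h1, j, hj, hl, rfl⟩
  · exact absurd h1 a3.ne'
  · have hj' := (loc_pos_iff hV.2.1 hj hl).1 a1
    obtain ⟨k1, k2⟩ := key hV.2.1 hj hj' hl
    refine ⟨sw, _, k1, fun u h2 h3 h4 => ?_, fun r hr => by rw [h1]; exact hr.1.2.2.2⟩
    rcases k2 u h2 h3 with h5 | h5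
    · exact ⟨_, ⟨⟨_, Or.inr (Or.inl ⟨by simpa using h1, j, hj, by simpa using h5, rfl⟩), rfl⟩, h4⟩, hg⟩
    · exact ⟨_, ⟨⟨_, Or.inr (Or.inl ⟨by simpa using h1, _, by omega, by simpa using h5, rfl⟩), rfl⟩, h4⟩, EdgeOK.dn hr.eB hi hj hj' hg⟩
  · exact absurd h1 a1.ne'
  · have hj' := (loc_pos_iff hV.2.2.1 hj hl).1 a3
    obtain ⟨k1, k2⟩ := key hV.2.2.1 hj hj' hl
    refine ⟨!sw, _, by rw [cu_not]; exact k1, fun u h2 h3 h4 => ?_, fun r hr => by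
      rw [cv_not, cv_not, h1]; exact hr.1.2.1⟩
    rw [cu_not] at h2
    simp only [mkP_not, cv_not] at h4 ⊢
    rcases k2 u h2 h3 with h5 | h5
    · exact ⟨_, ⟨⟨_, Or.inr (Or.inr (Or.inr ⟨by simpa using h1, j, hj, by simpa using h5, rfl⟩)), rfl⟩, h4⟩, hg⟩
    · exact ⟨_, ⟨⟨_, Or.inr (Or.inr (Or.inr ⟨by simpa using h1, _, by omega, by simpa using h5, rfl⟩)), rfl⟩, h4⟩, EdgeOK.dn hr.eE hi hj hj' hg⟩

theorem P_start (hp : p ∈ Tri) (hd : Y.geo.Done Y.c0 p g) (hi : i <= Y.N) (hb : bit g.1.p i) : ∃ r g', r ∈ Tri /\ pl r p /\ Y.geo.Done Y.c0 r g' /\ bit g'.1.p i := by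
  obtain ⟨n0, hn0⟩ := deep_rect (Y := Y) hp
  obtain ⟨n, d0, h1, h2⟩ := id hd
  obtain ⟨d, hd1, hd2⟩ := PHo_n (Y := Y) (n + n0) Vc0 (PHo_c0 hp)
  have hbd : Y.bd d p g := Geo.bd_of_reg (T := Y.geo) (c := Y.c0) Vc0 h1 h2 hd1 (PHo_reg hd2)
  obtain ⟨sw, s, us, vs, rfl⟩ := hn0 _ (Nat.le_add_left _ _) d hd1 (PHo_reg hd2)
  have hV : Y.V (.rect sw s us vs) := hd1.V Vc0
  obtain ⟨sw', b, k1, k2, k3⟩ := P_ray hV hd2 hbd hi hb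
  obtain ⟨p1, p2, p3⟩ := id hp
  obtain ⟨η, e0, e1, e2, e3⟩ : ∃ η : ℝ, 0 < η /\ η <= (p.2 - p.1)/2 /\ η <= p.1 /\ η <= cu sw' p - b :=
    ⟨min (min ((p.2-p.1)/2) p.1) (cu sw' p - b), lt_min (lt_min (by linarith) (by linarith)) (by linarith), (min_le_left _ _).trans (min_le_left _ _), (min_le_left _ _).trans (min_le_right _ _), min_le_right _ _⟩
  obtain ⟨n2, hn2⟩ := Geo.small (T := Y.geo) (c := Y.c0) Vc0 e0
  obtain ⟨e, he1, he2⟩ := PHo_n (Y := Y) n2 hV hd2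
  have he : Y.geo.Desc (n + n0 + n2) Y.c0 e := hd1.append he1
  have hw : Y.w e < η := hn2 _ (by omega) e he
  obtain ⟨sw1, s1, us1, vs1, rfl⟩ := hn0 _ (by omega) e he (PHo_reg he2)
  have hV1 : Y.V (.rect sw1 s1 us1 vs1) := he.V Vc0
  have hr := Y.rows s1 hV1.1
  have hm := hr.hm
  have hk := hr.hk
  have hreg := PHo_reg he2
  obtain ⟨⟨a1, a2, a3, a4⟩, a5⟩ := he2
  have hu := hV1.2.1.lt hr.hm le_rfl
  have hv := hV1.2.2.1.lt hr.hk le_rfl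
  have near : ∀ u v, us1 0 <= u -> u <= us1 (Y.row s1).m -> vs1 0 <= v -> v <= vs1 (Y.row s1).k -> (mkP sw1 u v).1 < (mkP sw1 u v).2 /\ 0 < (mkP sw1 u v).1 /\ cu sw1 p - u < η /\ cv sw1 p - v < η := by
    intro u v h1 h2 h3 h4
    obtain ⟨h5, h6⟩ := box_w2 hreg h1 h2 h3 h4
    rw [abs_le] at h5 h6
    refine ⟨by linarith, by linarith, ?_⟩
    cases sw1 <;> simp only [mkP, cu, cv] at * <;> constructor <;> linarith
  have fin : ∀ u v g', us1 0 <= u -> u <= us1 (Y.row s1).m -> vs1 0 <= v -> v <= vs1 (Y.row s1).k -> u < cu sw1 p -> v < cv sw1 p -> bdg (Y.row s1) us1 vs1 u v g' -> bit g'.1.p i ->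
      ∃ r g', r ∈ Tri /\ pl r p /\ Y.geo.Done Y.c0 r g' /\ bit g'.1.p i := by
    intro u v g' h1 h2 h3 h4 h5 h6 h7 h8
    obtain ⟨l1, l2, _⟩ := near u v h1 h2 h3 h4
    have hpl := mk_pl h5 h6
    refine ⟨_, g', ⟨l2, l1, ?_⟩, hpl, ⟨_, _, he, ⟨?_, l1⟩⟩, h8⟩
    · exact hpl.2.trans p3
    · simpa using h7
  have hsub : ∀ r, Y.reg (.rect sw1 s1 us1 vs1) r -> cv sw' r <= cv sw' p := fun r h =>
    k3 r (he1.reg hV h)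
  have hgap : ∀ {r g1}, Y.bd (.rect sw s us vs) r g1 -> Y.reg (.rect sw1 s1 us1 vs1) r -> Y.bd (.rect sw1 s1 us1 vs1) r g1 := fun h h' =>
    Geo.bd_desc (T := Y.geo) (c := .rect sw s us vs) hV h he1 h'
  have hreg' : ∀ u v, us1 0 <= u -> u <= us1 (Y.row s1).m -> vs1 0 <= v -> v <= vs1 (Y.row s1).k -> Y.reg (.rect sw1 s1 us1 vs1) (mkP sw1 u v) := fun u v h1 h2 h3 h4 =>
    ⟨by simpa using ⟨h1, h2, h3, h4⟩, (near u v h1 h2 h3 h4).1⟩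
  rcases (by cases sw' <;> cases sw1 <;> simp : sw' = sw1 ∨ sw' = !sw1) with rfl | rfl
  · have hc : cv sw' p = vs1 (Y.row s1).k := by
      have := hsub _ (hreg' (us1 0) (vs1 (Y.row s1).k) le_rfl hu.le hv.le le_rfl)
      simp only [cv_mkP] at this
      exact le_antisymm a4 this
    obtain ⟨g1, m1, m2⟩ := k2 (us1 0) a1.le
      (by have := (near (us1 0) (vs1 0) le_rfl hu.le le_rfl hv.le).2.2.1; linarith)
      (by rw [hc]; exact (near _ _ le_rfl hu.le hv.le le_rfl).1)
    rw [hc] at m1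
    have m3 := hgap m1 (hreg' _ _ le_rfl hu.le hv.le le_rfl)
    have m4 : g1 = gap ((Y.row s1).C (2*(Y.row s1).k)) := gA3 hV1 m3
      ⟨⟨_, Or.inr (Or.inr (Or.inl ⟨by simp, _, le_rfl, by simpa using loc_even vs1 _, rfl⟩)), rfl⟩, m3.2⟩
    rw [m4] at m2
    obtain ⟨v', l1, l2, l3, l4⟩ := slot_before hV1.2.2.1 (j := 2*(Y.row s1).k) le_rfl (by omega) (loc_even vs1 _)
    exact fin (us1 0) v' _ le_rfl hu.le l3.le l4.le a1 (by rw [hc]; exact l4)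
      ⟨_, Or.inr (Or.inr (Or.inl ⟨rfl, _, by omega, l2, rfl⟩)), rfl⟩
      (EdgeOK.dn hr.eC hi le_rfl (by omega) m2)
  · simp only [mkP_not, cv_not, cu_not] at *
    have hc : cu sw1 p = us1 (Y.row s1).m := by
      have := hsub _ (hreg' (us1 (Y.row s1).m) (vs1 (Y.row s1).k) hu.le le_rfl hv.le le_rfl)
      simp only [cu_mkP] at this
      exact le_antisymm a2 this
    obtain ⟨g1, m1, m2⟩ := k2 (vs1 0) a3.le
      (by have := (near (us1 0) (vs1 0) le_rfl hu.le le_rfl hv.le).2.2.2; linarith)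
      (by rw [hc]; exact (near _ _ hu.le le_rfl le_rfl hv.le).1)
    rw [hc] at m1
    have m3 := hgap m1 (hreg' _ _ hu.le le_rfl le_rfl hv.le)
    have m4 : g1 = gap ((Y.row s1).A (2*(Y.row s1).m)) := gA3 hV1 m3
      ⟨⟨_, Or.inl ⟨by simp, _, le_rfl, by simpa using loc_even us1 _, rfl⟩, rfl⟩, m3.2⟩
    rw [m4] at m2
    obtain ⟨u', l1, l2, l3, l4⟩ := slot_before hV1.2.1 (j := 2*(Y.row s1).m) le_rfl (by omega) (loc_even us1 _)
    exact fin u' (vs1 0) _ l3.le l4.le le_rfl hv.le (by rw [hc]; exact l4) a3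
      ⟨_, Or.inl ⟨rfl, _, by omega, l2, rfl⟩, rfl⟩
      (EdgeOK.dn hr.eA hi le_rfl (by omega) m2)

theorem P_ok (hp : p ∈ Tri) (hg : GapOf Y p g) (hi : i <= Y.N) (hb : bit g.1.p i) : ∃ q ∈ Tri, pl q p /\ bit (lam Y q) i := by
  have hex : ∃ r g', r ∈ Tri /\ pl r p /\ Y.geo.Done Y.c0 r g' /\ bit g'.1.p i := by
    rcases hg with hg | ⟨hl, rfl⟩
    · exact P_start hp hg hi hb
    · have hb' : bit (LO Y p).p i := hb
      simp only [LO, bit_setN] at hb'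
      obtain ⟨_, q, g', h1, h2, h3⟩ := hb'
      obtain ⟨r, g1, l1, l2, l3⟩ := hl.below h1
      obtain ⟨n, d, m1, m2⟩ := id h2
      have hq := reg_c0.1 (m1.reg Vc0 (gA2 (m1.V Vc0) m2))
      obtain ⟨n', d', m1', m2'⟩ := id l1
      have hr := reg_c0.1 (m1'.reg Vc0 (gA2 (m1'.V Vc0) m2'))
      exact ⟨r, g1, ⟨lt_of_le_of_lt hq.1 l2.1, hr.2.2, l3.2.trans hp.2.2⟩, l3, l1, ((Geo.coh (T := Y.geo) (c := Y.c0) Vc0 h2 l1 l2) i hi).2 h3⟩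
  obtain ⟨r, g', h1, h2, h3, h4⟩ := hex
  obtain ⟨q, q1, q2, q3, q4⟩ := P_near h1 h3 hi h4 (η := min (p.1 - r.1) (p.2 - r.2))
    (lt_min (by linarith [h2.1]) (by linarith [h2.2]))
  have t1 := min_le_left (p.1 - r.1) (p.2 - r.2)
  have t2 := min_le_right (p.1 - r.1) (p.2 - r.2)
  exact ⟨q, q1, ⟨by linarith, by linarith⟩, q2⟩

theorem lam_model : Model sltT Y.N (fun w : Tri => lam Y w.1) where
  ok w := by
    obtain ⟨g, hg⟩ := GapOf.exists (Y := Y) w.2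
    exact (lam_adm w.2 hg).1
  mF i hi w := by
    have hi' : i <= Y.N := (Nat.right_le_pair 3 i).trans hi
    obtain ⟨g, hg⟩ := GapOf.exists (Y := Y) w.2
    have ha := (lam_adm w.2 hg).2 i hi'
    rw [ha.2.1 hi]
    constructor
    · intro h
      obtain ⟨q, h1, h2, h3⟩ := F_ok w.2 hg hi' h
      exact ⟨⟨q, h1⟩, h2, h3⟩
    · rintro ⟨u, h1, h2⟩
      obtain ⟨g', hg'⟩ := GapOf.exists (Y := Y) u.2
      have hb := ((lam_adm u.2 hg').2 i hi').1 h2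
      exact ((hg.coh hg' h1) i hi').1 hb.1
  mP i hi w := by
    have hi' : i <= Y.N := (Nat.right_le_pair 4 i).trans hi
    obtain ⟨g, hg⟩ := GapOf.exists (Y := Y) w.2
    have ha := (lam_adm w.2 hg).2 i hi'
    rw [ha.2.2 hi]
    constructor
    · intro h
      obtain ⟨q, h1, h2, h3⟩ := P_ok w.2 hg hi' h
      exact ⟨⟨q, h1⟩, h2, h3⟩
    · rintro ⟨u, h1, h2⟩
      obtain ⟨g', hg'⟩ := GapOf.exists (Y := Y) u.2
      have hb := ((lam_adm u.2 hg').2 i hi').1 h2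
      exact ((hg'.coh hg h1) i hi').2 hb.2

theorem sat : SAT Y.N := by
  obtain ⟨t, ht, ht0, j, hj, hj', hb⟩ := Y.root.w
  have hz : Y.il Y.c0 (TZ (Y.trec Y.s0) _ t, TX (Y.trec Y.s0) _ j) ((Y.trec Y.s0).V t (2*j)) true :=
    Or.inl ⟨t, ht, ht0, rfl, 2*j, by omega, by omega, loc_even _ j, rfl, by simp⟩
  have hd : Y.geo.Desc 0 Y.c0 Y.c0 := rfl
  refine ⟨_, lam_model, ⟨_, il_Tri hd hz⟩, ?_⟩
  show bit (lam Y _) _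
  rw [lam_IL ⟨0, _, hd, hz⟩]
  exact hb

end Sys

theorem Cert.sat {row : ℕ -> Row} {trow : ℕ -> TRow} {rk : ℕ -> ℕ} {S ST : ℕ -> Prop} (h : Cert N row trow rk S ST) : SAT N := by
  obtain ⟨Y, rfl⟩ := h.sys
  exact Y.sat

/-! ## Part A1: real fields of demands -/

open Filter Topology

def fut (T : ℝ -> ℝ -> Prop) (x y : ℝ) : Prop := ∃ x' y', x < x' /\ y < y' /\ T x' y'
def pas (T : ℝ -> ℝ -> Prop) (x y : ℝ) : Prop := ∃ x' y', x' < x /\ y' < y /\ T x' y'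
def futm (T : ℝ -> ℝ -> Prop) (x y : ℝ) : Prop := ∀ ε > 0, fut T (x-ε) (y-ε)
def pasp (T : ℝ -> ℝ -> Prop) (x y : ℝ) : Prop := ∀ ε > 0, pas T (x+ε) (y+ε)

theorem fut_mono {T x y x' y'} (h : fut T x' y') (hx : x <= x') (hy : y <= y') : fut T x y := by
  obtain ⟨a, b, h1, h2, h3⟩ := h
  exact ⟨a, b, by linarith, by linarith, h3⟩

theorem pas_mono {T x y x' y'} (h : pas T x' y') (hx : x' <= x) (hy : y' <= y) : pas T x y := by
  obtain ⟨a, b, h1, h2, h3⟩ := h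
  exact ⟨a, b, by linarith, by linarith, h3⟩

theorem futm_mono {T x y x' y'} (h : futm T x' y') (hx : x <= x') (hy : y <= y') : futm T x y :=
  fun ε he => fut_mono (h ε he) (by linarith) (by linarith)

theorem pasp_mono {T x y x' y'} (h : pasp T x' y') (hx : x' <= x) (hy : y' <= y) : pasp T x y :=
  fun ε he => pas_mono (h ε he) (by linarith) (by linarith)

theorem fut_of_futm {T x y x' y'} (h : futm T x' y') (hx : x < x') (hy : y < y') : fut T x y := by
  have := h (min (x'-x) (y'-y)) (by rw [gt_iff_lt, lt_min_iff]; constructor <;> linarith)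
  have h1 := min_le_left (x'-x) (y'-y)
  have h2 := min_le_right (x'-x) (y'-y)
  exact fut_mono this (by linarith) (by linarith)

theorem pas_of_pasp {T x y x' y'} (h : pasp T x' y') (hx : x' < x) (hy : y' < y) : pas T x y := by
  have := h (min (x-x') (y-y')) (by rw [gt_iff_lt, lt_min_iff]; constructor <;> linarith)
  have h1 := min_le_left (x-x') (y-y')
  have h2 := min_le_right (x-x') (y-y')
  exact pas_mono this (by linarith) (by linarith)

theorem fut_swap {T x y} : fut (fun a b => T b a) y x ↔ fut T x y :=
  ⟨fun ⟨a, b, h1, h2, h3⟩ => ⟨b, a, h2, h1, h3⟩, fun ⟨a, b, h1, h2, h3⟩ => ⟨b, a, h2, h1, h3⟩⟩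

theorem pas_swap {T x y} : pas (fun a b => T b a) y x ↔ pas T x y :=
  ⟨fun ⟨a, b, h1, h2, h3⟩ => ⟨b, a, h2, h1, h3⟩, fun ⟨a, b, h1, h2, h3⟩ => ⟨b, a, h2, h1, h3⟩⟩

structure Ctx (N : ℕ) where
  D : ℝ -> ℝ -> Prop
  lam : ℝ -> ℝ -> ℕ
  lt : ∀ x y, lam x y < 2^(N+1)
  ok : ∀ x y, D x y -> okLab N (lam x y)
  mF : ∀ i, Nat.pair 3 i <= N -> ∀ x y, D x y -> (bit (lam x y) (Nat.pair 3 i) ↔ fut (fun x y => D x y /\ bit (lam x y) i) x y)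
  mP : ∀ i, Nat.pair 4 i <= N -> ∀ x y, D x y -> (bit (lam x y) (Nat.pair 4 i) ↔ pas (fun x y => D x y /\ bit (lam x y) i) x y)

namespace Ctx
variable (c : Ctx N)

def T (i : ℕ) (x y : ℝ) : Prop := c.D x y /\ bit (c.lam x y) i

noncomputable def lo (x y : ℝ) : Pos :=
  ⟨setN N (fun i => futm (c.T i) x y), setN N (fun i => pas (c.T i) x y)⟩
noncomputable def hi (x y : ℝ) : Pos :=
  ⟨setN N (fun i => fut (c.T i) x y), setN N (fun i => pasp (c.T i) x y)⟩

def swap : Ctx N where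
  D x y := c.D y x
  lam x y := c.lam y x
  lt x y := c.lt y x
  ok x y := c.ok y x
  mF i h x y hd := (c.mF i h y x hd).trans fut_swap.symm
  mP i h x y hd := (c.mP i h y x hd).trans pas_swap.symm

theorem swap_lo (x y : ℝ) : c.swap.lo y x = c.lo x y := by
  unfold lo
  congr 1
  · exact setN_congr _ _ _ fun i _ => forall_congr' fun ε => imp_congr Iff.rfl fut_swap
  · exact setN_congr _ _ _ fun i _ => pas_swap

theorem swap_hi (x y : ℝ) : c.swap.hi y x = c.hi x y := by
  unfold hi
  congr 1
  · exact setN_congr _ _ _ fun i _ => fut_swap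
  · exact setN_congr _ _ _ fun i _ => forall_congr' fun ε => imp_congr Iff.rfl pas_swap

theorem lof {x y i} (h : i <= N) : bit (c.lo x y).f i ↔ futm (c.T i) x y := by
  simp [lo, bit_setN, h]
theorem lop {x y i} (h : i <= N) : bit (c.lo x y).p i ↔ pas (c.T i) x y := by
  simp [lo, bit_setN, h]
theorem hif {x y i} (h : i <= N) : bit (c.hi x y).f i ↔ fut (c.T i) x y := by
  simp [hi, bit_setN, h]
theorem hip {x y i} (h : i <= N) : bit (c.hi x y).p i ↔ pasp (c.T i) x y := by
  simp [hi, bit_setN, h]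

/-- canonical positions -/
def Can (N : ℕ) (a : Pos) : Prop := ∃ P Q, a = ⟨setN N P, setN N Q⟩

theorem can_lo (x y : ℝ) : Can N (c.lo x y) := ⟨_, _, rfl⟩
theorem can_hi (x y : ℝ) : Can N (c.hi x y) := ⟨_, _, rfl⟩

theorem ple_antisymm {a b : Pos} (ha : Can N a) (hb : Can N b) (h : ple N a b) (h' : ple N b a) : a = b := by
  obtain ⟨P, Q, rfl⟩ := ha
  obtain ⟨P', Q', rfl⟩ := hb
  congr 1
  · refine setN_congr _ _ _ fun i hi => ?_
    have h1 := (h i hi).1; have h2 := (h' i hi).1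
    simp only [bit_setN, hi, true_and] at h1 h2
    exact ⟨h2, h1⟩
  · refine setN_congr _ _ _ fun i hi => ?_
    have h1 := (h i hi).2; have h2 := (h' i hi).2
    simp only [bit_setN, hi, true_and] at h1 h2
    exact ⟨h1, h2⟩

theorem ple_trans {a b d : Pos} (h : ple N a b) (h' : ple N b d) : ple N a d := fun i hi =>
  ⟨fun h1 => (h i hi).1 ((h' i hi).1 h1), fun h1 => (h' i hi).2 ((h i hi).2 h1)⟩

theorem lohi (x y : ℝ) : ple N (c.lo x y) (c.hi x y) := fun i hi => by
  rw [c.lof hi, c.hif hi, c.lop hi, c.hip hi]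
  exact ⟨fun h ε he => fut_mono h (by linarith) (by linarith), fun h ε he => pas_mono h (by linarith) (by linarith)⟩

theorem hilo (hx : x < x') (hy : y < y') : ple N (c.hi x y) (c.lo x' y') :=
  fun i hi => by
  rw [c.lof hi, c.hif hi, c.lop hi, c.hip hi]
  exact ⟨fun h => fut_of_futm h hx hy, fun h => pas_of_pasp h hx hy⟩

theorem lo_mono (hx : x <= x') (hy : y <= y') : ple N (c.lo x y) (c.lo x' y') :=
  fun i hi => by
  rw [c.lof hi, c.lof hi, c.lop hi, c.lop hi]
  exact ⟨fun h => futm_mono h hx hy, fun h => pas_mono h hx hy⟩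

theorem hi_mono (hx : x <= x') (hy : y <= y') : ple N (c.hi x y) (c.hi x' y') :=
  fun i hi => by
  rw [c.hif hi, c.hif hi, c.hip hi, c.hip hi]
  exact ⟨fun h => fut_mono h hx hy, fun h => pasp_mono h hx hy⟩

theorem adm_pt (h : c.D x y) : adm N (c.lo x y) (c.hi x y) (c.lam x y) := by
  refine ⟨c.ok x y h, fun i hi => ⟨fun hb => ?_, fun h3 => ?_, fun h4 => ?_⟩⟩
  · rw [c.lof hi, c.hip hi]
    exact ⟨fun ε he => ⟨x, y, by linarith, by linarith, h, hb⟩, fun ε he => ⟨x, y, by linarith, by linarith, h, hb⟩⟩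
  · rw [c.hif hi, c.mF i h3 x y h]; rfl
  · rw [c.lop hi, c.mP i h4 x y h]; rfl

theorem hasAdm_pt (h : c.D x y) : hasAdm N (c.lo x y) (c.hi x y) :=
  ⟨_, c.lt x y, c.adm_pt h⟩

theorem ev_all {l : Filter ℝ} {P : ℕ -> ℝ -> Prop} (h : ∀ i ≤ N, ∀ᶠ x in l, P i x) : ∀ᶠ x in l, ∀ i ≤ N, P i x :=
  (Filter.eventually_all_finite (Set.finite_Iic N)).2 h

theorem ev_lt (h : 0 < a) : ∀ᶠ d in 𝓝[>] (0:ℝ), 0 < d /\ d < a := Ioo_mem_nhdsGT h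

theorem ev_fut {T : ℝ -> ℝ -> Prop} (h : fut T x y) : ∀ᶠ d in 𝓝[>] (0:ℝ), fut T (x+d) (y+d) := by
  obtain ⟨a, b, h1, h2, h3⟩ := h
  filter_upwards [ev_lt (sub_pos.2 h1), ev_lt (sub_pos.2 h2)] with d h4 h5
  exact ⟨a, b, by linarith, by linarith, h3⟩

theorem ev_pas {T : ℝ -> ℝ -> Prop} (h : pas T x y) : ∀ᶠ d in 𝓝[>] (0:ℝ), pas T (x-d) (y-d) := by
  obtain ⟨a, b, h1, h2, h3⟩ := h
  filter_upwards [ev_lt (sub_pos.2 h1), ev_lt (sub_pos.2 h2)] with d h4 h5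
  exact ⟨a, b, by linarith, by linarith, h3⟩

theorem ev_npas {T : ℝ -> ℝ -> Prop} (h : ¬ pasp T x y) : ∀ᶠ d in 𝓝[>] (0:ℝ), ¬ pasp T (x+d) (y+d) := by
  unfold pasp at h
  push Not at h
  obtain ⟨ε, h1, h2⟩ := h
  filter_upwards [ev_lt h1] with d h4 h5
  exact h2 (pas_mono (h5 (ε-d) (by linarith)) (by linarith) (by linarith))

theorem ev_nfut {T : ℝ -> ℝ -> Prop} (h : ¬ futm T x y) : ∀ᶠ d in 𝓝[>] (0:ℝ), ¬ futm T (x-d) (y-d) := by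
  unfold futm at h
  push Not at h
  obtain ⟨ε, h1, h2⟩ := h
  filter_upwards [ev_lt h1] with d h4 h5
  exact h2 (fut_mono (h5 (ε-d) (by linarith)) (by linarith) (by linarith))

theorem ev_hi' (x y : ℝ) : ∀ᶠ d in 𝓝[>] (0:ℝ), ple N (c.hi (x+d) (y+d)) (c.hi x y) := by
  refine ev_all fun i hi => ?_
  simp only [c.hif hi, c.hip hi]
  by_cases h1 : fut (c.T i) x y <;> by_cases h2 : pasp (c.T i) x y
  · filter_upwards [ev_fut h1] with d h3 using ⟨fun _ => h3, fun _ => h2⟩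
  · filter_upwards [ev_fut h1, ev_npas h2] with d h3 h4 using ⟨fun _ => h3, fun h => absurd h h4⟩
  · exact Eventually.of_forall fun d => ⟨fun h => absurd h h1, fun _ => h2⟩
  · filter_upwards [ev_npas h2] with d h4 using ⟨fun h => absurd h h1, fun h => absurd h h4⟩

theorem ev_lo' (x y : ℝ) : ∀ᶠ d in 𝓝[>] (0:ℝ), ple N (c.lo x y) (c.lo (x-d) (y-d)) := by
  refine ev_all fun i hi => ?_
  simp only [c.lof hi, c.lop hi]
  by_cases h1 : pas (c.T i) x y <;> by_cases h2 : futm (c.T i) x y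
  · filter_upwards [ev_pas h1] with d h3 using ⟨fun _ => h2, fun _ => h3⟩
  · filter_upwards [ev_pas h1, ev_nfut h2] with d h3 h4 using ⟨fun h => absurd h h4, fun _ => h3⟩
  · exact Eventually.of_forall fun d => ⟨fun _ => h2, fun h => absurd h h1⟩
  · filter_upwards [ev_nfut h2] with d h4 using ⟨fun h => absurd h h4, fun h => absurd h h1⟩

/-- near and above a point, both fields equal `hi` of the point -/
theorem ev_hi (x y : ℝ) : ∀ᶠ d in 𝓝[>] (0:ℝ), c.lo (x+d) (y+d) = c.hi x y /\ c.hi (x+d) (y+d) = c.hi x y := by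
  filter_upwards [c.ev_hi' x y, ev_lt one_pos] with d h h1
  have a := c.hilo (show x < x+d by linarith) (show y < y+d by linarith)
  have b := c.lohi (x+d) (y+d)
  exact ⟨ple_antisymm (c.can_lo _ _) (c.can_hi _ _) (ple_trans b h) a, ple_antisymm (c.can_hi _ _) (c.can_hi _ _) h (ple_trans a b)⟩

theorem ev_lo (x y : ℝ) : ∀ᶠ d in 𝓝[>] (0:ℝ), c.hi (x-d) (y-d) = c.lo x y /\ c.lo (x-d) (y-d) = c.lo x y := by
  filter_upwards [c.ev_lo' x y, ev_lt one_pos] with d h h1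
  have a := c.hilo (show x-d < x by linarith) (show y-d < y by linarith)
  have b := c.lohi (x-d) (y-d)
  exact ⟨ple_antisymm (c.can_hi _ _) (c.can_lo _ _) a (ple_trans h b), ple_antisymm (c.can_lo _ _) (c.can_lo _ _) (ple_trans b a) h⟩

/-- right continuity of `hi` along a horizontal line -/
theorem hi_right (hb : x < b) : ∃ x', x < x' /\ x' < b /\ ple N (c.hi x' y) (c.hi x y) := by
  obtain ⟨d, h1, h2⟩ := ((c.ev_hi' x y).and (ev_lt (sub_pos.2 hb))).exists
  exact ⟨x+d, by linarith, by linarith, ple_trans (c.hi_mono le_rfl (by linarith)) h1⟩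

theorem lo_left (hb : b < x) : ∃ x', b < x' /\ x' < x /\ ple N (c.lo x y) (c.lo x' y) := by
  obtain ⟨d, h1, h2⟩ := ((c.ev_lo' x y).and (ev_lt (sub_pos.2 hb))).exists
  exact ⟨x-d, by linarith, by linarith, ple_trans h1 (c.lo_mono le_rfl (by linarith))⟩

end Ctx

/-! ## Part A2: critical points, tags -/

open Filter Topology

structure Rct where
  u0 : ℝ
  u1 : ℝ
  v0 : ℝ
  v1 : ℝ

def Hom (P : ℝ -> Prop) (a b : ℝ) : Prop := ∀ x y, a < x -> x < b -> a < y -> y < b -> P x -> P y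

theorem Hom.sub {P : ℝ -> Prop} {a' b' : ℝ} (h : Hom P a b) (ha : a <= a') (hb : b' <= b) : Hom P a' b' := fun x y h1 h2 h3 h4 =>
  h x y (by linarith) (by linarith) (by linarith) (by linarith)

namespace Ctx
variable (c : Ctx N)

structure Good (R : Rct) : Prop where
  hu : R.u0 < R.u1
  hv : R.v0 < R.v1
  int : ∀ x y, R.u0 < x -> x < R.u1 -> R.v0 < y -> y < R.v1 -> c.D x y
  hA : Hom (fun x => c.D x R.v0) R.u0 R.u1
  hB : Hom (fun x => c.D x R.v1) R.u0 R.u1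
  hC : Hom (fun y => c.D R.u0 y) R.v0 R.v1
  hE : Hom (fun y => c.D R.u1 y) R.v0 R.v1

theorem Good.child {c : Ctx N} {R : Rct} (h : c.Good R) (ha : R.u0 <= a) (hab : a < b) (hb : b <= R.u1) : c.swap.Good ⟨R.v0, R.v1, a, b⟩ where
  hu := h.hv
  hv := hab
  int x y h1 h2 h3 h4 := h.int y x (by simp at *; linarith) (by simp at *; linarith) h1 h2
  hA := by
    rcases ha.eq_or_lt with h1 | h1
    · subst h1; exact h.hC
    · intro x y _ _ h2 h3 _; exact h.int _ _ h1 (by simp at *; linarith) h2 h3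
  hB := by
    rcases hb.eq_or_lt with h1 | h1
    · subst h1; exact h.hE
    · intro x y _ _ h2 h3 _; exact h.int _ _ (by simp at *; linarith) h1 h2 h3
  hC := h.hA.sub ha hb
  hE := h.hB.sub ha hb

def same (R : Rct) (a b v w : ℝ) : Prop := c.hi a v = c.hi R.u0 R.v0 /\ c.lo b w = c.lo R.u1 R.v1

def Crit (R : Rct) (x y : ℝ) : Prop :=
  R.u0 <= x /\ x <= R.u1 /\ R.v0 <= y /\ y <= R.v1 /\ ∀ ε > 0, c.same R (max R.u0 (x-ε)) (min R.u1 (x+ε)) (max R.v0 (y-ε)) (min R.v1 (y+ε))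

def Lev : ℕ -> Ctx N -> Rct -> Prop
  | 0, _, _ => False
  | n+1, c, R => ∀ a b, R.u0 <= a -> a < b -> b <= R.u1 -> b - a <= (R.u1 - R.u0)/2 -> c.same R a b R.v0 R.v1 -> Lev n c.swap ⟨R.v0, R.v1, a, b⟩

def Tg (R : Rct) (tag : ℕ) : Prop :=
  (tag = 0 -> hasAdm N (c.hi R.u0 R.v0) (c.lo R.u1 R.v1)) /\
  (tag = 2 -> ∀ x y, c.Crit R x y -> x = R.u0 ∨ x = R.u1 -> R.v0 < y -> y < R.v1 -> False) /\
  (tag = 3 -> ∀ x y, c.Crit R x y -> (x = R.u0 /\ y = R.v1) ∨ (x = R.u1 /\ y = R.v0)) /\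
  (tag = 4 -> ∀ x y, c.Crit R x y -> x = R.u0 /\ y = R.v1) /\
  (tag = 5 -> ∀ x y, c.Crit R x y -> x = R.u1 /\ y = R.v0) /\
  (tag = 6 -> ∃ n, Lev n c R)

theorem crit_lift {R : Rct} (ha : R.u0 <= a) (hb : b <= R.u1) (hs : c.same R a b R.v0 R.v1) (h : c.swap.Crit ⟨R.v0, R.v1, a, b⟩ y x) : c.Crit R x y := by
  obtain ⟨h1, h2, h3, h4, h5⟩ := h
  simp only at h1 h2 h3 h4
  refine ⟨by linarith, by linarith, h1, h2, fun ε he => ?_⟩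
  have h6 := h5 ε he
  unfold same at h6 hs ⊢
  simp only [swap_lo, swap_hi] at h6
  rw [hs.1, hs.2] at h6
  constructor
  · refine ple_antisymm (c.can_hi _ _) (c.can_hi _ _) ?_ (c.hi_mono (le_max_left _ _) (le_max_left _ _))
    rw [<- h6.1]
    exact c.hi_mono (max_le_max ha le_rfl) le_rfl
  · refine ple_antisymm (c.can_lo _ _) (c.can_lo _ _) (c.lo_mono (min_le_left _ _) (min_le_left _ _)) ?_
    rw [<- h6.2]
    exact c.lo_mono (min_le_min hb le_rfl) le_rfl

/-- interior critical points -/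
theorem crit_int {R : Rct} (hg : c.Good R) (h : c.Crit R x y) (h1 : R.u0 < x) (h2 : x < R.u1) (h3 : R.v0 < y) (h4 : y < R.v1) : hasAdm N (c.hi R.u0 R.v0) (c.lo R.u1 R.v1) := by
  obtain ⟨d, ⟨h5, -⟩, ⟨h6, -⟩, e1, e2, e3, e4⟩ := ((c.ev_lo x y).and ((c.ev_hi x y).and
    ((ev_lt (sub_pos.2 h1)).and ((ev_lt (sub_pos.2 h2)).and ((ev_lt (sub_pos.2 h3)).and
    (ev_lt (sub_pos.2 h4))))))).exists
  have := h.2.2.2.2 d e1.1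
  rw [max_eq_right (by linarith), max_eq_right (by linarith), min_eq_right (by linarith), min_eq_right (by linarith)] at this
  unfold same at this
  rw [<- this.1, <- this.2, h5, h6]
  exact c.hasAdm_pt (hg.int x y h1 h2 h3 h4)

/-- critical points on the lower edge -/
theorem crit_low {R : Rct} (hg : c.Good R) (h : c.Crit R x y) (hy : y = R.v0) (h2 : x < R.u1) (h1 : x = R.u0 ∨ ∀ x', R.u0 < x' -> x' < R.u1 -> c.hi x' y = c.hi x y) : hasAdm N (c.hi R.u0 R.v0) (c.lo R.u1 R.v1) := by
  have hv := hg.hv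
  have h0 := h.1
  have ev := (c.ev_hi x y).and ((ev_lt (sub_pos.2 h2)).and (ev_lt (sub_pos.2 (hy ▸ hv))))
  have e0 : c.hi R.u0 R.v0 = c.hi x y := by
    rcases h1 with h1 | h1
    · rw [h1, hy]
    · rcases h0.eq_or_lt with h0 | h0
      · rw [h0, hy]
      · obtain ⟨d, h3, h4⟩ := (ev_lt (sub_pos.2 h0)).exists
        have := (h.2.2.2.2 d h3).1
        rw [max_eq_right (by linarith), max_eq_left (by linarith)] at this
        rw [<- this, <- hy]
        exact h1 _ (by linarith) (by linarith)
  obtain ⟨d, ⟨h5, h6⟩, h7, h8⟩ := ev.exists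
  have := (h.2.2.2.2 d h7.1).2
  rw [min_eq_right (by linarith), min_eq_right (by linarith)] at this
  have h9 := c.hasAdm_pt (hg.int (x+d) (y+d) (by linarith) (by linarith) (by linarith) (by linarith))
  rw [e0, <- this]
  rw [h5, h6] at h9
  rwa [h5]

theorem crit_up {R : Rct} (hg : c.Good R) (h : c.Crit R x y) (hy : y = R.v1) (h2 : R.u0 < x) (h1 : x = R.u1 ∨ ∀ x', R.u0 < x' -> x' < R.u1 -> c.lo x' y = c.lo x y) : hasAdm N (c.hi R.u0 R.v0) (c.lo R.u1 R.v1) := by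
  have hv := hg.hv
  have h0 := h.2.1
  have ev := (c.ev_lo x y).and ((ev_lt (sub_pos.2 h2)).and (ev_lt (sub_pos.2 (hy ▸ hv))))
  have e0 : c.lo R.u1 R.v1 = c.lo x y := by
    rcases h1 with h1 | h1
    · rw [h1, hy]
    · rcases h0.eq_or_lt with h0 | h0
      · rw [h0, hy]
      · obtain ⟨d, h3, h4⟩ := (ev_lt (sub_pos.2 h0)).exists
        have := (h.2.2.2.2 d h3).2
        rw [min_eq_right (by linarith), min_eq_left (by linarith)] at this
        rw [<- this, <- hy]
        exact h1 _ (by linarith) (by linarith)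
  obtain ⟨d, ⟨h5, h6⟩, h7, h8⟩ := ev.exists
  have := (h.2.2.2.2 d h7.1).1
  rw [max_eq_right (by linarith), max_eq_right (by linarith)] at this
  have h9 := c.hasAdm_pt (hg.int (x-d) (y-d) (by linarith) (by linarith) (by linarith) (by linarith))
  rw [e0, <- this]
  rw [h5, h6] at h9
  rwa [h5]

/-! ### no critical points: bounded level -/

def NS (g g' : Pos) (R : Rct) (δ : ℝ) : Prop := ∀ a b v w, R.u0 <= a -> a <= b -> b <= R.u1 -> R.v0 <= v ->
  v <= w -> w <= R.v1 -> b - a < δ -> w - v < δ -> ¬ (c.hi a v = g /\ c.lo b w = g')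

theorem exists_NS {R : Rct} (hn : ∀ x y, ¬ c.Crit R x y) : ∃ δ > 0, c.NS (c.hi R.u0 R.v0) (c.lo R.u1 R.v1) R δ := by
  have key : ∀ z : ℝ × ℝ, ∃ ε > 0, z ∈ Set.Icc R.u0 R.u1 ×ˢ Set.Icc R.v0 R.v1 -> ¬
      c.same R (max R.u0 (z.1-ε)) (min R.u1 (z.1+ε)) (max R.v0 (z.2-ε)) (min R.v1 (z.2+ε)) := by
    intro z
    have := hn z.1 z.2
    unfold Crit at this
    by_cases hz : z ∈ Set.Icc R.u0 R.u1 ×ˢ Set.Icc R.v0 R.v1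
    · obtain ⟨⟨h1, h2⟩, h3, h4⟩ := hz
      simp only [h1, h2, h3, h4, true_and] at this
      push Not at this
      obtain ⟨ε, h5, h6⟩ := this
      exact ⟨ε, h5, fun _ => h6⟩
    · exact ⟨1, one_pos, fun h => absurd h hz⟩
  choose ε he hne using key
  have hK : IsCompact (Set.Icc R.u0 R.u1 ×ˢ Set.Icc R.v0 R.v1) := isCompact_Icc.prod isCompact_Icc
  obtain ⟨δ, hd, hL⟩ := lebesgue_number_lemma_of_metric (ι := Set.Icc R.u0 R.u1 ×ˢ Set.Icc R.v0 R.v1)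
    (c := fun z => Metric.ball z.1 (ε z)) hK
    (fun z => Metric.isOpen_ball) (fun z hz => Set.mem_iUnion.2 ⟨⟨z, hz⟩, Metric.mem_ball_self (he z)⟩)
  refine ⟨δ, hd, fun a b v w h1 h2 h3 h4 h5 h6 h7 h8 ⟨h9, h10⟩ => ?_⟩
  obtain ⟨⟨z, hz⟩, hb⟩ := hL (a, v) ⟨⟨h1, h2.trans h3⟩, h4, h5.trans h6⟩
  have m1 := hb (Metric.mem_ball_self hd)
  have m2 : (b, w) ∈ Metric.ball z (ε z) := by
    apply hb
    rw [Metric.mem_ball, Prod.dist_eq, max_lt_iff, Real.dist_eq, Real.dist_eq, abs_of_nonneg (by simpa using h2), abs_of_nonneg (by simpa using h5)]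
    exact ⟨h7, h8⟩
  simp only [Metric.mem_ball, Prod.dist_eq, max_lt_iff, Real.dist_eq, abs_lt] at m1 m2
  refine hne z hz ⟨?_, ?_⟩
  · refine ple_antisymm (c.can_hi _ _) (c.can_hi _ _) ?_ (c.hi_mono (le_max_left _ _) (le_max_left _ _))
    rw [<- h9]
    exact c.hi_mono (max_le h1 (by linarith)) (max_le h4 (by linarith))
  · refine ple_antisymm (c.can_lo _ _) (c.can_lo _ _) (c.lo_mono (min_le_left _ _) (min_le_left _ _)) ?_
    rw [<- h10]
    exact c.lo_mono (le_min h3 (by linarith)) (le_min h6 (by linarith))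

theorem lev_of_NS {g g' : Pos} {δ : ℝ} (n : ℕ) : ∀ (c : Ctx N) (R : Rct), R.u0 <= R.u1 -> R.v0 <= R.v1 -> c.NS g g' R δ -> c.hi R.u0 R.v0 = g -> c.lo R.u1 R.v1 = g' -> R.u1 - R.u0 < δ * (4/3)^n -> 3/2 * (R.v1 - R.v0) < δ * (4/3)^n -> Lev n c R := by
  induction n with
  | zero =>
    intro c R h1 h2 h3 h4 h5 h6 h7
    simp only [pow_zero, mul_one] at h6 h7
    exact h3 R.u0 R.u1 R.v0 R.v1 le_rfl h1 le_rfl le_rfl h2 le_rfl h6 (by linarith) ⟨h4, h5⟩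
  | succ n ih =>
    intro c R h1 h2 h3 h4 h5 h6 h7 a b ha hab hb hw hs
    rw [pow_succ] at h6 h7
    refine ih c.swap _ h2 hab.le ?_ ?_ ?_ ?_ ?_
    · intro v w a' b' h8 h9 h10 h11 h12 h13 h14 h15
      simp only at *
      rw [swap_hi, swap_lo]
      exact h3 a' b' v w (by linarith) h12 (by linarith) h8 h9 h10 h15 h14
    · rw [swap_hi, hs.1, h4]
    · rw [swap_lo, hs.2, h5]
    · simp only; linarith
    · simp only; linarith

theorem exists_lev {R : Rct} (hu : R.u0 <= R.u1) (hv : R.v0 <= R.v1) (hn : ∀ x y, ¬ c.Crit R x y) : ∃ n, Lev n c R := by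
  obtain ⟨δ, hd, h⟩ := c.exists_NS hn
  obtain ⟨n, h1⟩ := pow_unbounded_of_one_lt ((max (R.u1 - R.u0) (3/2*(R.v1 - R.v0)))/δ)
    (show (1:ℝ) < 4/3 by norm_num)
  rw [div_lt_iff₀ hd, max_lt_iff, mul_comm] at h1
  exact ⟨n, lev_of_NS n c R hu hv h rfl rfl h1.1 h1.2⟩

/-- the tag of a child -/
theorem child_tag {R : Rct} (hg : c.Good R) {tag : ℕ} (htag : tag <= 6) (hT : c.Tg R tag) (ha : R.u0 <= a) (hab : a < b) (hb : b <= R.u1) (hw : b - a <= (R.u1 - R.u0)/2) (h0' : t = 0 -> a = R.u0) (h0 : t ≠ 0 -> R.u0 < a) (h1 : t + 1 ≠ M -> b < R.u1) (hA : ∀ x y, a < x -> x < b -> a < y -> y < b -> c.hi x R.v0 = c.hi y R.v0) (hB : ∀ x y, a < x -> x < b -> a < y -> y < b -> c.lo x R.v1 = c.lo y R.v1) : ∃ tag' ≤ 6, c.swap.Tg ⟨R.v0, R.v1, a, b⟩ tag' /\ (c.same R a b R.v0 R.v1 -> ∀ rk rk', (tag = 6 -> tag' = 6 -> rk' < rk)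 -> tagStep M t tag tag' rk rk') := by
  have hu := hg.hu
  have hv := hg.hv
  have hgc := hg.child ha hab hb
  by_cases had : hasAdm N (c.swap.hi R.v0 a) (c.swap.lo R.v1 b)
  · refine ⟨0, by omega, ⟨fun _ => had, ?_, ?_, ?_, ?_, ?_⟩, fun _ rk rk' _ => Or.inr (Or.inl rfl)⟩ <;>
      (intro h; omega)
  by_cases hs : c.same R a b R.v0 R.v1
  swap
  · refine ⟨1, by omega, ⟨?_, ?_, ?_, ?_, ?_, ?_⟩, fun h => absurd h hs⟩ <;> (intro h; omega)
  have had' : ¬ hasAdm N (c.hi R.u0 R.v0) (c.lo R.u1 R.v1) := by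
    rw [<- hs.1, <- hs.2]; rwa [swap_hi, swap_lo] at had
  have lift : ∀ y x, c.swap.Crit ⟨R.v0, R.v1, a, b⟩ y x -> c.Crit R x y :=
    fun y x h => c.crit_lift ha hb hs h
  have hg2 : c.Good ⟨a, b, R.v0, R.v1⟩ :=
    ⟨hab, hv, fun x y p q r s => hg.int x y (by simp at *; linarith) (by simp at *; linarith) r s, hg.hA.sub ha hb, hg.hB.sub ha hb, hgc.hA, hgc.hB⟩
  have hc : ∀ y x, c.swap.Crit ⟨R.v0, R.v1, a, b⟩ y x -> c.Crit ⟨a, b, R.v0, R.v1⟩ x y := fun y x h => by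
    refine ⟨h.2.2.1, h.2.2.2.1, h.1, h.2.1, fun ε he => ?_⟩
    have := h.2.2.2.2 ε he
    unfold same at this ⊢
    simpa only [swap_hi, swap_lo] using this
  have nC : ∀ y x, c.swap.Crit ⟨R.v0, R.v1, a, b⟩ y x -> y = R.v0 -> x = b := by
    intro y x h hy
    by_contra hx
    have hx1 : x <= b := h.2.2.2.1
    have hx2 : a <= x := h.2.2.1
    have hx3 : x < b := lt_of_le_of_ne hx1 hx
    refine had ?_
    have hy' : y = R.v0 := hy
    have := c.crit_low hg2 (hc y x h) hy' hx3 (by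
      rcases hx2.eq_or_lt with h | h
      · exact Or.inl h.symm
      · exact Or.inr fun x' h3 h4 => by rw [hy']; exact hA _ _ h3 h4 h hx3)
    rw [swap_hi, swap_lo]; exact this
  have nE : ∀ y x, c.swap.Crit ⟨R.v0, R.v1, a, b⟩ y x -> y = R.v1 -> x = a := by
    intro y x h hy
    by_contra hx
    have hx1 : x <= b := h.2.2.2.1
    have hx2 : a <= x := h.2.2.1
    have hx3 : a < x := lt_of_le_of_ne hx2 (Ne.symm hx)
    refine had ?_
    have := c.crit_up hg2 (hc y x h) hy hx3 (by
      rcases hx1.eq_or_lt with h | h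
      · exact Or.inl h
      · exact Or.inr fun x' h3 h4 => by rw [hy]; exact hB _ _ h3 h4 hx3 h)
    rw [swap_hi, swap_lo]; exact this
  -- no further critical points
  have noC : (∀ x y, c.swap.Crit ⟨R.v0, R.v1, a, b⟩ x y -> False) -> c.swap.Tg ⟨R.v0, R.v1, a, b⟩ 6 := fun h =>
    ⟨by omega, by omega, by omega, by omega, by omega, fun _ => c.swap.exists_lev hv.le hab.le h⟩
  obtain ⟨hT0, hT2, hT3, hT4, hT5, hT6⟩ := hT
  have hcase : tag = 0 ∨ tag = 1 ∨ tag = 2 ∨ tag = 3 ∨ tag = 4 ∨ tag = 5 ∨ tag = 6 := by omega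
  unfold tagStep
  rcases hcase with rfl | rfl | rfl | rfl | rfl | rfl | rfl
  · exact absurd (hT0 rfl) had'
  · refine ⟨2, by omega, ⟨by omega, fun _ y x h hy h3 h4 => ?_, by omega, by omega, by omega, by omega⟩, fun _ _ _ _ => by omega⟩
    rcases hy with hy | hy
    · have := nC y x h hy; simp only at h4; linarith
    · have := nE y x h hy; simp only at h3; linarith
  · refine ⟨3, by omega, ⟨by omega, by omega, fun _ y x h => ?_, by omega, by omega, by omega⟩, fun _ _ _ _ => by omega⟩
    simp only
    by_cases hy0 : y = R.v0
    · exact Or.inl ⟨hy0, nC y x h hy0⟩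
    by_cases hy1 : y = R.v1
    · exact Or.inr ⟨hy1, nE y x h hy1⟩
    exfalso
    have g0 : R.v0 < y := lt_of_le_of_ne h.1 (Ne.symm hy0)
    have g1 : y < R.v1 := lt_of_le_of_ne h.2.1 hy1
    have hl := lift y x h
    have g2 : R.u0 ≠ x := fun e => hT2 rfl x y hl (Or.inl e.symm) g0 g1
    have g3 : x ≠ R.u1 := fun e => hT2 rfl x y hl (Or.inr e) g0 g1
    exact had' (c.crit_int hg hl (lt_of_le_of_ne hl.1 g2) (lt_of_le_of_ne hl.2.1 g3) g0 g1)
  · by_cases ht : t = 0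
    · refine ⟨5, by omega, ⟨by omega, by omega, by omega, by omega, fun _ y x h => ?_, by omega⟩, fun _ _ _ _ => by omega⟩
      have hx : x <= b := h.2.2.2.1
      have hx0 : a <= x := h.2.2.1
      rcases hT3 rfl _ _ (lift y x h) with h5 | h5
      · exact ⟨h5.2, by simp only; linarith⟩
      · have := h0' ht; exfalso; linarith
    by_cases ht' : t + 1 = M
    · refine ⟨4, by omega, ⟨by omega, by omega, by omega, fun _ y x h => ?_, by omega, by omega⟩, fun _ _ _ _ => by omega⟩
      have hx : x <= b := h.2.2.2.1
      have hx0 : a <= x := h.2.2.1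
      rcases hT3 rfl _ _ (lift y x h) with h5 | h5
      · have := h0 ht; exfalso; linarith
      · exact ⟨h5.2, by simp only; linarith⟩
    refine ⟨6, by omega, noC fun y x h => ?_, fun _ _ _ _ => by omega⟩
    have hx : x <= b := h.2.2.2.1
    have hx0 : a <= x := h.2.2.1
    have := h0 ht
    have := h1 ht'
    rcases hT3 rfl _ _ (lift y x h) with h5 | h5 <;> linarith
  · by_cases ht : t = 0
    · refine ⟨5, by omega, ⟨by omega, by omega, by omega, by omega, fun _ y x h => ?_, by omega⟩, fun _ _ _ _ => by omega⟩
      have hx0 : a <= x := h.2.2.1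
      have h5 := hT4 rfl _ _ (lift y x h)
      exact ⟨h5.2, by simp only; linarith⟩
    refine ⟨6, by omega, noC fun y x h => ?_, fun _ _ _ _ => by omega⟩
    have hx0 : a <= x := h.2.2.1
    have := h0 ht
    have h5 := hT4 rfl _ _ (lift y x h)
    linarith
  · by_cases ht : t + 1 = M
    · refine ⟨4, by omega, ⟨by omega, by omega, by omega, fun _ y x h => ?_, by omega, by omega⟩, fun _ _ _ _ => by omega⟩
      have hx : x <= b := h.2.2.2.1
      have h5 := hT5 rfl _ _ (lift y x h)
      exact ⟨h5.2, by simp only; linarith⟩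
    refine ⟨6, by omega, noC fun y x h => ?_, fun _ _ _ _ => by omega⟩
    have hx : x <= b := h.2.2.2.1
    have := h1 ht
    have h5 := hT5 rfl _ _ (lift y x h)
    linarith
  · obtain ⟨n, hn⟩ := hT6 rfl
    refine ⟨6, by omega, ⟨by omega, by omega, by omega, by omega, by omega, fun _ => ?_⟩, fun _ _ _ h => by have := h rfl rfl; omega⟩
    cases n with
    | zero => exact hn.elim
    | succ n => exact ⟨n, hn a b ha hab hb hw hs⟩

end Ctx

/-! ## Part A3: marks -/

structure Mk (us : ℕ -> ℝ) (m : ℕ) (a b : ℝ) : Prop where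
  sm : SM us m
  pos : 1 <= m
  h0 : us 0 = a
  h1 : us m = b

noncomputable def pt (us : ℕ -> ℝ) (j : ℕ) : ℝ := (us (j/2) + us ((j+1)/2))/2

theorem loc_pt (h : SM us m) (hj : j <= 2*m) : loc us j (pt us j) := by
  unfold pt loc
  rcases Nat.mod_two_eq_zero_or_one j with h1 | h1
  · left; rw [show (j+1)/2 = j/2 by omega]; exact ⟨h1, by ring⟩
  · right; rw [show (j+1)/2 = j/2+1 by omega]
    have := h (j/2) (by omega)
    exact ⟨h1, by linarith, by linarith⟩

theorem exists_marks {F : Finset ℝ} (hab : a < b) (hF : ∀ x ∈ F, a <= x /\ x <= b) (ha : a ∈ F) (hb : b ∈ F) : ∃ m us, Mk us m a b /\ m + 1 = F.card /\ (∀ i ≤ m, us i ∈ F) /\ ∀ x ∈ F, ∃ i ≤ m, us i = x := by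
  have h2 : 1 < F.card := Finset.one_lt_card.2 ⟨a, ha, b, hb, hab.ne⟩
  obtain ⟨m, hm⟩ : ∃ m, F.card = m + 1 := ⟨F.card - 1, by omega⟩
  set e := F.orderEmbOfFin hm with he
  have he' : ∀ i (hi : i < m+1), (if h : i < m+1 then e ⟨i, h⟩ else 0) = e ⟨i, hi⟩ :=
    fun i hi => dif_pos hi
  have mem : ∀ i, e i ∈ F := F.orderEmbOfFin_mem hm
  have sur : ∀ x ∈ F, ∃ i, e i = x := fun x hx => by
    have := F.range_orderEmbOfFin hm
    have h3 : x ∈ Set.range e := by rw [he, this]; exact hx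
    exact h3
  refine ⟨m, fun i => if h : i < m+1 then e ⟨i, h⟩ else 0, ⟨fun i hi => ?_, by omega, ?_, ?_⟩, by omega, fun i hi => ?_, fun x hx => ?_⟩
  · rw [he' i (by omega), he' (i+1) (by omega)]
    exact e.strictMono (by simp)
  · rw [he' 0 (by omega)]
    obtain ⟨i, hi⟩ := sur a ha
    refine le_antisymm ?_ (hF _ (mem _)).1
    rw [<- hi]; exact e.monotone (Fin.mk_le_of_le_val (by simp))
  · rw [he' m (by omega)]
    obtain ⟨i, hi⟩ := sur b hb
    refine le_antisymm (hF _ (mem _)).2 ?_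
    rw [<- hi]; exact e.monotone (by rw [Fin.le_def]; exact Nat.lt_succ_iff.1 i.2)
  · beta_reduce; rw [he' i (by omega)]; exact mem _
  · obtain ⟨i, hi⟩ := sur x hx
    exact ⟨i, Nat.lt_succ_iff.1 i.2, by beta_reduce; rw [he' i i.2]; exact hi⟩

theorem Mk.mem (h : Mk us m a b) (hj : j <= 2*m) (hx : loc us j x) : a <= x /\ x <= b := by
  have h1 := loc_ge hx
  have h2 := loc_le hx
  have h3 := h.sm.le (Nat.zero_le (j/2)) (by omega)
  have h4 := h.sm.le (show (j+1)/2 <= m by omega) le_rfl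
  rw [h.h0] at h3; rw [h.h1] at h4
  exact ⟨by linarith, by linarith⟩

theorem Mk.lt_b (h : Mk us m a b) (hj : j < 2*m) (hx : loc us j x) : x < b := by
  rcases hx with ⟨h1, rfl⟩ | ⟨h1, h2, h3⟩
  · rw [<- h.h1]; exact h.sm.lt (by omega) le_rfl
  · have := h.sm.le (show j/2+1 <= m by omega) le_rfl
    rw [h.h1] at this; linarith

theorem Mk.gt_a (h : Mk us m a b) (hj : j <= 2*m) (hj0 : 0 < j) (hx : loc us j x) : a < x := by
  rcases hx with ⟨h1, rfl⟩ | ⟨h1, h2, h3⟩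
  · rw [<- h.h0]; exact h.sm.lt (by omega) (by omega)
  · have := h.sm.le (Nat.zero_le (j/2)) (by omega)
    rw [h.h0] at this; linarith

theorem Mk.ex (h : Mk us m a b) (h1 : a <= x) (h2 : x <= b) : ∃ j ≤ 2*m, loc us j x := loc_exists (by rw [h.h0]; exact h1) (by rw [h.h1]; exact h2)

theorem Mk.ex_int (h : Mk us m a b) (h1 : a < x) (h2 : x < b) : ∃ j, 0 < j /\ j < 2*m /\ loc us j x := by
  obtain ⟨j, hj, hx⟩ := h.ex h1.le h2.le
  refine ⟨j, Nat.pos_of_ne_zero ?_, lt_of_le_of_ne hj ?_, hx⟩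
  · rintro rfl
    have := (loc_even_iff (i := 0)).1 hx; rw [h.h0] at this; linarith
  · rintro rfl
    have := loc_even_iff.1 hx; rw [h.h1] at this; linarith

/-- refinement index map -/
theorem exists_ref (h : Mk us m a b) (H : Mk Us M a b) (hs : ∀ i ≤ m, ∃ j ≤ M, Us j = us i) : ∃ ru, IsRef ru M m /\ (∀ j ≤ 2*M, ru j <= 2*m) /\ (∀ j, 2*M < j -> ru j = 0) /\ ∀ j ≤ 2*M, ∀ x, loc Us j x -> loc us (ru j) x := by
  have h1 : ∀ j, ∃ i, (j ≤ 2*M -> i <= 2*m /\ loc us i (pt Us j)) /\ (2*M < j -> i = 0) := fun j => by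
    by_cases hj : j <= 2*M
    · obtain ⟨h1, h2⟩ := H.mem hj (loc_pt H.sm hj)
      obtain ⟨i, h3, h4⟩ := h.ex h1 h2
      exact ⟨i, fun _ => ⟨h3, h4⟩, fun h => absurd hj (by omega)⟩
    · exact ⟨0, fun h => absurd h hj, fun _ => rfl⟩
  choose ru hru hru0 using h1
  have key : ∀ j ≤ 2*M, ∀ x, loc Us j x -> loc us (ru j) x := by
    intro j hj x hx
    obtain ⟨hi, hl⟩ := hru j hj
    have hp := loc_pt H.sm hj
    rcases hx with ⟨p0, hx⟩ | ⟨p1, hx⟩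
    · rcases hp with ⟨_, q⟩ | ⟨q, _⟩
      · rw [hx, <- q]; exact hl
      · omega
    · rcases hp with ⟨q, _⟩ | ⟨_, q⟩
      · omega
      have out : ∀ i ≤ m, us i <= Us (j/2) ∨ Us (j/2+1) <= us i := by
        intro i hi
        obtain ⟨k, hk, e⟩ := hs i hi
        rw [<- e]
        rcases Nat.lt_or_ge (j/2) k with h2 | h2
        · exact Or.inr (H.sm.le h2 hk)
        · exact Or.inl (H.sm.le h2 (by omega))
      rcases hl with ⟨r, e⟩ | ⟨r, e1, e2⟩
      · rcases out (ru j/2) (by omega) with o | o <;> (rw [e] at q; linarith)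
      · right
        refine ⟨r, ?_, ?_⟩
        · rcases out (ru j/2) (by omega) with o | o <;> linarith
        · rcases out (ru j/2+1) (by omega) with o | o <;> linarith
  have od : ∀ j < 2*M, j % 2 = 1 -> ru j % 2 = 1 := fun j hj hj1 => by
    by_contra hc
    obtain ⟨k, hk⟩ : ∃ k, j = 2*k+1 := ⟨j/2, by omega⟩
    have e : ∀ x, loc Us j x -> x = us (ru j/2) := fun x hx => by
      rcases key j hj.le x hx with h2 | h2
      · exact h2.2
      · omega
    have hlt := H.sm k (by omega)
    have e1 := e ((2*Us k + Us (k+1))/3) (by rw [hk, loc_odd_iff]; constructor <;> linarith)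
    have e2 := e ((Us k + 2*Us (k+1))/3) (by rw [hk, loc_odd_iff]; constructor <;> linarith)
    linarith
  refine ⟨ru, ⟨?_, ?_, fun j hj => ⟨od j hj, fun h0 => ?_, fun h1 => ?_⟩⟩, fun j hj => (hru j hj).1, hru0, key⟩
  · refine loc_unique h.sm (hru 0 (by omega)).1 (by omega) (key 0 (by omega) _ (loc_even Us 0)) ?_
    rw [H.h0, <- h.h0]; exact loc_even us 0
  · refine loc_unique h.sm (hru _ le_rfl).1 le_rfl (key _ le_rfl _ (loc_even Us M)) ?_
    rw [H.h1, <- h.h1]; exact loc_even us m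
  · -- coarse index even: next is odd slot
    have hb := hru j hj.le
    have hx := loc_pt H.sm hj.le
    have hx' := key j hj.le _ hx
    have hy := loc_pt H.sm (show j+1 <= 2*M by omega)
    have hy' := key (j+1) hj _ hy
    have hj0 : j % 2 = 0 := by have := od j hj; omega
    have hxu : pt Us j = us (ru j/2) := by
      rcases hx' with h2 | h2
      · exact h2.2
      · omega
    have hxU : pt Us j = Us (j/2) := by
      rcases hx with h2 | h2
      · exact h2.2
      · omega
    have hm : ru j/2 < m := by
      by_contra hc
      have : ru j/2 = m := by omega
      rw [this, h.h1, <- H.h1, hxU] at hxu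
      have := H.sm.inj (by omega) le_rfl hxu
      omega
    -- a point of the fine slot close to its left end
    have hlt := H.sm (j/2) (by omega)
    have hlt' := h.sm (ru j/2) hm
    obtain ⟨x, hx1, hx2⟩ := exists_between (lt_min hlt (by rw [<- hxU, hxu]; exact hlt'))
    rw [lt_min_iff] at hx2
    have l1 : loc Us (j+1) x := Or.inr ⟨by omega, by rw [show (j+1)/2 = j/2 by omega]; exact ⟨hx1, hx2.1⟩⟩
    have l2 : loc us (ru j+1) x := Or.inr ⟨by omega, by
      rw [show (ru j+1)/2 = ru j/2 by omega, <- hxu, hxU]; exact ⟨hx1, hx2.2⟩⟩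
    exact loc_unique h.sm (hru _ hj).1 (by omega) (key _ hj _ l1) l2
  · -- coarse index odd
    have hb := hru j hj.le
    have hb' := hru (j+1) hj
    have hx := loc_pt H.sm hj.le
    have hx' := key j hj.le _ hx
    have hy := loc_pt H.sm (show j+1 <= 2*M by omega)
    have hy' := key (j+1) hj _ hy
    have hxy : pt Us j < pt Us (j+1) := by
      rcases hx with ⟨p, h2⟩ | ⟨p, h2⟩ <;> rcases hy with ⟨q, h3⟩ | ⟨q, h3⟩ <;> try omega
      · rw [show (j+1)/2 = j/2 by omega] at h3; rw [h2]; exact h3.1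
      · rw [show (j+1)/2 = j/2+1 by omega] at h3; rw [h3]; exact h2.2
    have g1 := loc_lt h.sm hb.1 hb'.1 hx' hy' hxy
    by_contra hc
    push Not at hc
    have g2 : ru j + 2 <= ru (j+1) := by omega
    -- the mark us (ru j/2+1) is strictly between
    obtain ⟨k, hk, ek⟩ := hs (ru j/2+1) (by omega)
    have lk : loc us (2*(ru j/2+1)) (Us k) := by rw [ek]; exact loc_even us _
    have a1 : pt Us j < Us k := by
      rcases hx' with h2 | h2
      · omega
      · rw [ek]; exact h2.2.2
    have a2 : Us k < pt Us (j+1) := by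
      rw [ek]
      have := h.sm.le (show ru j/2+1 <= ru (j+1)/2 by omega) (by omega)
      have e := loc_ge hy'
      rcases hy' with h2 | h2
      · rw [h2.2]; exact h.sm.lt (by omega) (by omega)
      · linarith [h2.2.1]
    have b1 := loc_lt H.sm hj.le (show 2*k <= 2*M by omega) hx (loc_even Us k) a1
    have b2 := loc_lt H.sm (show 2*k <= 2*M by omega) hj (loc_even Us k) hy a2
    omega

theorem threshold {P : ℝ -> Prop} (a b : ℝ) (h : (∀ x y, x <= y -> P x -> P y) ∨ ∀ x y, x <= y -> P y -> P x) : ∃ τ : ℝ, ∀ x y, a < x -> x < b -> a < y -> y < b -> (τ < x ↔ τ < y) -> (x < τ ↔ y < τ) -> (P x -> P y) := by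
  have anti : ∀ P : ℝ -> Prop, (∀ x y, x <= y -> P y -> P x) -> ∃ τ : ℝ, ∀ x y, a < x -> x < b -> a < y -> y < b -> (τ < x ↔ τ < y) -> (x < τ ↔ y < τ) -> (P x -> P y) := by
    intro P h
    have bd : BddAbove {x | a < x /\ x < b /\ P x} := ⟨b, fun x hx => hx.2.1.le⟩
    refine ⟨sSup {x | a < x /\ x < b /\ P x}, fun x y h1 h2 h3 h4 h5 h6 hP => ?_⟩
    by_contra hn
    have hxy : x < y := by
      by_contra hc; exact hn (h _ _ (not_lt.1 hc) hP)
    have le : x <= sSup {x | a < x /\ x < b /\ P x} := le_csSup bd ⟨h1, h2, hP⟩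
    rcases le.eq_or_lt with e | e
    · rw [<- e] at h5; exact absurd (h5.2 hxy) (lt_irrefl _)
    · obtain ⟨z, hz, hz'⟩ := exists_lt_of_lt_csSup
        (show Set.Nonempty {x | a < x /\ x < b /\ P x} from ⟨x, h1, h2, hP⟩) (h6.1 (e.trans_le le_rfl))
      exact hn (h _ _ hz'.le hz.2.2)
  rcases h with h | h
  · obtain ⟨τ, ht⟩ := anti (fun x => ¬ P x) (fun x y hxy h1 h2 => h1 (h x y hxy h2))
    exact ⟨τ, fun x y h1 h2 h3 h4 h5 h6 hP => by
      by_contra hn; exact ht y x h3 h4 h1 h2 h5.symm h6.symm hn hP⟩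
  · exact anti P h

namespace Ctx
variable (c : Ctx N)

theorem thr (v a b : ℝ) : ∃ F : Finset ℝ, F.card <= 4*(N+1) /\ ∀ x y, a < x -> x < b -> a < y -> y < b -> (∀ f ∈ F, (f < x ↔ f < y) /\ (x < f ↔ y < f)) -> c.lo x v = c.lo y v /\ c.hi x v = c.hi y v := by
  choose t1 h1 using fun i => threshold (P := fun x => fut (c.T i) x v) a b
    (Or.inr fun x y hxy h => fut_mono h hxy le_rfl)
  choose t2 h2 using fun i => threshold (P := fun x => futm (c.T i) x v) a b
    (Or.inr fun x y hxy h => futm_mono h hxy le_rfl)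
  choose t3 h3 using fun i => threshold (P := fun x => pas (c.T i) x v) a b
    (Or.inl fun x y hxy h => pas_mono h hxy le_rfl)
  choose t4 h4 using fun i => threshold (P := fun x => pasp (c.T i) x v) a b
    (Or.inl fun x y hxy h => pasp_mono h hxy le_rfl)
  classical
  refine ⟨(Finset.range (N+1)).image t1 ∪ (Finset.range (N+1)).image t2 ∪
    (Finset.range (N+1)).image t3 ∪ (Finset.range (N+1)).image t4, ?_, fun x y e1 e2 e3 e4 hf => ?_⟩
  · have b1 := fun t : ℕ -> ℝ => (Finset.card_image_le (s := Finset.range (N+1)) (f := t))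
    simp only [Finset.card_range] at b1
    have c1 := Finset.card_union_le ((Finset.range (N+1)).image t1 ∪ (Finset.range (N+1)).image t2 ∪
      (Finset.range (N+1)).image t3) ((Finset.range (N+1)).image t4)
    have c2 := Finset.card_union_le ((Finset.range (N+1)).image t1 ∪ (Finset.range (N+1)).image t2)
      ((Finset.range (N+1)).image t3)
    have c3 := Finset.card_union_le ((Finset.range (N+1)).image t1) ((Finset.range (N+1)).image t2)
    have := b1 t1; have := b1 t2; have := b1 t3; have := b1 t4
    omega
  · have sy : ∀ {P : ℝ -> Prop} {τ : ℝ}, (∀ x y, a < x -> x < b -> a < y -> y < b -> (τ < x ↔ τ < y) -> (x < τ ↔ y < τ) -> (P x -> P y)) -> ((τ < x ↔ τ < y) /\ (x < τ ↔ y < τ)) -> (P x ↔ P y) :=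
      fun h hh => ⟨h x y e1 e2 e3 e4 hh.1 hh.2, h y x e3 e4 e1 e2 hh.1.symm hh.2.symm⟩
    unfold lo hi
    refine ⟨?_, ?_⟩ <;> congr 1 <;> refine setN_congr _ _ _ fun i hi => ?_
    all_goals simp only [Finset.mem_union, Finset.mem_image, Finset.mem_range] at hf
    · exact sy (h2 i) (hf _ (Or.inl (Or.inl (Or.inr ⟨i, by omega, rfl⟩))))
    · exact sy (h3 i) (hf _ (Or.inl (Or.inr ⟨i, by omega, rfl⟩)))
    · exact sy (h1 i) (hf _ (Or.inl (Or.inl (Or.inl ⟨i, by omega, rfl⟩))))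
    · exact sy (h4 i) (hf _ (Or.inr ⟨i, by omega, rfl⟩))

/-- the fields are constant on the pieces of a horizontal line -/
def Cst (v : ℝ) (us : ℕ -> ℝ) (m : ℕ) : Prop := ∀ j ≤ 2*m, ∀ x y, loc us j x -> loc us j y ->
  c.lo x v = c.lo y v /\ c.hi x v = c.hi y v

theorem cst_of (hk : Mk us m a b) {F : Finset ℝ} (h : ∀ x y, a < x -> x < b -> a < y -> y < b -> (∀ f ∈ F, (f < x ↔ f < y) /\ (x < f ↔ y < f)) -> c.lo x v = c.lo y v /\ c.hi x v = c.hi y v) (hF : ∀ f ∈ F, a < f -> f < b -> ∃ i ≤ m, us i = f) : c.Cst v us m := by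
  intro j hj x y hx hy
  rcases Nat.mod_two_eq_zero_or_one j with p | p
  · have : x = y := by
      rcases hx with hx | hx
      · rcases hy with hy | hy
        · rw [hx.2, hy.2]
        · omega
      · omega
    rw [this]; exact ⟨rfl, rfl⟩
  · have x1 := hk.gt_a hj (by omega) hx
    have y1 := hk.gt_a hj (by omega) hy
    have x2 := hk.lt_b (by omega) hx
    have y2 := hk.lt_b (by omega) hy
    refine h x y x1 x2 y1 y2 fun f hf => ?_
    rcases hx with hx | ⟨_, hx, hx'⟩
    · omega
    rcases hy with hy | ⟨_, hy, hy'⟩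
    · omega
    have cl : f <= us (j/2) ∨ us (j/2+1) <= f := by
      by_cases f1 : a < f
      · by_cases f2 : f < b
        · obtain ⟨i, hi, rfl⟩ := hF f hf f1 f2
          rcases Nat.lt_or_ge (j/2) i with q | q
          · exact Or.inr (hk.sm.le q hi)
          · exact Or.inl (hk.sm.le q (by omega))
        · have := hk.sm.le (show j/2+1 <= m by omega) le_rfl
          rw [hk.h1] at this
          exact Or.inr (by linarith)
      · have := hk.sm.le (Nat.zero_le (j/2)) (by omega)
        rw [hk.h0] at this
        exact Or.inl (by linarith)
    rcases cl with cl | cl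
    · exact ⟨iff_of_true (by linarith) (by linarith), iff_of_false (by linarith) (by linarith)⟩
    · exact ⟨iff_of_false (by linarith) (by linarith), iff_of_true (by linarith) (by linarith)⟩

theorem mk_pts (hab : a < b) (X : Finset ℝ) : ∃ m us, Mk us m a b /\ m <= X.card + 1 /\ (∀ x ∈ X, a <= x -> x <= b -> ∃ i ≤ m, us i = x) := by
  classical
  obtain ⟨m, us, h1, h2, -, h3⟩ := exists_marks (F := insert a (insert b (X.filter fun x => a < x /\ x < b)))
    hab (by
      intro x hx
      simp only [Finset.mem_insert, Finset.mem_filter] at hx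
      rcases hx with rfl | rfl | ⟨_, h1, h2⟩
      · exact ⟨le_rfl, hab.le⟩
      · exact ⟨hab.le, le_rfl⟩
      · exact ⟨h1.le, h2.le⟩) (by simp) (by simp)
  refine ⟨m, us, h1, ?_, fun x hx h4 h5 => h3 x ?_⟩
  swap
  · rcases h4.eq_or_lt with h | h
    · simp [h]
    · rcases h5.eq_or_lt with h' | h'
      · simp [h']
      · simp [hx, h, h']
  have := Finset.card_insert_le a (insert b (X.filter fun x => a < x /\ x < b))
  have := Finset.card_insert_le b (X.filter fun x => a < x /\ x < b)
  have := Finset.card_filter_le X (fun x => a < x /\ x < b)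
  omega

/-- marks on which two given lines (in given contexts) have constant fields -/
theorem mk_marks (c1 c2 : Ctx N) (v1 v2 : ℝ) (hab : a < b) : ∃ m us, Mk us m a b /\ m <= 8*(N+1)+1 /\ c1.Cst v1 us m /\ c2.Cst v2 us m := by
  classical
  obtain ⟨F1, n1, h1⟩ := c1.thr v1 a b
  obtain ⟨F2, n2, h2⟩ := c2.thr v2 a b
  obtain ⟨m, us, h3, h4, h5⟩ := mk_pts hab (F1 ∪ F2)
  have := Finset.card_union_le F1 F2
  exact ⟨m, us, h3, by omega, c1.cst_of h3 h1 fun f hf p q => h5 f (Finset.mem_union_left _ hf) p.le q.le, c2.cst_of h3 h2 fun f hf p q => h5 f (Finset.mem_union_right _ hf) p.le q.le⟩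

end Ctx

/-! ## Part A4: rows of a rectangle -/

def e0 : Ent := ⟨⟨0, 0⟩, ⟨0, 0⟩, 0⟩

def EntB (N : ℕ) (e : Ent) : Prop := e.lo.f <= 2^(N+1) /\ e.lo.p <= 2^(N+1) /\ e.hi.f <= 2^(N+1) /\
  e.hi.p <= 2^(N+1) /\ e.lab <= 2^(N+1)

theorem e0B (N : ℕ) : EntB N e0 := by simp [EntB, e0]

def EdgeB (N n : ℕ) (A : ℕ -> Ent) : Prop := ∀ j, EntB N (A j) /\ (n < j -> A j = e0)
def FnB (b n : ℕ) (f : ℕ -> ℕ) : Prop := ∀ j, f j <= b /\ (n < j -> f j = 0)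

theorem EdgeB.mono {n' : ℕ} (h : EdgeB N n A) (hn : n <= n') : EdgeB N n' A :=
  fun j => ⟨(h j).1, fun hj => (h j).2 (by omega)⟩

/-- bound for the number of marks of rows -/
def X0 (N : ℕ) : ℕ := 8*(N+1)+1
/-- bound for everything in a record -/
def X1 (N : ℕ) : ℕ := 40*((X0 N+1)*(X0 N+1))

structure RowB (N : ℕ) (r : Row) : Prop where
  m : r.m <= X0 N
  k : r.k <= X0 N
  tag : r.tag <= 6
  A : EdgeB N (2*X0 N) r.A
  B : EdgeB N (2*X0 N) r.B
  C : EdgeB N (2*X0 N) r.C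
  E : EdgeB N (2*X0 N) r.E

theorem Mk.bd (h : Mk us m a b) (hi : i <= m) : a <= us i /\ us i <= b :=
  h.mem (by omega) (loc_even us i)

namespace Ctx
variable (c : Ctx N)

open Classical in
noncomputable def ent (p : ℕ) (x v : ℝ) : Ent :=
  ⟨c.lo x v, c.hi x v, if c.D x v then (if p % 2 = 1 then 1 else c.lam x v + 1) else 0⟩

theorem ent_mod {p q : ℕ} (h : p % 2 = q % 2) (x v : ℝ) : c.ent p x v = c.ent q x v := by
  unfold ent; rw [h]

theorem ent_swap (p : ℕ) (x v : ℝ) : c.swap.ent p v x = c.ent p x v := by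
  unfold ent; rw [swap_lo, swap_hi]; rfl

theorem ent_B (p : ℕ) (x v : ℝ) : EntB N (c.ent p x v) := by
  have := c.lt x v
  simp only [EntB, ent, lo, hi]
  refine ⟨(setN_lt _ _).le, (setN_lt _ _).le, (setN_lt _ _).le, (setN_lt _ _).le, ?_⟩
  split_ifs <;> omega

theorem refE_ent (h : j % 2 = 1 -> i % 2 = 1) (x v : ℝ) : refE N (c.ent i x v) i (c.ent j x v) j := by
  refine ⟨⟨rfl, rfl⟩, fun hl => ?_⟩
  by_cases hd : c.D x v
  · rcases Nat.mod_two_eq_zero_or_one i with hi | hi <;> rcases Nat.mod_two_eq_zero_or_one j with hj | hj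
    · exact Or.inl ⟨by omega, by rw [c.ent_mod (by omega : i % 2 = j % 2)]⟩
    · omega
    · refine Or.inr ⟨hi, hj, by simp [ent, hd, hi], ?_⟩
      simpa [ent, hd, hj] using c.adm_pt hd
    · exact Or.inl ⟨by omega, by rw [c.ent_mod (by omega : i % 2 = j % 2)]⟩
  · simp [ent, hd] at hl

theorem cooE_ent (i j : ℕ) (x v : ℝ) : cooE (c.ent i x v) i (c.ent j x v) j :=
  ⟨⟨rfl, rfl⟩, fun h _ => by rw [c.ent_mod h]⟩

theorem wit_ent (h : c.T i x v) : wit N i j (c.ent j x v) := by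
  obtain ⟨h1, h2⟩ := h
  refine ⟨by simp only [ent, h1]; split_ifs <;> simp, fun hj => by simpa [ent, h1, hj] using h2, fun hj => ⟨by simp [ent, h1, hj], _, c.lt x v, c.adm_pt h1, h2⟩⟩

theorem lab_ent (h : c.T i x v) (hj : j % 2 = 0) : bit ((c.ent j x v).lab - 1) i := by
  simpa [ent, h.1, hj] using h.2

theorem intE_ent (h : c.D x v) : intE N (c.ent j x v) j :=
  ⟨fun hj => ⟨by simp [ent, h, hj], by simpa [ent, h, hj] using c.adm_pt h⟩, fun hj => ⟨by simp [ent, h, hj], c.hasAdm_pt h⟩⟩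

/-- `A` is the list of entries on the horizontal line `y = v` -/
def Edge (v : ℝ) (us : ℕ -> ℝ) (m : ℕ) (A : ℕ -> Ent) : Prop :=
  ∀ j ≤ 2*m, ∀ x, loc us j x -> A j = c.ent j x v

theorem Edge.cst {c : Ctx N} (h : c.Edge v us m A) : c.Cst v us m := fun j hj x y hx hy => by
  have := (h j hj x hx).symm.trans (h j hj y hy)
  exact ⟨congrArg Ent.lo this, congrArg Ent.hi this⟩

theorem ex_edge (hk : Mk us m a b) (hC : c.Cst v us m) (hH : Hom (fun x => c.D x v) a b) : ∃ A, c.Edge v us m A /\ EdgeB N (2*m) A := by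
  refine ⟨fun j => if j <= 2*m then c.ent j (pt us j) v else e0, fun j hj x hx => ?_, fun j => ⟨?_, fun h => ?_⟩⟩
  · simp only [hj, if_true]
    have hp := loc_pt hk.sm hj
    obtain ⟨h1, h2⟩ := hC j hj _ _ hp hx
    rcases Nat.mod_two_eq_zero_or_one j with p | p
    · rcases hx with hx | hx
      · rcases hp with hp | hp
        · rw [hx.2, hp.2]
        · omega
      · omega
    · have a1 := hk.gt_a hj (by omega) hp
      have a2 := hk.lt_b (by omega) hp
      have b1 := hk.gt_a hj (by omega) hx
      have b2 := hk.lt_b (by omega) hx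
      have : c.D (pt us j) v ↔ c.D x v := ⟨hH _ _ a1 a2 b1 b2, hH _ _ b1 b2 a1 a2⟩
      by_cases hd : c.D x v
      · simp [ent, h1, h2, p, hd, this.2 hd]
      · simp [ent, h1, h2, hd, mt this.1 hd]
  · simp only; split_ifs
    · exact c.ent_B _ _ _
    · exact e0B N
  · simp only; rw [if_neg (by omega)]

/-- constancy on a refinement -/
theorem Cst.ref {c : Ctx N} (h : c.Cst v us m) (h1 : ∀ j ≤ 2*M, ru j <= 2*m) (h2 : ∀ j ≤ 2*M, ∀ x, loc Us j x -> loc us (ru j) x) : c.Cst v Us M :=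
  fun j hj x y hx hy => h (ru j) (h1 j hj) x y (h2 j hj x hx) (h2 j hj y hy)

theorem pt_lt (h : SM us m) (hij : i < j) (hj : j <= 2*m) : pt us i < pt us j := by
  unfold pt
  have h1 := h.le (show i/2 <= j/2 by omega) (by omega)
  have h2 := h.le (show (i+1)/2 <= (j+1)/2 by omega) (by omega)
  rcases Nat.lt_or_ge (i/2) (j/2) with h3 | h3
  · have := h.lt h3 (by omega); linarith
  · have := h.lt (show (i+1)/2 < (j+1)/2 by omega) (by omega); linarith

section
variable {c} {w : ℝ} {B : ℕ -> Ent}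

theorem Edge.ok1 (h : c.Edge v us m A) (hk : Mk us m a b) (hi : i < m) : ple N (A (2*i+1)).hi (A (2*i)).hi := by
  obtain ⟨x, h1, h2, h3⟩ := c.hi_right (y := v) (hk.sm i hi)
  rw [h (2*i+1) (by omega) x (loc_odd_iff.2 ⟨h1, h2⟩), h (2*i) (by omega) _ (loc_even us i)]
  exact h3

theorem Edge.ok2 (h : c.Edge v us m A) (hk : Mk us m a b) (hi : i < m) : ple N (A (2*i+2)).lo (A (2*i+1)).lo := by
  obtain ⟨x, h1, h2, h3⟩ := c.lo_left (y := v) (hk.sm i hi)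
  rw [h (2*i+1) (by omega) x (loc_odd_iff.2 ⟨h1, h2⟩), h (2*i+2) (by omega) _ (loc_even us (i+1))]
  exact h3

theorem Edge.ok0 (h : c.Edge v us m A) (hk : Mk us m a b) (hi : i <= 2*m) : ple N (A i).lo (A i).hi := by
  rw [h i hi _ (loc_pt hk.sm hi)]; exact c.lohi _ _

theorem Edge.ok (h : c.Edge v us m A) (hk : Mk us m a b) : EdgeOK N m A :=
  ⟨fun _ hi => h.ok0 hk hi, fun _ hi => ⟨h.ok1 hk hi, h.ok2 hk hi⟩⟩

theorem Edge.opp (h : c.Edge v us m A) (h' : c.Edge w us m B) (hk : Mk us m a b) (hvw : v < w) : OppOK N m A B := by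
  intro i hi j hj hij
  rcases hij with hij | ⟨rfl, hi1⟩
  · rw [h i (by omega) _ (loc_pt hk.sm (by omega)), h' j hj _ (loc_pt hk.sm hj)]
    exact c.hilo (pt_lt hk.sm hij hj) hvw
  · obtain ⟨k, rfl⟩ : ∃ k, i = 2*k+1 := ⟨i/2, by omega⟩
    obtain ⟨x, h1, h2⟩ := exists_between (hk.sm k (by omega))
    obtain ⟨y, h3, h4⟩ := exists_between h2
    rw [h _ hj x (loc_odd_iff.2 ⟨h1, h2⟩), h' _ hj y (loc_odd_iff.2 ⟨by linarith, h4⟩)]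
    exact c.hilo h3 hvw

theorem Edge.adj {v' : ℝ} (h : c.Edge v us m A) (h' : c.swap.Edge b vs k B) (hk : Mk us m a b) (hk' : Mk vs k v v') : AdjOK N m k A B := by
  intro i hi j hj hj0
  have l1 := loc_pt hk.sm hi.le
  have l2 := loc_pt hk'.sm hj
  rw [h i hi.le _ l1, h' j hj _ l2, ent_swap]
  exact c.hilo (hk.lt_b hi l1) (hk'.gt_a hj hj0 l2)

theorem Edge.first (h : c.Edge v us m A) (hk : Mk us m a b) : A 0 = c.ent 0 a v := by
  have := h 0 (by omega) _ (loc_even us 0); rwa [hk.h0] at this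

theorem Edge.last (h : c.Edge v us m A) (hk : Mk us m a b) : A (2*m) = c.ent 0 b v := by
  have := h (2*m) le_rfl _ (loc_even us m)
  rw [this, hk.h1]; exact c.ent_mod (by omega) _ _

/-- pass to a subdivision -/
theorem Edge.at_ (h : c.Edge v us m A) (h1 : ∀ j ≤ 2*M, ru j <= 2*m) (h2 : ∀ j ≤ 2*M, ∀ x, loc Us j x -> loc us (ru j) x) (hj : j <= 2*M) (hx : loc Us j x) : A (ru j) = c.ent (ru j) x v := h _ (h1 j hj) _ (h2 j hj x hx)
end

structure Rep (R : Rct) (r : Row) (us vs : ℕ -> ℝ) : Prop where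
  good : c.Good R
  ku : Mk us r.m R.u0 R.u1
  kv : Mk vs r.k R.v0 R.v1
  sA : c.Edge R.v0 us r.m r.A
  sB : c.Edge R.v1 us r.m r.B
  sC : c.swap.Edge R.u0 vs r.k r.C
  sE : c.swap.Edge R.u1 vs r.k r.E
  tg : c.Tg R r.tag

variable {c}

theorem Rep.rowOK {R : Rct} (h : c.Rep R r us vs) (ht : r.tag <= 6) : RowOK N r where
  hm := h.ku.pos
  hk := h.kv.pos
  c1 := by rw [h.sA.first h.ku, h.sC.first h.kv, ent_swap]
  c2 := by rw [h.sA.last h.ku, h.sE.first h.kv, ent_swap]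
  c3 := by rw [h.sB.first h.ku, h.sC.last h.kv, ent_swap]
  c4 := by rw [h.sB.last h.ku, h.sE.last h.kv, ent_swap]
  eA := h.sA.ok h.ku
  eB := h.sB.ok h.ku
  eC := h.sC.ok h.kv
  eE := h.sE.ok h.kv
  oAB := h.sA.opp h.sB h.ku h.good.hv
  oCE := h.sC.opp h.sE h.kv h.good.hu
  aAE := h.sA.adj h.sE h.ku h.kv
  aCB := h.sC.adj (c := c.swap) h.sB h.kv h.ku
  ht := ht
  tg h0 := by rw [h.sA.first h.ku, h.sB.last h.ku]; exact h.tg.1 h0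

/-- build a row -/
theorem ex_row (c : Ctx N) {R : Rct} (hg : c.Good R) {tag : ℕ} (ku : Mk us m R.u0 R.u1) (kv : Mk vs k R.v0 R.v1) (a : c.Cst R.v0 us m) (b : c.Cst R.v1 us m) (d : c.swap.Cst R.u0 vs k) (e : c.swap.Cst R.u1 vs k) (hm : m <= X0 N) (hk : k <= X0 N) (ht : tag <= 6) (htg : c.Tg R tag) : ∃ r : Row, r.m = m /\ r.k = k /\ r.tag = tag /\ c.Rep R r us vs /\ RowB N r := by
  obtain ⟨A, a1, a2⟩ := c.ex_edge ku a hg.hA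
  obtain ⟨B, b1, b2⟩ := c.ex_edge ku b hg.hB
  obtain ⟨C, c1, c2⟩ := c.swap.ex_edge kv d hg.hC
  obtain ⟨E, e1, e2⟩ := c.swap.ex_edge kv e hg.hE
  exact ⟨⟨m, k, tag, A, B, C, E⟩, rfl, rfl, rfl, ⟨hg, ku, kv, a1, b1, c1, e1, htg⟩, ⟨hm, hk, ht, a2.mono (by omega), b2.mono (by omega), c2.mono (by omega), e2.mono (by omega)⟩⟩

end Ctx

/-! ## Part A5: records of a rectangle -/

structure RecB (N Bd : ℕ) (R : Rec) : Prop where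
  M : R.M <= X1 N
  K : R.K <= X1 N
  ru : FnB (X1 N) (X1 N) R.ru
  rv : FnB (X1 N) (X1 N) R.rv
  L : ∀ t, EdgeB N (X1 N) (R.L t) /\ (X1 N < t -> ∀ j, R.L t j = e0)
  ch : FnB Bd (X1 N) R.ch
  rc : ∀ t, FnB (X1 N) (X1 N) (R.rc t) /\ (X1 N < t -> ∀ j, R.rc t j = 0)

theorem ex_or {α : Sort*} {P : Prop} {Q : α -> Prop} (d : α) (h : P -> ∃ x, Q x) : ∃ x, (P -> Q x) /\ (¬ P -> x = d) := by
  by_cases hP : P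
  · obtain ⟨x, hx⟩ := h hP; exact ⟨x, fun _ => hx, fun h => absurd hP h⟩
  · exact ⟨d, fun h => absurd h hP, fun _ => rfl⟩

theorem pt_even (us : ℕ -> ℝ) (k : ℕ) : pt us (2*k) = us k := by
  unfold pt; rw [show 2*k/2 = k by omega, show (2*k+1)/2 = k by omega]; ring

theorem FnB.of {f : ℕ -> ℕ} {b : ℕ} (h1 : ∀ j ≤ 2*K, f j <= 2*m) (h2 : ∀ j, 2*K < j -> f j = 0) (hn : 2*K <= n) (hb : 2*m <= b) : FnB b n f := fun j =>
  ⟨by rcases Nat.lt_or_ge (2*K) j with h | h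
      · rw [h2 j h]; omega
      · exact (h1 j h).trans hb, fun h => h2 j (by omega)⟩

theorem FnB.or {P : ℕ -> Prop} {f : ℕ -> ℕ} {b : ℕ} (h1 : ∀ t, P t -> f t <= b) (h2 : ∀ t, ¬ P t -> f t = 0) (h : ∀ t, P t -> t <= n) : FnB b n f := fun t => by
  by_cases hp : P t
  · exact ⟨h1 t hp, fun hh => absurd (h t hp) (by omega)⟩
  · rw [h2 t hp]; exact ⟨Nat.zero_le _, fun _ => rfl⟩

theorem FnB.or2 {P : ℕ -> Prop} {f : ℕ -> ℕ -> ℕ} {b : ℕ} (h1 : ∀ t, P t -> FnB b n (f t)) (h2 : ∀ t, ¬ P t -> f t = fun _ => 0) (h : ∀ t, P t -> t <= n) (t : ℕ) : FnB b n (f t) /\ (n < t -> ∀ j, f t j = 0) := by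
  by_cases hp : P t
  · exact ⟨h1 t hp, fun hh => absurd (h t hp) (by omega)⟩
  · rw [h2 t hp]; exact ⟨fun _ => ⟨Nat.zero_le _, fun _ => rfl⟩, fun _ _ => rfl⟩

theorem X1_bd (hM : M <= 4*(X0 N+1)+1) (hn : n <= 12*(X0 N+1)+4) (hK : K <= n*(X0 N+1)+1) : 2*M <= X1 N /\ 2*K <= X1 N /\ 2*X0 N <= X1 N := by
  unfold X1
  have h1 := Nat.mul_le_mul_right (X0 N+1) hn
  rw [add_mul (12*(X0 N+1)), mul_assoc] at h1
  have h2 := Nat.le_mul_self (X0 N+1)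
  generalize (X0 N+1)*(X0 N+1) = Z at *
  omega

theorem mk_fam (hab : a < b) (f : ℕ -> ℕ -> ℝ) (n Y : ℕ) : ∃ m us, Mk us m a b /\ m <= n*Y + 1 /\ ∀ t < n, ∀ i < Y, a <= f t i -> f t i <= b -> ∃ j ≤ m, us j = f t i := by
  classical
  obtain ⟨m, us, h1, h2, h3⟩ := Ctx.mk_pts hab ((Finset.range n).biUnion fun t => (Finset.range Y).image (f t))
  refine ⟨m, us, h1, h2.trans ?_, fun t ht i hi h4 h5 => h3 _ ?_ h4 h5⟩
  · have := Finset.card_biUnion_le_card_mul (Finset.range n) (fun t => (Finset.range Y).image (f t)) Y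
      (fun t _ => Finset.card_image_le.trans (by simp))
    simp only [Finset.card_range] at this
    omega
  · simp only [Finset.mem_biUnion, Finset.mem_range, Finset.mem_image]
    exact ⟨t, ht, i, hi, rfl⟩

theorem coarse_marks (h : Mk us m a b) (hm : m <= X0 N) (w : ℕ -> ℝ) : ∃ M Us ru, Mk Us M a b /\ M <= 4*(X0 N+1)+1 /\ IsRef ru M m /\ Halv ru M /\ (∀ j ≤ 2*M, ru j <= 2*m) /\ (∀ j, 2*M < j -> ru j = 0) /\ (∀ j ≤ 2*M, ∀ x, loc Us j x -> loc us (ru j) x) /\ (∀ t < M, Us (t+1) - Us t <= (b-a)/2) /\ ∀ i ≤ N, a <= w i -> w i <= b -> ∃ j ≤ M, Us j = w i := by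
  have hab : a < b := by have := h.sm.lt h.pos le_rfl; rwa [h.h0, h.h1] at this
  obtain ⟨M, Us, H, hM, hU⟩ := mk_fam hab (fun t i => match t with
    | 0 => us i | 1 => pt us (2*i+1) | 2 => w i | _ => (a+b)/2) 4 (X0 N+1)
  obtain ⟨ru, r1, r2, r3, r4⟩ := exists_ref h H fun i hi =>
    hU 0 (by omega) i (by omega) (h.bd hi).1 (h.bd hi).2
  have sep : ∀ k ≤ M, ∀ t < M, Us k <= Us t ∨ Us (t+1) <= Us k := fun k hk t ht => by
    rcases Nat.lt_or_ge t k with h1 | h1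
    · exact Or.inr (H.sm.le h1 hk)
    · exact Or.inl (H.sm.le h1 (by omega))
  refine ⟨M, Us, ru, H, hM, r1, fun j hj h1 => ?_, r2, r3, r4, fun t ht => ?_, fun i hi h1 h2 =>
    hU 2 (by omega) i (by unfold X0; omega) h1 h2⟩
  · by_contra h2
    have l1 := r4 (2*j) (by omega) _ (loc_even Us j)
    have l2 := r4 (2*j+2) (by omega) _ (loc_even Us (j+1))
    rw [show ru (2*j) = 2*(ru (2*j)/2) by omega, loc_even_iff] at l1
    rw [show ru (2*j+2) = 2*(ru (2*j+2)/2) by omega, loc_even_iff] at l2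
    have b1 := r2 (2*j) (by omega)
    have b2 := r2 (2*j+2) (by omega)
    have lt := H.sm j hj
    rw [l1, l2, h.sm.lt_iff (by omega) (by omega)] at lt
    have le := h.sm.le (show ru (2*j)/2 + 1 <= ru (2*j+2)/2 by omega) (by omega)
    have hp := loc_pt h.sm (show 2*(ru (2*j)/2)+1 <= 2*m by omega)
    obtain ⟨k, hk, ek⟩ := hU 1 (by omega) (ru (2*j)/2) (by omega) (h.mem (by omega) hp).1
      (h.mem (by omega) hp).2
    rw [loc_odd_iff] at hp
    simp only at ek
    rcases sep k hk j hj with q | q <;> rw [ek] at q <;> linarith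
  · obtain ⟨k, hk, ek⟩ := hU 3 (by omega) 0 (by omega) (by simp only; linarith) (by simp only; linarith)
    simp only at ek
    have := H.bd (show t <= M by omega)
    have := H.bd (show t+1 <= M by omega)
    rcases sep k hk t ht with q | q <;> rw [ek] at q <;> linarith

namespace Ctx
variable {c : Ctx N}

section
variable {R : Rct} {B C E : ℕ -> Ent} {u0 u1 v0 v1 : ℝ}

theorem Edge.fbit (h : c.Edge v us m A) (hi : i <= N) (hj : j <= 2*m) (hx : loc us j x) : bit (A j).hi.f i ↔ fut (c.T i) x v := by rw [h j hj x hx]; exact c.hif hi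

theorem Edge.pbit (h : c.Edge v us m A) (hi : i <= N) (hj : j <= 2*m) (hx : loc us j x) : bit (A j).lo.p i ↔ pas (c.T i) x v := by rw [h j hj x hx]; exact c.lop hi

/-- fine point near the beginning of the first slot -/
theorem near0 (h : Mk us m u0 u1) (hy : u0 < y) : ∃ x, loc us 1 x /\ x < y := by
  have := h.sm 0 h.pos
  obtain ⟨x, h1, h2⟩ := exists_between (lt_min this (by rw [h.h0]; exact hy))
  rw [lt_min_iff] at h2
  exact ⟨x, (loc_odd_iff (i := 0)).2 ⟨h1, h2.1⟩, h2.2⟩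

theorem near1 (h : Mk us m u0 u1) (hy : y < u1) : ∃ x, loc us (2*m-1) x /\ y < x := by
  obtain ⟨n, rfl⟩ : ∃ n, m = n+1 := ⟨m-1, by have := h.pos; omega⟩
  have := h.sm n (by omega)
  obtain ⟨x, h1, h2⟩ := exists_between (max_lt this (by rw [h.h1]; exact hy))
  rw [max_lt_iff] at h1
  exact ⟨x, (loc_odd_iff (i := n)).2 ⟨h1.1, h2⟩, h1.2⟩

theorem gen_F (ku : Mk us m u0 u1) (kv : Mk vs k v0 v1) (sA : c.Edge v0 us m A) (sB : c.Edge v1 us m B) (sE : c.swap.Edge u1 vs k E) {a : ℕ} (ha : a < m) (hi : i <= N) (hb : bit (A (2*a+1)).hi.f i) : bit (B (2*a+1)).hi.f i ∨ bit (E 1).hi.f i ∨ ∃ p q, c.T i p q /\ u0 <= p /\ p <= u1 /\ v0 <= q /\ q <= v1 := by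
  have hp := loc_pt ku.sm (show 2*a+1 <= 2*m by omega)
  have hp0 := (ku.mem (by omega) hp).1
  rw [sA.fbit hi (by omega) hp] at hb
  obtain ⟨p, q, h1, h2, h3⟩ := hb
  rcases lt_or_ge v1 q with h4 | h4
  · exact Or.inl ((sB.fbit hi (by omega) hp).2 ⟨p, q, h1, h4, h3⟩)
  rcases lt_or_ge u1 p with h5 | h5
  · obtain ⟨y, y1, y2⟩ := near0 kv h2
    exact Or.inr (Or.inl ((sE.fbit hi (by have := kv.pos; omega) y1).2 ⟨q, p, y2, h5, h3⟩))
  exact Or.inr (Or.inr ⟨p, q, h3, by linarith, h5, by linarith, h4⟩)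

theorem gen_P (ku : Mk us m u0 u1) (kv : Mk vs k v0 v1) (sA : c.Edge v0 us m A) (sB : c.Edge v1 us m B) (sC : c.swap.Edge u0 vs k C) {a : ℕ} (ha : a < m) (hi : i <= N) (hb : bit (B (2*a+1)).lo.p i) : bit (A (2*a+1)).lo.p i ∨ bit (C (2*k-1)).lo.p i ∨ ∃ p q, c.T i p q /\ u0 <= p /\ p <= u1 /\ v0 <= q /\ q <= v1 := by
  have hp := loc_pt ku.sm (show 2*a+1 <= 2*m by omega)
  have hp0 := (ku.mem (by omega) hp).2
  rw [sB.pbit hi (by omega) hp] at hb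
  obtain ⟨p, q, h1, h2, h3⟩ := hb
  rcases lt_or_ge q v0 with h4 | h4
  · exact Or.inl ((sA.pbit hi (by omega) hp).2 ⟨p, q, h1, h4, h3⟩)
  rcases lt_or_ge p u0 with h5 | h5
  · obtain ⟨y, y1, y2⟩ := near1 kv h2
    exact Or.inr (Or.inl ((sC.pbit hi (by omega) y1).2 ⟨q, p, y2, h5, h3⟩))
  exact Or.inr (Or.inr ⟨p, q, h3, h5, by linarith, h4, by linarith⟩)
end

def SS (N Bd : ℕ) (row : ℕ -> Row) (s : ℕ) : Prop :=
  s < Bd /\ RowB N (row s) /\ ∃ (c : Ctx N) (R : Rct) (us vs : ℕ -> ℝ), c.Rep R (row s) us vs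

noncomputable def lev (N : ℕ) (row : ℕ -> Row) (s : ℕ) : ℕ :=
  sInf {n | ∃ (c : Ctx N) (R : Rct) (us vs : ℕ -> ℝ), c.Rep R (row s) us vs /\ Lev n c R}

/-- the child rows -/
theorem Rep.child {R : Rct} (h : c.Rep R r us vs) (ht : r.tag <= 6) (H : Mk Us M R.u0 R.u1) (h1 : ∀ j ≤ 2*M, ru j <= 2*r.m) (h2 : ∀ j ≤ 2*M, ∀ x, loc Us j x -> loc us (ru j) x) (htM : t < M) (hw : Us (t+1) - Us t <= (R.u1 - R.u0)/2) {ws : ℕ -> ℝ} {mw : ℕ} (kw : Mk ws mw R.v0 R.v1) (hmw : mw <= X0 N) (w0 : c.swap.Cst (Us t) ws mw) (w1 : c.swap.Cst (Us (t+1)) ws mw) : ∃ r' vs', c.swap.Rep ⟨R.v0, R.v1, Us t, Us (t+1)⟩ r' ws vs' /\ RowB N r' /\ r'.m = mw /\ r'.k = 1 /\ (∀ x, loc Us (2*t+1) x -> loc vs' 1 x) /\ (c.same R (Us t) (Us (t+1)) R.v0 R.v1 -> ∀ rk rk', (r.tag = 6 -> r'.tag = 6 -> rk' < rk) -> tagStep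 M t r.tag r'.tag rk rk') := by
  have lt := H.sm t htM
  have b0 := H.bd htM.le
  have b1 := H.bd (show t+1 <= M from htM)
  have cs : ∀ {v}, c.Cst v us r.m -> ∀ x y, Us t < x -> x < Us (t+1) -> Us t < y -> y < Us (t+1) -> c.lo x v = c.lo y v /\ c.hi x v = c.hi y v := fun hc x y x1 x2 y1 y2 =>
    hc.ref h1 h2 (2*t+1) (by omega) x y (loc_odd_iff.2 ⟨x1, x2⟩) (loc_odd_iff.2 ⟨y1, y2⟩)
  obtain ⟨tag', t1, t2, t3⟩ := c.child_tag (t := t) (M := M) h.good ht h.tg b0.1 lt b1.2 hw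
    (fun h0 => by rw [h0]; exact H.h0) (fun h0 => by rw [<- H.h0]; exact H.sm.lt (by omega) htM.le)
    (fun h0 => by rw [<- H.h1]; exact H.sm.lt (by omega) le_rfl)
    (fun x y x1 x2 y1 y2 => (cs h.sA.cst x y x1 x2 y1 y2).2)
    (fun x y x1 x2 y1 y2 => (cs h.sB.cst x y x1 x2 y1 y2).1)
  have kv : Mk (fun i => if i = 0 then Us t else Us (t+1)) 1 (Us t) (Us (t+1)) :=
    ⟨fun i hi => by obtain rfl : i = 0 := by omega
                    simpa using lt, le_rfl, by simp, by simp⟩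
  have hc : ∀ v, c.Cst v us r.m -> c.swap.swap.Cst v (fun i => if i = 0 then Us t else Us (t+1)) 1 := by
    intro v hv j hj x y hx hy
    obtain rfl | rfl | rfl : j = 0 ∨ j = 1 ∨ j = 2 := by omega
    · rw [loc_even_iff (i := 0)] at hx hy; rw [hx, hy]; exact ⟨rfl, rfl⟩
    · rw [loc_odd_iff (i := 0)] at hx hy
      simp only [if_true] at hx hy
      exact cs hv x y hx.1 hx.2 hy.1 hy.2
    · rw [loc_even_iff (i := 1)] at hx hy; rw [hx, hy]; exact ⟨rfl, rfl⟩
  obtain ⟨r', e1, e2, e3, e4, e5⟩ := c.swap.ex_row (R := ⟨R.v0, R.v1, Us t, Us (t+1)⟩) (tag := tag')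
    (h.good.child b0.1 lt b1.2) kw kv w0 w1 (hc _ h.sA.cst) (hc _ h.sB.cst) hmw (by unfold X0; omega) t1 t2
  refine ⟨r', _, e4, e5, e1, e2, fun x hx => ?_, by rw [e3]; exact t3⟩
  rw [loc_odd_iff] at hx
  exact (loc_odd_iff (i := 0)).2 (by simpa using hx)

theorem ent_ite_B (c : Ctx N) (P : Prop) [Decidable P] (i : ℕ) (x v : ℝ) : EntB N (if P then c.ent i x v else e0) := by
  split_ifs
  · exact c.ent_B _ _ _
  · exact e0B N

theorem SS.rec {Bd : ℕ} {row : ℕ -> Row} (hrow : ∀ r, RowB N r -> ∃ s < Bd, row s = r) {rk : ℕ -> ℕ} (hrk : ∀ s s', s < Bd -> s' < Bd -> lev N row s' < lev N row s -> rk s' < rk s) (hs : SS N Bd row s) : ∃ R, RecB N Bd R /\ RecOK N row rk (SS N Bd row) s R := by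
  obtain ⟨hsB, hB, hs⟩ := hs
  obtain ⟨c, R, us, vs, h, hl⟩ : ∃ (c : Ctx N) (R : Rct) (us vs : ℕ -> ℝ), c.Rep R (row s) us vs /\
      ((row s).tag = 6 -> Lev (lev N row s) c R) := by
    by_cases h6 : (row s).tag = 6
    · obtain ⟨c, R, us, vs, h⟩ := hs
      obtain ⟨n, hn⟩ := h.tg.2.2.2.2.2 h6
      obtain ⟨c, R, us, vs, h, h'⟩ := Nat.sInf_mem (s := {n | ∃ (c : Ctx N) (R : Rct) (us vs : ℕ -> ℝ), c.Rep R (row s) us vs /\ Lev n c R}) ⟨n, c, R, us, vs, h, hn⟩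
      exact ⟨c, R, us, vs, h, fun _ => h'⟩
    · obtain ⟨c, R, us, vs, h⟩ := hs
      exact ⟨c, R, us, vs, h, fun h' => absurd h' h6⟩
  have hw : ∀ i, ∃ p : ℝ × ℝ, ((∃ p : ℝ × ℝ, R.u0 < p.1 /\ p.1 < R.u1 /\ R.v0 < p.2 /\ p.2 < R.v1 /\
      c.T i p.1 p.2) -> R.u0 < p.1 /\ p.1 < R.u1 /\ R.v0 < p.2 /\ p.2 < R.v1 /\ c.T i p.1 p.2) /\ _ :=
    fun i => ex_or (0, 0) id
  choose w hw _ using hw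
  obtain ⟨M, Us, ru, HU, hM, r1, r2, r3, r4, r5, r6, r7⟩ := coarse_marks h.ku hB.m fun i => (w i).1
  choose mw ws kw hmw w0 w1 using fun t => mk_marks c.swap c.swap (Us t) (Us (t+1)) h.good.hv
  obtain ⟨K, Vs, HV, hK, hV⟩ := mk_fam h.good.hv (fun t i => match t with
    | 0 => vs i | 1 => (w i).2 | t+2 => ws t i) (M+3) (X0 N+1)
  obtain ⟨rv, v1, v2, v3, v4⟩ := exists_ref h.kv HV fun i hi =>
    hV 0 (by omega) i (by have := hB.k; omega) (h.kv.bd hi).1 (h.kv.bd hi).2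
  choose rc hrc hrc0 using fun t => ex_or (fun _ => 0) fun ht : t <= M =>
    exists_ref (kw t) HV fun i hi => hV (t+2) (by omega) i
      (by have := hmw t; unfold X0; omega) ((kw t).bd hi).1 ((kw t).bd hi).2
  have hch : ∀ t, ∃ s', (t < M -> s' < Bd /\ ∃ vs', c.swap.Rep ⟨R.v0, R.v1, Us t, Us (t+1)⟩ (row s') (ws t) vs' /\
      RowB N (row s') /\ (row s').m = mw t /\ (row s').k = 1 /\ (∀ x, loc Us (2*t+1) x -> loc vs' 1 x) /\
      (c.same R (Us t) (Us (t+1)) R.v0 R.v1 -> ∀ rk rk', ((row s).tag = 6 -> (row s').tag = 6 -> rk' < rk) -> tagStep M t (row s).tag (row s').tag rk rk')) /\ (¬ t < M -> s' = 0) := fun t => ex_or 0 fun ht => by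
    obtain ⟨r', vs', q1, q2, q3⟩ := h.child hB.tag HU r3 r5 ht (r6 t ht) (kw t) (hmw t) (w0 t) (w1 t)
    obtain ⟨s', q4, rfl⟩ := hrow r' q2
    exact ⟨s', q4, vs', q1, q2, q3⟩
  choose ch hch hch0 using hch
  have X1b := X1_bd hM (show M+3 <= _ by omega) hK
  set L : ℕ -> ℕ -> Ent := fun t j => if t <= M /\ j <= 2*K then c.ent j (Us t) (pt Vs j) else e0 with hL
  have L0 : ∀ t ≤ M, ∀ j ≤ 2*K, L t j = c.ent j (Us t) (pt Vs j) := fun t ht j hj => if_pos ⟨ht, hj⟩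
  have key : ∀ i ≤ N, (∃ p q, c.T i p q /\ R.u0 <= p /\ p <= R.u1 /\ R.v0 <= q /\ q <= R.v1) -> WitIn N (row s) ⟨M, K, ru, rv, L, ch, rc⟩ i := by
    rintro i hi ⟨p, q, hT, p0, p1, q0, q1⟩
    obtain ⟨j, hj, lj⟩ := h.ku.ex p0 p1
    obtain ⟨k, hk, lk⟩ := h.kv.ex q0 q1
    rcases q0.eq_or_lt with e | q0
    · exact Or.inl ⟨j, hj, by rw [h.sA j hj p lj, e]; exact c.wit_ent hT⟩
    rcases q1.eq_or_lt with e | q1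
    · exact Or.inr (Or.inl ⟨j, hj, by rw [h.sB j hj p lj, <- e]; exact c.wit_ent hT⟩)
    rcases p0.eq_or_lt with e | p0
    · exact Or.inr (Or.inr (Or.inl ⟨k, hk, by rw [h.sC k hk q lk, e]; exact c.swap.wit_ent hT⟩))
    rcases p1.eq_or_lt with e | p1
    · exact Or.inr (Or.inr (Or.inr (Or.inl ⟨k, hk, by rw [h.sE k hk q lk, <- e]; exact c.swap.wit_ent hT⟩)))
    obtain ⟨x0, x1, y0, y1, hT⟩ := hw i ⟨(p, q), p0, p1, q0, q1, hT⟩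
    obtain ⟨t, ht, et⟩ := r7 i hi x0.le x1.le
    obtain ⟨k, hk, ek⟩ := hV 1 (by omega) i (by unfold X0; omega) y0.le y1.le
    simp only at ek
    refine Or.inr (Or.inr (Or.inr (Or.inr ⟨t, ?_, ?_, k, ?_, ?_, ?_⟩)))
    · exact lt_of_le_of_ne ht fun e => by subst e; rw [HU.h1] at et; linarith
    · exact Nat.pos_of_ne_zero fun e => by subst e; rw [HU.h0] at et; linarith
    · exact lt_of_le_of_ne hk fun e => by subst e; rw [HV.h1] at ek; linarith
    · exact Nat.pos_of_ne_zero fun e => by subst e; rw [HV.h0] at ek; linarith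
    · show bit ((L t (2*k)).lab - 1) i
      rw [L0 t ht (2*k) (by omega), pt_even]
      exact c.lab_ent (by rw [et, ek]; exact hT) (by omega)
  refine ⟨⟨M, K, ru, rv, L, ch, rc⟩, ⟨by simp only; omega, by simp only; omega, .of r3 r4 X1b.1 (by have := hB.m; omega), .of v2 v3 X1b.2.1 (by have := hB.k; omega), fun t => ⟨fun j => ⟨ent_ite_B _ _ _ _ _, fun _ => if_neg (by omega)⟩, fun _ j => if_neg (by omega)⟩,
    .or (fun t ht => (hch t ht).1.le) hch0 fun t ht => by omega, FnB.or2 (fun t ht => .of (hrc t ht).2.1 (hrc t ht).2.2.1 X1b.2.1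
      (by have := hmw t; unfold X0 at X1b; omega)) hrc0 fun t ht => by omega⟩, ?_⟩
  have lU : ∀ t, loc Us (2*t) (Us t) := loc_even Us
  constructor <;> try simp only
  · exact r1
  · exact r2
  · exact v1
  · intro t ht
    rw [h.sA.at_ r3 r5 (show 2*t <= 2*M by omega) (lU t), L0 t ht 0 (by omega), pt_even _ 0, HV.h0]
    exact c.refE_ent (by omega) _ _
  · intro t ht
    rw [h.sB.at_ r3 r5 (show 2*t <= 2*M by omega) (lU t), L0 t ht _ le_rfl, pt_even, HV.h1, c.ent_mod (show (2*K) % 2 = 0 % 2 by omega)]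
    exact c.refE_ent (by omega) _ _
  · intro j hj
    have lj := loc_pt HV.sm hj
    rw [h.sC.at_ v2 v4 hj lj, L0 0 (by omega) j hj, HU.h0, <- c.ent_swap]
    exact c.swap.refE_ent (v1.odd hj) _ _
  · intro j hj
    have lj := loc_pt HV.sm hj
    rw [h.sE.at_ v2 v4 hj lj, L0 M le_rfl j hj, HU.h1, <- c.ent_swap]
    exact c.swap.refE_ent (v1.odd hj) _ _
  · intro t ht t0 j hj j0
    have lj := loc_pt HV.sm hj.le
    rw [L0 t ht.le j hj.le]
    exact c.intE_ent (h.good.int _ _ (HU.gt_a (by omega) (by omega) (lU t)) (HU.lt_b (by omega) (lU t))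
      (HV.gt_a hj.le j0 lj) (HV.lt_b hj lj))
  · intro t ht
    obtain ⟨q1, vs', q2, q3, -⟩ := hch t ht
    exact ⟨q1, q3, _, _, _, _, q2⟩
  · intro t ht
    obtain ⟨q1, vs', q2, q3, qm, qk, ql, -⟩ := hch t ht
    obtain ⟨g1, g2, -, g3⟩ := hrc t ht.le
    rw [<- qm] at g1 g2
    have lx := loc_pt HU.sm (show 2*t+1 <= 2*M by omega)
    have od := r1.odd (show 2*t+1 <= 2*M by omega) (by omega)
    constructor <;> try simp only
    · exact qk
    · exact g1
    · intro j hj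
      have lj := loc_pt HV.sm hj
      rw [q2.sA.at_ g2 g3 hj lj, L0 t ht.le j hj, <- c.ent_swap]
      exact c.swap.cooE_ent _ _ _ _
    · intro j hj
      have lj := loc_pt HV.sm hj
      rw [q2.sB.at_ g2 g3 hj lj, L0 (t+1) ht j hj, <- c.ent_swap]
      exact c.swap.cooE_ent _ _ _ _
    · rw [q2.sC 1 (by omega) _ (ql _ lx), h.sA.at_ r3 r5 (by omega) lx, c.ent_mod (q := 1) (by omega)]
      exact c.cooE_ent 1 1 _ _
    · rw [q2.sE 1 (by omega) _ (ql _ lx), h.sB.at_ r3 r5 (by omega) lx, c.ent_mod (q := 1) (by omega)]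
      exact c.cooE_ent 1 1 _ _
  · intro t ht hg
    obtain ⟨q1, vs', q2, q3, qm, qk, ql, qt⟩ := hch t ht
    have hsame : c.same R (Us t) (Us (t+1)) R.v0 R.v1 := by
      obtain ⟨g1, g2, g3, g4⟩ := hg
      rw [h.sA.first h.ku, q2.sA.first q2.ku, ent_swap] at g1 g2
      rw [h.sB.last h.ku, q2.sB.last q2.ku, ent_swap] at g3 g4
      exact ⟨ple_antisymm (c.can_hi _ _) (c.can_hi _ _) g2 g1, ple_antisymm (c.can_lo _ _) (c.can_lo _ _) g4 g3⟩
    refine qt hsame _ _ fun h6 h6' => hrk _ _ hsB q1 ?_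
    have hl := hl h6
    obtain ⟨n, hn⟩ : ∃ n, lev N row s = n+1 := Nat.exists_eq_succ_of_ne_zero fun e => by
      rw [e] at hl; exact hl
    rw [hn] at hl ⊢
    have b0 := HU.bd ht.le
    have b1 := HU.bd (show t+1 <= M from ht)
    exact Nat.lt_succ_of_le (Nat.sInf_le ⟨_, _, _, _, q2, hl _ _ b0.1 (HU.sm t ht) b1.2 (r6 t ht) hsame⟩)
  · exact fun a ha i hi hb => (gen_F h.ku h.kv h.sA h.sB h.sE ha hi hb).imp_right (Or.imp_right (key i hi))
  · exact fun a ha i hi hb => (gen_F (c := c.swap) h.kv h.ku h.sC h.sE h.sB ha hi hb).imp_right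
      (Or.imp_right fun ⟨p, q, q1, q2, q3, q4, q5⟩ => key i hi ⟨q, p, q1, q4, q5, q2, q3⟩)
  · exact fun a ha i hi hb => (gen_P h.ku h.kv h.sA h.sB h.sC ha hi hb).imp_right (Or.imp_right (key i hi))
  · exact fun a ha i hi hb => (gen_P (c := c.swap) h.kv h.ku h.sC h.sE h.sA ha hi hb).imp_right
      (Or.imp_right fun ⟨p, q, q1, q2, q3, q4, q5⟩ => key i hi ⟨q, p, q1, q4, q5, q2, q3⟩)

end Ctx

/-! ## Part A6: triangles -/

structure TRowB (N : ℕ) (r : TRow) : Prop where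
  m : r.m <= X0 N
  L : EdgeB N (2*X0 N) r.L
  U : EdgeB N (2*X0 N) r.U

structure TRecB (N Bd BdT : ℕ) (R : TRec) : Prop where
  M : R.M <= X1 N
  Q : R.Q <= X1 N
  ruZ : FnB (X1 N) (X1 N) R.ruZ
  ruC : FnB (X1 N) (X1 N) R.ruC
  zc : FnB (X1 N) (X1 N) R.zc
  V : ∀ t, EdgeB N (X1 N) (R.V t) /\ (X1 N < t -> ∀ j, R.V t j = e0)
  H : ∀ t, EdgeB N (X1 N) (R.H t) /\ (X1 N < t -> ∀ j, R.H t j = e0)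
  chT : FnB BdT (X1 N) R.chT
  chR : FnB Bd (X1 N) R.chR
  rT : ∀ t, FnB (X1 N) (X1 N) (R.rT t) /\ (X1 N < t -> ∀ j, R.rT t j = 0)
  rA : ∀ t, FnB (X1 N) (X1 N) (R.rA t) /\ (X1 N < t -> ∀ j, R.rA t j = 0)
  rC : ∀ t, FnB (X1 N) (X1 N) (R.rC t) /\ (X1 N < t -> ∀ j, R.rC t j = 0)

theorem sub_ref {Qs : ℕ -> ℝ} {Q p q : ℕ} {x0 x1 : ℝ} (h : Mk us m a b) (H : Mk Qs Q x0 x1) (hp : p <= Q) (hq : q <= Q) (ep : Qs p = a) (eq : Qs q = b) (hs : ∀ i ≤ m, ∃ j ≤ Q, Qs j = us i) : ∃ ru, IsRef ru (q-p) m /\ (∀ j ≤ 2*(q-p), ru j <= 2*m) /\ (∀ j, 2*(q-p) < j -> ru j = 0) /\ ∀ j ≤ 2*(q-p), loc us (ru j) (pt Qs (2*p+j)) := by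
  have hpq : p < q := by
    rw [<- H.sm.lt_iff hp hq, ep, eq, <- h.h0, <- h.h1]; exact h.sm.lt h.pos le_rfl
  obtain ⟨ru, r1, r2, r3, r4⟩ := exists_ref h (Us := fun i => Qs (p+i)) (M := q-p)
    ⟨H.sm.shift (by omega), by omega, ep, by rwa [show p+(q-p) = q by omega]⟩ fun i hi => by
      obtain ⟨j, hj, e⟩ := hs i hi
      have := h.bd hi
      rw [<- ep, <- eq, <- e, H.sm.le_iff hp hj, H.sm.le_iff hj hq] at this
      exact ⟨j-p, by omega, by rw [<- e]; congr 1; omega⟩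
  refine ⟨ru, r1, r2, r3, fun j hj => r4 j hj _ ?_⟩
  have := loc_pt (H.sm.shift (z := p) (K := q-p) (by omega)) hj
  rwa [show pt (fun i => Qs (p+i)) j = pt Qs (2*p+j) by
    simp only [pt]; rw [show (2*p+j)/2 = p+j/2 by omega, show (2*p+j+1)/2 = p+(j+1)/2 by omega]] at this

namespace Ctx
variable (c : Ctx N)

structure TGood (x0 x1 : ℝ) : Prop where
  lt : x0 < x1
  tri : ∀ x y, c.D x y -> x < y
  int : ∀ x y, x0 < x -> x < y -> y < x1 -> c.D x y
  hL : Hom (fun y => c.D x0 y) x0 x1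
  hU : Hom (fun x => c.D x x1) x0 x1

structure TRep (x0 x1 : ℝ) (r : TRow) (us : ℕ -> ℝ) : Prop where
  good : c.TGood x0 x1
  k : Mk us r.m x0 x1
  sL : c.swap.Edge x0 us r.m r.L
  sU : c.Edge x1 us r.m r.U

variable {c} {x0 x1 : ℝ}

theorem TGood.homL (h : c.TGood x0 x1) {d : ℝ} (ha : x0 <= a) (hab : a <= b) (hd : d <= x1) : Hom (fun y => c.D a y) b d := by
  rcases ha.eq_or_lt with rfl | ha
  · exact h.hL.sub hab hd
  · exact fun _ y _ _ h1 h2 _ => h.int a y ha (by linarith) (by linarith)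

theorem TGood.homU (h : c.TGood x0 x1) {d : ℝ} (ha : x0 <= a) (hbd : b <= d) (hd : d <= x1) : Hom (fun x => c.D x d) a b := by
  rcases hd.eq_or_lt with rfl | hd
  · exact h.hU.sub ha hbd
  · exact fun _ y _ _ h1 h2 _ => h.int y d (by linarith) (by linarith) hd

theorem TGood.row (h : c.TGood x0 x1) : ∃ r us, TRowB N r /\ c.TRep x0 x1 r us := by
  obtain ⟨m, us, k, hm, a, b⟩ := mk_marks c.swap c x0 x1 h.lt
  obtain ⟨L, l1, l2⟩ := c.swap.ex_edge k a h.hL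
  obtain ⟨U, u1, u2⟩ := c.ex_edge k b h.hU
  have : 2*m <= 2*X0 N := by unfold X0; omega
  exact ⟨⟨m, L, U⟩, us, ⟨hm, l2.mono this, u2.mono this⟩, h, k, l1, u1⟩

theorem TRep.rowOK {r : TRow} (h : c.TRep x0 x1 r us) : TRowOK N r where
  hm := h.k.pos
  c := by rw [h.sL.last h.k, h.sU.first h.k, ent_swap]
  lhL i hi _ := h.sL.ok0 h.k hi
  lhU i hi := h.sU.ok0 h.k hi.le
  eL1 i hi _ := h.sL.ok1 h.k hi
  eL2 i hi := h.sL.ok2 h.k hi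
  eU1 i hi := h.sU.ok1 h.k hi
  eU2 i hi _ := h.sU.ok2 h.k hi
  o i hi i0 j hj j0 := by
    have l1 := loc_pt h.k.sm hi.le
    have l2 := loc_pt h.k.sm hj.le
    rw [h.sL i hi.le _ l1, h.sU j hj.le _ l2, ent_swap]
    exact c.hilo (h.k.gt_a hj.le j0 l2) (h.k.lt_b hi l1)

def TS (N BdT : ℕ) (trow : ℕ -> TRow) (s : ℕ) : Prop :=
  s < BdT /\ TRowB N (trow s) /\ ∃ (c : Ctx N) (x0 x1 : ℝ) (us : ℕ -> ℝ), c.TRep x0 x1 (trow s) us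

theorem TRep.ex_rec {Bd BdT : ℕ} {row : ℕ -> Row} {trow : ℕ -> TRow} (hrow : ∀ r, RowB N r -> ∃ s < Bd, row s = r) (htrow : ∀ r, TRowB N r -> ∃ s < BdT, trow s = r) (hB : TRowB N (trow s)) (h : c.TRep x0 x1 (trow s) us) : ∃ R, TRecB N Bd BdT R /\ TRecOK N row trow (SS N Bd row) (TS N BdT trow) s R /\ ∀ i ≤ N, (∃ p q, c.T i p q /\ x0 < p /\ q < x1) -> ∃ t < R.M, 0 < t /\ ∃ j < R.Q, R.zc t < j /\ bit ((R.V t (2*j)).lab - 1) i := by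
  have hg := h.good
  choose w hw _ using fun i => ex_or (Q := fun p : ℝ × ℝ => c.T i p.1 p.2 /\ x0 < p.1 /\ p.2 < x1) (0, 0) id
  obtain ⟨M, Z, ruZ, HZ, hM, z1, z2, z3, z4, z5, z6, z7⟩ := coarse_marks h.k hB.m fun i => (w i).1
  have Zlt : ∀ t, t+1 < M -> Z (t+1) < x1 := fun t ht => by rw [<- HZ.h1]; exact HZ.sm.lt ht le_rfl
  have Zgt : ∀ t, 0 < t -> t <= M -> x0 < Z t := fun t t0 ht => by rw [<- HZ.h0]; exact HZ.sm.lt t0 ht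
  choose pT hT hT0 using fun t => ex_or (Q := fun p : ℕ × (ℕ -> ℝ) => p.1 < BdT /\ TRowB N (trow p.1) /\
      c.TRep (Z t) (Z (t+1)) (trow p.1) p.2) (0, fun _ => 0) fun ht : t < M => by
    have b0 := HZ.bd ht.le
    have b1 := HZ.bd (show t+1 <= M from ht)
    have lt := HZ.sm t ht
    obtain ⟨r, us', h1, h2⟩ := TGood.row (c := c) (x0 := Z t) (x1 := Z (t+1)) ⟨lt, hg.tri, fun x y h1 h2 h3 => hg.int x y (by linarith) h2 (by linarith), hg.homL b0.1 le_rfl b1.2,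
      hg.homU b0.1 le_rfl b1.2⟩
    obtain ⟨s', h3, rfl⟩ := htrow r h1
    exact ⟨(s', us'), h3, h1, h2⟩
  choose pR hR hR0 using fun t => ex_or (Q := fun p : ℕ × (ℕ -> ℝ) × (ℕ -> ℝ) => p.1 < Bd /\ RowB N (row p.1) /\
      c.Rep ⟨Z t, Z (t+1), Z (t+1), x1⟩ (row p.1) p.2.1 p.2.2) (0, fun _ => 0, fun _ => 0)
      fun ht : t+1 < M => by
    have b0 := HZ.bd (show t <= M by omega)
    have b1 := HZ.bd ht.le
    have lt := HZ.sm t (by omega)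
    have lt1 := Zlt t ht
    obtain ⟨m, us', ku, hm, a1, a2⟩ := mk_marks c c (Z (t+1)) x1 lt
    obtain ⟨k, vs', kv, hk, a3, a4⟩ := mk_marks c.swap c.swap (Z t) (Z (t+1)) lt1
    obtain ⟨r, -, -, -, h1, h2⟩ := c.ex_row (R := ⟨Z t, Z (t+1), Z (t+1), x1⟩) (tag := 1)
      ⟨lt, lt1, fun x y h1 h2 h3 h4 => hg.int x y (by simp only at *; linarith) (by simp only at *; linarith) h4, hg.homU b0.1 le_rfl b1.2, hg.homU b0.1 lt1.le le_rfl, hg.homL b0.1 lt.le le_rfl,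
      hg.homL b1.1 le_rfl le_rfl⟩ ku kv a1 a2 a3 a4 hm hk (by omega) (by simp [Tg])
    obtain ⟨s', h3, rfl⟩ := hrow r h2
    exact ⟨(s', us', vs'), h3, h2, h1⟩
  obtain ⟨Q, Y, HQ, hQ, hY⟩ := mk_fam hg.lt (fun t i => match t with
    | 0 => (w i).2 | t+1 => if t % 3 = 0 then (pT (t/3)).2 i else if t % 3 = 1 then (pR (t/3)).2.1 i
        else (pR (t/3)).2.2 i) (3*M+1) (X0 N+1)
  have YT : ∀ t < M, ∀ i ≤ (trow (pT t).1).m, ∃ j ≤ Q, Y j = (pT t).2 i := fun t ht i hi => by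
    obtain ⟨-, q1, q2⟩ := hT t ht
    have := q2.k.bd hi
    have b0 := HZ.bd ht.le
    have b1 := HZ.bd (show t+1 <= M from ht)
    have e := hY (3*t+1) (by omega) i (by have := q1.m; omega)
    simp only [show 3*t % 3 = 0 by omega, show 3*t/3 = t by omega, if_true] at e
    exact e (by linarith) (by linarith)
  have YA : ∀ t, t+1 < M -> ∀ i ≤ (row (pR t).1).m, ∃ j ≤ Q, Y j = (pR t).2.1 i := fun t ht i hi => by
    obtain ⟨-, q1, q2⟩ := hR t ht
    have := q2.ku.bd hi
    have b0 := HZ.bd (show t <= M by omega)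
    have b1 := HZ.bd (show t+1 <= M by omega)
    have e := hY (3*t+1+1) (by omega) i (by have := q1.m; omega)
    simp only [show (3*t+1) % 3 = 1 by omega, show (3*t+1)/3 = t by omega, if_true, one_ne_zero, if_false] at e
    exact e (by linarith) (by linarith)
  have YC : ∀ t, t+1 < M -> ∀ i ≤ (row (pR t).1).k, ∃ j ≤ Q, Y j = (pR t).2.2 i := fun t ht i hi => by
    obtain ⟨-, q1, q2⟩ := hR t ht
    have := q2.kv.bd hi
    have b1 := HZ.bd (show t+1 <= M by omega)
    have e := hY (3*t+2+1) (by omega) i (by have := q1.k; omega)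
    simp only [show (3*t+2) % 3 = 2 by omega, show (3*t+2)/3 = t by omega, OfNat.ofNat_ne_zero, if_false, OfNat.ofNat_ne_one] at e
    exact e (by linarith) (by linarith)
  choose zc hzc zc0 using fun t => ex_or (Q := fun k => k <= Q /\ Y k = Z t) 0 fun ht : t <= M => by
    rcases ht.eq_or_lt with rfl | ht
    · exact ⟨Q, le_rfl, by rw [HQ.h1, HZ.h1]⟩
    · have := YT t ht 0 (by omega)
      rwa [(hT t ht).2.2.k.h0] at this
  obtain ⟨ruC, c1, c2, c3, c4⟩ := exists_ref HZ HQ fun i hi => ⟨zc i, hzc i hi⟩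
  have X1b := X1_bd hM (show 3*M+1 <= _ by omega) hQ
  choose rT hrT rT0 using fun t => ex_or (fun _ => 0) fun ht : t < M =>
    sub_ref (hT t ht).2.2.k HQ (hzc t ht.le).1 (hzc (t+1) ht).1 (hzc t ht.le).2 (hzc (t+1) ht).2 (YT t ht)
  choose rA hrA rA0 using fun t => ex_or (fun _ => 0) fun ht : t+1 < M =>
    sub_ref (hR t ht).2.2.ku HQ (hzc t (by omega)).1 (hzc (t+1) ht.le).1 (hzc t (by omega)).2
      (hzc (t+1) ht.le).2 (YA t ht)
  choose rC hrC rC0 using fun t => ex_or (fun _ => 0) fun ht : t+1 < M =>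
    sub_ref (hR t ht).2.2.kv HQ (hzc (t+1) ht.le).1 le_rfl (hzc (t+1) ht.le).2 HQ.h1 (YC t ht)
  set V : ℕ -> ℕ -> Ent := fun t j => if t <= M /\ j <= 2*Q then c.ent j (Z t) (pt Y j) else e0 with hV
  set H : ℕ -> ℕ -> Ent := fun t j => if t < M /\ j <= 2*Q then c.ent j (pt Y j) (Z (t+1)) else e0 with hH
  have V0 : ∀ t ≤ M, ∀ j ≤ 2*Q, V t j = c.ent j (Z t) (pt Y j) := fun t ht j hj => if_pos ⟨ht, hj⟩
  have H0 : ∀ t < M, ∀ j ≤ 2*Q, H t j = c.ent j (pt Y j) (Z (t+1)) := fun t ht j hj => if_pos ⟨ht, hj⟩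
  have pz : ∀ t ≤ M, pt Y (2*zc t) = Z t := fun t ht => by rw [pt_even]; exact (hzc t ht).2
  have zle : ∀ t ≤ M, zc t <= Q := fun t ht => (hzc t ht).1
  have zlt : ∀ t < M, zc t < zc (t+1) := fun t ht => by
    rw [<- HQ.sm.lt_iff (zle t ht.le) (zle (t+1) ht), (hzc t ht.le).2, (hzc (t+1) ht).2]; exact HZ.sm t ht
  have keyI : ∀ i ≤ N, (∃ p q, c.T i p q /\ x0 < p /\ q < x1) -> ∃ t < M, 0 < t /\ ∃ j < Q, zc t < j /\ bit ((V t (2*j)).lab - 1) i := by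
    rintro i hi ⟨p, q, hp⟩
    obtain ⟨hTi, h0, h1⟩ := hw i ⟨(p, q), hp⟩
    have h2 := hg.tri _ _ hTi.1
    obtain ⟨t, ht, et⟩ := z7 i hi h0.le (by linarith)
    obtain ⟨k, hk, ek⟩ := hY 0 (by omega) i (by unfold X0; omega) (by simp only; linarith) h1.le
    simp only at ek et
    refine ⟨t, lt_of_le_of_ne ht fun e => ?_, Nat.pos_of_ne_zero fun e => ?_, k, lt_of_le_of_ne hk fun e => ?_, ?_, ?_⟩
    · subst e; rw [HZ.h1] at et; linarith
    · subst e; rw [HZ.h0] at et; linarith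
    · subst e; rw [HQ.h1] at ek; linarith
    · rw [<- HQ.sm.lt_iff (zle t ht) hk, (hzc t ht).2, et, ek]; exact h2
    · rw [V0 t ht _ (by omega), pt_even]
      exact c.lab_ent (by rw [et, ek]; exact hTi) (by omega)
  have key : ∀ i ≤ N, ∀ p q, c.T i p q -> x0 <= p -> q <= x1 -> TWitIn N (trow s) ⟨M, Q, ruZ, ruC, zc, V, H, fun t => (pT t).1, fun t => (pR t).1, rT, rA, rC⟩ i := by
    intro i hi p q hTi hp hq
    have lt := hg.tri _ _ hTi.1
    rcases hp.eq_or_lt with e | hp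
    · obtain ⟨j, hj, lj⟩ := h.k.ex (x := q) (by linarith) hq
      refine Or.inl ⟨j, hj, Nat.pos_of_ne_zero fun e => ?_, ?_⟩
      · subst e; rw [loc_even_iff (i := 0), h.k.h0] at lj; linarith
      · rw [h.sL j hj q lj, e]; exact c.swap.wit_ent hTi
    rcases hq.eq_or_lt with e | hq
    · obtain ⟨j, hj, h2, lj⟩ := h.k.ex_int (x := p) hp (by linarith)
      exact Or.inr (Or.inl ⟨j, h2, by rw [h.sU j h2.le p lj, <- e]; exact c.wit_ent hTi⟩)
    exact Or.inr (Or.inr (keyI i hi ⟨p, q, hTi, hp, hq⟩))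
  refine ⟨⟨M, Q, ruZ, ruC, zc, V, H, fun t => (pT t).1, fun t => (pR t).1, rT, rA, rC⟩, ?_, ?_, keyI⟩
  · have := hB.m
    refine ⟨by simp only; omega, by simp only; omega, .of z3 z4 X1b.1 (by omega), .of c2 c3 X1b.2.1 X1b.1, .or (P := fun t => t <= M) (fun t ht => (zle t ht).trans (by omega)) zc0 fun t ht => by omega,
      fun t => ⟨fun j => ⟨ent_ite_B _ _ _ _ _, fun hj => if_neg (by omega)⟩, fun _ j => if_neg (by omega)⟩, fun t => ⟨fun j => ⟨ent_ite_B _ _ _ _ _, fun hj => if_neg (by omega)⟩, fun _ j => if_neg (by omega)⟩,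
      .or (fun t ht => (hT t ht).1.le) (fun t ht => by simp only; rw [hT0 t ht]) fun t ht => by omega, .or (fun t ht => (hR t ht).1.le) (fun t ht => by simp only; rw [hR0 t ht]) fun t ht => by omega,
      FnB.or2 (fun t ht => .of (hrT t ht).2.1 (hrT t ht).2.2.1 (by have := zle (t+1) ht; omega)
        (by have := (hT t ht).2.1.m; omega)) rT0 fun t ht => by omega,
      FnB.or2 (fun t ht => .of (hrA t ht).2.1 (hrA t ht).2.2.1 (by have := zle (t+1) ht.le; omega)
        (by have := (hR t ht).2.1.m; omega)) rA0 fun t ht => by omega,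
      FnB.or2 (fun t ht => .of (hrC t ht).2.1 (hrC t ht).2.2.1 (by omega)
        (by have := (hR t ht).2.1.k; omega)) rC0 fun t ht => by omega⟩
  have M0 := HZ.pos
  have lZ := fun j (hj : j <= 2*Q) => z5 _ (c2 j hj) _ (c4 j hj _ (loc_pt HQ.sm hj))
  have lz : ∀ j, c.ent (2*j) = c.ent 0 := fun j => by funext x y; exact c.ent_mod (by omega) _ _
  have lp : ∀ i j, c.ent (2*i+j) = c.ent j := fun i j => by funext x y; exact c.ent_mod (by omega) _ _
  have od : ∀ j ≤ 2*Q, j % 2 = 1 -> ruZ (ruC j) % 2 = 1 := fun j hj h1 => z1.odd (c2 j hj) (c1.odd hj h1)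
  constructor <;> try simp only
  · exact z1
  · exact z2
  · exact c1
  · exact HQ.sm.inj (zle 0 (by omega)) (by omega) (by rw [(hzc 0 (by omega)).2, HZ.h0, HQ.h0])
  · exact HQ.sm.inj (zle M le_rfl) le_rfl (by rw [(hzc M le_rfl).2, HZ.h1, HQ.h1])
  · exact zlt
  · intro t ht
    have := c4 _ (show 2*zc t <= 2*Q by have := zle t ht; omega) _ (loc_even Y _)
    rw [(hzc t ht).2] at this
    exact loc_unique HZ.sm (c2 _ (by have := zle t ht; omega)) (by omega) this (loc_even Z t)
  · intro j hj j0
    rw [h.sL _ (z3 _ (c2 j hj)) _ (lZ j hj), V0 0 (by omega) j hj, HZ.h0, <- c.ent_swap]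
    exact c.swap.refE_ent (od j hj) _ _
  · intro j hj j0
    rw [h.sU _ (z3 _ (c2 j hj.le)) _ (lZ j hj.le), H0 (M-1) (by omega) j hj.le, show M-1+1 = M by omega, HZ.h1]
    exact c.refE_ent (od j hj.le) _ _
  · intro t ht
    rw [h.sU.at_ z3 z5 (show 2*t <= 2*M by omega) (loc_even Z t), V0 t ht.le _ le_rfl, pt_even, HQ.h1, lz]
    exact c.refE_ent (by omega) _ _
  · intro t ht
    rw [H0 t ht _ (by have := zle t ht.le; omega), V0 t ht.le _ (by have := zle (t+1) ht; omega), pz t ht.le, pz (t+1) ht, lz, lz]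
  · intro t ht t0 j hj jz
    rw [V0 t ht.le j hj.le]
    refine c.intE_ent (hg.int _ _ (Zgt t t0 ht.le) ?_ (HQ.lt_b hj (loc_pt HQ.sm hj.le)))
    rw [<- pz t ht.le]; exact pt_lt HQ.sm jz hj.le
  · intro t ht ht1 j hj jz
    have := zle (t+1) ht
    rw [H0 t ht j (by omega)]
    refine c.intE_ent (hg.int _ _ (HQ.gt_a (by omega) (by omega) (loc_pt HQ.sm (by omega))) ?_ (Zlt t ht1))
    rw [<- pz (t+1) ht]; exact pt_lt HQ.sm hj (by omega)
  · intro t ht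
    obtain ⟨q1, q2, q3⟩ := hT t ht
    exact ⟨q1, q2, _, _, _, _, q3⟩
  · intro t ht
    obtain ⟨q1, q2, q3⟩ := hT t ht
    obtain ⟨g1, g2, -, g3⟩ := hrT t ht
    have := zle (t+1) ht
    have := zlt t ht
    constructor <;> try simp only
    · exact g1
    · intro j hj j0
      rw [q3.sL _ (g2 j hj) _ (g3 j hj), V0 t ht.le _ (by omega), ent_swap, lp]
      exact c.cooE_ent _ _ _ _
    · intro j hj
      rw [q3.sU _ (g2 j hj.le) _ (g3 j hj.le), H0 t ht _ (by omega), lp]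
      exact c.cooE_ent _ _ _ _
  · intro t ht ht1
    obtain ⟨q1, q2, q3⟩ := hR t ht1
    exact ⟨q1, q2, _, _, _, _, q3⟩
  · intro t ht ht1
    obtain ⟨q1, q2, q3⟩ := hR t ht1
    obtain ⟨g1, g2, -, g3⟩ := hrA t ht1
    obtain ⟨k1, k2, -, k3⟩ := hrC t ht1
    have := zle (t+1) ht
    have := zlt t ht
    constructor <;> try simp only
    · exact g1
    · exact k1
    · intro j hj
      rw [q3.sA _ (g2 j hj.le) _ (g3 j hj.le), H0 t ht _ (by omega), lp]
      exact c.cooE_ent _ _ _ _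
    · rw [q3.sA.last q3.ku]
      exact if_neg fun hd => lt_irrefl _ (hg.tri _ _ hd)
    · rw [q3.sB.first q3.ku, V0 t ht.le _ le_rfl, pt_even, HQ.h1, lz]
      exact c.cooE_ent 0 0 _ _
    · rw [q3.sB.last q3.ku, V0 (t+1) ht _ le_rfl, pt_even, HQ.h1, lz]
      exact c.cooE_ent 0 0 _ _
    · intro i hi i0
      have li := loc_pt q3.ku.sm hi.le
      rw [q3.sB i hi.le _ li, h.sU.at_ z3 z5 (show 2*t+1 <= 2*M by omega)
        (loc_odd_iff.2 ⟨q3.ku.gt_a hi.le i0 li, q3.ku.lt_b hi li⟩), c.ent_mod (q := 1) (z1.odd (by omega) (by omega))]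
      exact c.refE_ent (by omega) _ _
    · intro j hj
      rw [q3.sC _ (k2 j hj) _ (k3 j hj), V0 t ht.le _ (by omega), ent_swap, lp]
      exact c.cooE_ent _ _ _ _
    · intro j hj j0
      rw [q3.sE _ (k2 j hj) _ (k3 j hj), V0 (t+1) ht _ (by omega), ent_swap, lp]
      exact c.cooE_ent _ _ _ _
  · intro a ha i hi hb
    have hp := loc_pt h.k.sm (show 2*a+1 <= 2*(trow s).m by omega)
    have hp0 := (h.k.mem (by omega) hp).1
    rw [h.sL.fbit hi (by omega) hp] at hb
    obtain ⟨q, p, h1, h2, h3⟩ := hb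
    rcases lt_or_ge x1 q with h4 | h4
    · obtain ⟨y, y1, y2⟩ := near0 h.k h2
      exact Or.inl ((h.sU.fbit hi (by have := h.k.pos; omega) y1).2 ⟨p, q, y2, h4, h3⟩)
    · exact Or.inr (key i hi p q h3 h2.le h4)
  · intro a ha i hi hb
    have hp := loc_pt h.k.sm (show 2*a+1 <= 2*(trow s).m by omega)
    rw [h.sU.pbit hi (by omega) hp] at hb
    obtain ⟨p, q, h1, h2, h3⟩ := hb
    rcases lt_or_ge p x0 with h4 | h4
    · obtain ⟨y, y1, y2⟩ := near1 h.k h2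
      exact Or.inl ((h.sL.pbit hi (by omega) y1).2 ⟨q, p, y2, h4, h3⟩)
    · exact Or.inr (key i hi p q h3 h4 h2.le)

end Ctx

/-! ## Part A7: the root -/

open Classical in
noncomputable def labX (N : ℕ) (lam : Tri -> ℕ) (x y : ℝ) : ℕ :=
  setN N fun i => ∃ h : (x, y) ∈ Tri, bit (lam ⟨(x, y), h⟩) i

theorem labX_bit {N : ℕ} {lam : Tri -> ℕ} {x y : ℝ} (h : (x, y) ∈ Tri) {i : ℕ} (hi : i <= N) : bit (labX N lam x y) i ↔ bit (lam ⟨(x, y), h⟩) i := by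
  rw [labX, bit_setN]
  exact ⟨fun ⟨_, _, h⟩ => h, fun h' => ⟨hi, h, h'⟩⟩

theorem exists_ctx {N : ℕ} {lam : Tri -> ℕ} (h : Model sltT N lam) : ∃ c : Ctx N, (∀ x y, c.D x y ↔ (x, y) ∈ Tri) /\ c.lam = labX N lam :=
  ⟨{  D := fun x y => (x, y) ∈ Tri
      lam := labX N lam
      lt := fun x y => setN_lt _ _
      ok := fun x y hd k hk => by
        have := h.ok ⟨(x, y), hd⟩ k hk
        have a1 := Nat.unpair_right_le k
        have a2 := Nat.unpair_left_le k.unpair.2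
        have a3 := Nat.unpair_right_le k.unpair.2
        rw [labX_bit hd hk, labX_bit hd (by omega), labX_bit hd (by omega), labX_bit hd (by omega)]
        exact this
      mF := fun i hi x y hd => by
        have := lt_pair 3 i (by omega)
        rw [labX_bit hd hi, h.mF i hi]
        constructor
        · rintro ⟨⟨⟨x', y'⟩, hu⟩, h1, h2⟩
          exact ⟨x', y', h1.1, h1.2, hu, (labX_bit hu (by omega)).2 h2⟩
        · rintro ⟨x', y', h1, h2, hu, h3⟩
          exact ⟨⟨(x', y'), hu⟩, ⟨h1, h2⟩, (labX_bit hu (by omega)).1 h3⟩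
      mP := fun i hi x y hd => by
        have := lt_pair 4 i (by omega)
        rw [labX_bit hd hi, h.mP i hi]
        constructor
        · rintro ⟨⟨⟨x', y'⟩, hu⟩, h1, h2⟩
          exact ⟨x', y', h1.1, h1.2, hu, (labX_bit hu (by omega)).2 h2⟩
        · rintro ⟨x', y', h1, h2, hu, h3⟩
          exact ⟨⟨(x', y'), hu⟩, ⟨h1, h2⟩, (labX_bit hu (by omega)).1 h3⟩ }, fun _ _ => Iff.rfl, rfl⟩

open Ctx in
theorem exists_root {N Bd BdT : ℕ} {row : ℕ -> Row} {trow : ℕ -> TRow} (hrow : ∀ r, RowB N r -> ∃ s < Bd, row s = r) (htrow : ∀ r, TRowB N r -> ∃ s < BdT, trow s = r) (h : SAT N) : ∃ s R, TS N BdT trow s /\ TRecB N Bd BdT R /\ TRecOK N row trow (SS N Bd row) (TS N BdT trow) s R /\ RootOK N (trow s) R := by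
  obtain ⟨lam, hM, ⟨⟨x, y⟩, hw⟩, hN⟩ := h
  obtain ⟨c, hD, hl⟩ := exists_ctx hM
  have g : c.TGood 0 1 := ⟨one_pos, fun x y h => ((hD x y).1 h).2.1, fun x y a b d => (hD x y).2 ⟨a, b, d⟩, fun _ y _ _ _ _ h => absurd ((hD _ _).1 h).1 (lt_irrefl _), fun _ y _ _ _ _ h => absurd ((hD _ _).1 h).2.2 (lt_irrefl _)⟩
  obtain ⟨r, us, hB, hr⟩ := g.row
  obtain ⟨s, hs, rfl⟩ := htrow r hB
  obtain ⟨R, h1, h2, h3⟩ := hr.ex_rec hrow htrow hB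
  refine ⟨s, R, ⟨hs, hB, c, _, _, us, hr⟩, h1, h2, ⟨fun a ha i hi h => ?_, fun a ha i hi h => ?_, fun j hj => ?_, fun j hj _ => ?_, h3 N le_rfl ⟨x, y, ⟨(hD _ _).2 hw, ?_⟩, hw.1, hw.2.2⟩⟩⟩
  · obtain ⟨x', y', _, h6, h7, _⟩ := (hr.sU.fbit hi (by omega) (loc_pt hr.k.sm (by omega))).1 h
    exact h6.not_gt ((hD _ _).1 h7).2.2
  · obtain ⟨x', y', _, h6, h7, _⟩ := (hr.sL.pbit hi (by omega) (loc_pt hr.k.sm (by omega))).1 h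
    exact h6.not_gt ((hD _ _).1 h7).1
  · rw [hr.sU j hj.le _ (loc_pt hr.k.sm hj.le), ent]
    exact if_neg fun h => lt_irrefl _ ((hD _ _).1 h).2.2
  · rw [hr.sL j hj _ (loc_pt hr.k.sm hj), ent]
    exact if_neg fun h => lt_irrefl _ ((hD _ _).1 h).1
  · rw [hl]; exact (labX_bit hw le_rfl).2 hN

/-! ## Part C: decidability -/

class PR {α β : Type} [Primcodable α] [Primcodable β] (f : α -> β) : Prop where
  h : Primrec f

class PD {α : Type} [Primcodable α] (p : α -> Prop) : Prop where
  h : PrimrecPred p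

section
variable {α β γ : Type} [Primcodable α] [Primcodable β] [Primcodable γ]

theorem PR.c2 {g : ℕ -> ℕ -> ℕ} (h : Primrec₂ g) {f f' : α -> ℕ} [a : PR f] [b : PR f'] : PR fun a => g (f a) (f' a) := ⟨h.comp a.h b.h⟩
theorem PD.c2 {g : β -> β -> Prop} (h : PrimrecRel g) {f f' : α -> β} [a : PR f] [b : PR f'] : PD fun a => g (f a) (f' a) := ⟨h.comp a.h b.h⟩
theorem PD.iff {p q : α -> Prop} (h : PD q) (e : ∀ a, q a ↔ p a) : PD p := ⟨h.h.of_eq e⟩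

variable {f f' : α -> ℕ} {F F' : α -> β} {p q : α -> Prop} [PR f] [PR f'] [PR F] [PR F'] [hp : PD p] [hq : PD q]

instance {g : β -> γ} {f : α -> β} [hg : PR g] [hf : PR f] : PR fun a => g (f a) := ⟨hg.h.comp hf.h⟩
instance (c : β) : PR fun _ : α => c := ⟨.const c⟩
instance : PR fun a : α => a := ⟨.id⟩
instance {f : α -> β × γ} [h : PR f] : PR fun a => (f a).1 := ⟨Primrec.fst.comp h.h⟩
instance {f : α -> β × γ} [h : PR f] : PR fun a => (f a).2 := ⟨Primrec.snd.comp h.h⟩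
instance : PR fun a => (f a).unpair := ⟨Primrec.unpair.comp PR.h⟩
instance : PR fun a => f a + f' a := .c2 Primrec.nat_add
instance : PR fun a => f a * f' a := .c2 Primrec.nat_mul
instance : PR fun a => f a - f' a := .c2 Primrec.nat_sub
instance : PR fun a => f a / f' a := .c2 Primrec.nat_div
instance : PR fun a => f a % f' a := .c2 Primrec.nat_mod
instance : PR fun a => f a ^ f' a := .c2 (Primrec₂.unpaired'.1 Nat.Primrec.pow)
instance : PR fun a => Nat.pair (f a) (f' a) := .c2 Primrec₂.natPair
instance : PD fun a => f a < f' a := .c2 Primrec.nat_lt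
instance : PD fun a => f a <= f' a := .c2 Primrec.nat_le
instance : PD fun a => F a = F' a := .c2 Primrec.eq
instance : PD fun a => p a /\ q a := ⟨hp.h.and hq.h⟩
instance : PD fun a => p a ∨ q a := ⟨hp.h.or hq.h⟩
instance : PD fun a => ¬ p a := ⟨hp.h.not⟩
instance : PD fun a => p a -> q a := .iff (q := fun a => ¬ p a ∨ q a) inferInstance fun _ => imp_iff_not_or.symm
instance : PD fun a => p a ↔ q a := .iff (q := fun a => (p a -> q a) /\ (q a -> p a)) inferInstance
  fun _ => iff_def.symm
instance : PD fun a => F a ≠ F' a := inferInstanceAs (PD fun a => ¬ (F a = F' a))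

variable {P : α -> ℕ -> Prop} [hP : PD fun x : α × ℕ => P x.1 x.2]

instance ball : PD fun a => ∀ x, x < f a -> P a x :=
  ⟨((PrimrecRel.forall_mem_list (R := fun x a => P a x) (hP.h.comp (.pair .snd .fst))).comp
    (Primrec.list_range.comp (PR.h (f := f))) .id).of_eq fun _ => by simp⟩
instance : PD fun a => ∀ x, x ≤ f a -> P a x :=
  .iff (q := fun a => ∀ x, x < f a + 1 -> P a x) inferInstance fun _ => by simp only [Nat.lt_succ_iff]
instance bex : PD fun a => ∃ x, x < f a /\ P a x :=
  ⟨((PrimrecRel.exists_mem_list (R := fun x a => P a x) (hP.h.comp (.pair .snd .fst))).comp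
    (Primrec.list_range.comp (PR.h (f := f))) .id).of_eq fun _ => by simp⟩
instance : PD fun a => ∃ x, x ≤ f a /\ P a x :=
  .iff (q := fun a => ∃ x, x < f a + 1 /\ P a x) inferInstance fun _ => by simp only [Nat.lt_succ_iff]

instance : PD fun a => bit (f a) (f' a) := .iff (q := fun a => f a / 2^f' a % 2 = 1) inferInstance fun a => by
  rw [bit, Nat.testBit_eq_decide_div_mod_eq, decide_eq_true_iff]

end

def posE : Pos ≃ ℕ where
  toFun e := Nat.pair e.f e.p
  invFun n := ⟨n.unpair.1, n.unpair.2⟩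
  left_inv e := by simp
  right_inv e := by simp

def entE : Ent ≃ ℕ where
  toFun e := Nat.pair (Nat.pair (posE e.lo) (posE e.hi)) e.lab
  invFun n := ⟨posE.symm n.unpair.1.unpair.1, posE.symm n.unpair.1.unpair.2, n.unpair.2⟩
  left_inv e := by simp
  right_inv e := by simp

instance : Primcodable Pos := .ofEquiv ℕ posE
instance : Primcodable Ent := .ofEquiv ℕ entE

section
variable {α : Type} [Primcodable α] {n i j x y z w : α -> ℕ} {p q : α -> Pos} {e e' : α -> Ent} [PR n] [PR i] [PR j] [PR x] [PR y] [PR z] [PR w] [hp : PR p] [PR q] [he : PR e] [PR e']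

instance : PR fun a => entE.symm (i a) := ⟨Primrec.of_equiv_symm.comp PR.h⟩
instance : PR fun a => (p a).f := ⟨Primrec.fst.comp (Primrec.unpair.comp (Primrec.of_equiv.comp hp.h)) |>.of_eq
  fun a => by simp [posE]⟩
instance : PR fun a => (p a).p := ⟨Primrec.snd.comp (Primrec.unpair.comp (Primrec.of_equiv.comp hp.h)) |>.of_eq
  fun a => by simp [posE]⟩
theorem ent1 : PR fun a => (entE (e a)).unpair := ⟨Primrec.unpair.comp (Primrec.of_equiv.comp he.h)⟩
instance : PR fun a => (e a).lab := ⟨Primrec.snd.comp (ent1 (e := e)).h |>.of_eq fun a => by simp [entE]⟩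
theorem ent2 : PR fun a => (entE (e a)).unpair.1.unpair := ⟨Primrec.unpair.comp (Primrec.fst.comp ent1.h)⟩
instance : PR fun a => (e a).lo := ⟨Primrec.of_equiv_symm.comp (Primrec.fst.comp (ent2 (e := e)).h) |>.of_eq fun a => by
  simp [entE]⟩
instance : PR fun a => (e a).hi := ⟨Primrec.of_equiv_symm.comp (Primrec.snd.comp (ent2 (e := e)).h) |>.of_eq fun a => by
  simp [entE]⟩

set_option synthInstance.maxHeartbeats 400000
set_option synthInstance.maxSize 4000

instance : PD fun a => ple (n a) (p a) (q a) := by unfold ple; infer_instance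
instance : PD fun a => okLab (n a) (x a) := by unfold okLab; infer_instance
instance : PD fun a => adm (n a) (p a) (q a) (x a) := by unfold adm; infer_instance
instance : PD fun a => hasAdm (n a) (p a) (q a) := by unfold hasAdm; infer_instance
instance : PD fun a => refE (n a) (e a) (i a) (e' a) (j a) := by unfold refE gq; infer_instance
instance : PD fun a => cooE (e a) (i a) (e' a) (j a) := by unfold cooE gq; infer_instance
instance : PD fun a => wit (n a) (i a) (j a) (e a) := by unfold wit; infer_instance
instance : PD fun a => intE (n a) (e a) (j a) := by unfold intE; infer_instance
instance : PD fun a => tagStep (i a) (j a) (x a) (y a) (z a) (w a) := by unfold tagStep; infer_instance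
end

def dg (b s c t j : ℕ) : ℕ := s / b^(Nat.pair c (Nat.pair t j)) % b

theorem exists_digits {b : ℕ} (n : ℕ) : ∀ g : ℕ -> ℕ, (∀ i, g i < b) -> (∀ i, n ≤ i -> g i = 0) -> ∃ s < b^n, ∀ i, s / b^i % b = g i := by
  induction n with
  | zero => exact fun g _ h => ⟨0, by simp, fun i => by simp [h i]⟩
  | succ n ih =>
    intro g hb h
    obtain ⟨s, hs, h'⟩ := ih (fun i => g (i+1)) (fun i => hb _) fun i hi => h _ (by omega)
    have h0 := hb 0
    refine ⟨b*s + g 0, ?_, fun i => ?_⟩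
    · rw [pow_succ]; nlinarith
    · cases i with
      | zero => simp [Nat.mod_eq_of_lt h0]
      | succ i => rw [<- h' i, pow_succ', <- Nat.div_div_eq_div_mul, Nat.mul_add_div (by omega), Nat.div_eq_of_lt h0, add_zero]

def pk (n : ℕ) : ℕ := ((n+1)^2+1)^2

theorem exists_pack {b n : ℕ} (l : ℕ -> ℕ -> List ℕ) (hl : ∀ t j, ∀ x ∈ l t j, x < b) (hb : 0 < b) : ∃ s < b^pk n, ∀ c t j, dg b s c t j = if c <= n /\ t <= n /\ j <= n then (l t j).getD c 0 else 0 := by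
  obtain ⟨s, h1, h2⟩ := exists_digits (b := b) (pk n) (fun i => if i.unpair.1 <= n /\ i.unpair.2.unpair.1 <= n /\
    i.unpair.2.unpair.2 <= n then (l i.unpair.2.unpair.1 i.unpair.2.unpair.2).getD i.unpair.1 0 else 0)
    (fun i => by
      split_ifs
      · rcases Nat.lt_or_ge i.unpair.1 (l i.unpair.2.unpair.1 i.unpair.2.unpair.2).length with h | h
        · rw [List.getD_eq_getElem _ _ h]; exact hl _ _ _ (List.getElem_mem h)
        · rwa [List.getD_eq_default _ _ h]
      · exact hb)
    (fun i hi => if_neg fun ⟨a1, a2, a3⟩ => by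
      have e1 := Nat.pair_lt_max_add_one_sq i.unpair.2.unpair.1 i.unpair.2.unpair.2
      have e2 := Nat.pair_lt_max_add_one_sq i.unpair.1 i.unpair.2
      rw [Nat.pair_unpair] at e1 e2
      have e3 := e1.trans_le (Nat.pow_le_pow_left (Nat.succ_le_succ (max_le a2 a3)) 2)
      have : n <= (n+1)^2 := by nlinarith
      have e4 := e2.trans_le (Nat.pow_le_pow_left (Nat.succ_le_succ (max_le (a1.trans this) e3.le)) 2)
      exact absurd hi (not_le.2 e4))
  exact ⟨s, h1, fun c t j => by simpa [dg] using h2 (Nat.pair c (Nat.pair t j))⟩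

def EB (N : ℕ) : ℕ := (((2^(N+1)+1)^2+1)^2+1)^2

theorem pair_le {a b x : ℕ} (ha : a <= x) (hb : b <= x) : Nat.pair a b <= (x+1)^2 :=
  (Nat.pair_lt_max_add_one_sq a b).le.trans (Nat.pow_le_pow_left (Nat.succ_le_succ (max_le ha hb)) 2)

theorem EntB.le {N : ℕ} {e : Ent} (h : EntB N e) : entE e <= EB N := by
  obtain ⟨h1, h2, h3, h4, h5⟩ := h
  refine pair_le (pair_le (pair_le h1 h2) (pair_le h3 h4)) (h5.trans ?_)
  nlinarith [sq_nonneg ((2^(N+1)+1)^2)]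

theorem entE_e0 : entE.symm 0 = e0 := by simp [entE, posE, e0]

def b1 (N : ℕ) : ℕ := EB N + X0 N + 7
def Bd (N : ℕ) : ℕ := b1 N ^ pk (2*X0 N + 6)
def b2 (N : ℕ) : ℕ := EB N + X1 N + Bd N + 1
def RB (N : ℕ) : ℕ := b2 N ^ pk (X1 N + 11)

def row (N s : ℕ) : Row where
  m := dg (b1 N) s 0 0 0
  k := dg (b1 N) s 1 0 0
  tag := dg (b1 N) s 2 0 0
  A j := entE.symm (dg (b1 N) s 3 0 j)
  B j := entE.symm (dg (b1 N) s 4 0 j)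
  C j := entE.symm (dg (b1 N) s 5 0 j)
  E j := entE.symm (dg (b1 N) s 6 0 j)

def trow (N s : ℕ) : TRow := ⟨(row N s).m, (row N s).A, (row N s).B⟩

def trec (N s : ℕ) : TRec where
  M := dg (b2 N) s 0 0 0
  Q := dg (b2 N) s 1 0 0
  ruZ := dg (b2 N) s 2 0
  ruC := dg (b2 N) s 3 0
  zc := dg (b2 N) s 4 0
  V t j := entE.symm (dg (b2 N) s 5 t j)
  H t j := entE.symm (dg (b2 N) s 6 t j)
  chT := dg (b2 N) s 7 0
  chR := dg (b2 N) s 8 0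
  rT := dg (b2 N) s 9
  rA := dg (b2 N) s 10
  rC := dg (b2 N) s 11

def rcd (N s : ℕ) : Rec := ⟨(trec N s).M, (trec N s).Q, (trec N s).ruZ, (trec N s).ruC, (trec N s).V,
  (trec N s).chT, (trec N s).rT⟩

theorem row_surj {N : ℕ} (r : Row) (h : RowB N r) : ∃ s < Bd N, row N s = r := by
  obtain ⟨s, hs, e⟩ := exists_pack (b := b1 N) (n := 2*X0 N+6) (fun _ j =>
    [r.m, r.k, r.tag, entE (r.A j), entE (r.B j), entE (r.C j), entE (r.E j)]) (fun t j => by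
      have := h.m; have := h.k; have := h.tag
      have := (h.A j).1.le; have := (h.B j).1.le; have := (h.C j).1.le; have := (h.E j).1.le
      simp only [List.forall_mem_cons, b1]
      refine ⟨?_, ?_, ?_, ?_, ?_, ?_, ?_, by simp⟩ <;> omega) (by unfold b1; omega)
  have key : ∀ c ≤ 6, ∀ (f : ℕ -> Ent), EdgeB N (2*X0 N) f -> (∀ j, [r.m, r.k, r.tag, entE (r.A j), entE (r.B j), entE (r.C j), entE (r.E j)].getD c 0 = entE (f j)) -> (fun j => entE.symm (dg (b1 N) s c 0 j)) = f := by
    intro c hc f hf hg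
    funext j
    rw [e, hg]
    split_ifs with hj
    · simp
    · rw [entE_e0, (hf j).2 (by omega)]
  refine ⟨s, hs, ?_⟩
  rw [row, e, e, e, key 3 (by omega) r.A h.A fun _ => rfl, key 4 (by omega) r.B h.B fun _ => rfl, key 5 (by omega) r.C h.C fun _ => rfl, key 6 (by omega) r.E h.E fun _ => rfl]
  simp

theorem trow_surj {N : ℕ} (r : TRow) (h : TRowB N r) : ∃ s < Bd N, trow N s = r := by
  obtain ⟨s, hs, e⟩ := row_surj ⟨r.m, 0, 0, r.L, r.U, r.L, r.L⟩ ⟨h.m, by simp, by simp, h.L, h.U, h.L, h.L⟩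
  exact ⟨s, hs, by rw [trow, e]⟩

theorem trec_surj {N : ℕ} (R : TRec) (h : TRecB N (Bd N) (Bd N) R) : ∃ s < RB N, trec N s = R := by
  obtain ⟨s, hs, e⟩ := exists_pack (b := b2 N) (n := X1 N+11) (fun t j =>
    [R.M, R.Q, R.ruZ j, R.ruC j, R.zc j, entE (R.V t j), entE (R.H t j), R.chT j, R.chR j, R.rT t j, R.rA t j, R.rC t j]) (fun t j => by
      have := h.M; have := h.Q; have := (h.ruZ j).1; have := (h.ruC j).1; have := (h.zc j).1
      have := ((h.V t).1 j).1.le; have := ((h.H t).1 j).1.le; have := (h.chT j).1; have := (h.chR j).1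
      have := ((h.rT t).1 j).1; have := ((h.rA t).1 j).1; have := ((h.rC t).1 j).1
      simp only [List.forall_mem_cons, b2]
      refine ⟨?_, ?_, ?_, ?_, ?_, ?_, ?_, ?_, ?_, ?_, ?_, ?_, by simp⟩ <;> omega) (by unfold b2; omega)
  have k1 : ∀ c ≤ 11, ∀ b f, FnB b (X1 N) f -> (∀ j, [R.M, R.Q, R.ruZ j, R.ruC j, R.zc j, entE (R.V 0 j), entE (R.H 0 j), R.chT j, R.chR j, R.rT 0 j, R.rA 0 j, R.rC 0 j].getD c 0 = f j) -> dg (b2 N) s c 0 = f := by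
    intro c hc b f hf hg
    funext j
    rw [e, hg]
    split_ifs with hj
    · rfl
    · rw [(hf j).2 (by omega)]
  have k2 : ∀ c ≤ 11, ∀ f : ℕ -> ℕ -> ℕ, (∀ t j, X1 N < t ∨ X1 N < j -> f t j = 0) -> (∀ t j, [R.M, R.Q, R.ruZ j, R.ruC j, R.zc j, entE (R.V t j), entE (R.H t j), R.chT j, R.chR j, R.rT t j, R.rA t j,
      R.rC t j].getD c 0 = f t j) -> dg (b2 N) s c = f := by
    intro c hc f hf hg
    funext t j
    rw [e, hg]
    split_ifs with hj
    · rfl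
    · rw [hf t j (by omega)]
  have z : ∀ f : ℕ -> ℕ -> Ent, (∀ t, EdgeB N (X1 N) (f t) /\ (X1 N < t -> ∀ j, f t j = e0)) -> ∀ t j, X1 N < t ∨ X1 N < j -> entE (f t j) = 0 := fun f hf t j h => by
    rw [h.elim (fun h => (hf t).2 h j) fun h => ((hf t).1 j).2 h, <- entE_e0, Equiv.apply_symm_apply]
  have z' : ∀ f : ℕ -> ℕ -> ℕ, (∀ t, FnB (X1 N) (X1 N) (f t) /\ (X1 N < t -> ∀ j, f t j = 0)) -> ∀ t j, X1 N < t ∨ X1 N < j -> f t j = 0 := fun f hf t j h => h.elim (fun h => (hf t).2 h j) fun h => ((hf t).1 j).2 h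
  refine ⟨s, hs, ?_⟩
  rw [trec, e, e, k1 2 (by omega) _ _ h.ruZ fun _ => rfl, k1 3 (by omega) _ _ h.ruC fun _ => rfl, k1 4 (by omega) _ _ h.zc fun _ => rfl, k2 5 (by omega) _ (z _ h.V) fun _ _ => rfl,
    k2 6 (by omega) _ (z _ h.H) fun _ _ => rfl, k1 7 (by omega) _ _ h.chT fun _ => rfl, k1 8 (by omega) _ _ h.chR fun _ => rfl, k2 9 (by omega) _ (z' _ h.rT) fun _ _ => rfl,
    k2 10 (by omega) _ (z' _ h.rA) fun _ _ => rfl, k2 11 (by omega) _ (z' _ h.rC) fun _ _ => rfl]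
  simp

theorem rcd_surj {N : ℕ} (R : Rec) (h : RecB N (Bd N) R) : ∃ s < RB N, rcd N s = R := by
  have z : FnB (Bd N) (X1 N) fun _ => 0 := fun _ => ⟨by simp, by simp⟩
  obtain ⟨s, hs, e⟩ := trec_surj ⟨R.M, R.K, R.ru, R.rv, R.ru, R.L, R.L, R.ch, R.ch, R.rc, R.rc, R.rc⟩
    ⟨h.M, h.K, h.ru, h.rv, h.ru, h.L, h.L, h.ch, h.ch, h.rc, h.rc, h.rc⟩
  exact ⟨s, hs, by rw [rcd, e]⟩

section
variable {α : Type} [Primcodable α]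

theorem PD.st {p q : α -> Prop} (h1 : ∀ a, p a -> q a) (h2 : ∀ a, q a -> p a) (h : PD q) : PD p :=
  h.iff fun a => ⟨h2 a, h1 a⟩

theorem ai {a b : Prop} (h : a) (h' : b) : a /\ b := ⟨h, h'⟩

def dgt (b k s : ℕ) : ℕ := k / b^s % b

variable {n s c t j x y z w : α -> ℕ} [PR n] [PR s] [PR c] [PR t] [PR j] [PR x] [PR y] [PR z] [PR w]

instance : PR fun a => dg (x a) (s a) (c a) (t a) (j a) := by unfold dg; infer_instance
instance : PR fun a => dgt (x a) (s a) (c a) := by unfold dgt; infer_instance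
instance : PR fun a => pk (n a) := by unfold pk; infer_instance
instance : PR fun a => EB (n a) := by unfold EB; infer_instance
instance : PR fun a => X0 (n a) := by unfold X0; infer_instance
instance : PR fun a => X1 (n a) := by unfold X1; infer_instance
instance : PR fun a => b1 (n a) := by unfold b1; infer_instance
instance : PR fun a => Bd (n a) := by unfold Bd; infer_instance
instance : PR fun a => b2 (n a) := by unfold b2; infer_instance
instance : PR fun a => RB (n a) := by unfold RB; infer_instance

set_option synthInstance.maxHeartbeats 4000000
set_option synthInstance.maxSize 40000
set_option maxHeartbeats 4000000

instance : PD fun a => RowOK (n a) (row (n a) (s a)) := by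
  refine .st (fun a h => ai h.1 <| ai h.2 <| ai h.3 <| ai h.4 <| ai h.5 <| ai h.6 <| ai h.7 <| ai h.8 <| ai h.9 <|
    ai h.10 <| ai h.11 <| ai h.12 <| ai h.13 <| ai h.14 <| ai h.15 h.16)
    (fun a ⟨a1, a2, a3, a4, a5, a6, a7, a8, a9, b1, b2, b3, b4, b5, b6, b7⟩ =>
    ⟨a1, a2, a3, a4, a5, a6, a7, a8, a9, b1, b2, b3, b4, b5, b6, b7⟩) ?_
  simp only [EdgeOK, OppOK, AdjOK, row]
  infer_instance

def CO (n s c t x : ℕ) : Prop := ChildOK n (row n s) (rcd n c) t (row n x)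
def WI (n s c t : ℕ) : Prop := WitIn n (row n s) (rcd n c) t
def CT (n c t x : ℕ) : Prop := ChildTOK (trec n c) t (trow n x)
def CR (n s c t x : ℕ) : Prop := ChildROK n (trow n s) (trec n c) t (row n x)
def TW (n s c t : ℕ) : Prop := TWitIn n (trow n s) (trec n c) t

theorem CO_eq (n s c t x) : ChildOK n (row n s) (rcd n c) t (row n x) = CO n s c t x := rfl
theorem WI_eq (n s c t) : WitIn n (row n s) (rcd n c) t = WI n s c t := rfl
theorem CT_eq (n c t x) : ChildTOK (trec n c) t (trow n x) = CT n c t x := rfl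
theorem CR_eq (n s c t x) : ChildROK n (trow n s) (trec n c) t (row n x) = CR n s c t x := rfl
theorem TW_eq (n s c t) : TWitIn n (trow n s) (trec n c) t = TW n s c t := rfl

instance : PD fun a => CO (n a) (s a) (c a) (t a) (x a) := by
  refine .st (fun a h => ai h.1 <| ai h.2 <| ai h.3 <| ai h.4 <| ai h.5 h.6)
    (fun a ⟨a1, a2, a3, a4, a5, a6⟩ => ⟨a1, a2, a3, a4, a5, a6⟩) ?_
  simp only [IsRef, row, rcd, trec]
  infer_instance

instance : PD fun a => WI (n a) (s a) (c a) (t a) := by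
  simp only [WI, WitIn, row, rcd, trec]
  infer_instance

instance : PD fun a => CT (n a) (c a) (t a) (x a) := by
  refine .st (fun a h => ai h.1 <| ai h.2 h.3) (fun a ⟨a1, a2, a3⟩ => ⟨a1, a2, a3⟩) ?_
  simp only [IsRef, row, trow, trec]
  infer_instance

instance : PD fun a => CR (n a) (s a) (c a) (t a) (x a) := by
  refine .st (fun a h => ai h.1 <| ai h.2 <| ai h.3 <| ai h.4 <| ai h.5 <| ai h.6 <| ai h.7 <| ai h.8 h.9)
    (fun a ⟨a1, a2, a3, a4, a5, a6, a7, a8, a9⟩ => ⟨a1, a2, a3, a4, a5, a6, a7, a8, a9⟩) ?_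
  simp only [IsRef, row, trow, trec]
  infer_instance

instance : PD fun a => TW (n a) (s a) (c a) (t a) := by
  simp only [TW, TWitIn, row, trow, trec]
  infer_instance

instance : PD fun a => RecOK (n a) (row (n a)) (dgt (x a) (y a)) (bit (z a)) (s a) (rcd (n a) (c a)) := by
  refine .st (fun a h => ai h.1 <| ai h.2 <| ai h.3 <| ai h.4 <| ai h.5 <| ai h.6 <| ai h.7 <| ai h.8 <| ai h.9 <|
    ai h.10 <| ai h.11 <| ai h.12 <| ai h.13 <| ai h.14 h.15)
    (fun a ⟨a1, a2, a3, a4, a5, a6, a7, a8, a9, b1, b2, b3, b4, b5, b6⟩ =>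
    ⟨a1, a2, a3, a4, a5, a6, a7, a8, a9, b1, b2, b3, b4, b5, b6⟩) ?_
  simp only [CO_eq, WI_eq]
  simp only [IsRef, Halv, sameGap, row, rcd, trec]
  infer_instance

instance : PD fun a => TRowOK (n a) (trow (n a) (s a)) := by
  refine .st (fun a h => ai h.1 <| ai h.2 <| ai h.3 <| ai h.4 <| ai h.5 <| ai h.6 <| ai h.7 <| ai h.8 h.9)
    (fun a ⟨a1, a2, a3, a4, a5, a6, a7, a8, a9⟩ => ⟨a1, a2, a3, a4, a5, a6, a7, a8, a9⟩) ?_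
  simp only [row, trow]
  infer_instance

instance : PD fun a => TRecOK (n a) (row (n a)) (trow (n a)) (bit (x a)) (bit (y a)) (s a) (trec (n a) (c a)) := by
  refine .st (fun a h => ai h.1 <| ai h.2 <| ai h.3 <| ai h.4 <| ai h.5 <| ai h.6 <| ai h.7 <| ai h.8 <| ai h.9 <|
    ai h.10 <| ai h.11 <| ai h.12 <| ai h.13 <| ai h.14 <| ai h.15 <| ai h.16 <| ai h.17 <| ai h.18 h.19)
    (fun a ⟨a1, a2, a3, a4, a5, a6, a7, a8, a9, b1, b2, b3, b4, b5, b6, b7, b8, b9, c1⟩ =>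
    ⟨a1, a2, a3, a4, a5, a6, a7, a8, a9, b1, b2, b3, b4, b5, b6, b7, b8, b9, c1⟩) ?_
  simp only [CT_eq, CR_eq, TW_eq]
  simp only [IsRef, Halv, row, trow, trec]
  infer_instance

instance : PD fun a => RootOK (n a) (trow (n a) (s a)) (trec (n a) (c a)) := by
  refine .st (fun a h => ai h.1 <| ai h.2 <| ai h.3 <| ai h.4 h.5)
    (fun a ⟨a1, a2, a3, a4, a5⟩ => ⟨a1, a2, a3, a4, a5⟩) ?_
  simp only [row, trow, trec]
  infer_instance

/-- the bounded version of `SAT` -/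
def CC (N : ℕ) : Prop := ∃ σ < 2^Bd N, ∃ τ < 2^Bd N, ∃ κ < (Bd N + 1)^Bd N,
  (∀ s < Bd N, bit σ s -> RowOK N (row N s) /\ ∃ ρ < RB N, RecOK N (row N) (dgt (Bd N + 1) κ) (bit σ) s (rcd N ρ)) /\
  (∀ s < Bd N, bit τ s -> TRowOK N (trow N s) /\
    ∃ ρ < RB N, TRecOK N (row N) (trow N) (bit σ) (bit τ) s (trec N ρ)) /\
  ∃ s < Bd N, bit τ s /\ ∃ ρ < RB N, TRecOK N (row N) (trow N) (bit σ) (bit τ) s (trec N ρ) /\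
    RootOK N (trow N s) (trec N ρ)

theorem CC.pd (n : α -> ℕ) [PR n] : PD fun a => CC (n a) := by unfold CC; infer_instance
end

theorem bit_lt {m i n : ℕ} (h : bit m i) (hm : m < 2^n) : i < n := by
  by_contra h'
  rw [bit, Nat.testBit_eq_false_of_lt (hm.trans_le (Nat.pow_le_pow_right (by omega) (not_lt.1 h')))] at h
  cases h

theorem CC.sat {N : ℕ} : CC N -> SAT N := by
  rintro ⟨σ, hσ, τ, hτ, κ, -, h1, h2, s, -, h3, ρ, -, h4, h5⟩
  exact Cert.sat (S := bit σ) (ST := bit τ) (rk := dgt (Bd N + 1) κ) ⟨fun s hs => (h1 s (bit_lt hs hσ) hs).1, fun s hs => (h1 s (bit_lt hs hσ) hs).2.imp' _ fun _ h => h.2, fun s hs => (h2 s (bit_lt hs hτ) hs).1,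
    fun s hs => (h2 s (bit_lt hs hτ) hs).2.imp' _ fun _ h => h.2, s, h3, _, h4, h5⟩

theorem exists_set (n : ℕ) (P : ℕ -> Prop) (h : ∀ s, P s -> s < n) : ∃ σ < 2^n, bit σ = P := by
  cases n with
  | zero => exact ⟨0, by simp, funext fun s => propext ⟨fun h' => by simp [bit] at h', fun h' => absurd (h s h') (by simp)⟩⟩
  | succ n => exact ⟨setN n P, setN_lt n P, funext fun s => propext ((bit_setN n P s).trans
      ⟨fun h => h.2, fun h' => ⟨Nat.lt_succ_iff.1 (h s h'), h'⟩⟩)⟩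

theorem exists_rank (n : ℕ) (l : ℕ -> ℕ) : ∃ κ < (n + 1)^n, ∀ s s', s < n -> s' < n -> l s' < l s -> dgt (n + 1) κ s' < dgt (n + 1) κ s := by
  classical
  let f := fun s => ((Finset.range n).filter fun s' => l s' < l s).card
  obtain ⟨κ, hκ, eκ⟩ := exists_digits (b := n + 1) n (fun s => if s < n then f s else 0) (fun s => by
    split_ifs
    · exact Nat.lt_succ_iff.2 ((Finset.card_filter_le _ _).trans_eq (Finset.card_range _))
    · omega) fun s hs => if_neg (by omega)
  have e : ∀ s, s < n -> dgt (n + 1) κ s = f s := fun s hs => (eκ s).trans (if_pos hs)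
  refine ⟨κ, hκ, fun s s' h1 h2 h3 => ?_⟩
  rw [e _ h1, e _ h2]
  refine Finset.card_lt_card ⟨fun x hx => ?_, fun hh => ?_⟩
  · rw [Finset.mem_filter] at hx ⊢; exact ⟨hx.1, hx.2.trans h3⟩
  · exact lt_irrefl _ (Finset.mem_filter.1 (hh (Finset.mem_filter.2 ⟨Finset.mem_range.2 h2, h3⟩))).2

theorem CC.of_sat {N : ℕ} (h : SAT N) : CC N := by
  obtain ⟨σ, hσ, eσ⟩ := exists_set (Bd N) (Ctx.SS N (Bd N) (row N)) fun s h => h.1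
  obtain ⟨τ, hτ, eτ⟩ := exists_set (Bd N) (Ctx.TS N (Bd N) (trow N)) fun s h => h.1
  obtain ⟨κ, hκ, eκ⟩ := exists_rank (Bd N) (Ctx.lev N (row N))
  refine ⟨σ, hσ, τ, hτ, κ, hκ, ?_⟩
  rw [eσ, eτ]
  refine ⟨fun s hs h' => ?_, fun s hs h' => ?_, ?_⟩
  · obtain ⟨R, a1, a2⟩ := Ctx.SS.rec row_surj eκ h'
    obtain ⟨ρ, hρ, rfl⟩ := rcd_surj R a1
    obtain ⟨-, hB, c, R, us, vs, hr⟩ := h'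
    exact ⟨hr.rowOK hB.tag, ρ, hρ, a2⟩
  · obtain ⟨-, hB, c, x0, x1, us, hr⟩ := h'
    obtain ⟨R, a1, a2, -⟩ := hr.ex_rec row_surj trow_surj hB
    obtain ⟨ρ, hρ, rfl⟩ := trec_surj R a1
    exact ⟨hr.rowOK, ρ, hρ, a2⟩
  · obtain ⟨s, R, b1, b2, b3, b4⟩ := exists_root row_surj trow_surj h
    obtain ⟨ρ, hρ, rfl⟩ := trec_surj R b2
    exact ⟨s, b1.1, b1, ρ, hρ, b3, b4⟩

end HP

/-- The set of validities of the basic temporal language over `(H_<, ≺)` is decidable: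
there is a computable total function (on codes of formulas) returning `true`
exactly on the valid formulas. -/
theorem validity_decidable_halfplane_slt : ∃ f : ℕ → Bool, Computable f ∧
      ∀ φ : Formula, (f φ.enc = true ↔ Valid sltH φ) := by
  classical
  have : HP.PR fun n => Nat.pair 1 n := ⟨Primrec₂.natPair.comp (.const 1) .id⟩
  have h := (HP.CC.pd fun n => Nat.pair 1 n).h.not
  exact ⟨fun n => decide (¬ HP.CC (Nat.pair 1 n)), h.decide.to_comp, fun φ => by
    rw [decide_eq_true_iff, HP.valid_iff]
    exact not_congr ⟨HP.CC.sat, HP.CC.of_sat⟩⟩
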